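/- Assume N ≥ 1, p > 2N/(N+1), f : [0,∞) → [0,∞) is locally Lipschitz continuous, nondecreasing, f(0) = 0, f(s) > 0 for s > 0, J := ∫_1^∞ ds/f(s) < ∞ and K := ∫_1^∞ ds/F(s)^{1/p} = ∞. Then for any u₀ ∈ C(ℝ^N) satisfying 0 ≤ u₀(x) ≤ w_b(|x|) for all x ∈ ℝ^N, for some b > 0, there exists a nonnegative weak solution u̲ of ∂_t u − Δ_p u + f(u) = 0 in Q_∞, continuous on the closure of Q_∞, with u̲(·,0) = u₀ and u̲(x,t) ≤ min{ w_b(|x|), φ_∞(t) } for all (x,t) ∈ Q_∞. -/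

import Mathlib

open MeasureTheory Set Filter Topology
open scoped RealInnerProductSpace ENNReal NNReal

noncomputable section

abbrev Spc (N : ℕ) := EuclideanSpace ℝ (Fin N)

/-- spatial gradient of `u (·, t)` at `x`. -/
noncomputable def sgrad {N : ℕ} (u : Spc N → ℝ → ℝ) (x : Spc N) (t : ℝ) : Spc N :=
  gradient (fun y => u y t) x

/-- weak solution of `∂ₜ u - Δ_p u + f(u) = 0` on `Ω × I`. -/
def IsWeakSolution {N : ℕ} (p : ℝ) (f : ℝ → ℝ) (Ω : Set (Spc N)) (I : Set ℝ)
    (u : Spc N → ℝ → ℝ) : Prop :=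
  MeasureTheory.LocallyIntegrableOn (fun z : Spc N × ℝ => u z.1 z.2) (Ω ×ˢ I) ∧
  MeasureTheory.LocallyIntegrableOn (fun z : Spc N × ℝ => ‖sgrad u z.1 z.2‖ ^ p) (Ω ×ˢ I) ∧
  MeasureTheory.LocallyIntegrableOn (fun z : Spc N × ℝ => f (u z.1 z.2)) (Ω ×ˢ I) ∧
  ∀ (φ : Spc N → ℝ → ℝ) (g G : ℝ → ℝ),
    ContDiff ℝ (⊤ : ℕ∞) (fun z : Spc N × ℝ => φ z.1 z.2) →
    HasCompactSupport (fun z : Spc N × ℝ => φ z.1 z.2) →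
    tsupport (fun z : Spc N × ℝ => φ z.1 z.2) ⊆ Ω ×ˢ I →
    Continuous g → (∃ L : ℝ≥0, LipschitzWith L g) →
    (∀ r : ℝ, HasDerivAt G (g r) r) →
    ∫ z : Spc N × ℝ in Ω ×ˢ I,
      (-(G (u z.1 z.2) * deriv (fun s : ℝ => φ z.1 s) z.2)
        + ‖sgrad u z.1 z.2‖ ^ (p - 2) *
            ⟪sgrad u z.1 z.2, gradient (fun y : Spc N => g (u y z.2) * φ y z.2) z.1⟫
        + f (u z.1 z.2) * g (u z.1 z.2) * φ z.1 z.2) = 0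

/-- the fundamental solution with initial data `k δ₀`. -/
def IsFundSol {N : ℕ} (p : ℝ) (f : ℝ → ℝ) (k : ℝ) (u : Spc N → ℝ → ℝ) : Prop :=
  (∀ x t, 0 ≤ u x t) ∧ (∀ x t, 0 < t → 0 < u x t) ∧
  ContinuousOn (fun z : Spc N × ℝ => u z.1 z.2) ((univ : Set (Spc N)) ×ˢ Ioi (0:ℝ)) ∧
  IsWeakSolution p f univ (Ioi 0) u ∧
  ∀ ζ : Spc N → ℝ, Continuous ζ → HasCompactSupport ζ →
    Tendsto (fun t : ℝ => ∫ x : Spc N, u x t * ζ x) (𝓝[>] (0:ℝ)) (𝓝 (k * ζ 0))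

noncomputable def Fint (f : ℝ → ℝ) (s : ℝ) : ℝ := ∫ σ in (0:ℝ)..s, f σ

/-- `H_p`, the inverse of `t ↦ |t|^{p-2} t`. -/
noncomputable def Hp (p t : ℝ) : ℝ := Real.sign t * |t| ^ (1 / (p - 1))

/-- `w` solves the radial integral equation with value `b` at the origin. -/
def IsWa (N : ℕ) (p : ℝ) (f : ℝ → ℝ) (a : ℝ) (w : ℝ → ℝ) : Prop :=
  ContinuousOn w (Ici 0) ∧
  ∀ r : ℝ, 0 ≤ r →
    w r = a + ∫ s in (0:ℝ)..r,
      Hp p (s ^ (1 - (N : ℝ)) * ∫ τ in (0:ℝ)..s, τ ^ ((N : ℝ) - 1) * f (w τ))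

/-- the monotone power `s ↦ |s|^{p-2} s`. -/
def Psi (p s : ℝ) : ℝ := |s| ^ (p - 2) * s

lemma Psi_neg (p s : ℝ) : Psi p (-s) = -Psi p s := by simp [Psi]

@[simp] lemma Psi_zero (p : ℝ) : Psi p 0 = 0 := by simp [Psi]

lemma Psi_of_nonneg {p s : ℝ} (hp : 2 ≤ p) (hs : 0 ≤ s) : Psi p s = s ^ (p - 1) := by
  rcases hs.eq_or_lt with rfl | h
  · rw [Psi_zero, Real.zero_rpow (by linarith)]
  · rw [Psi, abs_of_pos h, ← Real.rpow_add_one h.ne']; congr 1; ring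

lemma continuous_Psi {p : ℝ} (hp : 2 ≤ p) : Continuous (Psi p) := by
  unfold Psi
  exact (continuous_abs.rpow_const fun x => Or.inr (by linarith)).mul continuous_id

lemma abs_Psi {p : ℝ} (hp : 2 ≤ p) (s : ℝ) : |Psi p s| = |s| ^ (p - 1) := by
  rcases le_total 0 s with h | h
  · rw [Psi_of_nonneg hp h, abs_of_nonneg h, abs_of_nonneg (by positivity)]
  · have : Psi p s = -Psi p (-s) := by rw [Psi_neg]; ring
    rw [this, Psi_of_nonneg hp (by linarith), abs_of_nonpos h, abs_neg,
      abs_of_nonneg (Real.rpow_nonneg (by linarith) _)]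

lemma Psi_mul_self {p : ℝ} (hp : 2 ≤ p) (s : ℝ) : Psi p s * s = |s| ^ p := by
  rcases eq_or_ne s 0 with rfl | h
  · simp [Real.zero_rpow (by linarith : p ≠ 0)]
  · have h' : 0 < |s| := abs_pos.2 h
    have : |s| ^ p = |s| ^ (p - 2) * |s| ^ (2 : ℝ) := by rw [← Real.rpow_add h']; ring_nf
    rw [this, Psi, Real.rpow_two, sq_abs]; ring

lemma Psi_mul {p : ℝ} {c : ℝ} (hc : 0 < c) (s : ℝ) : Psi p (c * s) = c ^ (p - 1) * Psi p s := by
  have : c ^ (p - 1) = c ^ (p - 2) * c := by rw [← Real.rpow_add_one hc.ne']; congr 1; ring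
  rw [Psi, Psi, abs_mul, abs_of_pos hc, Real.mul_rpow hc.le (abs_nonneg s), this]; ring

lemma hasDerivAt_Psi {p : ℝ} (hp : 2 ≤ p) (s : ℝ) :
    HasDerivAt (Psi p) ((p - 1) * |s| ^ (p - 2)) s := by
  have pos : ∀ s : ℝ, 0 < s → HasDerivAt (Psi p) ((p - 1) * |s| ^ (p - 2)) s := by
    intro s hs
    have h := Real.hasDerivAt_rpow_const (x := s) (p := p - 1) (Or.inl hs.ne')
    rw [abs_of_pos hs]
    have e : p - 1 - 1 = p - 2 := by ring
    rw [e] at h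
    refine h.congr_of_eventuallyEq ?_
    filter_upwards [lt_mem_nhds hs] with x hx
    exact Psi_of_nonneg hp hx.le
  rcases lt_trichotomy s 0 with h | rfl | h
  · have h1 := pos (-s) (by linarith)
    have h2 := (h1.comp s (hasDerivAt_neg s)).neg
    rw [abs_neg] at h2
    have e1 : Psi p = -Psi p ∘ Neg.neg := by funext x; simp [Psi_neg]
    rw [e1]
    exact h2.congr_deriv (by ring)
  · rcases hp.eq_or_lt with rfl | hp
    · have : Psi 2 = fun s => s := by funext s; simp [Psi]
      rw [this]; exact (hasDerivAt_id' (0:ℝ)).congr_deriv (by norm_num)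
    · rw [abs_zero, Real.zero_rpow (by linarith), mul_zero, hasDerivAt_iff_tendsto]
      have : Tendsto (fun x : ℝ => |x| ^ (p - 2)) (𝓝 0) (𝓝 0) := by
        have hc : Continuous fun x : ℝ => |x| ^ (p - 2) :=
          continuous_abs.rpow_const fun x => Or.inr (by linarith)
        simpa [Real.zero_rpow (by linarith : p - 2 ≠ 0)] using hc.tendsto 0
      refine this.congr fun x => ?_
      rcases eq_or_ne x 0 with rfl | hx
      · simp [Real.zero_rpow (by linarith : p - 2 ≠ 0)]
      · have : |x| ≠ 0 := abs_ne_zero.2 hx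
        simp only [Psi_zero, sub_zero, smul_zero, Real.norm_eq_abs, abs_Psi hp.le]
        rw [show p - 1 = p - 2 + 1 by ring, Real.rpow_add_one this]; field_simp
  · exact pos s h

lemma monotone_Psi {p : ℝ} (hp : 2 ≤ p) : Monotone (Psi p) := by
  refine monotone_of_deriv_nonneg (fun s => (hasDerivAt_Psi hp s).differentiableAt) fun s => ?_
  rw [(hasDerivAt_Psi hp s).deriv]
  exact mul_nonneg (by linarith) (by positivity)

lemma Psi_nonneg {p : ℝ} {s : ℝ} (hs : 0 ≤ s) : 0 ≤ Psi p s := by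
  unfold Psi; positivity

lemma Psi_lip {p : ℝ} (hp : 2 ≤ p) {R a b : ℝ} (ha : |a| ≤ R) (hb : |b| ≤ R) :
    |Psi p a - Psi p b| ≤ (p - 1) * R ^ (p - 2) * |a - b| := by
  have := (convex_Icc (-R) R).norm_image_sub_le_of_norm_hasDerivWithin_le
    (f := Psi p) (f' := fun s => (p - 1) * |s| ^ (p - 2)) (C := (p - 1) * R ^ (p - 2))
    (fun x _ => (hasDerivAt_Psi hp x).hasDerivWithinAt) (fun x hx => by
      rw [Real.norm_eq_abs, abs_mul, abs_of_nonneg (by linarith : 0 ≤ p - 1),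
        abs_of_nonneg (by positivity : 0 ≤ |x| ^ (p-2))]
      have : |x| ≤ R := abs_le.2 hx
      have := Real.rpow_le_rpow (abs_nonneg x) this (by linarith : 0 ≤ p - 2)
      exact mul_le_mul_of_nonneg_left this (by linarith)) (abs_le.1 hb) (abs_le.1 ha)
  simpa using this

lemma Psi_sub_lower {p : ℝ} (hp : 2 ≤ p) {a b : ℝ} (ha : 0 ≤ a) (hab : a ≤ b) :
    a ^ (p - 2) * (b - a) ≤ Psi p b - Psi p a := by
  have hb : 0 ≤ b := ha.trans hab
  have := Real.rpow_le_rpow ha hab (by linarith : 0 ≤ p - 2)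
  rw [Psi, Psi, abs_of_nonneg ha, abs_of_nonneg hb]
  nlinarith [mul_le_mul_of_nonneg_right this hb]

lemma Psi_strong_mono {p : ℝ} (hp : 2 ≤ p) (a b : ℝ) :
    2 ^ (1 - p) * |a - b| ^ p ≤ (Psi p a - Psi p b) * (a - b) := by
  wlog hab : b ≤ a generalizing a b
  · have := this b a (le_of_not_ge hab)
    rw [abs_sub_comm] at this; linarith [this, show (Psi p a - Psi p b) * (a - b) = (Psi p b - Psi p a) * (b - a) by ring]
  have hd : 0 ≤ a - b := by linarith
  have key : 2 ^ (1 - p) * (a - b) ^ (p - 1) ≤ Psi p a - Psi p b := by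
    have e : (2:ℝ) ^ (1 - p) * (a - b) ^ (p - 1) = ((a - b) / 2) ^ (p - 1) := by
      rw [Real.div_rpow hd (by norm_num), show (1 - p) = -(p - 1) by ring,
        Real.rpow_neg (by norm_num)]; field_simp
    have sup : ∀ a b : ℝ, 0 ≤ b → b ≤ a → ((a - b) / 2) ^ (p - 1) ≤ Psi p a - Psi p b := by
      intro a b hb hab
      have h1 := Real.add_rpow_le_rpow_add (p := p - 1) (a := a - b) (b := b) (by linarith) hb (by linarith)
      rw [sub_add_cancel] at h1
      rw [Psi_of_nonneg hp hb, Psi_of_nonneg hp (hb.trans hab)]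
      have := Real.rpow_le_rpow (by linarith) (by linarith : (a - b) / 2 ≤ a - b) (by linarith : 0 ≤ p - 1)
      linarith
    rw [e]
    rcases le_total 0 b with hb | hb
    · exact sup a b hb hab
    rcases le_total a 0 with ha | ha
    · have := sup (-b) (-a) (by linarith) (by linarith)
      rw [Psi_neg, Psi_neg] at this
      convert this using 1 <;> ring_nf
    · have hb' : Psi p b = -Psi p (-b) := by rw [Psi_neg]; ring
      rw [hb']
      have n1 := Psi_nonneg (p := p) ha
      have n2 := Psi_nonneg (p := p) (neg_nonneg.2 hb)
      rcases le_total (-b) a with h | h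
      · have := Real.rpow_le_rpow (by linarith) (by linarith : (a - b) / 2 ≤ a) (by linarith : 0 ≤ p - 1)
        rw [← Psi_of_nonneg hp ha] at this; linarith
      · have := Real.rpow_le_rpow (by linarith) (by linarith : (a - b) / 2 ≤ -b) (by linarith : 0 ≤ p - 1)
        rw [← Psi_of_nonneg hp (by linarith : 0 ≤ -b)] at this; linarith
  rw [abs_of_nonneg hd]
  have e : (a - b) ^ p = (a - b) ^ (p - 1) * (a - b) := by
    rcases hd.eq_or_lt with h | h
    · rw [← h, Real.zero_rpow (by linarith)]; simp
    · rw [← Real.rpow_add_one h.ne']; ring_nf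
  rw [e, ← mul_assoc]
  exact mul_le_mul_of_nonneg_right key hd

/-- a form of Young's inequality. -/
lemma rpow_mul_le_young {p η : ℝ} (hp : 2 ≤ p) (hη : 0 < η) {a c : ℝ} (ha : 0 ≤ a) (hc : 0 ≤ c) :
    a ^ (p - 1) * c ≤ η * a ^ p + η ^ (1 - p) * c ^ p := by
  have pw : ∀ x : ℝ, 0 ≤ x → x ^ p = x ^ (p - 1) * x := by
    intro x hx
    rcases hx.eq_or_lt with h | h
    · rw [← h, Real.zero_rpow (by linarith)]; simp
    · rw [← Real.rpow_add_one h.ne']; ring_nf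
  rcases le_total c (η * a) with h | h
  · have : a ^ (p - 1) * c ≤ a ^ (p - 1) * (η * a) := by gcongr
    rw [pw a ha]
    have : 0 ≤ η ^ (1 - p) * c ^ p := by positivity
    linarith
  · have h1 : a ≤ c / η := by rw [le_div_iff₀ hη]; linarith
    have h2 : a ^ (p - 1) ≤ (c / η) ^ (p - 1) := Real.rpow_le_rpow ha h1 (by linarith)
    have h3 : (c / η) ^ (p - 1) = η ^ (1 - p) * c ^ (p - 1) := by
      rw [Real.div_rpow hc hη.le, show (1 - p) = -(p - 1) by ring, Real.rpow_neg hη.le]; field_simp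
    have : a ^ (p - 1) * c ≤ η ^ (1 - p) * c ^ p := by
      rw [pw c hc, ← mul_assoc, ← h3]; gcongr
    have : 0 ≤ η * a ^ p := by positivity
    linarith

/-- algebraic core of the reflection coupling. -/
lemma Psi_coupling {p : ℝ} (hp : 2 ≤ p) {ap am bp bm η q : ℝ}
    (h1 : ap ≤ bp) (h3 : am ≤ bm) (h4 : ap + am ≤ bp + bm - η)
    (h5 : am ≤ -q) (h6 : q ≤ bp) (hη : 0 ≤ η) (hηq : η ≤ q) :
    Psi p ap + Psi p am - Psi p bp - Psi p bm ≤ -((q / 2) ^ (p - 2) * (η / 2)) := by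
  have m1 := monotone_Psi hp h1
  have m3 := monotone_Psi hp h3
  have low : ∀ b : ℝ, q ≤ b → (q / 2) ^ (p - 2) * (η / 2) ≤ Psi p b - Psi p (b - η / 2) := by
    intro b hb
    have := Psi_sub_lower hp (a := b - η / 2) (b := b) (by linarith) (by linarith)
    have h := Real.rpow_le_rpow (by linarith) (by linarith : q / 2 ≤ b - η / 2) (by linarith : 0 ≤ p - 2)
    have : (q / 2) ^ (p - 2) * (η / 2) ≤ (b - η / 2) ^ (p - 2) * (η / 2) := by gcongr
    have e : b - (b - η / 2) = η / 2 := by ring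
    rw [e] at *; linarith
  rcases le_or_gt ap (bp - η / 2) with h | h
  · have := monotone_Psi hp h
    have := low bp h6
    linarith
  · have := monotone_Psi hp (show am + η / 2 ≤ bm by linarith)
    have l := low (-am) (by linarith)
    rw [show -am - η / 2 = -(am + η / 2) by ring, Psi_neg, Psi_neg] at l
    linarith

/-- structural hypotheses on the absorption term. -/
structure Absorb (f : ℝ → ℝ) : Prop where
  lip : ∀ M : ℝ, 0 < M → ∃ L : ℝ≥0, LipschitzOnWith L f (Icc 0 M)
  mono : MonotoneOn f (Ici 0)
  zero : f 0 = 0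
  pos : ∀ s : ℝ, 0 < s → 0 < f s
  int : IntegrableOn (fun s : ℝ => 1 / f s) (Ioi 1)

namespace Absorb

variable {f : ℝ → ℝ}

lemma nonneg (hf : Absorb f) {s : ℝ} (hs : 0 ≤ s) : 0 ≤ f s := by
  rcases hs.eq_or_lt with rfl | h
  · exact hf.zero.ge
  · exact (hf.pos s h).le

lemma antitoneOn_inv (hf : Absorb f) {a : ℝ} (ha : 0 < a) : AntitoneOn (fun s => 1 / f s) (Ici a) := by
  intro x hx y hy hxy
  have hx0 : 0 < x := ha.trans_le hx
  exact one_div_le_one_div_of_le (hf.pos x hx0) (hf.mono hx0.le (hx0.le.trans hxy) hxy)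

lemma integrableOn_inv (hf : Absorb f) {a : ℝ} (ha : 0 < a) : IntegrableOn (fun s => 1 / f s) (Ioi a) := by
  have h1 : IntegrableOn (fun s => 1 / f s) (Icc a (max a 1)) :=
    ((hf.antitoneOn_inv ha).mono Icc_subset_Ici_self).integrableOn_isCompact isCompact_Icc
  refine (h1.union hf.int).mono_set fun x hx => ?_
  rcases le_or_gt x (max a 1) with h | h
  · exact Or.inl ⟨le_of_lt hx, h⟩
  · exact Or.inr (lt_of_le_of_lt (le_max_right a 1) h)

lemma tail_sub (hf : Absorb f) {a b : ℝ} (ha : 0 < a) (hab : a ≤ b) :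
    (b - a) / f b ≤ (∫ s in Ioi a, 1 / f s) - ∫ s in Ioi b, 1 / f s := by
  have hb : 0 < b := ha.trans_le hab
  have e : (∫ s in Ioi a, 1 / f s) = (∫ s in Ioc a b, 1 / f s) + ∫ s in Ioi b, 1 / f s := by
    rw [← setIntegral_union (Set.Ioc_disjoint_Ioi le_rfl) measurableSet_Ioi
      ((hf.integrableOn_inv ha).mono_set Ioc_subset_Ioi_self) (hf.integrableOn_inv hb),
      Ioc_union_Ioi_eq_Ioi hab]
  have h : (∫ _ in Ioc a b, 1 / f b) ≤ ∫ s in Ioc a b, 1 / f s := by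
    refine setIntegral_mono_on (integrableOn_const (by simp)) ((hf.integrableOn_inv ha).mono_set Ioc_subset_Ioi_self)
      measurableSet_Ioc fun x hx => ?_
    exact hf.antitoneOn_inv ha hx.1.le hab hx.2
  rw [setIntegral_const] at h
  simp only [Real.volume_real_Ioc_of_le hab, smul_eq_mul] at h
  rw [e]; have : (b - a) / f b = (b - a) * (1 / f b) := by ring
  linarith

lemma linear_lower (hf : Absorb f) : ∃ c : ℝ, 0 < c ∧ ∀ s : ℝ, 1 / 2 ≤ s → c * s ≤ f s := by
  set J := ∫ s in Ioi 1, 1 / f s with hJ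
  have hJ0 : 0 ≤ J := setIntegral_nonneg measurableSet_Ioi fun x hx =>
    (one_div_pos.2 (hf.pos x (by linarith [mem_Ioi.1 hx]))).le
  have hh := hf.pos (1/2) (by norm_num)
  refine ⟨min (1 / (2 * (J + 1))) (f (1/2) / 2), by positivity, fun s hs => ?_⟩
  have hs0 : 0 < s := by linarith
  rcases le_total s 2 with h | h
  · have := hf.mono (a := 1/2) (b := s) (by norm_num) hs0.le hs
    calc _ ≤ f (1/2) / 2 * s := by gcongr; exact min_le_right _ _
      _ ≤ f (1/2) / 2 * 2 := by gcongr
      _ ≤ f s := by linarith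
  · have h1 := hf.tail_sub (a := 1) (b := s) (by norm_num) (by linarith)
    have h2 : 0 ≤ ∫ u in Ioi s, 1 / f u := setIntegral_nonneg measurableSet_Ioi fun x hx =>
      (one_div_pos.2 (hf.pos x (by linarith [mem_Ioi.1 hx]))).le
    have h3 : (s - 1) / f s ≤ J + 1 := by linarith
    rw [div_le_iff₀ (hf.pos s hs0)] at h3
    calc _ ≤ 1 / (2 * (J + 1)) * s := by gcongr; exact min_le_left _ _
      _ ≤ f s := by rw [one_div_mul_eq_div, div_le_iff₀ (by positivity)]; linarith

lemma two_le (hf : Absorb f) {p : ℝ} (hp : 0 < p)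
    (hK : ¬ IntegrableOn (fun s : ℝ => 1 / (Fint f s) ^ (1 / p)) (Ioi 1)) : 2 ≤ p := by
  by_contra hp2
  push Not at hp2
  apply hK
  obtain ⟨c, hc, hcf⟩ := hf.linear_lower
  have fii : ∀ a b : ℝ, 0 ≤ a → 0 ≤ b → IntervalIntegrable f volume a b := by
    intro a b ha hb
    refine (hf.mono.mono ?_).intervalIntegrable
    intro x hx; exact (le_min ha hb).trans hx.1
  have hF : ∀ s : ℝ, 1 ≤ s → c / 4 * s ^ 2 ≤ Fint f s := by
    intro s hs
    have e : Fint f s = (∫ x in (0:ℝ)..(s/2), f x) + ∫ x in (s/2)..s, f x :=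
      (intervalIntegral.integral_add_adjacent_intervals (fii _ _ le_rfl (by linarith))
        (fii _ _ (by linarith) (by linarith))).symm
    have h1 : 0 ≤ ∫ x in (0:ℝ)..(s/2), f x :=
      intervalIntegral.integral_nonneg (by linarith) fun x hx => hf.nonneg hx.1
    have h2 : (∫ x in (s/2)..s, c * (s / 2)) ≤ ∫ x in (s/2)..s, f x := by
      refine intervalIntegral.integral_mono_on (by linarith) (by simp) (fii _ _ (by linarith) (by linarith)) fun x hx => ?_
      exact (mul_le_mul_of_nonneg_left hx.1 hc.le).trans (hcf x (by linarith [hx.1]))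
    rw [intervalIntegral.integral_const, smul_eq_mul] at h2
    rw [e]; nlinarith
  have hFm : MonotoneOn (Fint f) (Ici 1) := by
    intro x hx y hy hxy
    have hx : (1:ℝ) ≤ x := hx
    have e : Fint f y = Fint f x + ∫ u in x..y, f u :=
      (intervalIntegral.integral_add_adjacent_intervals (fii _ _ le_rfl (by linarith))
        (fii _ _ (by linarith) (by linarith))).symm
    have h1 : 0 ≤ ∫ u in x..y, f u :=
      intervalIntegral.integral_nonneg hxy fun u hu => hf.nonneg (by linarith [hu.1])
    linarith
  have hFp : ∀ s : ℝ, 1 ≤ s → 0 < Fint f s := fun s hs => lt_of_lt_of_le (by positivity) (hF s hs)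
  have hintg : IntegrableOn (fun s : ℝ => (c / 4) ^ (-(1 / p)) * s ^ (-(2 / p))) (Ioi 1) := by
    refine Integrable.const_mul (integrableOn_Ioi_rpow_of_lt ?_ one_pos) _
    rw [neg_lt_neg_iff, lt_div_iff₀ hp]; linarith
  refine Integrable.mono' hintg ?_ ?_
  · refine AEMeasurable.aestronglyMeasurable (aemeasurable_restrict_of_antitoneOn measurableSet_Ioi ?_)
    intro x hx y hy hxy
    have hx : 1 < x := hx
    have := hFm (a := x) (b := y) hx.le (by simp; linarith) hxy
    have hpx := hFp x hx.le
    exact one_div_le_one_div_of_le (by positivity) (Real.rpow_le_rpow hpx.le this (by positivity))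
  · refine (ae_restrict_iff' measurableSet_Ioi).2 (ae_of_all _ fun s hs => ?_)
    have hs : 1 < s := hs
    have hps := hFp s hs.le
    rw [Real.norm_of_nonneg (by positivity)]
    have h1 := Real.rpow_le_rpow (by positivity) (hF s hs.le) (by positivity : 0 ≤ 1 / p)
    have e : (c / 4) ^ (-(1 / p)) * s ^ (-(2 / p)) = 1 / (c / 4 * s ^ 2) ^ (1 / p) := by
      rw [Real.mul_rpow (by positivity) (by positivity), ← Real.rpow_natCast s 2, ← Real.rpow_mul (by linarith),
        Real.rpow_neg (by positivity), Real.rpow_neg (by positivity), ← mul_inv, ← one_div]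
      congr 3; push_cast; ring
    rw [e]
    exact one_div_le_one_div_of_le (by positivity) h1

lemma flat_antitone (hf : Absorb f) {φ : ℝ → ℝ}
    (hφ : ∀ t : ℝ, 0 < t → 0 < φ t ∧ (∫ s in Ioi (φ t), 1 / f s) = t) {s t : ℝ} (hs : 0 < s) (hst : s ≤ t) : φ t ≤ φ s := by
  by_contra h
  push Not at h
  obtain ⟨h1, h2⟩ := hφ s hs
  obtain ⟨h3, h4⟩ := hφ t (hs.trans_le hst)
  have := hf.tail_sub h1 h.le
  rw [h2, h4] at this
  have : 0 < (φ t - φ s) / f (φ t) := div_pos (by linarith) (hf.pos _ h3)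
  linarith

lemma flat_step (hf : Absorb f) {φ : ℝ → ℝ}
    (hφ : ∀ t : ℝ, 0 < t → 0 < φ t ∧ (∫ s in Ioi (φ t), 1 / f s) = t) {t τ : ℝ} (ht : 0 < t) (hτ : 0 ≤ τ) : φ t - τ * f (φ t) ≤ φ (t + τ) := by
  obtain ⟨h1, h2⟩ := hφ t ht
  obtain ⟨h3, h4⟩ := hφ (t + τ) (by linarith)
  have := hf.tail_sub h3 (hf.flat_antitone hφ ht (by linarith : t ≤ t + τ))
  rw [h2, h4, div_le_iff₀ (hf.pos _ h1)] at this
  linarith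

lemma flat_surj (hf : Absorb f) {φ : ℝ → ℝ}
    (hφ : ∀ t : ℝ, 0 < t → 0 < φ t ∧ (∫ s in Ioi (φ t), 1 / f s) = t) {M : ℝ} (hM : 0 < M) : ∃ s, 0 < s ∧ φ s = M := by
  have hpos : 0 < ∫ s in Ioi M, 1 / f s := by
    have := hf.tail_sub hM (by linarith : M ≤ M + 1)
    have h2 : 0 ≤ ∫ u in Ioi (M + 1), 1 / f u := setIntegral_nonneg measurableSet_Ioi fun x hx =>
      (one_div_pos.2 (hf.pos x (by linarith [mem_Ioi.1 hx]))).le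
    have : 0 < (M + 1 - M) / f (M + 1) := div_pos (by linarith) (hf.pos _ (by linarith))
    linarith
  refine ⟨_, hpos, ?_⟩
  obtain ⟨h1, h2⟩ := hφ _ hpos
  rcases lt_trichotomy (φ (∫ s in Ioi M, 1 / f s)) M with h | h | h
  · have := hf.tail_sub h1 h.le
    have : 0 < (M - φ (∫ s in Ioi M, 1 / f s)) / f M := div_pos (by linarith) (hf.pos _ hM)
    linarith
  · exact h
  · have := hf.tail_sub hM h.le
    have := div_pos (sub_pos.2 h) (hf.pos _ h1)
    linarith

end Absorb

lemma ae_bdd_integrable_of_continuous {N : ℕ} {ν : Measure (Spc N)} [IsFiniteMeasure ν]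
    (hs : ∀ᵐ z ∂ν, ‖z‖ ≤ 1) {F : Spc N → ℝ} (hF : Continuous F) : Integrable F ν := by
  obtain ⟨C, hC⟩ := (isCompact_closedBall (0 : Spc N) 1).exists_bound_of_continuousOn hF.continuousOn
  refine Integrable.mono' (integrable_const C) hF.aestronglyMeasurable ?_
  filter_upwards [hs] with z hz
  exact hC z (by simpa using hz)

/-- a finite rotation invariant measure on the unit ball, normalised so that the nonlocal
`p`-Laplacian it generates is consistent with `Δ_p`. -/
structure Kern {N : ℕ} (p : ℝ) (ν : Measure (Spc N)) : Prop where
  fin : IsFiniteMeasure ν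
  supp : ∀ᵐ z ∂ν, ‖z‖ ≤ 1
  iso : ∀ L : Spc N ≃ₗᵢ[ℝ] Spc N, MeasurePreserving L ν ν
  mom : ∀ q w : Spc N, ∫ z, Psi p ⟪q, z⟫ * ⟪w, z⟫ ∂ν = ‖q‖ ^ (p - 2) * ⟪q, w⟫
  cone : ∃ m : ℝ, 0 < m ∧ ∀ e : Spc N, ‖e‖ = 1 → m ≤ ν.real {z | 1 / 2 ≤ ⟪e, z⟫}
  lap : ∀ e : Spc N, ‖e‖ = 1 →
    (p - 1) * ∫ z, |⟪e, z⟫| ^ (p - 2) * (‖z‖ ^ 2 - ⟪e, z⟫ ^ 2) ∂ν = (N : ℝ) - 1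

lemma integral_iso {N : ℕ} {ν : Measure (Spc N)} (hiso : ∀ L : Spc N ≃ₗᵢ[ℝ] Spc N, MeasurePreserving L ν ν)
    (L : Spc N ≃ₗᵢ[ℝ] Spc N) (F : Spc N → ℝ) : ∫ z, F (L z) ∂ν = ∫ z, F z ∂ν :=
  (hiso L).integral_comp L.toHomeomorph.measurableEmbedding F

lemma lap_of_mom {N : ℕ} {p : ℝ} (hp : 2 ≤ p) {ν : Measure (Spc N)} [IsFiniteMeasure ν]
    (hs : ∀ᵐ z ∂ν, ‖z‖ ≤ 1)
    (mom : ∀ q w : Spc N, ∫ z, Psi p ⟪q, z⟫ * ⟪w, z⟫ ∂ν = ‖q‖ ^ (p - 2) * ⟪q, w⟫)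
    (hN : 1 ≤ N) (e : Spc N) (he : ‖e‖ = 1) :
    (p - 1) * ∫ z, |⟪e, z⟫| ^ (p - 2) * (‖z‖ ^ 2 - ⟪e, z⟫ ^ 2) ∂ν = (N : ℝ) - 1 := by
  have hc : Continuous fun x : ℝ => |x| ^ (p - 2) :=
    continuous_abs.rpow_const fun x => Or.inr (by linarith)
  have key : ∀ w : Spc N, ‖w‖ = 1 → ⟪e, w⟫ = 0 →
      ∫ z, ((p - 1) * |⟪e, z⟫| ^ (p - 2)) * ⟪w, z⟫ ^ 2 ∂ν = 1 := by
    intro w hw hew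
    have bd : ∀ᵐ z ∂ν, ∀ σ ∈ Metric.ball (0:ℝ) 1,
        ‖((p - 1) * |⟪e, z⟫ + σ * ⟪w, z⟫| ^ (p - 2)) * ⟪w, z⟫ ^ 2‖ ≤ (p - 1) * 2 ^ (p - 2) := by
      filter_upwards [hs] with z hz σ hσ
      have h1 : |⟪e, z⟫| ≤ 1 := (abs_real_inner_le_norm e z).trans (by rw [he, one_mul]; exact hz)
      have h2 : |⟪w, z⟫| ≤ 1 := (abs_real_inner_le_norm w z).trans (by rw [hw, one_mul]; exact hz)
      have hσ' : |σ| ≤ 1 := by simpa using (mem_ball_zero_iff.1 hσ).le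
      have h3 : |⟪e, z⟫ + σ * ⟪w, z⟫| ≤ 2 := by
        refine (abs_add_le _ _).trans ?_
        rw [abs_mul]; nlinarith [abs_nonneg σ, abs_nonneg ⟪w, z⟫]
      have h4 : ⟪w, z⟫ ^ 2 ≤ 1 := by rw [← sq_abs]; nlinarith [abs_nonneg ⟪w, z⟫]
      have h5 := Real.rpow_le_rpow (abs_nonneg _) h3 (by linarith : 0 ≤ p - 2)
      rw [Real.norm_of_nonneg (mul_nonneg (mul_nonneg (by linarith) (by positivity)) (sq_nonneg _))]
      have : (p - 1) * |⟪e, z⟫ + σ * ⟪w, z⟫| ^ (p - 2) ≤ (p - 1) * 2 ^ (p - 2) :=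
        mul_le_mul_of_nonneg_left h5 (by linarith)
      calc _ ≤ (p - 1) * 2 ^ (p - 2) * 1 := by
            apply mul_le_mul this h4 (sq_nonneg _)
            exact mul_nonneg (by linarith) (by positivity)
        _ = _ := mul_one _
    have hcP := continuous_Psi hp
    have D := hasDerivAt_integral_of_dominated_loc_of_deriv_le (μ := ν) (x₀ := (0:ℝ))
      (s := Metric.ball (0:ℝ) 1)
      (F := fun σ z => Psi p (⟪e, z⟫ + σ * ⟪w, z⟫) * ⟪w, z⟫)
      (F' := fun σ z => ((p - 1) * |⟪e, z⟫ + σ * ⟪w, z⟫| ^ (p - 2)) * ⟪w, z⟫ ^ 2)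
      (bound := fun _ => (p - 1) * 2 ^ (p - 2)) (Metric.ball_mem_nhds _ one_pos)
      (Eventually.of_forall fun σ => Continuous.aestronglyMeasurable (by fun_prop))
      (ae_bdd_integrable_of_continuous hs (by fun_prop))
      (Continuous.aestronglyMeasurable (by fun_prop (disch := linarith))) bd (integrable_const _)
      (by
        refine ae_of_all _ fun z σ _ => ?_
        have h1 : HasDerivAt (fun σ : ℝ => ⟪e, z⟫ + σ * ⟪w, z⟫) ⟪w, z⟫ σ := by
          simpa using ((hasDerivAt_id σ).mul_const ⟪w, z⟫).const_add ⟪e, z⟫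
        have h2 := ((hasDerivAt_Psi hp (⟪e, z⟫ + σ * ⟪w, z⟫)).comp σ h1).mul_const ⟪w, z⟫
        exact h2.congr_deriv (by ring))
    have e1 : (fun σ : ℝ => ∫ z, Psi p (⟪e, z⟫ + σ * ⟪w, z⟫) * ⟪w, z⟫ ∂ν) =
        fun σ => ‖e + σ • w‖ ^ (p - 2) * σ := by
      funext σ
      have := mom (e + σ • w) w
      simp only [inner_add_left, inner_smul_left, hew, real_inner_self_eq_norm_sq, hw] at this
      simpa using this
    have D2 := D.2
    rw [e1] at D2
    have D3 : HasDerivAt (fun σ : ℝ => ‖e + σ • w‖ ^ (p - 2) * σ) 1 0 := by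
      rw [hasDerivAt_iff_tendsto_slope]
      have hcc : Continuous fun σ : ℝ => ‖e + σ • w‖ ^ (p - 2) :=
        (by fun_prop : Continuous fun σ : ℝ => ‖e + σ • w‖).rpow_const fun x => Or.inr (by linarith)
      have ht : Tendsto (fun σ : ℝ => ‖e + σ • w‖ ^ (p - 2)) (𝓝[≠] 0) (𝓝 1) := by
        have := hcc.tendsto 0
        simp only [zero_smul, add_zero, he, Real.one_rpow] at this
        exact this.mono_left nhdsWithin_le_nhds
      refine ht.congr' ?_
      filter_upwards [self_mem_nhdsWithin] with σ hσ
      have hσ : σ ≠ 0 := hσ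
      simp [slope_def_field, hσ]
    have := D2.unique D3
    simpa using this
  obtain ⟨b, hb⟩ := Orthonormal.exists_orthonormalBasis_extension_of_card_eq (𝕜 := ℝ) (E := Spc N)
    (ι := Fin N) (by simp) (v := fun _ => e) (s := {⟨0, hN⟩}) (by
      constructor
      · intro i; simpa using he
      · intro i j hij; exact absurd (Subsingleton.elim i j) hij)
  have hb0 : b ⟨0, hN⟩ = e := hb _ rfl
  have hsum : ∀ z : Spc N, ‖z‖ ^ 2 - ⟪e, z⟫ ^ 2 = ∑ i ∈ Finset.univ.erase (⟨0, hN⟩ : Fin N), ⟪b i, z⟫ ^ 2 := by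
    intro z
    have := b.sum_sq_norm_inner_right z
    rw [← Finset.add_sum_erase _ _ (Finset.mem_univ (⟨0, hN⟩ : Fin N)), hb0] at this
    simp only [Real.norm_eq_abs, sq_abs] at this
    linarith
  have : (p - 1) * ∫ z, |⟪e, z⟫| ^ (p - 2) * (‖z‖ ^ 2 - ⟪e, z⟫ ^ 2) ∂ν =
      ∫ z, ∑ i ∈ Finset.univ.erase (⟨0, hN⟩ : Fin N), ((p - 1) * |⟪e, z⟫| ^ (p - 2)) * ⟪b i, z⟫ ^ 2 ∂ν := by
    rw [← integral_const_mul]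
    congr 1; funext z; rw [hsum, ← Finset.mul_sum]; ring
  rw [this, integral_finsetSum]
  · rw [Finset.sum_congr rfl (g := fun _ => (1:ℝ))]
    · simp [Finset.card_erase_of_mem, Nat.cast_sub hN]
    · intro i hi
      have hi' := Finset.ne_of_mem_erase hi
      refine key (b i) (b.norm_eq_one i) ?_
      rw [← hb0]; exact b.orthonormal.2 (Ne.symm hi')
  · intro i _
    exact ae_bdd_integrable_of_continuous hs (by fun_prop (disch := linarith))

lemma exists_Kern {N : ℕ} (hN : 1 ≤ N) {p : ℝ} (hp : 2 ≤ p) : ∃ ν : Measure (Spc N), Kern p ν := by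
  set e0 : Spc N := EuclideanSpace.single ⟨0, hN⟩ 1 with he0
  have he0n : ‖e0‖ = 1 := by simp [he0]
  set μ : Measure (Spc N) := volume.restrict (Metric.ball 0 1) with hμ
  have : IsFiniteMeasure μ := ⟨by rw [hμ, Measure.restrict_apply_univ]; exact measure_ball_lt_top⟩
  have hs : ∀ᵐ z ∂μ, ‖z‖ ≤ 1 := by
    refine (ae_restrict_iff' measurableSet_ball).2 (ae_of_all _ fun z hz => ?_)
    simpa using (mem_ball_zero_iff.1 hz).le
  have hiso : ∀ L : Spc N ≃ₗᵢ[ℝ] Spc N, MeasurePreserving L μ μ := by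
    intro L
    have h := L.measurePreserving.restrict_preimage (s := Metric.ball (0 : Spc N) 1) measurableSet_ball
    have : L ⁻¹' Metric.ball (0 : Spc N) 1 = Metric.ball 0 1 := by ext z; simp
    rwa [this] at h
  have hcP := continuous_Psi hp
  have cone : ∀ e : Spc N, ‖e‖ = 1 →
      (volume : Measure (Spc N)).real (Metric.ball 0 (1/4)) ≤ μ.real {z | 1 / 2 ≤ ⟪e, z⟫} := by
    intro e he
    rw [← MeasureTheory.Measure.addHaar_real_ball_center volume ((3/4 : ℝ) • e), hμ,
      measureReal_restrict_apply (measurableSet_le measurable_const (by fun_prop))]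
    refine measureReal_mono ?_ (ne_top_of_le_ne_top (measure_ball_lt_top (x := (0 : Spc N)) (r := 1)).ne
      (measure_mono inter_subset_right))
    intro z hz
    have hz' : ‖z - (3/4 : ℝ) • e‖ < 1/4 := by simpa [dist_eq_norm] using hz
    have hz2 : z = (3/4 : ℝ) • e + (z - (3/4 : ℝ) • e) := by abel
    constructor
    · have h1 := abs_le.1 (abs_real_inner_le_norm e (z - (3/4 : ℝ) • e))
      have : ⟪e, z⟫ = 3/4 + ⟪e, z - (3/4 : ℝ) • e⟫ := by
        conv_lhs => rw [hz2]
        rw [inner_add_right, inner_smul_right, real_inner_self_eq_norm_sq, he]; norm_num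
      show 1/2 ≤ ⟪e, z⟫
      rw [he] at h1; linarith [h1.1]
    · rw [mem_ball_zero_iff, hz2]
      refine (norm_add_le _ _).trans_lt ?_
      rw [norm_smul, he]; norm_num; linarith
  set B := ∫ z, |⟪e0, z⟫| ^ p ∂μ with hB
  have hci : ∀ e : Spc N, Continuous fun z : Spc N => |⟪e, z⟫| ^ p := fun e =>
    (by fun_prop : Continuous fun z : Spc N => |⟪e, z⟫|).rpow_const fun x => Or.inr (by linarith)
  have m0 : 0 < (volume : Measure (Spc N)).real (Metric.ball 0 (1/4)) := by
    rw [measureReal_def, ENNReal.toReal_pos_iff]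
    exact ⟨Metric.measure_ball_pos _ _ (by norm_num), measure_ball_lt_top⟩
  have hBpos : 0 < B := by
    have h1 : (1/2 : ℝ) ^ p * μ.real {z | 1 / 2 ≤ ⟪e0, z⟫} ≤ B := by
      have hm : MeasurableSet {z : Spc N | 1 / 2 ≤ ⟪e0, z⟫} := measurableSet_le measurable_const (by fun_prop)
      have h2 : ∫ z in {z : Spc N | 1 / 2 ≤ ⟪e0, z⟫}, (1/2:ℝ) ^ p ∂μ ≤ ∫ z in {z : Spc N | 1 / 2 ≤ ⟪e0, z⟫}, |⟪e0, z⟫| ^ p ∂μ := by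
        refine setIntegral_mono_on (integrable_const _) (ae_bdd_integrable_of_continuous hs (hci e0)).integrableOn hm fun z hz => ?_
        exact Real.rpow_le_rpow (by norm_num) (le_trans hz (le_abs_self _)) (by linarith)
      rw [setIntegral_const, smul_eq_mul] at h2
      rw [mul_comm]
      exact h2.trans (setIntegral_le_integral (ae_bdd_integrable_of_continuous hs (hci e0)) (ae_of_all _ fun z => by positivity))
    have := cone e0 he0n
    have : 0 < (1/2 : ℝ) ^ p * μ.real {z | 1 / 2 ≤ ⟪e0, z⟫} := by
      apply mul_pos (by positivity); linarith
    linarith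
  have hBe : ∀ e : Spc N, ‖e‖ = 1 → ∫ z, |⟪e, z⟫| ^ p ∂μ = B := by
    intro e he
    set R := (ℝ ∙ (e - e0))ᗮ.reflection
    have hR : R e = e0 := Submodule.reflection_sub (by rw [he, he0n])
    have hi : ∀ z, ⟪e0, R z⟫ = ⟪e, z⟫ := fun z => by rw [← R.inner_map_map e z, hR]
    rw [hB, ← integral_iso hiso R fun z => |⟪e0, z⟫| ^ p]
    simp_rw [hi]
  have mom : ∀ q w : Spc N, ∫ z, Psi p ⟪q, z⟫ * ⟪w, z⟫ ∂μ = B * (‖q‖ ^ (p - 2) * ⟪q, w⟫) := by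
    intro q w
    rcases eq_or_ne q 0 with rfl | hq
    · simp
    have hqn : 0 < ‖q‖ := norm_pos_iff.2 hq
    have h1 : ∫ z, Psi p ⟪q, z⟫ * ⟪q, z⟫ ∂μ = B * ‖q‖ ^ p := by
      have : ∀ z : Spc N, Psi p ⟪q, z⟫ * ⟪q, z⟫ = |⟪‖q‖⁻¹ • q, z⟫| ^ p * ‖q‖ ^ p := by
        intro z
        rw [Psi_mul_self hp, ← Real.mul_rpow (abs_nonneg _) hqn.le, inner_smul_left, abs_mul]
        congr 1
        rw [conj_trivial, abs_of_pos (inv_pos.2 hqn)]; field_simp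
      simp_rw [this]
      rw [integral_mul_const, hBe]
      rw [norm_smul, norm_inv, norm_norm, inv_mul_cancel₀ hqn.ne']
    set c := ⟪q, w⟫ / ‖q‖ ^ 2 with hc
    set w' := w - c • q with hw'
    have hort : ⟪w', q⟫ = 0 := by
      rw [hw', inner_sub_left, inner_smul_left, real_inner_self_eq_norm_sq, hc,
        conj_trivial, real_inner_comm w q]
      field_simp; simp
    have h2 : ∫ z, Psi p ⟪q, z⟫ * ⟪w', z⟫ ∂μ = 0 := by
      set R := (ℝ ∙ w')ᗮ.reflection with hR
      have hRq : R q = q := Submodule.reflection_mem_subspace_eq_self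
        (by rw [Submodule.mem_orthogonal_singleton_iff_inner_right]; exact hort)
      have hRw : R w' = -w' := Submodule.reflection_orthogonalComplement_singleton_eq_neg w'
      have hsym : ∀ a z, ⟪a, R z⟫ = ⟪R a, z⟫ := by
        intro a z
        rw [← R.inner_map_map (R a) z, hR, Submodule.reflection_reflection]
      have := integral_iso hiso R fun z => Psi p ⟪q, z⟫ * ⟪w', z⟫
      simp only [hsym, hRq, hRw, inner_neg_left, mul_neg, integral_neg] at this
      linarith
    have h3 : ∀ z : Spc N, Psi p ⟪q, z⟫ * ⟪w, z⟫ = c * (Psi p ⟪q, z⟫ * ⟪q, z⟫) + Psi p ⟪q, z⟫ * ⟪w', z⟫ := by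
      intro z; rw [hw', inner_sub_left, inner_smul_left]; simp; ring
    simp_rw [h3]
    rw [integral_add, integral_const_mul, h1, h2, hc]
    · have : ‖q‖ ^ p = ‖q‖ ^ (p - 2) * ‖q‖ ^ 2 := by
        rw [← Real.rpow_two, ← Real.rpow_add hqn]; ring_nf
      rw [this]; field_simp; simp
    · exact ae_bdd_integrable_of_continuous hs (by fun_prop)
    · exact ae_bdd_integrable_of_continuous hs (by fun_prop)
  set ν : Measure (Spc N) := (Real.toNNReal B⁻¹) • μ with hν
  have : IsFiniteMeasure ν := by rw [hν]; infer_instance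
  have hBi : 0 < B⁻¹ := inv_pos.2 hBpos
  have hsν : ∀ᵐ z ∂ν, ‖z‖ ≤ 1 := Measure.ae_smul_measure hs _
  have int_eq : ∀ F : Spc N → ℝ, ∫ z, F z ∂ν = B⁻¹ * ∫ z, F z ∂μ := by
    intro F
    rw [hν, integral_smul_nnreal_measure, NNReal.smul_def, Real.coe_toNNReal _ hBi.le, smul_eq_mul]
  have momν : ∀ q w : Spc N, ∫ z, Psi p ⟪q, z⟫ * ⟪w, z⟫ ∂ν = ‖q‖ ^ (p - 2) * ⟪q, w⟫ := by
    intro q w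
    rw [int_eq, mom]; field_simp
  refine ⟨ν, ⟨inferInstance, hsν, ?_, momν, ?_, lap_of_mom hp hsν momν hN⟩⟩
  · intro L
    exact (hiso L).smul_measure _
  · refine ⟨B⁻¹ * (volume : Measure (Spc N)).real (Metric.ball 0 (1/4)), by positivity, fun e he => ?_⟩
    have : ν.real {z | 1 / 2 ≤ ⟪e, z⟫} = B⁻¹ * μ.real {z | 1 / 2 ≤ ⟪e, z⟫} := by
      rw [hν, measureReal_nnreal_smul_apply, Real.coe_toNNReal _ hBi.le]
    rw [this]
    exact mul_le_mul_of_nonneg_left (cone e he) hBi.le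

/-- nonlocal approximation of the `p`-Laplacian. -/
def Lop {N : ℕ} (p : ℝ) (ν : Measure (Spc N)) (ε : ℝ) (u : Spc N → ℝ) (x : Spc N) : ℝ :=
  2 * ε ^ (-p) * ∫ z, Psi p (u (x + ε • z) - u x) ∂ν

/-- one explicit Euler step. -/
def stp {N : ℕ} (p : ℝ) (ν : Measure (Spc N)) (f : ℝ → ℝ) (ε τ : ℝ) (u : Spc N → ℝ) (x : Spc N) : ℝ :=
  u x + τ * (Lop p ν ε u x - f (u x))

/-- stability condition of the explicit scheme for values in `[0, R]`. -/
structure CFL {N : ℕ} (p : ℝ) (ν : Measure (Spc N)) (f : ℝ → ℝ) (R ε τ : ℝ) : Prop where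
  eps : 0 < ε
  tau : 0 < τ
  bd : ∃ L : ℝ≥0, LipschitzOnWith L f (Icc 0 R) ∧
    τ * (2 * ε ^ (-p) * (ν.real univ * ((p - 1) * R ^ (p - 2))) + L) ≤ 1 / 2

section
variable {N : ℕ} {p : ℝ} {ν : Measure (Spc N)} {f : ℝ → ℝ} {R ε τ : ℝ}

lemma Kern.integrable_incr (hp : 2 ≤ p) (hν : Kern p ν) {u : Spc N → ℝ} (hu : Continuous u) (x : Spc N) (c ε : ℝ) :
    Integrable (fun z => Psi p (u (x + ε • z) - c)) ν := by
  have := hν.fin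
  have := continuous_Psi hp
  exact ae_bdd_integrable_of_continuous hν.supp (by fun_prop)

lemma step_mono (hp : 2 ≤ p) (hν : Kern p ν) (h : CFL p ν f R ε τ) {α β : ℝ} {a b : Spc N → ℝ}
    (h0 : 0 ≤ α) (hαβ : α ≤ β) (hβ : β ≤ R) (ha : ∀ᵐ z ∂ν, a z ∈ Icc 0 R) (hab : ∀ᵐ z ∂ν, a z ≤ b z)
    (hia : Integrable (fun z => Psi p (a z - α)) ν) (hib : Integrable (fun z => Psi p (b z - β)) ν) :
    α + τ * (2 * ε ^ (-p) * (∫ z, Psi p (a z - α) ∂ν) - f α) + (β - α) / 2 ≤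
      β + τ * (2 * ε ^ (-p) * (∫ z, Psi p (b z - β) ∂ν) - f β) := by
  have := hν.fin
  obtain ⟨L, hL, hcfl⟩ := h.bd
  have hε : 0 < ε ^ (-p) := Real.rpow_pos_of_pos h.eps _
  have hintg : ∫ z, Psi p (a z - α) ∂ν ≤
      (∫ z, Psi p (b z - β) ∂ν) + ν.real univ * ((p - 1) * R ^ (p - 2)) * (β - α) := by
    have e : ν.real univ * ((p - 1) * R ^ (p - 2)) * (β - α) = ∫ _, (p - 1) * R ^ (p - 2) * (β - α) ∂ν := by
      rw [integral_const, smul_eq_mul]; ring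
    rw [e, ← integral_add hib (integrable_const _)]
    refine integral_mono_ae hia (hib.add (integrable_const _)) ?_
    filter_upwards [ha, hab] with z hz hz2
    have h1 := Psi_lip hp (R := R) (a := a z - α) (b := a z - β)
      (abs_le.2 ⟨by linarith [hz.1], by linarith [hz.2]⟩) (abs_le.2 ⟨by linarith [hz.1], by linarith [hz.2]⟩)
    have e2 : a z - α - (a z - β) = β - α := by ring
    rw [e2, abs_of_nonneg (sub_nonneg.2 hαβ)] at h1
    have h2 := monotone_Psi hp (show a z - β ≤ b z - β by linarith)
    have := (abs_le.1 h1).2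
    show Psi p (a z - α) ≤ Psi p (b z - β) + (p - 1) * R ^ (p - 2) * (β - α)
    linarith
  have hf : f β - f α ≤ L * (β - α) := by
    have := hL.dist_le_mul β ⟨h0.trans hαβ, hβ⟩ α ⟨h0, hαβ.trans hβ⟩
    rw [Real.dist_eq, Real.dist_eq, abs_of_nonneg (sub_nonneg.2 hαβ)] at this
    exact (le_abs_self _).trans this
  have h3 : 2 * ε ^ (-p) * (∫ z, Psi p (a z - α) ∂ν) ≤ 2 * ε ^ (-p) * (∫ z, Psi p (b z - β) ∂ν) +
      2 * ε ^ (-p) * (ν.real univ * ((p - 1) * R ^ (p - 2))) * (β - α) := by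
    have := mul_le_mul_of_nonneg_left hintg (by positivity : 0 ≤ 2 * ε ^ (-p))
    linarith
  have h4 := mul_le_mul_of_nonneg_right hcfl (sub_nonneg.2 hαβ)
  have h5 := mul_le_mul_of_nonneg_left (add_le_add h3 hf) h.tau.le
  nlinarith

/-- comparison with a constant from above. -/
lemma stp_le_const (hp : 2 ≤ p) (hν : Kern p ν) (h : CFL p ν f R ε τ) {u : Spc N → ℝ} (hu : Continuous u)
    {c : ℝ} (hc : c ≤ R) (h0 : ∀ x, 0 ≤ u x) (h1 : ∀ x, u x ≤ c) (x : Spc N) :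
    stp p ν f ε τ u x ≤ c - τ * f c := by
  have := step_mono hp hν h (α := u x) (β := c) (a := fun z => u (x + ε • z)) (b := fun _ => c)
    (h0 x) (h1 x) hc (ae_of_all _ fun z => ⟨h0 _, (h1 _).trans hc⟩) (ae_of_all _ fun z => h1 _)
    (hν.integrable_incr hp hu x _ _) (by simp)
  simp only [sub_self, Psi_zero, integral_zero, mul_zero] at this
  have h2 := h1 x
  unfold stp Lop; linarith

lemma stp_nonneg (hp : 2 ≤ p) (hν : Kern p ν) (hf0 : f 0 = 0) (h : CFL p ν f R ε τ) {u : Spc N → ℝ}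
    (hu : Continuous u) (hR : 0 ≤ R) (h0 : ∀ x, 0 ≤ u x) (h1 : ∀ x, u x ≤ R) (x : Spc N) :
    0 ≤ stp p ν f ε τ u x := by
  have := step_mono hp hν h (α := 0) (β := u x) (a := fun _ => 0) (b := fun z => u (x + ε • z))
    le_rfl (h0 x) (h1 x) (ae_of_all _ fun z => ⟨le_rfl, hR⟩) (ae_of_all _ fun z => h0 _)
    (by simp) (hν.integrable_incr hp hu x _ _)
  simp only [sub_self, Psi_zero, integral_zero, mul_zero, hf0] at this
  have h2 := h0 x
  unfold stp Lop; linarith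

/-- comparison up to an additive constant. -/
lemma stp_le_add (hp : 2 ≤ p) (hν : Kern p ν) (hf : Absorb f) (h : CFL p ν f R ε τ) {u v : Spc N → ℝ}
    (hu : Continuous u) (hv : Continuous v) {M c : ℝ} (hM : 2 * M ≤ R)
    (hu0 : ∀ x, u x ∈ Icc 0 M) (hv0 : ∀ x, v x ∈ Icc 0 M) (hc : 0 ≤ c) (huv : ∀ x, u x ≤ v x + c) (x : Spc N) :
    stp p ν f ε τ u x ≤ stp p ν f ε τ v x + c := by
  have hM0 : 0 ≤ M := (hu0 x).1.trans (hu0 x).2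
  rcases le_total c M with hcM | hcM
  · have := step_mono hp hν h (α := u x) (β := v x + c) (a := fun z => u (x + ε • z))
      (b := fun z => v (x + ε • z) + c) (hu0 x).1 (huv x) (by linarith [(hv0 x).2])
      (ae_of_all _ fun z => ⟨(hu0 _).1, by linarith [(hu0 (x + ε • z)).2]⟩) (ae_of_all _ fun z => huv _)
      (hν.integrable_incr hp hu x _ _)
      (by simpa using hν.integrable_incr hp hv x (v x) ε)
    simp only [add_sub_add_right_eq_sub] at this
    have hfm := hf.mono (hv0 x).1 (show 0 ≤ v x + c by linarith [(hv0 x).1]) (by linarith)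
    have h2 := mul_le_mul_of_nonneg_left hfm h.tau.le
    have := huv x
    unfold stp Lop; linarith
  · have h1 := stp_le_const hp hν h hu (c := M) (by linarith) (fun x => (hu0 x).1) (fun x => (hu0 x).2) x
    have h2 := stp_nonneg hp hν hf.zero h hv (by linarith) (fun x => (hv0 x).1)
      (fun x => by linarith [(hv0 x).2]) x
    have h3 := mul_nonneg h.tau.le (hf.nonneg hM0)
    linarith

lemma stp_translate (u : Spc N → ℝ) (y x : Spc N) :
    stp p ν f ε τ (fun x => u (x + y)) x = stp p ν f ε τ u (x + y) := by
  simp only [stp, Lop]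
  congr 5; ext z; rw [add_right_comm]

/-- Lipschitz functions with values in `[0, M]`. -/
structure Adm (M : ℝ) (L : ℝ≥0) (u : Spc N → ℝ) : Prop where
  mem : ∀ x, u x ∈ Icc 0 M
  lip : LipschitzWith L u

lemma Adm.cont {M : ℝ} {L : ℝ≥0} {u : Spc N → ℝ} (h : Adm M L u) : Continuous u := h.lip.continuous

lemma Adm.stp (hp : 2 ≤ p) (hν : Kern p ν) (hf : Absorb f) (h : CFL p ν f R ε τ) {u : Spc N → ℝ} {M : ℝ} {L : ℝ≥0}
    (hM : 2 * M ≤ R) (hu : Adm M L u) : Adm M L (stp p ν f ε τ u) := by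
  have hM0 : 0 ≤ M := (hu.mem 0).1.trans (hu.mem 0).2
  refine ⟨fun x => ⟨stp_nonneg hp hν hf.zero h hu.cont (by linarith) (fun x => (hu.mem x).1)
    (fun x => by linarith [(hu.mem x).2]) x, ?_⟩, ?_⟩
  · have h1 := stp_le_const hp hν h hu.cont (c := M) (by linarith) (fun x => (hu.mem x).1) (fun x => (hu.mem x).2) x
    have h3 := mul_nonneg h.tau.le (hf.nonneg hM0)
    linarith
  · refine LipschitzWith.of_le_add_mul _ fun x y => ?_
    have := stp_le_add hp hν hf h (u := fun w => u (w + (x - y))) (v := u) (c := L * dist x y)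
      (by have := hu.cont; fun_prop) hu.cont hM (fun w => hu.mem _) hu.mem (by positivity) (fun w => by
        have := hu.lip.le_add_mul (w + (x - y)) w
        rwa [dist_eq_norm (w + (x - y)), add_sub_cancel_left, ← dist_eq_norm] at this) y
    rwa [stp_translate, add_sub_cancel] at this

lemma Adm.iter (hp : 2 ≤ p) (hν : Kern p ν) (hf : Absorb f) (h : CFL p ν f R ε τ) {u : Spc N → ℝ} {M : ℝ} {L : ℝ≥0}
    (hM : 2 * M ≤ R) (hu : Adm M L u) (k : ℕ) : Adm M L ((_root_.stp p ν f ε τ)^[k] u) := by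
  induction k with
  | zero => exact hu
  | succ k ih => rw [Function.iterate_succ_apply']; exact ih.stp hp hν hf h hM

lemma abs_Lop_le (hp : 2 ≤ p) (hν : Kern p ν) (hε : 0 < ε) {u : Spc N → ℝ} {L : ℝ≥0} (hu : LipschitzWith L u)
    (x : Spc N) : |Lop p ν ε u x| ≤ 2 * ν.real univ * (L : ℝ) ^ (p - 1) / ε := by
  have := hν.fin
  have h1 : ‖∫ z, Psi p (u (x + ε • z) - u x) ∂ν‖ ≤ (L * ε) ^ (p - 1) * ν.real univ := by
    refine norm_integral_le_of_norm_le_const ?_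
    filter_upwards [hν.supp] with z hz
    rw [Real.norm_eq_abs, abs_Psi hp]
    refine Real.rpow_le_rpow (abs_nonneg _) ?_ (by linarith)
    have := hu.dist_le_mul (x + ε • z) x
    rw [Real.dist_eq, dist_eq_norm, add_sub_cancel_left, norm_smul, Real.norm_of_nonneg hε.le] at this
    refine this.trans (mul_le_mul_of_nonneg_left ?_ (by positivity))
    nlinarith
  have e : ε ^ (-p) * ε ^ (p - 1) = ε⁻¹ := by
    rw [← Real.rpow_add hε, show -p + (p - 1) = -1 by ring, Real.rpow_neg_one]
  have hεp : 0 < ε ^ (-p) := Real.rpow_pos_of_pos hε _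
  rw [Lop, abs_mul, abs_of_nonneg (by positivity : 0 ≤ 2 * ε ^ (-p))]
  rw [Real.norm_eq_abs, Real.mul_rpow (by positivity) hε.le] at h1
  calc _ ≤ 2 * ε ^ (-p) * ((L : ℝ) ^ (p - 1) * ε ^ (p - 1) * ν.real univ) := by gcongr
    _ = 2 * ν.real univ * (L : ℝ) ^ (p - 1) * (ε ^ (-p) * ε ^ (p - 1)) := by ring
    _ = _ := by rw [e]; ring

lemma iter_incr (hp : 2 ≤ p) (hν : Kern p ν) (hf : Absorb f) (h : CFL p ν f R ε τ) {u : Spc N → ℝ} {M : ℝ} {L : ℝ≥0}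
    (hM : 2 * M ≤ R) (hu : Adm M L u) (k : ℕ) (x : Spc N) :
    |(stp p ν f ε τ)^[k + 1] u x - (stp p ν f ε τ)^[k] u x| ≤
      τ * (2 * ν.real univ * (L : ℝ) ^ (p - 1) / ε + f M) := by
  have hM0 : 0 ≤ M := (hu.mem 0).1.trans (hu.mem 0).2
  have hεp := h.eps
  have hfM := hf.nonneg hM0
  have hτ := h.tau
  have hc : 0 ≤ τ * (2 * ν.real univ * (L : ℝ) ^ (p - 1) / ε + f M) := by positivity
  have base : ∀ x, |stp p ν f ε τ u x - u x| ≤ τ * (2 * ν.real univ * (L : ℝ) ^ (p - 1) / ε + f M) := by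
    intro x
    have h1 := abs_Lop_le hp hν h.eps hu.lip x
    have h2 := hf.mono (hu.mem x).1 hM0 (hu.mem x).2
    have h3 := hf.nonneg (hu.mem x).1
    rw [stp, add_sub_cancel_left, abs_mul, abs_of_pos hτ]
    refine mul_le_mul_of_nonneg_left ((abs_sub _ _).trans ?_) hτ.le
    rw [abs_of_nonneg h3]; linarith
  have key : ∀ k, (∀ x, (stp p ν f ε τ)^[k + 1] u x ≤ (stp p ν f ε τ)^[k] u x + τ * (2 * ν.real univ * (L : ℝ) ^ (p - 1) / ε + f M)) ∧
      ∀ x, (stp p ν f ε τ)^[k] u x ≤ (stp p ν f ε τ)^[k + 1] u x + τ * (2 * ν.real univ * (L : ℝ) ^ (p - 1) / ε + f M) := by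
    intro k
    induction k with
    | zero => exact ⟨fun x => by linarith [(abs_le.1 (base x)).2, show (stp p ν f ε τ)^[0+1] u x = stp p ν f ε τ u x from rfl, show (stp p ν f ε τ)^[0] u x = u x from rfl],
        fun x => by linarith [(abs_le.1 (base x)).1, show (stp p ν f ε τ)^[0+1] u x = stp p ν f ε τ u x from rfl, show (stp p ν f ε τ)^[0] u x = u x from rfl]⟩
    | succ k ih =>
      have a1 := hu.iter hp hν hf h hM k
      have a2 := hu.iter hp hν hf h hM (k + 1)
      constructor
      · intro x
        rw [Function.iterate_succ_apply' _ (k + 1), Function.iterate_succ_apply' _ k] at *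
        exact stp_le_add hp hν hf h a2.cont a1.cont hM a2.mem a1.mem hc ih.1 x
      · intro x
        rw [Function.iterate_succ_apply' _ (k + 1), Function.iterate_succ_apply' _ k] at *
        exact stp_le_add hp hν hf h a1.cont a2.cont hM a1.mem a2.mem hc ih.2 x
  rw [abs_le]
  constructor
  · linarith [(key k).2 x]
  · linarith [(key k).1 x]

/-- decay of the scheme along the flat solution. -/
lemma iter_le_flat (hp : 2 ≤ p) (hν : Kern p ν) (hf : Absorb f) (h : CFL p ν f R ε τ) {u : Spc N → ℝ} {M : ℝ} {L : ℝ≥0}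
    (hM : 2 * M ≤ R) (hu : Adm M L u) {φ : ℝ → ℝ}
    (hφ : ∀ t : ℝ, 0 < t → 0 < φ t ∧ (∫ s in Ioi (φ t), 1 / f s) = t) {s : ℝ} (hs : 0 < s) (hsM : φ s = M)
    (k : ℕ) (x : Spc N) : (stp p ν f ε τ)^[k] u x ≤ φ (s + k * τ) := by
  have hτ := h.tau
  have hM0 : 0 ≤ M := (hu.mem 0).1.trans (hu.mem 0).2
  induction k generalizing x with
  | zero => simpa [hsM] using (hu.mem x).2
  | succ k ih =>
    have a1 := hu.iter hp hν hf h hM k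
    have hle : φ (s + k * τ) ≤ M := hsM ▸ hf.flat_antitone hφ hs (by nlinarith [(Nat.cast_nonneg k : (0:ℝ) ≤ k)])
    have hpos : 0 < s + k * τ := by positivity
    rw [Function.iterate_succ_apply']
    have := stp_le_const hp hν h a1.cont (c := φ (s + k * τ)) (by linarith) (fun x => (a1.mem x).1) ih x
    have h2 := hf.flat_step hφ hpos hτ.le
    rw [show s + ((k + 1 : ℕ) : ℝ) * τ = s + k * τ + τ by push_cast; ring]
    linarith

end

section
variable {N : ℕ} {p : ℝ} {ν : Measure (Spc N)} {f : ℝ → ℝ} {R ε τ : ℝ}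

/-- concave modulus used in the Lipschitz smoothing estimate. -/
def modu (M A θ r : ℝ) : ℝ := A * r - A ^ 2 / (16 * M) * r ^ 2 + θ

lemma modu_mono {M A θ r s : ℝ} (hM : 0 < M) (hA : 0 < A) (hrs : r ≤ s) (hs : s ≤ 8 * M / A) :
    modu M A θ r ≤ modu M A θ s := by
  unfold modu
  have h1 : s * A ≤ 8 * M := (le_div_iff₀ hA).1 hs
  have h2 : A / (16 * M) * (s + r) ≤ 1 := by
    rw [div_mul_eq_mul_div, div_le_one (by positivity)]; nlinarith
  have e : A ^ 2 / (16 * M) * (s ^ 2 - r ^ 2) = A * (s - r) * (A / (16 * M) * (s + r)) := by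
    field_simp; ring
  have : A * (s - r) * (A / (16 * M) * (s + r)) ≤ A * (s - r) * 1 :=
    mul_le_mul_of_nonneg_left h2 (mul_nonneg hA.le (by linarith))
  nlinarith

lemma modu_ge_half {M A θ r : ℝ} (hM : 0 < M) (hA : 0 < A) (hr : 0 ≤ r) (hs : r ≤ 8 * M / A) :
    A * r / 2 + θ ≤ modu M A θ r := by
  unfold modu
  have h1 : r * A ≤ 8 * M := (le_div_iff₀ hA).1 hs
  have h2 : A / (16 * M) * r ≤ 1 / 2 := by
    rw [div_mul_eq_mul_div, div_le_iff₀ (by positivity)]; nlinarith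
  have e : A ^ 2 / (16 * M) * r ^ 2 = A * r * (A / (16 * M) * r) := by ring
  have : A * r * (A / (16 * M) * r) ≤ A * r * (1 / 2) :=
    mul_le_mul_of_nonneg_left h2 (by positivity)
  linarith

lemma modu_drop {M A θ r s : ℝ} (hM : 0 < M) (hA : 0 < A) (hs : 0 ≤ s) (hr : r ≤ 4 * M / A) :
    modu M A θ (r - s / 2) ≤ modu M A θ r - A * s / 4 := by
  unfold modu
  have h1 : r * A ≤ 4 * M := (le_div_iff₀ hA).1 hr
  have h2 : A / (16 * M) * (2 * r) ≤ 1 / 2 := by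
    rw [div_mul_eq_mul_div, div_le_iff₀ (by positivity)]; nlinarith
  have e : A ^ 2 / (16 * M) * (r ^ 2 - (r - s / 2) ^ 2) =
      A * (s / 2) * (A / (16 * M) * (2 * r)) - A ^ 2 / (16 * M) * (s / 2) ^ 2 := by ring
  have : A * (s / 2) * (A / (16 * M) * (2 * r)) ≤ A * (s / 2) * (1 / 2) :=
    mul_le_mul_of_nonneg_left h2 (by positivity)
  have : 0 ≤ A ^ 2 / (16 * M) * (s / 2) ^ 2 := by positivity
  nlinarith

/-- hypotheses of the one step coupling estimate. -/
structure CoupHyp (M A θ ε R : ℝ) (u : Spc N → ℝ) : Prop where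
  Mpos : 0 < M
  Apos : 0 < A
  θ0 : 0 ≤ θ
  θM : θ ≤ M
  small : A * ε ≤ M / 4
  RM : 6 * M ≤ R
  cont : Continuous u
  mem : ∀ x, u x ∈ Icc 0 M
  mod : ∀ x y, ‖x - y‖ ≤ 8 * M / A → u x - u y ≤ modu M A θ ‖x - y‖

lemma coup_slack (hp : 2 ≤ p) (hν : Kern p ν) (hf : Absorb f) (h : CFL p ν f R ε τ) {M A θ : ℝ} {u : Spc N → ℝ}
    (H : CoupHyp M A θ ε R u) {x y : Spc N} (hr : ‖x - y‖ ≤ 8 * M / A) :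
    stp p ν f ε τ u x - stp p ν f ε τ u y ≤ modu M A θ ‖x - y‖ - (modu M A θ ‖x - y‖ - (u x - u y)) / 2 := by
  have hM := H.Mpos
  have hA := H.Apos
  set Φ := modu M A θ ‖x - y‖ with hΦ
  have hΦ0 : 0 ≤ Φ := by
    have := modu_ge_half (θ := θ) hM hA (norm_nonneg (x - y)) hr
    have : 0 ≤ A * ‖x - y‖ / 2 := by positivity
    linarith [H.θ0]
  have hΦ5 : Φ ≤ 5 * M := by
    have := modu_mono (θ := θ) hM hA hr le_rfl
    have e : modu M A θ (8 * M / A) = 4 * M + θ := by unfold modu; field_simp; ring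
    linarith [H.θM]
  have := step_mono hp hν h (α := u x) (β := u y + Φ) (a := fun z => u (x + ε • z))
    (b := fun z => u (y + ε • z) + Φ) (H.mem x).1 (by linarith [H.mod x y hr]) (by linarith [(H.mem y).2, H.RM])
    (ae_of_all _ fun z => ⟨(H.mem _).1, by linarith [(H.mem (x + ε • z)).2, H.RM]⟩)
    (ae_of_all _ fun z => by
      have := H.mod (x + ε • z) (y + ε • z) (by rwa [add_sub_add_right_eq_sub])
      rw [add_sub_add_right_eq_sub] at this
      linarith)
    (hν.integrable_incr hp H.cont x _ _)
    (by simpa using hν.integrable_incr hp H.cont y (u y) ε)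
  simp only [add_sub_add_right_eq_sub] at this
  have hfm := hf.mono (H.mem y).1 (show 0 ≤ u y + Φ by linarith [(H.mem y).1]) (by linarith)
  have h2 := mul_le_mul_of_nonneg_left hfm h.tau.le
  unfold stp Lop; linarith

set_option maxHeartbeats 1000000 in
/-- pointwise estimate of the coupled increments. -/
lemma coup_pointwise (hp : 2 ≤ p) (hε : 0 < ε) {M A θ : ℝ} {u : Spc N → ℝ}
    (H : CoupHyp M A θ ε R u) {x y e : Spc N} {r : ℝ} (he : ‖e‖ = 1) (hxy : x - y = r • e) (hr1 : 2 * ε ≤ r)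
    (hr2 : r ≤ 4 * M / A) (hs : modu M A θ r - (u x - u y) ≤ A * ε / 16)
    {z z' : Spc N} (hz : ‖z‖ ≤ 1) (hz' : z' = z - (2 * ⟪e, z⟫) • e) :
    Psi p (u (x + ε • z) - u x) + Psi p (u (x + ε • z') - u x) - Psi p (u (y + ε • z) - u y)
      - Psi p (u (y + ε • z') - u y) ≤ 2 * ((p - 1) * R ^ (p - 2)) * (modu M A θ r - (u x - u y)) -
      {z : Spc N | 1 / 2 ≤ ⟪e, z⟫}.indicator (fun _ => 32 ^ (2 - p) * A ^ p * ε ^ p / (16 * M)) z := by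
  have hM := H.Mpos
  have hA := H.Apos
  have hRM := H.RM
  have hr0 : 0 ≤ r := by linarith
  have hAε := H.small
  have hnxy : ‖x - y‖ = r := by rw [hxy, norm_smul, he, mul_one, Real.norm_of_nonneg hr0]
  have hrA : r * A ≤ 4 * M := (le_div_iff₀ hA).1 hr2
  set s0 := modu M A θ r - (u x - u y) with hs0
  have hr8 : r ≤ 8 * M / A := by rw [le_div_iff₀ hA]; linarith
  have hs0n : 0 ≤ s0 := by
    have := H.mod x y (by rw [hnxy]; exact hr8)
    rw [hnxy] at this; linarith
  have same : ∀ w, u (x + ε • w) - u x ≤ u (y + ε • w) - u y + s0 := by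
    intro w
    have := H.mod (x + ε • w) (y + ε • w) (by rw [add_sub_add_right_eq_sub, hnxy]; exact hr8)
    rw [add_sub_add_right_eq_sub, hnxy] at this
    linarith
  have shift : ∀ w, Psi p (u (y + ε • w) - u y + s0) ≤ Psi p (u (y + ε • w) - u y) + (p - 1) * R ^ (p - 2) * s0 := by
    intro w
    have b1 := H.mem (y + ε • w)
    have b2 := H.mem y
    have := Psi_lip hp (R := R) (a := u (y + ε • w) - u y + s0) (b := u (y + ε • w) - u y)
      (abs_le.2 ⟨by linarith [b1.1, b2.2], by linarith [b1.2, b2.1]⟩)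
      (abs_le.2 ⟨by linarith [b1.1, b2.2], by linarith [b1.2, b2.1]⟩)
    rw [add_sub_cancel_left, abs_of_nonneg hs0n] at this
    linarith [(abs_le.1 this).2]
  have sh1 := shift z
  have sh2 := shift z'
  by_cases hcone : z ∈ {z : Spc N | 1 / 2 ≤ ⟪e, z⟫}
  · rw [indicator_of_mem hcone]
    have hc : 1 / 2 ≤ ⟪e, z⟫ := hcone
    have hc1 : ⟪e, z⟫ ≤ 1 := (real_inner_le_norm e z).trans (by rw [he, one_mul]; exact hz)
    set s := ε * ⟪e, z⟫ with hsdef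
    have hs1 : ε / 2 ≤ s := by nlinarith
    have hs2 : s ≤ ε := by nlinarith
    have ee : ⟪e, e⟫ = 1 := by rw [real_inner_self_eq_norm_sq, he]; norm_num
    have d1 : (x + ε • z) - (y + ε • z') = (r + 2 * s) • e := by
      have : (x + ε • z) - (y + ε • z') = (x - y) + ε • (z - z') := by rw [smul_sub]; abel
      rw [this, hxy, hz', sub_sub_cancel, smul_smul, ← add_smul]; congr 1; rw [hsdef]; ring
    have d2 : (x + ε • z') - (y + ε • z) = (r - 2 * s) • e := by
      have : (x + ε • z') - (y + ε • z) = (x - y) - ε • (z - z') := by rw [smul_sub]; abel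
      rw [this, hxy, hz', sub_sub_cancel, smul_smul, ← sub_smul]; congr 1; rw [hsdef]; ring
    have n1 : ‖(x + ε • z) - (y + ε • z')‖ = r + 2 * s := by
      rw [d1, norm_smul, he, mul_one, Real.norm_of_nonneg (by linarith)]
    have n2 : ‖(x + ε • z') - (y + ε • z)‖ = r - 2 * s := by
      rw [d2, norm_smul, he, mul_one, Real.norm_of_nonneg (by linarith)]
    have hsA : A * s ≤ M / 4 := (mul_le_mul_of_nonneg_left hs2 hA.le).trans hAε
    have hAs : 0 < A * s := mul_pos hA (by linarith)
    have hAsε : A * ε ≤ 2 * (A * s) := by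
      have := mul_le_mul_of_nonneg_left hs1 hA.le
      linarith
    have q1 := H.mod (x + ε • z) (y + ε • z') (by rw [n1, le_div_iff₀ hA]; linarith)
    have q2 := H.mod (x + ε • z') (y + ε • z) (by rw [n2, le_div_iff₀ hA]; linarith)
    rw [n1] at q1
    rw [n2] at q2
    have hsum : modu M A θ (r + 2 * s) + modu M A θ (r - 2 * s) = 2 * modu M A θ r - 8 * (A ^ 2 / (16 * M)) * s ^ 2 := by
      unfold modu; ring
    have nle : ∀ w : Spc N, ‖w‖ ≤ 1 → ⟪e, w⟫ = -⟪e, z⟫ → ‖r • e + ε • w‖ ≤ r - s / 2 := by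
      intro w hw hew
      have hsq : ‖r • e + ε • w‖ ^ 2 ≤ (r - s / 2) ^ 2 := by
        rw [norm_add_sq_real, norm_smul, norm_smul, inner_smul_left, inner_smul_right, hew, he,
          Real.norm_of_nonneg hr0, Real.norm_of_nonneg hε.le]
        simp only [conj_trivial]
        have h1 : (ε * ‖w‖) ^ 2 ≤ ε ^ 2 :=
          pow_le_pow_left₀ (by positivity) (mul_le_of_le_one_right hε.le hw) 2
        have hrs : ε ^ 2 ≤ r * s := by
          calc ε ^ 2 = (2 * ε) * (ε / 2) := by ring
            _ ≤ r * s := mul_le_mul hr1 hs1 (by linarith) hr0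
        have e1 : r * 1 * (r * 1) = r ^ 2 := by ring
        have e2 : (r - s / 2) ^ 2 = r ^ 2 - r * s + s ^ 2 / 4 := by ring
        have e3 : (r * 1) ^ 2 + 2 * (r * (ε * -⟪e, z⟫)) + (ε * ‖w‖) ^ 2 = r ^ 2 - 2 * (r * s) + (ε * ‖w‖) ^ 2 := by
          rw [hsdef]; ring
        rw [e2, e3]
        linarith [sq_nonneg s]
      exact (pow_le_pow_iff_left₀ (norm_nonneg _) (by linarith) two_ne_zero).1 hsq
    have hz'n : ‖z'‖ ≤ 1 := by
      have : ‖z'‖ ^ 2 = ‖z‖ ^ 2 := by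
        rw [hz', norm_sub_sq_real, norm_smul, inner_smul_right, he, real_inner_comm, Real.norm_eq_abs, mul_one, sq_abs]; ring
      have := (pow_left_inj₀ (norm_nonneg z') (norm_nonneg z) two_ne_zero).1 this
      linarith
    have hez' : ⟪e, z'⟫ = -⟪e, z⟫ := by
      rw [hz', inner_sub_right, inner_smul_right, ee]; ring
    have n3 := nle z' hz'n hez'
    have n4 := nle (-z) (by simpa using hz) (by simp)
    have e3 : r • e + ε • z' = (x + ε • z') - y := by rw [← hxy]; abel
    have e4 : r • e + ε • (-z) = x - (y + ε • z) := by rw [← hxy, smul_neg]; abel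
    rw [e3] at n3
    rw [e4] at n4
    have hr8' : r - s / 2 ≤ 8 * M / A := by linarith
    have q3 := (H.mod _ _ (n3.trans hr8')).trans (modu_mono hM hA n3 hr8')
    have q4 := (H.mod _ _ (n4.trans hr8')).trans (modu_mono hM hA n4 hr8')
    have dr := modu_drop (θ := θ) hM hA (by linarith : 0 ≤ s) hr2
    have hq1 : A * ε / 16 ≤ A * s / 8 := by linarith
    have hη : 8 * (A ^ 2 / (16 * M)) * s ^ 2 ≤ A * s / 8 := by
      have e : 8 * (A ^ 2 / (16 * M)) * s ^ 2 = (A * s) * (A * s) / (2 * M) := by field_simp; ring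
      rw [e, div_le_iff₀ (by positivity)]
      have := mul_le_mul_of_nonneg_left hsA hAs.le
      linarith
    have key := Psi_coupling hp (ap := u (x + ε • z) - u x) (am := u (x + ε • z') - u x)
      (bp := u (y + ε • z) - u y + s0) (bm := u (y + ε • z') - u y + s0)
      (η := 8 * (A ^ 2 / (16 * M)) * s ^ 2) (q := A * s / 8) (same z) (same z')
      (by linarith) (by linarith) (by linarith) (by positivity) hη
    have low : 32 ^ (2 - p) * A ^ p * ε ^ p / (16 * M) ≤
        (A * s / 8 / 2) ^ (p - 2) * (8 * (A ^ 2 / (16 * M)) * s ^ 2 / 2) := by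
      have e1 : (32:ℝ) ^ (2 - p) * A ^ p * ε ^ p / (16 * M) = (A * ε / 32) ^ (p - 2) * (A ^ 2 * ε ^ 2 / (16 * M)) := by
        rw [Real.div_rpow (by positivity) (by norm_num), Real.mul_rpow hA.le hε.le,
          show (2 - p) = -(p - 2) by ring, Real.rpow_neg (by norm_num)]
        have a1 : A ^ p = A ^ (p - 2) * A ^ 2 := by
          rw [← Real.rpow_two, ← Real.rpow_add hA]; ring_nf
        have a2 : ε ^ p = ε ^ (p - 2) * ε ^ 2 := by
          rw [← Real.rpow_two, ← Real.rpow_add hε]; ring_nf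
        rw [a1, a2]; field_simp
      rw [e1]
      have b1 : (A * ε / 32) ^ (p - 2) ≤ (A * s / 8 / 2) ^ (p - 2) :=
        Real.rpow_le_rpow (by positivity) (by linarith) (by linarith)
      have b2 : A ^ 2 * ε ^ 2 / (16 * M) ≤ 8 * (A ^ 2 / (16 * M)) * s ^ 2 / 2 := by
        have : ε ^ 2 ≤ 4 * s ^ 2 := by
          calc ε ^ 2 ≤ (2 * s) ^ 2 := pow_le_pow_left₀ hε.le (by linarith) 2
            _ = _ := by ring
        have e : 8 * (A ^ 2 / (16 * M)) * s ^ 2 / 2 = A ^ 2 * (4 * s ^ 2) / (16 * M) := by ring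
        rw [e]; gcongr
      exact mul_le_mul b1 b2 (by positivity) (by positivity)
    linarith
  · rw [indicator_of_notMem hcone]
    have m1 := monotone_Psi hp (same z)
    have m2 := monotone_Psi hp (same z')
    linarith

end

section
variable {N : ℕ} {p : ℝ} {ν : Measure (Spc N)} {f : ℝ → ℝ} {R ε τ : ℝ}

lemma Kern.reflect_integral (hν : Kern p ν) {e : Spc N} (he : ‖e‖ = 1) (F : Spc N → ℝ) :
    ∫ z, F (z - (2 * ⟪e, z⟫) • e) ∂ν = ∫ z, F z ∂ν := by
  rw [← integral_iso hν.iso ((ℝ ∙ e)ᗮ.reflection) F]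
  congr 1; ext z
  congr 1
  rw [Submodule.reflection_orthogonal_apply, Submodule.reflection_singleton_apply, he]
  simp only [RCLike.ofReal_real_eq_id, id, one_pow, div_one]
  rw [← Nat.cast_smul_eq_nsmul ℝ, smul_smul]
  push_cast
  abel

lemma coup_Lop (hp : 2 ≤ p) (hν : Kern p ν) (hε : 0 < ε) {M A θ : ℝ} {u : Spc N → ℝ}
    (H : CoupHyp M A θ ε R u) {m : ℝ} (hm : ∀ e : Spc N, ‖e‖ = 1 → m ≤ ν.real {z | 1 / 2 ≤ ⟪e, z⟫})
    {x y : Spc N} (hr1 : 2 * ε ≤ ‖x - y‖) (hr2 : ‖x - y‖ ≤ 4 * M / A)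
    (hs : modu M A θ ‖x - y‖ - (u x - u y) ≤ A * ε / 16) :
    Lop p ν ε u x - Lop p ν ε u y ≤
      2 * ε ^ (-p) * (ν.real univ * ((p - 1) * R ^ (p - 2))) * (modu M A θ ‖x - y‖ - (u x - u y)) -
        m * 32 ^ (2 - p) / 16 * A ^ p / M := by
  have := hν.fin
  have hM := H.Mpos
  have hA := H.Apos
  set r := ‖x - y‖ with hr
  set s0 := modu M A θ r - (u x - u y) with hs0
  have hr0 : 0 < r := by linarith
  set e : Spc N := r⁻¹ • (x - y) with hedef
  have he : ‖e‖ = 1 := by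
    rw [hedef, norm_smul, ← hr, norm_inv, Real.norm_of_nonneg hr0.le, inv_mul_cancel₀ hr0.ne']
  have hxy : x - y = r • e := by rw [hedef, smul_smul, mul_inv_cancel₀ hr0.ne', one_smul]
  have i1 := hν.integrable_incr hp H.cont x (u x) ε
  have i2 := hν.integrable_incr hp H.cont y (u y) ε
  have hcΨ := continuous_Psi hp
  have hcu := H.cont
  have i3 : ∀ w, Integrable (fun z : Spc N => Psi p (u (w + ε • (z - (2 * ⟪e, z⟫) • e)) - u w)) ν := fun w =>
    ae_bdd_integrable_of_continuous hν.supp (by fun_prop)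
  have r1 : ∀ w, ∫ z : Spc N, Psi p (u (w + ε • (z - (2 * ⟪e, z⟫) • e)) - u w) ∂ν =
      ∫ z, Psi p (u (w + ε • z) - u w) ∂ν := fun w =>
    hν.reflect_integral he (fun z => Psi p (u (w + ε • z) - u w))
  have hmeas : MeasurableSet {z : Spc N | 1 / 2 ≤ ⟪e, z⟫} :=
    measurableSet_le measurable_const (by fun_prop)
  have j1 : Integrable (fun z => Psi p (u (x + ε • z) - u x) + Psi p (u (x + ε • (z - (2 * ⟪e, z⟫) • e)) - u x)) ν :=
    i1.add (i3 x)
  have j2 : Integrable (fun z => Psi p (u (x + ε • z) - u x) + Psi p (u (x + ε • (z - (2 * ⟪e, z⟫) • e)) - u x)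
      - Psi p (u (y + ε • z) - u y)) ν := j1.sub i2
  have key : ∫ z : Spc N, (Psi p (u (x + ε • z) - u x) + Psi p (u (x + ε • (z - (2 * ⟪e, z⟫) • e)) - u x)
      - Psi p (u (y + ε • z) - u y) - Psi p (u (y + ε • (z - (2 * ⟪e, z⟫) • e)) - u y)) ∂ν ≤
      ∫ z, (2 * ((p - 1) * R ^ (p - 2)) * s0 -
      {z : Spc N | 1 / 2 ≤ ⟪e, z⟫}.indicator (fun _ => 32 ^ (2 - p) * A ^ p * ε ^ p / (16 * M)) z) ∂ν := by
    refine integral_mono_ae (j2.sub (i3 y))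
      ((integrable_const _).sub ((integrable_const _).indicator hmeas)) ?_
    filter_upwards [hν.supp] with z hz
    exact coup_pointwise hp hε H he hxy hr1 hr2 hs hz rfl
  rw [integral_sub j2 (i3 y), integral_sub j1 i2, integral_add i1 (i3 x),
    r1, r1, integral_sub (integrable_const _) ((integrable_const _).indicator hmeas), integral_const,
    integral_indicator hmeas, setIntegral_const, smul_eq_mul, smul_eq_mul] at key
  have hmm := hm e he
  have hεp : 0 < ε ^ (-p) := Real.rpow_pos_of_pos hε _
  have hεε : ε ^ (-p) * ε ^ p = 1 := by rw [← Real.rpow_add hε]; simp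
  have hc : 0 ≤ 32 ^ (2 - p) * A ^ p * ε ^ p / (16 * M) := by positivity
  have k2 := mul_le_mul_of_nonneg_right hmm hc
  have k3 := mul_le_mul_of_nonneg_left (add_le_add key k2) hεp.le
  have e1 : ε ^ (-p) * (m * (32 ^ (2 - p) * A ^ p * ε ^ p / (16 * M))) = m * 32 ^ (2 - p) / 16 * A ^ p / M := by
    calc _ = (ε ^ (-p) * ε ^ p) * (m * (32 ^ (2 - p) * A ^ p / (16 * M))) := by ring
      _ = _ := by rw [hεε, one_mul]; field_simp
  unfold Lop
  rw [mul_add, e1] at k3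
  nlinarith

lemma coup_step (hp : 2 ≤ p) (hν : Kern p ν) (hf : Absorb f) (h : CFL p ν f R ε τ) {M A θ : ℝ} {u : Spc N → ℝ}
    (H : CoupHyp M A θ ε R u) {m : ℝ} (hm : ∀ e : Spc N, ‖e‖ = 1 → m ≤ ν.real {z | 1 / 2 ≤ ⟪e, z⟫})
    {x y : Spc N} (hr1 : 2 * ε ≤ ‖x - y‖) (hr2 : ‖x - y‖ ≤ 4 * M / A) :
    stp p ν f ε τ u x - stp p ν f ε τ u y ≤ modu M A θ ‖x - y‖ -
      min (A * ε / 32) (τ * (m * 32 ^ (2 - p) / 16 * A ^ p / M)) := by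
  have hM := H.Mpos
  have hA := H.Apos
  have hr8 : ‖x - y‖ ≤ 8 * M / A := hr2.trans (by gcongr; norm_num)
  set s0 := modu M A θ ‖x - y‖ - (u x - u y) with hs0
  have hs0n : 0 ≤ s0 := by have := H.mod x y hr8; linarith
  rcases le_total s0 (A * ε / 16) with hs | hs
  · have h1 := coup_Lop hp hν h.eps H hm hr1 hr2 hs
    obtain ⟨L, -, hcfl⟩ := h.bd
    have hR : 0 < R := by linarith [H.RM]
    have hτL : 0 ≤ τ * L := mul_nonneg h.tau.le L.2
    have h2 : τ * (2 * ε ^ (-p) * (ν.real univ * ((p - 1) * R ^ (p - 2)))) * s0 ≤ 1 / 2 * s0 :=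
      mul_le_mul_of_nonneg_right (by linarith) hs0n
    have hhalf := modu_ge_half (θ := θ) hM hA (norm_nonneg (x - y)) hr8
    have hle : u y ≤ u x := by
      have := mul_le_mul_of_nonneg_left hr1 hA.le
      have := mul_pos hA h.eps
      linarith [H.θ0]
    have h3 := mul_le_mul_of_nonneg_left (hf.mono (H.mem y).1 (H.mem x).1 hle) h.tau.le
    have h4 := mul_le_mul_of_nonneg_left h1 h.tau.le
    have := min_le_right (A * ε / 32) (τ * (m * 32 ^ (2 - p) / 16 * A ^ p / M))
    unfold stp
    rw [← hs0] at h4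
    linarith
  · have h1 := coup_slack hp hν hf h H hr8
    rw [← hs0] at h1
    have := min_le_left (A * ε / 32) (τ * (m * 32 ^ (2 - p) / 16 * A ^ p / M))
    linarith

end

section
variable {N : ℕ} {p : ℝ} {ν : Measure (Spc N)} {f : ℝ → ℝ} {R ε τ : ℝ}

/-- parameter conditions for the Lipschitz smoothing estimate. -/
structure SmoothHyp (M K s ε τ R m p : ℝ) (L : ℝ≥0) : Prop where
  Mpos : 0 < M
  spos : 0 < s
  RM : 6 * M ≤ R
  mpos : 0 < m
  K1 : 4 * M ^ 2 ≤ K * (m * 32 ^ (2 - p) / 16)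
  Kε : K / s * ε ≤ M / 4
  θM : 2 * ε * L ≤ M
  τs : τ ≤ s
  τε : 128 * M * τ ≤ K * ε
  L0 : 2 * L ≤ K / s

lemma SmoothHyp.Kpos {M K s m : ℝ} {L : ℝ≥0} (H : SmoothHyp M K s ε τ R m p L) : 0 < K := by
  have h1 := H.K1
  have h2 : 0 < m * 32 ^ (2 - p) / 16 := by have := H.mpos; positivity
  have h3 : 0 < 4 * M ^ 2 := by have := H.Mpos; positivity
  exact pos_of_mul_pos_left (h3.trans_le h1) h2.le

lemma smoothing_aux (hp : 2 ≤ p) (hν : Kern p ν) (hf : Absorb f) (h : CFL p ν f R ε τ) {M K s m : ℝ} {L : ℝ≥0}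
    {u : Spc N → ℝ} (hu : Adm M L u) (H : SmoothHyp M K s ε τ R m p L)
    (hm : ∀ e : Spc N, ‖e‖ = 1 → m ≤ ν.real {z | 1 / 2 ≤ ⟪e, z⟫}) (k : ℕ) (hk : k * τ + s ≤ K) (x y : Spc N)
    (hr : ‖x - y‖ ≤ 8 * M / (K / (k * τ + s))) :
    (stp p ν f ε τ)^[k] u x - (stp p ν f ε τ)^[k] u y ≤ modu M (K / (k * τ + s)) (2 * ε * L) ‖x - y‖ := by
  have hM := H.Mpos
  have hK := H.Kpos
  have hs := H.spos
  have hτ := h.tau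
  have hε := h.eps
  have hR2 : 2 * M ≤ R := by linarith [H.RM]
  have hθ : 0 ≤ 2 * ε * L := by positivity
  induction k generalizing x y with
  | zero =>
    simp only [Nat.cast_zero, zero_mul, zero_add, Function.iterate_zero, id] at hr ⊢
    have h1 := modu_ge_half (θ := 2 * ε * L) hM (by positivity : 0 < K / s) (norm_nonneg (x - y)) hr
    have h2 := hu.lip.dist_le_mul x y
    rw [Real.dist_eq, dist_eq_norm] at h2
    have h3 := mul_le_mul_of_nonneg_right H.L0 (norm_nonneg (x - y))
    linarith [le_abs_self (u x - u y)]
  | succ k ih =>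
    have hcast : ((k + 1 : ℕ) : ℝ) * τ + s = k * τ + s + τ := by push_cast; ring
    rw [hcast] at hk hr ⊢
    set t := k * τ + s with ht
    have hts : s ≤ t := by rw [ht]; have : 0 ≤ k * τ := by positivity
                           linarith
    have ht0 : 0 < t := by linarith
    have hAdm := hu.iter hp hν hf h hR2 k
    have hAdm1 := hu.iter hp hν hf h hR2 (k + 1)
    have ih' := ih (by linarith)
    set A := K / t with hA
    set A' := K / (t + τ) with hA'
    have hA0 : 0 < A := by positivity
    have hA0' : 0 < A' := by positivity
    have hA1 : 1 ≤ A := by rw [hA, le_div_iff₀ ht0]; linarith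
    have hAA : A' ≤ A := by rw [hA, hA']; gcongr; linarith
    have hhalf : A ≤ 2 * A' := by
      rw [hA, hA', div_le_iff₀ ht0, ← mul_div_assoc, div_mul_eq_mul_div, le_div_iff₀ (by linarith)]
      have : K * (t + τ) ≤ K * (2 * t) := mul_le_mul_of_nonneg_left (by linarith [H.τs]) hK.le
      linarith
    have hge := modu_ge_half (θ := 2 * ε * L) hM hA0' (norm_nonneg (x - y)) hr
    have hr0 := norm_nonneg (x - y)
    rcases le_total ‖x - y‖ (2 * ε) with h1 | h1
    · have h2 := hAdm1.lip.dist_le_mul x y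
      rw [Real.dist_eq, dist_eq_norm] at h2
      have h3 := mul_le_mul_of_nonneg_left h1 L.2
      have h4 : 0 ≤ A' * ‖x - y‖ := by positivity
      have h5 : ((L : ℝ)) * ‖x - y‖ ≤ L * (2 * ε) := h3
      linarith [le_abs_self ((stp p ν f ε τ)^[k + 1] u x - (stp p ν f ε τ)^[k + 1] u y)]
    rcases le_total (4 * M / A) ‖x - y‖ with h2 | h2
    · have h3 : 4 * M ≤ ‖x - y‖ * A := (div_le_iff₀ hA0).1 h2
      have h4 := mul_le_mul_of_nonneg_left hhalf hr0
      linarith [(hAdm1.mem x).2, (hAdm1.mem y).1]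
    · have C : CoupHyp M A (2 * ε * L) ε R ((stp p ν f ε τ)^[k] u) := by
        refine ⟨hM, hA0, hθ, H.θM, ?_, H.RM, hAdm.cont, hAdm.mem, fun x y hxy => ih' x y hxy⟩
        have : A ≤ K / s := by rw [hA]; gcongr
        exact (mul_le_mul_of_nonneg_right this hε.le).trans H.Kε
      have st := coup_step hp hν hf h C hm h1 h2
      rw [Function.iterate_succ_apply']
      refine st.trans ?_
      have hd : modu M A (2 * ε * L) ‖x - y‖ - modu M A' (2 * ε * L) ‖x - y‖ ≤ 4 * M * τ * A / K := by
        have e1 : modu M A (2 * ε * L) ‖x - y‖ - modu M A' (2 * ε * L) ‖x - y‖ =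
            (A - A') * ‖x - y‖ - (A ^ 2 - A' ^ 2) / (16 * M) * ‖x - y‖ ^ 2 := by unfold modu; ring
        have e2 : 0 ≤ (A ^ 2 - A' ^ 2) / (16 * M) * ‖x - y‖ ^ 2 := by
          have : A' ^ 2 ≤ A ^ 2 := pow_le_pow_left₀ hA0'.le hAA 2
          have : 0 ≤ A ^ 2 - A' ^ 2 := by linarith
          positivity
        have e3 : (A - A') * ‖x - y‖ ≤ (A - A') * (4 * M / A) :=
          mul_le_mul_of_nonneg_left h2 (by linarith)
        have e4 : (A - A') * (4 * M / A) = 4 * M * τ / (t + τ) := by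
          rw [hA, hA']; field_simp; ring
        have e5 : 4 * M * τ / (t + τ) ≤ 4 * M * τ * A / K := by
          have : 4 * M * τ * A / K = 4 * M * τ / t := by rw [hA]; field_simp
          rw [this]; gcongr; linarith
        linarith
      have hmin : 4 * M * τ * A / K ≤ min (A * ε / 32) (τ * (m * 32 ^ (2 - p) / 16 * A ^ p / M)) := by
        refine le_min ?_ ?_
        · rw [div_le_div_iff₀ hK (by norm_num)]
          have := mul_le_mul_of_nonneg_left H.τε hA0.le
          linarith
        · have e : A ^ p = A ^ (p - 1) * A := by
            rw [Real.rpow_sub_one hA0.ne']; field_simp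
          have h3 : 1 ≤ A ^ (p - 1) := Real.one_le_rpow hA1 (by linarith)
          have hmp := H.mpos
          have h4 : 0 < m * 32 ^ (2 - p) / 16 := by positivity
          have h5 : 4 * M ^ 2 ≤ K * (m * 32 ^ (2 - p) / 16) * A ^ (p - 1) :=
            H.K1.trans (le_mul_of_one_le_right (by positivity) h3)
          rw [e, div_le_iff₀ hK]
          have h6 := mul_le_mul_of_nonneg_left h5 (by positivity : 0 ≤ τ * A / M)
          have e6 : τ * A / M * (4 * M ^ 2) = 4 * M * τ * A := by field_simp
          rw [e6] at h6
          refine h6.trans (le_of_eq ?_)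
          ring
      linarith

/-- Lipschitz smoothing of the explicit scheme. -/
lemma smoothing (hp : 2 ≤ p) (hν : Kern p ν) (hf : Absorb f) (h : CFL p ν f R ε τ) {M K s m : ℝ} {L : ℝ≥0}
    {u : Spc N → ℝ} (hu : Adm M L u) (H : SmoothHyp M K s ε τ R m p L)
    (hm : ∀ e : Spc N, ‖e‖ = 1 → m ≤ ν.real {z | 1 / 2 ≤ ⟪e, z⟫}) (k : ℕ) (hk : k * τ + s ≤ K) (x y : Spc N) :
    (stp p ν f ε τ)^[k] u x - (stp p ν f ε τ)^[k] u y ≤ K / (k * τ + s) * ‖x - y‖ + 2 * ε * L := by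
  have hM := H.Mpos
  have hK := H.Kpos
  have hs := H.spos
  have hτ := h.tau
  have hε := h.eps
  have hA0 : 0 < K / (k * τ + s) := by positivity
  rcases le_total ‖x - y‖ (8 * M / (K / (k * τ + s))) with h1 | h1
  · refine (smoothing_aux hp hν hf h hu H hm k hk x y h1).trans ?_
    unfold modu
    have : 0 ≤ (K / (k * τ + s)) ^ 2 / (16 * M) * ‖x - y‖ ^ 2 := by positivity
    linarith
  · rw [div_le_iff₀ hA0] at h1
    have hR2 : 2 * M ≤ R := by linarith [H.RM]
    have a := hu.iter hp hν hf h hR2 k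
    have : 0 ≤ 2 * ε * L := by positivity
    linarith [(a.mem x).2, (a.mem y).1]

end

lemma Absorb.continuous_max {f : ℝ → ℝ} (hf : Absorb f) : Continuous fun s => f (max s 0) := by
  rw [continuous_iff_continuousAt]
  intro s
  obtain ⟨L, hL⟩ := hf.lip (|s| + 1) (by positivity)
  have h1 : ContinuousOn (fun s => f (max s 0)) (Ioo (s - 1) (s + 1)) := by
    refine hL.continuousOn.comp (by fun_prop) fun x hx => ⟨le_max_right _ _, max_le ?_ (by positivity)⟩
    linarith [hx.2, le_abs_self s]
  exact h1.continuousAt (Ioo_mem_nhds (by linarith) (by linarith))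

/-- the radial flux `s^{1-N} ∫_0^s τ^{N-1} F(τ) dτ`. -/
def hav (N : ℕ) (F : ℝ → ℝ) (s : ℝ) : ℝ := s ^ (1 - (N : ℝ)) * ∫ τ in (0:ℝ)..s, τ ^ ((N : ℝ) - 1) * F τ

section
variable {N : ℕ} {F : ℝ → ℝ}

lemma hav_cont_aux (hN : 1 ≤ N) (hF : Continuous F) : Continuous fun τ : ℝ => τ ^ ((N : ℝ) - 1) * F τ := by
  have : (1:ℝ) ≤ N := by exact_mod_cast hN
  exact (Real.continuous_rpow_const (by linarith)).mul hF

lemma hasDerivAt_hav (hN : 1 ≤ N) (hF : Continuous F) {r : ℝ} (hr : 0 < r) :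
    HasDerivAt (hav N F) (F r - (N - 1) * hav N F r / r) r := by
  have h1 : HasDerivAt (fun s : ℝ => ∫ τ in (0:ℝ)..s, τ ^ ((N : ℝ) - 1) * F τ) (r ^ ((N : ℝ) - 1) * F r) r :=
    (hav_cont_aux hN hF).integral_hasStrictDerivAt 0 r |>.hasDerivAt
  have h2 := Real.hasDerivAt_rpow_const (x := r) (p := 1 - (N : ℝ)) (Or.inl hr.ne')
  refine (h2.mul h1).congr_deriv ?_
  have e1 : r ^ (1 - (N : ℝ)) * r ^ ((N : ℝ) - 1) = 1 := by rw [← Real.rpow_add hr]; simp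
  have e2 : r ^ (1 - (N : ℝ) - 1) = r ^ (1 - (N : ℝ)) / r := Real.rpow_sub_one hr.ne' _
  rw [← mul_assoc (r ^ (1 - (N : ℝ))), e1, e2, hav]
  field_simp
  ring

lemma hav_const_aux (hN : 1 ≤ N) {r : ℝ} (hr : 0 < r) (c : ℝ) :
    r ^ (1 - (N : ℝ)) * ∫ τ in (0:ℝ)..r, τ ^ ((N : ℝ) - 1) * c = c * r / N := by
  have hN' : (1:ℝ) ≤ N := by exact_mod_cast hN
  rw [intervalIntegral.integral_mul_const, integral_rpow (Or.inl (by linarith)), sub_add_cancel,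
    Real.zero_rpow (by linarith), sub_zero]
  have e : r ^ (1 - (N : ℝ)) * r ^ (N : ℝ) = r := by rw [← Real.rpow_add hr]; simp
  calc r ^ (1 - (N : ℝ)) * (r ^ (N : ℝ) / N * c) = (r ^ (1 - (N : ℝ)) * r ^ (N : ℝ)) * c / N := by ring
    _ = _ := by rw [e]; ring

lemma hav_mono (hN : 1 ≤ N) {F G : ℝ → ℝ} (hF : Continuous F) (hG : Continuous G) {r : ℝ} (hr : 0 < r)
    (h : ∀ s ∈ Icc 0 r, F s ≤ G s) : hav N F r ≤ hav N G r := by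
  refine mul_le_mul_of_nonneg_left ?_ (Real.rpow_nonneg hr.le _)
  exact intervalIntegral.integral_mono_on hr.le ((hav_cont_aux hN hF).intervalIntegrable _ _)
    ((hav_cont_aux hN hG).intervalIntegrable _ _) fun x hx =>
      mul_le_mul_of_nonneg_left (h x hx) (Real.rpow_nonneg hx.1 _)

lemma hav_le (hN : 1 ≤ N) (hF : Continuous F) {r c : ℝ} (hr : 0 < r)
    (h : ∀ s ∈ Icc 0 r, F s ≤ c) : hav N F r ≤ c * r / N :=
  (hav_mono hN hF continuous_const hr h).trans (hav_const_aux hN hr c).le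

lemma le_hav (hN : 1 ≤ N) (hF : Continuous F) {r c : ℝ} (hr : 0 < r)
    (h : ∀ s ∈ Icc 0 r, c ≤ F s) : c * r / N ≤ hav N F r :=
  (hav_const_aux hN hr c).ge.trans (hav_mono hN continuous_const hF hr h)

lemma hav_zero : hav N F 0 = 0 := by simp [hav]

lemma hav_nonneg (hN : 1 ≤ N) (hF : Continuous F) (h : ∀ s, 0 ≤ F s) {r : ℝ} (hr : 0 ≤ r) : 0 ≤ hav N F r := by
  rcases hr.eq_or_lt with rfl | hr
  · rw [hav_zero]
  · simpa using le_hav (c := 0) hN hF hr fun s _ => h s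

lemma hav_continuousOn (hN : 1 ≤ N) (hF : Continuous F) (h : ∀ s, 0 ≤ F s) : ContinuousOn (hav N F) (Ici 0) := by
  intro r hr
  rcases (mem_Ici.1 hr).eq_or_lt with rfl | hr
  · obtain ⟨c, hc⟩ := (isCompact_Icc (a := (0:ℝ)) (b := 1)).bddAbove_image hF.continuousOn
    have hc' : ∀ s ∈ Icc (0:ℝ) 1, F s ≤ c := fun s hs => hc (mem_image_of_mem _ hs)
    have hb : ∀ s ∈ Icc (0:ℝ) 1, hav N F s ≤ c * s / N := by
      intro s hs
      rcases hs.1.eq_or_lt with rfl | h0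
      · simp [hav_zero]
      · exact hav_le hN hF h0 fun σ hσ => hc' σ ⟨hσ.1, hσ.2.trans hs.2⟩
    have hm : Icc (0:ℝ) 1 ∈ 𝓝[≥] (0:ℝ) := Icc_mem_nhdsGE one_pos
    rw [ContinuousWithinAt, hav_zero]
    refine tendsto_of_tendsto_of_tendsto_of_le_of_le' tendsto_const_nhds
      (h := fun s => c * s / N) ?_ ?_ ?_
    · have : Tendsto (fun s : ℝ => c * s / N) (𝓝[≥] 0) (𝓝 (c * 0 / N)) :=
        ((continuous_const.mul continuous_id).div_const _).continuousWithinAt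
      simpa using this
    · filter_upwards [hm] with s hs using hav_nonneg hN hF h hs.1
    · filter_upwards [hm] with s hs using hb s hs
  · exact (hasDerivAt_hav hN hF hr).continuousAt.continuousWithinAt

end

/-- structural facts about the radial stationary solution. -/
structure Radial (N : ℕ) (p : ℝ) (f : ℝ → ℝ) (b : ℝ) (w F : ℝ → ℝ) : Prop where
  Feq : ∀ r, F r = f (w (max r 0))
  Fc : Continuous F
  wge : ∀ r, 0 ≤ r → b ≤ w r
  eq : ∀ r, 0 ≤ r → w r = b + ∫ s in (0:ℝ)..r, hav N F s ^ (1 / (p - 1))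

lemma Hp_of_nonneg {p t : ℝ} (hp : 2 ≤ p) (ht : 0 ≤ t) : Hp p t = t ^ (1 / (p - 1)) := by
  rcases ht.eq_or_lt with rfl | h
  · have : 1 / (p - 1) ≠ 0 := (one_div_pos.2 (by linarith)).ne'
    rw [Real.zero_rpow this]; simp [Hp]
  · simp [Hp, Real.sign_of_pos h, abs_of_pos h]

lemma IsWa.radial {N : ℕ} (hN : 1 ≤ N) {p : ℝ} (hp : 2 ≤ p) {f : ℝ → ℝ} (hf : Absorb f) {b : ℝ} (hb : 0 < b)
    {w : ℝ → ℝ} (hw : IsWa N p f b w) : ∃ F, Radial N p f b w F := by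
  have hwc : Continuous fun r => w (max r 0) :=
    hw.1.comp_continuous (by fun_prop) fun r => mem_Ici.2 (le_max_right _ _)
  have w0 : w 0 = b := by simpa using hw.2 0 le_rfl
  have step : ∀ r, 0 ≤ r → (∀ s, 0 ≤ s → s < r → 0 ≤ w s) → b ≤ w r := by
    intro r hr h
    rw [hw.2 r hr]
    have : 0 ≤ ∫ s in (0:ℝ)..r, Hp p (s ^ (1 - (N : ℝ)) * ∫ τ in (0:ℝ)..s, τ ^ ((N : ℝ) - 1) * f (w τ)) := by
      refine intervalIntegral.integral_nonneg_of_ae_restrict hr ?_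
      filter_upwards [self_mem_ae_restrict (measurableSet_Icc),
        ae_restrict_of_ae (compl_mem_ae_iff.2 (measure_singleton r))] with s hs hsr
      have hsr : s < r := lt_of_le_of_ne hs.2 hsr
      have : 0 ≤ s ^ (1 - (N : ℝ)) * ∫ τ in (0:ℝ)..s, τ ^ ((N : ℝ) - 1) * f (w τ) :=
        mul_nonneg (Real.rpow_nonneg hs.1 _) (intervalIntegral.integral_nonneg hs.1 fun τ hτ =>
          mul_nonneg (Real.rpow_nonneg hτ.1 _) (hf.nonneg (h τ hτ.1 (hτ.2.trans_lt hsr))))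
      rw [Hp_of_nonneg hp this]
      exact Real.rpow_nonneg this _
    linarith
  have hpos : ∀ r, 0 ≤ r → 0 ≤ w r := by
    by_contra hcon
    push Not at hcon
    obtain ⟨r, hr, hwr⟩ := hcon
    have hS : IsCompact {s | s ∈ Icc 0 r ∧ w (max s 0) ≤ 0} :=
      isCompact_Icc.inter_right (isClosed_le hwc continuous_const)
    obtain ⟨s, ⟨hs1, hs2⟩, hmin⟩ := hS.exists_isLeast ⟨r, ⟨hr, le_rfl⟩, by rw [max_eq_left hr]; exact hwr.le⟩
    rw [max_eq_left hs1.1] at hs2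
    have := step s hs1.1 fun σ h0 hσ => by
      by_contra hneg
      push Not at hneg
      have := hmin ⟨⟨h0, hσ.le.trans hs1.2⟩, by rw [max_eq_left h0]; exact hneg.le⟩
      linarith
    linarith
  have hwge : ∀ r, 0 ≤ r → b ≤ w r := fun r hr => step r hr fun s hs _ => hpos s hs
  have hFc : Continuous fun r => f (w (max r 0)) := by
    have := hf.continuous_max.comp hwc
    refine this.congr fun r => ?_
    simp only [Function.comp]
    rw [max_eq_left (hpos _ (le_max_right _ _))]
  refine ⟨fun r => f (w (max r 0)), fun r => rfl, hFc, hwge, fun r hr => ?_⟩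
  rw [hw.2 r hr]
  congr 1
  refine intervalIntegral.integral_congr fun s hs => ?_
  rw [uIcc_of_le hr] at hs
  have e : s ^ (1 - (N : ℝ)) * ∫ τ in (0:ℝ)..s, τ ^ ((N : ℝ) - 1) * f (w τ) = hav N (fun r => f (w (max r 0))) s := by
    unfold hav
    congr 1
    refine intervalIntegral.integral_congr fun τ hτ => ?_
    rw [uIcc_of_le hs.1] at hτ
    simp only [max_eq_left hτ.1]
  simp only [e]
  exact Hp_of_nonneg hp (hav_nonneg hN hFc (fun s => hf.nonneg (hpos _ (le_max_right _ _))) hs.1)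

namespace Radial
variable {N : ℕ} {p : ℝ} {f : ℝ → ℝ} {b : ℝ} {w F : ℝ → ℝ}

lemma Fnonneg (hf : Absorb f) (hb : 0 < b) (H : Radial N p f b w F) (r : ℝ) : 0 ≤ F r := by
  rw [H.Feq]; exact hf.nonneg (hb.le.trans (H.wge _ (le_max_right _ _)))

lemma contOn (hN : 1 ≤ N) (hp : 2 ≤ p) (hf : Absorb f) (hb : 0 < b) (H : Radial N p f b w F) :
    ContinuousOn (fun s => hav N F s ^ (1 / (p - 1))) (Ici 0) := by
  have : 0 ≤ 1 / (p - 1) := one_div_nonneg.2 (by linarith)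
  exact (hav_continuousOn hN H.Fc (H.Fnonneg hf hb)).rpow_const fun x _ => Or.inr this

lemma intble (hN : 1 ≤ N) (hp : 2 ≤ p) (hf : Absorb f) (hb : 0 < b) (H : Radial N p f b w F) {r s : ℝ} (hr : 0 ≤ r) (hs : 0 ≤ s) :
    IntervalIntegrable (fun s => hav N F s ^ (1 / (p - 1))) volume r s :=
  ((H.contOn hN hp hf hb).mono (by
    intro x hx
    exact (le_min hr hs).trans hx.1)).intervalIntegrable

lemma hav_pos_rpow (hN : 1 ≤ N) (hf : Absorb f) (hb : 0 < b) (H : Radial N p f b w F) {r : ℝ} (hr : 0 ≤ r) :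
    0 ≤ hav N F r ^ (1 / (p - 1)) := Real.rpow_nonneg (hav_nonneg hN H.Fc (H.Fnonneg hf hb) hr) _

lemma sub_eq (hN : 1 ≤ N) (hp : 2 ≤ p) (hf : Absorb f) (hb : 0 < b) (H : Radial N p f b w F) {r s : ℝ} (hr : 0 ≤ r) (hrs : 0 ≤ s) :
    w s - w r = ∫ s in r..s, hav N F s ^ (1 / (p - 1)) := by
  rw [H.eq r hr, H.eq s hrs, ← intervalIntegral.integral_add_adjacent_intervals
    (H.intble hN hp hf hb le_rfl hr) (H.intble hN hp hf hb hr hrs)]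
  ring

lemma wmono (hN : 1 ≤ N) (hp : 2 ≤ p) (hf : Absorb f) (hb : 0 < b) (H : Radial N p f b w F) : MonotoneOn w (Ici 0) := by
  intro r hr s hs hrs
  have := H.sub_eq hN hp hf hb hr hs
  have h2 := intervalIntegral.integral_nonneg (μ := volume) hrs
    (fun x hx => H.hav_pos_rpow hN hf hb (p := p) ((mem_Ici.1 hr).trans hx.1))
  linarith

lemma Fmono (hN : 1 ≤ N) (hp : 2 ≤ p) (hf : Absorb f) (hb : 0 < b) (H : Radial N p f b w F) {r s : ℝ} (hr : 0 ≤ r) (hrs : r ≤ s) :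
    F r ≤ F s := by
  rw [H.Feq, H.Feq, max_eq_left hr, max_eq_left (hr.trans hrs)]
  exact hf.mono (hb.le.trans (H.wge r hr)) (hb.le.trans (H.wge s (hr.trans hrs)))
    (H.wmono hN hp hf hb hr (hr.trans hrs) hrs)

lemma hasDerivAt (hN : 1 ≤ N) (hp : 2 ≤ p) (hf : Absorb f) (hb : 0 < b) (H : Radial N p f b w F) {r : ℝ} (hr : 0 < r) :
    HasDerivAt w (hav N F r ^ (1 / (p - 1))) r := by
  have hc : ContinuousAt (fun s => hav N F s ^ (1 / (p - 1))) r :=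
    (H.contOn hN hp hf hb).continuousAt (Ici_mem_nhds hr)
  have h1 := intervalIntegral.integral_hasDerivAt_right (H.intble hN hp hf hb le_rfl hr.le)
    ((H.contOn hN hp hf hb).stronglyMeasurableAtFilter_nhdsWithin measurableSet_Ici r |>.filter_mono (by
      rw [nhdsWithin_eq_nhds.2 (Ici_mem_nhds hr)])) hc
  refine (h1.const_add b).congr_of_eventuallyEq ?_
  filter_upwards [Ioi_mem_nhds hr] with s hs
  exact H.eq s (mem_Ioi.1 hs).le

/-- the stationary solution is unbounded. -/
lemma unbounded (hN : 1 ≤ N) (hp : 2 ≤ p) (hf : Absorb f) (hb : 0 < b) (H : Radial N p f b w F) (M : ℝ) :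
    ∃ r, 0 < r ∧ M ≤ w r := by
  set c := (f b / N) ^ (1 / (p - 1)) with hc
  have hN' : (0:ℝ) < N := by exact_mod_cast hN
  have hc0 : 0 < c := Real.rpow_pos_of_pos (div_pos (hf.pos b hb) hN') _
  have hα : 0 ≤ 1 / (p - 1) := one_div_nonneg.2 (by linarith)
  have hF0 : F 0 = f b := by rw [H.Feq, max_self, H.eq 0 le_rfl]; simp
  refine ⟨1 + |M| / c, by positivity, ?_⟩
  have h1 := H.sub_eq hN hp hf hb (r := 1) (s := 1 + |M| / c) zero_le_one (by positivity)
  have hle : (1:ℝ) ≤ 1 + |M| / c := by have : 0 ≤ |M| / c := by positivity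
                                       linarith
  have h2 : ∫ _ in (1:ℝ)..(1 + |M| / c), c ≤ ∫ s in (1:ℝ)..(1 + |M| / c), hav N F s ^ (1 / (p - 1)) := by
    refine intervalIntegral.integral_mono_on hle (by simp) (H.intble hN hp hf hb zero_le_one (by linarith)) ?_
    intro s hs
    refine Real.rpow_le_rpow (by have := hf.pos b hb; positivity) ?_ hα
    have h3 := le_hav hN H.Fc (c := f b) (by linarith [hs.1] : 0 < s) fun σ hσ => by
      rw [← hF0]; exact H.Fmono hN hp hf hb le_rfl hσ.1
    refine le_trans ?_ h3
    gcongr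
    have := hf.pos b hb
    nlinarith [hs.1]
  rw [intervalIntegral.integral_const, smul_eq_mul, add_sub_cancel_left, div_mul_cancel₀ _ hc0.ne'] at h2
  have h4 := H.wge 1 zero_le_one
  linarith [le_abs_self M]

end Radial

lemma hasDerivAt_max_sq (s : ℝ) : HasDerivAt (fun s : ℝ => max 0 s ^ 2) (2 * max 0 s) s := by
  rcases lt_trichotomy s 0 with h | rfl | h
  · rw [max_eq_left h.le, mul_zero]
    refine (hasDerivAt_const s (0:ℝ)).congr_of_eventuallyEq ?_
    filter_upwards [Iio_mem_nhds h] with x hx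
    simp [max_eq_left (mem_Iio.1 hx).le]
  · rw [max_self, mul_zero, hasDerivAt_iff_isLittleO]
    have h1 : (fun x : ℝ => max 0 x ^ 2 - max 0 0 ^ 2 - (x - 0) • (0:ℝ)) =O[𝓝 0] fun x : ℝ => x ^ 2 := by
      refine Asymptotics.isBigO_of_le _ fun x => ?_
      rw [Real.norm_eq_abs, Real.norm_eq_abs]
      rcases le_total 0 x with hx | hx
      · simp [max_eq_right hx]
      · simp [max_eq_left hx]; positivity
    refine h1.trans_isLittleO ?_
    simpa using Asymptotics.isLittleO_pow_id one_lt_two (𝕜 := ℝ)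
  · have h1 := hasDerivAt_pow 2 s
    rw [max_eq_right h.le]
    refine HasDerivAt.congr_of_eventuallyEq (by simpa using h1) ?_
    filter_upwards [Ioi_mem_nhds h] with x hx
    rw [max_eq_right (mem_Ioi.1 hx).le]

/-- truncated flux-to-slope map. -/
def trunc (p κ t : ℝ) : ℝ := t ^ (1 / (p - 1)) * max 0 (1 - κ / t) ^ 2

/-- derivative of `trunc`. -/
def trunc' (p κ t : ℝ) : ℝ := 1 / (p - 1) * t ^ (1 / (p - 1) - 1) * max 0 (1 - κ / t) ^ 2 +
  t ^ (1 / (p - 1)) * (2 * max 0 (1 - κ / t) * (κ / t ^ 2))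

section
variable {p κ t : ℝ}

lemma hasDerivAt_trunc (ht : 0 < t) : HasDerivAt (trunc p κ) (trunc' p κ t) t := by
  have h1 := Real.hasDerivAt_rpow_const (x := t) (p := 1 / (p - 1)) (Or.inl ht.ne')
  have h2 : HasDerivAt (fun t : ℝ => 1 - κ / t) (κ / t ^ 2) t := by
    have := ((hasDerivAt_inv ht.ne').const_mul κ).const_sub 1
    refine this.congr_deriv ?_
    field_simp
  have h3 := (hasDerivAt_max_sq (1 - κ / t)).comp t h2
  exact h1.mul h3

lemma continuousAt_trunc' (ht : 0 < t) : ContinuousAt (trunc' p κ) t := by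
  have h1 : ∀ a : ℝ, ContinuousAt (fun t : ℝ => t ^ a) t := fun a => Real.continuousAt_rpow_const _ _ (Or.inl ht.ne')
  have h2 : ContinuousAt (fun t : ℝ => max 0 (1 - κ / t)) t :=
    continuousAt_const.max (continuousAt_const.sub (continuousAt_const.div continuousAt_id ht.ne'))
  have h3 : ContinuousAt (fun t : ℝ => κ / t ^ 2) t :=
    continuousAt_const.div (continuousAt_id.pow 2) (pow_ne_zero 2 ht.ne')
  exact ((continuousAt_const.mul (h1 _)).mul (h2.pow 2)).add ((h1 _).mul ((continuousAt_const.mul h2).mul h3))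

lemma trunc_nonneg (ht : 0 ≤ t) : 0 ≤ trunc p κ t := by
  unfold trunc; positivity

lemma trunc_eq_zero (ht : 0 ≤ t) (h : t ≤ κ) (hp : 2 ≤ p) : trunc p κ t = 0 := by
  unfold trunc
  rcases ht.eq_or_lt with rfl | ht
  · rw [Real.zero_rpow (one_div_pos.2 (by linarith)).ne']; simp
  · rw [max_eq_left, zero_pow two_ne_zero, mul_zero]
    have : 1 ≤ κ / t := (one_le_div ht).2 h
    linarith

lemma sigma_mem (ht : 0 < t) (hκ : 0 < κ) : max 0 (1 - κ / t) ∈ Icc (0:ℝ) 1 :=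
  ⟨le_max_left _ _, max_le zero_le_one (by have : 0 < κ / t := by positivity
                                           linarith)⟩

lemma trunc_le (ht : 0 < t) (hκ : 0 < κ) : trunc p κ t ≤ t ^ (1 / (p - 1)) :=
  mul_le_of_le_one_right (by positivity) (pow_le_one₀ (sigma_mem ht hκ).1 (sigma_mem ht hκ).2)

lemma le_trunc (hp : 2 ≤ p) (ht : 0 < t) (hκ : 0 < κ) :
    t ^ (1 / (p - 1)) - 2 * κ ^ (1 / (p - 1)) ≤ trunc p κ t := by
  have hα : 0 < 1 / (p - 1) := one_div_pos.2 (by linarith)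
  have hα1 : 1 / (p - 1) ≤ 1 := (div_le_one (by linarith)).2 (by linarith)
  rcases le_total t κ with h | h
  · have := Real.rpow_le_rpow ht.le h hα.le
    have h2 : 0 < κ ^ (1 / (p - 1)) := by positivity
    linarith [trunc_nonneg (p := p) (κ := κ) ht.le]
  · have hle : κ / t ≤ 1 := (div_le_one ht).2 h
    rw [trunc, max_eq_right (by linarith)]
    have e : t ^ (1 / (p - 1)) * (κ / t) ≤ κ ^ (1 / (p - 1)) := by
      have h1 : (κ / t) ≤ (κ / t) ^ (1 / (p - 1)) := by
        conv_lhs => rw [← Real.rpow_one (κ / t)]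
        exact Real.rpow_le_rpow_of_exponent_ge (by positivity) hle hα1
      have h2 : t ^ (1 / (p - 1)) * (κ / t) ^ (1 / (p - 1)) = κ ^ (1 / (p - 1)) := by
        rw [← Real.mul_rpow ht.le (by positivity)]; congr 1; field_simp
      rw [← h2]; gcongr
    have h0 : 0 < t ^ (1 / (p - 1)) := by positivity
    nlinarith [mul_nonneg h0.le (sq_nonneg (κ / t))]

lemma trunc_rpow_le (hp : 2 ≤ p) (ht : 0 < t) (hκ : 0 < κ) : trunc p κ t ^ (p - 1) ≤ t := by
  have h1 := Real.rpow_le_rpow (trunc_nonneg ht.le) (trunc_le (p := p) ht hκ) (by linarith : 0 ≤ p - 1)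
  rwa [← Real.rpow_mul ht.le, one_div_mul_cancel (by linarith), Real.rpow_one] at h1

lemma trunc_slope (hp : 2 ≤ p) (ht : 0 < t) (hκ : 0 < κ) : (p - 1) * trunc p κ t ^ (p - 2) * trunc' p κ t ≤ 1 := by
  have hp1 : p - 1 ≠ 0 := by linarith
  rcases le_or_gt (1 - κ / t) 0 with h | h
  · have : trunc' p κ t = 0 := by unfold trunc'; rw [max_eq_left h]; simp
    rw [this]; simp
  · set s := 1 - κ / t with hs
    have hκs : κ / t = 1 - s := by rw [hs]; ring
    have hs1 : s ≤ 1 := by have : 0 < κ / t := by positivity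
                           linarith
    have e0 : trunc p κ t ^ (p - 2) = t ^ (1 / (p - 1) * (p - 2)) * s ^ (2 * (p - 2)) := by
      rw [trunc, ← hs, max_eq_right h.le, Real.mul_rpow (by positivity) (by positivity), ← Real.rpow_mul ht.le,
        ← Real.rpow_natCast, ← Real.rpow_mul h.le]; norm_num
    have e1 : t ^ (1 / (p - 1) * (p - 2)) * t ^ (1 / (p - 1) - 1) = 1 := by
      rw [← Real.rpow_add ht]
      have : 1 / (p - 1) * (p - 2) + (1 / (p - 1) - 1) = 0 := by field_simp; ring
      rw [this, Real.rpow_zero]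
    have e2 : t ^ (1 / (p - 1)) * (κ / t ^ 2) = t ^ (1 / (p - 1) - 1) * (1 - s) := by
      rw [Real.rpow_sub_one ht.ne', ← hκs]; field_simp
    have e3 : trunc' p κ t = t ^ (1 / (p - 1) - 1) * (1 / (p - 1) * s ^ 2 + 2 * s * (1 - s)) := by
      have : trunc' p κ t = 1 / (p - 1) * t ^ (1 / (p - 1) - 1) * s ^ 2 + 2 * s * (t ^ (1 / (p - 1)) * (κ / t ^ 2)) := by
        rw [trunc', ← hs, max_eq_right h.le]; ring
      rw [this, e2]; ring
    have e4 : (p - 1) * trunc p κ t ^ (p - 2) * trunc' p κ t =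
        s ^ (2 * (p - 2)) * (s ^ 2 + 2 * (p - 1) * s * (1 - s)) := by
      rw [e0, e3]
      calc _ = (t ^ (1 / (p - 1) * (p - 2)) * t ^ (1 / (p - 1) - 1)) * (s ^ (2 * (p - 2)) *
            ((p - 1) * (1 / (p - 1)) * s ^ 2 + (p - 1) * (2 * s * (1 - s)))) := by ring
        _ = _ := by rw [e1, mul_one_div_cancel hp1]; ring
    rw [e4]
    set q := 2 * (p - 1) with hq
    have e5 : s ^ (2 * (p - 2)) * s ^ 2 = s ^ q := by
      rw [← Real.rpow_natCast, ← Real.rpow_add h]; congr 1; rw [hq]; push_cast; ring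
    have e6 : s ^ (2 * (p - 2)) * s = s ^ (q - 1) := by
      nth_rewrite 2 [← Real.rpow_one s]
      rw [← Real.rpow_add h]; congr 1; rw [hq]; ring
    have e7 : s ^ (2 * (p - 2)) * (s ^ 2 + q * s * (1 - s)) = s ^ q + q * s ^ (q - 1) * (1 - s) := by
      rw [← e5, ← e6]; ring
    rw [e7]
    have hcv : ConvexOn ℝ (Ici 0) fun x : ℝ => x ^ q := convexOn_rpow (by linarith)
    rcases hs1.eq_or_lt with h1 | h1
    · rw [h1]; simp
    · have := hcv.le_slope_of_hasDerivAt h.le (mem_Ici.2 zero_le_one) h1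
        (Real.hasDerivAt_rpow_const (p := q) (Or.inl h.ne'))
      rw [slope_def_field, le_div_iff₀ (by linarith), Real.one_rpow] at this
      linarith

end

/-- a smooth radial subsolution-type barrier `ω(|x|²)` close to the stationary solution `w(|x|)`. -/
structure Barrier (N : ℕ) (p κ : ℝ) (w F ω ω1 ω2 : ℝ → ℝ) : Prop where
  d1 : ∀ q, HasDerivAt ω (ω1 q) q
  d2 : ∀ q, HasDerivAt ω1 (ω2 q) q
  c2 : Continuous ω2
  zero : ω1 0 = 0
  nonneg : ∀ q, 0 ≤ ω1 q
  le : ∀ r, 0 ≤ r → ω (r ^ 2) ≤ w r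
  ge : ∀ r, 0 ≤ r → w r - 2 * κ ^ (1 / (p - 1)) * r ≤ ω (r ^ 2)
  pde : ∀ r, 0 < r → (p - 1) * (2 * r * ω1 (r ^ 2)) ^ (p - 2) * (2 * ω1 (r ^ 2) + 4 * r ^ 2 * ω2 (r ^ 2)) +
    (N - 1) * (2 * r * ω1 (r ^ 2)) ^ (p - 1) / r ≤ F r

lemma Radial.exists_barrier {N : ℕ} (hN : 1 ≤ N) {p : ℝ} (hp : 2 ≤ p) {f : ℝ → ℝ} (hf : Absorb f) {b : ℝ} (hb : 0 < b)
    {w F : ℝ → ℝ} (H : Radial N p f b w F) {κ : ℝ} (hκ : 0 < κ) : ∃ ω ω1 ω2, Barrier N p κ w F ω ω1 ω2 := by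
  have hN' : (1:ℝ) ≤ N := by exact_mod_cast hN
  set h := hav N F with hdef
  have hF0 : F 0 = f b := by rw [H.Feq, max_self, H.eq 0 le_rfl]; simp
  have hfb := hf.pos b hb
  have hpos : ∀ r, 0 < r → 0 < h r := fun r hr =>
    lt_of_lt_of_le (by positivity) (le_hav hN H.Fc (c := f b) hr fun σ hσ => by
      rw [← hF0]; exact H.Fmono hN hp hf hb le_rfl hσ.1)
  have hcont : ContinuousOn h (Ici 0) := hav_continuousOn hN H.Fc (H.Fnonneg hf hb)
  have hd : ∀ r, 0 < r → HasDerivAt h (F r - (N - 1) * h r / r) r := fun r hr => hasDerivAt_hav hN H.Fc hr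
  have hd0 : ∀ r, 0 < r → 0 ≤ F r - (N - 1) * h r / r := by
    intro r hr
    have h1 := hav_le hN H.Fc (c := F r) hr fun σ hσ => H.Fmono hN hp hf hb hσ.1 hσ.2
    have h2 : (N - 1) * h r / r ≤ (N - 1) * (F r * r / N) / r := by
      have : (0:ℝ) ≤ N - 1 := by linarith
      gcongr
    have h3 : (N - 1) * (F r * r / N) / r = F r - F r / N := by field_simp
    have h4 : 0 ≤ F r / N := div_nonneg (H.Fnonneg hf hb r) (by linarith)
    linarith
  obtain ⟨r0, hr0, hsmall⟩ : ∃ r0 > 0, ∀ r ∈ Ico 0 r0, h r ≤ κ := by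
    have h1 : Tendsto h (𝓝[≥] 0) (𝓝 0) := by
      have := hcont 0 (mem_Ici.2 le_rfl)
      rwa [ContinuousWithinAt, hdef, hav_zero] at this
    obtain ⟨r0, hr0, hsub⟩ := mem_nhdsGE_iff_exists_Ico_subset.1 (h1.eventually (gt_mem_nhds hκ))
    exact ⟨r0, hr0, fun r hr => (hsub hr).le⟩
  set W1 : ℝ → ℝ := fun r => trunc p κ (h r) with hW1
  set W1' : ℝ → ℝ := fun r => trunc' p κ (h r) * (F r - (N - 1) * h r / r) with hW1'
  have W1d : ∀ r, 0 < r → HasDerivAt W1 (W1' r) r := fun r hr => (hasDerivAt_trunc (hpos r hr)).comp r (hd r hr)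
  have W1'c : ∀ r, 0 < r → ContinuousAt W1' r := fun r hr =>
    (ContinuousAt.comp (continuousAt_trunc' (hpos r hr)) (hd r hr).continuousAt).mul
      (H.Fc.continuousAt.sub ((continuousAt_const.mul (hd r hr).continuousAt).div continuousAt_id hr.ne'))
  have W1z : ∀ r ∈ Ico 0 r0, W1 r = 0 := fun r hr =>
    trunc_eq_zero (hav_nonneg hN H.Fc (H.Fnonneg hf hb) hr.1) (hsmall r hr) hp
  set ω1 : ℝ → ℝ := fun q => W1 (√q) / (2 * √q) with hω1
  set ω2 : ℝ → ℝ := fun q => if q < r0 ^ 2 then 0 else W1' (√q) / (4 * q) - W1 (√q) / (4 * q * √q) with hω2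
  have near : ∀ q, q < r0 ^ 2 → ω1 q = 0 := by
    intro q hq
    have : √q < r0 := by
      rw [Real.sqrt_lt' hr0]; exact hq
    simp only [hω1, W1z _ ⟨Real.sqrt_nonneg _, this⟩, zero_div]
  have form : ∀ q, 0 < q → HasDerivAt ω1 (W1' (√q) / (4 * q) - W1 (√q) / (4 * q * √q)) q := by
    intro q hq
    have hs : 0 < √q := Real.sqrt_pos.2 hq
    have h1 := Real.hasDerivAt_sqrt hq.ne'
    have h2 := (W1d _ hs).comp q h1
    have h3 := h2.div (h1.const_mul 2) (by positivity)
    refine h3.congr_deriv ?_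
    have hsq : √q ^ 2 = q := Real.sq_sqrt hq.le
    simp only [Function.comp]
    generalize W1' √q = a
    generalize W1 √q = c
    generalize √q = s at *
    subst hsq
    field_simp
    ring
  have eq2 : ∀ q, 0 < q → ω2 q = W1' (√q) / (4 * q) - W1 (√q) / (4 * q * √q) := by
    intro q hq
    by_cases hqr : q < r0 ^ 2
    · have e1 : ω2 q = 0 := if_pos hqr
      rw [e1]
      have := (form q hq).unique ((hasDerivAt_const q (0:ℝ)).congr_of_eventuallyEq (by
        filter_upwards [Iio_mem_nhds hqr] with x hx using near x hx))
      exact this.symm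
    · exact if_neg hqr
  have d2 : ∀ q, HasDerivAt ω1 (ω2 q) q := by
    intro q
    rcases lt_or_ge 0 q with hq | hq
    · rw [eq2 q hq]; exact form q hq
    · have hqr : q < r0 ^ 2 := hq.trans_lt (by positivity)
      have e1 : ω2 q = 0 := if_pos hqr
      rw [e1]
      exact (hasDerivAt_const q (0:ℝ)).congr_of_eventuallyEq (by
        filter_upwards [Iio_mem_nhds hqr] with x hx using near x hx)
  have c2 : Continuous ω2 := by
    rw [continuous_iff_continuousAt]
    intro q
    rcases lt_or_ge 0 q with hq | hq
    · have hs : 0 < √q := Real.sqrt_pos.2 hq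
      have hsc : ContinuousAt (fun q : ℝ => √q) q := Real.continuous_sqrt.continuousAt
      have : ContinuousAt (fun q => W1' (√q) / (4 * q) - W1 (√q) / (4 * q * √q)) q :=
        ((ContinuousAt.comp (f := fun q : ℝ => √q) (W1'c _ hs) hsc).div (continuousAt_const.mul continuousAt_id) (mul_pos (by norm_num) hq).ne').sub
          ((ContinuousAt.comp (f := fun q : ℝ => √q) (W1d _ hs).continuousAt hsc).div
            ((continuousAt_const.mul continuousAt_id).mul hsc) (mul_pos (mul_pos (by norm_num) hq) hs).ne')
      refine this.congr ?_
      filter_upwards [Ioi_mem_nhds hq] with x hx using (eq2 x hx).symm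
    · have hqr : q < r0 ^ 2 := hq.trans_lt (by positivity)
      refine (continuousAt_const (y := (0:ℝ))).congr ?_
      filter_upwards [Iio_mem_nhds hqr] with x hx using (if_pos hx).symm
  have c1 : Continuous ω1 := continuous_iff_continuousAt.2 fun q => (d2 q).continuousAt
  set ω : ℝ → ℝ := fun q => b + ∫ x in (0:ℝ)..q, ω1 x with hω
  have d1 : ∀ q, HasDerivAt ω (ω1 q) q := fun q =>
    ((c1.integral_hasStrictDerivAt 0 q).hasDerivAt).const_add b
  have W1eq : ∀ r, 0 ≤ r → 2 * r * ω1 (r ^ 2) = W1 r := by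
    intro r hr
    simp only [hω1, Real.sqrt_sq hr]
    rcases hr.eq_or_lt with rfl | hr
    · rw [W1z 0 ⟨le_rfl, hr0⟩]; simp
    · field_simp
  have dr : ∀ r, HasDerivAt (fun r => ω (r ^ 2)) (2 * r * ω1 (r ^ 2)) r := by
    intro r
    have h1 := (d1 (r ^ 2)).comp r (hasDerivAt_pow 2 r)
    refine h1.congr_deriv ?_
    norm_num; ring
  have w0 : w 0 = b := by simpa using H.eq 0 le_rfl
  have ω0 : ω ((0:ℝ) ^ 2) = b := by simp [hω]
  have hwc : ContinuousOn w (Ici 0) := by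
    intro r hr
    rcases (mem_Ici.1 hr).eq_or_lt with rfl | hr
    · have hi := H.contOn hN hp hf hb
      set G : ℝ → ℝ := fun s => hav N F (max s 0) ^ (1 / (p - 1)) with hG
      have hGc : Continuous G := hi.comp_continuous (f := fun s : ℝ => max s 0) (by fun_prop) fun s => mem_Ici.2 (le_max_right _ _)
      have hcont : Continuous fun r => b + ∫ s in (0:ℝ)..r, G s :=
        continuous_const.add (continuous_iff_continuousAt.2 fun r => (hGc.integral_hasStrictDerivAt 0 r).hasDerivAt.continuousAt)
      refine (hcont.continuousWithinAt (s := Ici 0) (x := 0)).congr (fun r hr => ?_) ?_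
      · rw [H.eq r hr]
        congr 1
        refine intervalIntegral.integral_congr fun s hs => ?_
        rw [uIcc_of_le hr] at hs
        simp only [hG, max_eq_left hs.1]
      · rw [w0]; simp
    · exact (H.hasDerivAt hN hp hf hb hr).continuousAt.continuousWithinAt
  have Dc : ContinuousOn (fun r => w r - ω (r ^ 2)) (Ici 0) :=
    hwc.sub (continuous_iff_continuousAt.2 fun r => (dr r).continuousAt).continuousOn
  have Dd : ∀ r, 0 < r → HasDerivAt (fun r => w r - ω (r ^ 2)) (h r ^ (1 / (p - 1)) - W1 r) r := by
    intro r hr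
    have := (H.hasDerivAt hN hp hf hb hr).sub (dr r)
    rwa [W1eq r hr.le] at this
  have Ddiff : DifferentiableOn ℝ (fun r => w r - ω (r ^ 2)) (interior (Ici 0)) := by
    rw [interior_Ici]
    exact fun r hr => (Dd r hr).differentiableAt.differentiableWithinAt
  refine ⟨ω, ω1, ω2, d1, d2, c2, ?_, ?_, ?_, ?_, ?_⟩
  · simp [hω1]
  · intro q
    exact div_nonneg (trunc_nonneg (hav_nonneg hN H.Fc (H.Fnonneg hf hb) (Real.sqrt_nonneg _))) (by positivity)
  · intro r hr
    have := (convex_Ici (0:ℝ)).mul_sub_le_image_sub_of_le_deriv Dc Ddiff (C := 0) (fun x hx => by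
      rw [interior_Ici] at hx
      rw [(Dd x hx).deriv]
      linarith [trunc_le (p := p) (hpos x hx) hκ]) 0 (mem_Ici.2 le_rfl) r hr hr
    simp only [w0, ω0] at this
    linarith
  · intro r hr
    have := (convex_Ici (0:ℝ)).image_sub_le_mul_sub_of_deriv_le Dc Ddiff (C := 2 * κ ^ (1 / (p - 1))) (fun x hx => by
      rw [interior_Ici] at hx
      rw [(Dd x hx).deriv]
      linarith [le_trunc (p := p) hp (hpos x hx) hκ]) 0 (mem_Ici.2 le_rfl) r hr hr
    simp only [w0, ω0] at this
    linarith
  · intro r hr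
    have e1 : 2 * ω1 (r ^ 2) + 4 * r ^ 2 * ω2 (r ^ 2) = W1' r := by
      rw [eq2 _ (by positivity)]
      simp only [hω1, Real.sqrt_sq hr.le]
      field_simp
      ring
    rw [e1, W1eq r hr.le]
    have h1 := mul_le_mul_of_nonneg_right (trunc_slope hp (hpos r hr) hκ) (hd0 r hr)
    have h2 := trunc_rpow_le hp (hpos r hr) hκ
    have h3 : (N - 1) * W1 r ^ (p - 1) / r ≤ (N - 1) * h r / r := by
      have : (0:ℝ) ≤ N - 1 := by linarith
      gcongr
    have h4 : (p - 1) * W1 r ^ (p - 2) * W1' r =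
      (p - 1) * trunc p κ (h r) ^ (p - 2) * trunc' p κ (h r) * (F r - (N - 1) * h r / r) := by
      simp only [hW1']; ring
    linarith

lemma exists_second_diff {y y1 y2 : ℝ → ℝ} (h1 : ∀ s, HasDerivAt y (y1 s) s) (h2 : ∀ s, HasDerivAt y1 (y2 s) s)
    {p ε : ℝ} (hp : 2 ≤ p) (hε : 0 < ε) : ∃ s1 s2 s3 ξ, |s1| ≤ ε ∧ |s2| ≤ ε ∧ |s3| ≤ ε ∧ min (y1 s1) (y1 s2) ≤ ξ ∧
      ξ ≤ max (y1 s1) (y1 s2) ∧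
      ε ^ (-p) * (Psi p (y ε - y 0) - Psi p (y 0 - y (-ε))) = (p - 1) * |ξ| ^ (p - 2) * y2 s3 := by
  have c0 : Continuous y := continuous_iff_continuousAt.2 fun s => (h1 s).continuousAt
  have c1 : Continuous y1 := continuous_iff_continuousAt.2 fun s => (h2 s).continuousAt
  obtain ⟨s1, hs1, e1⟩ := exists_hasDerivAt_eq_slope y y1 hε c0.continuousOn fun x _ => h1 x
  obtain ⟨s2, hs2, e2⟩ := exists_hasDerivAt_eq_slope y y1 (neg_lt_zero.2 hε) c0.continuousOn fun x _ => h1 x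
  have hY : ∀ s, HasDerivAt (fun s => y s + y (-s)) (y1 s - y1 (-s)) s := by
    intro s
    have := (h1 s).add ((h1 (-s)).comp s (hasDerivAt_neg s))
    refine this.congr_deriv (by ring)
  have hY1 : ∀ s, HasDerivAt (fun s => y1 s - y1 (-s)) (y2 s + y2 (-s)) s := by
    intro s
    have := (h2 s).sub ((h2 (-s)).comp s (hasDerivAt_neg s))
    refine this.congr_deriv (by ring)
  obtain ⟨σ, hσ, e3⟩ := exists_ratio_hasDerivAt_eq_ratio_slope (fun s => y s + y (-s)) (fun s => y1 s - y1 (-s)) hε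
    (by fun_prop) (fun x _ => hY x) (fun s => s ^ 2) (fun s => 2 * s) (by fun_prop)
    (fun x _ => by simpa using hasDerivAt_pow 2 x)
  obtain ⟨s3, hs3, e4⟩ := exists_hasDerivAt_eq_slope y1 y2 (show -σ < σ by linarith [hσ.1]) c1.continuousOn fun x _ => h2 x
  have e1' : y ε - y 0 = ε * y1 s1 := by rw [e1, sub_zero]; field_simp
  have e2' : y 0 - y (-ε) = ε * y1 s2 := by rw [e2, zero_sub, neg_neg]; field_simp
  have e5 : y1 s1 - y1 s2 = ε * y2 s3 := by
    have hσ0 := hσ.1.ne'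
    have : y1 σ - y1 (-σ) = 2 * σ * y2 s3 := by rw [e4]; field_simp; ring
    rw [this] at e3
    have e6 : (y ε - y 0) - (y 0 - y (-ε)) = ε ^ 2 * y2 s3 := by
      simp only [neg_zero] at e3
      have : (2 * σ) * ((y ε - y 0) - (y 0 - y (-ε))) = (2 * σ) * (ε ^ 2 * y2 s3) := by linarith
      exact mul_left_cancel₀ (by positivity) this
    rw [e1', e2'] at e6
    have : ε * (y1 s1 - y1 s2) = ε * (ε * y2 s3) := by linarith
    exact mul_left_cancel₀ hε.ne' this
  have hξ : ∀ a b : ℝ, ∃ ξ, min a b ≤ ξ ∧ ξ ≤ max a b ∧ Psi p a - Psi p b = (p - 1) * |ξ| ^ (p - 2) * (a - b) := by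
    intro a b
    rcases lt_trichotomy a b with h | h | h
    · obtain ⟨ξ, hξ, e⟩ := exists_hasDerivAt_eq_slope (Psi p) _ h (continuous_Psi hp).continuousOn fun x _ => hasDerivAt_Psi hp x
      refine ⟨ξ, by simp [hξ.1.le], by simp [hξ.2.le], ?_⟩
      rw [e]; have : b - a ≠ 0 := by linarith
      field_simp; ring
    · exact ⟨a, by simp, by simp, by simp [h]⟩
    · obtain ⟨ξ, hξ, e⟩ := exists_hasDerivAt_eq_slope (Psi p) _ h (continuous_Psi hp).continuousOn fun x _ => hasDerivAt_Psi hp x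
      refine ⟨ξ, by simp [hξ.1.le], by simp [hξ.2.le], ?_⟩
      rw [e]; have : a - b ≠ 0 := by linarith
      field_simp
  obtain ⟨ξ, h3, h4, h5⟩ := hξ (y1 s1) (y1 s2)
  refine ⟨s1, s2, s3, ξ, ?_, ?_, ?_, h3, h4, ?_⟩
  · rw [abs_of_pos hs1.1]; exact hs1.2.le
  · rw [abs_le]; constructor <;> linarith [hs2.1, hs2.2]
  · rw [abs_le]; constructor <;> linarith [hs3.1, hs3.2, hσ.2]
  · rw [e1', e2', Psi_mul hε, Psi_mul hε, ← mul_sub, h5, e5]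
    have : ε ^ (-p) * ε ^ (p - 1) * ε = 1 := by
      rw [← Real.rpow_add hε]
      nth_rewrite 2 [← Real.rpow_one ε]
      rw [← Real.rpow_add hε]; ring_nf; simp
    calc ε ^ (-p) * (ε ^ (p - 1) * ((p - 1) * |ξ| ^ (p - 2) * (ε * y2 s3)))
        = (ε ^ (-p) * ε ^ (p - 1) * ε) * ((p - 1) * |ξ| ^ (p - 2) * y2 s3) := by ring
      _ = _ := by rw [this, one_mul]

section
variable {N : ℕ} {p κ : ℝ} {w F ω ω1 ω2 : ℝ → ℝ}

/-- squared norm along a line. -/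
def sqL (x z : Spc N) (s : ℝ) : ℝ := ‖x‖ ^ 2 + 2 * s * ⟪x, z⟫ + s ^ 2 * ‖z‖ ^ 2

lemma norm_add_smul_sq (x z : Spc N) (s : ℝ) : ‖x + s • z‖ ^ 2 = sqL x z s := by
  rw [norm_add_sq_real, inner_smul_right, norm_smul, mul_pow, Real.norm_eq_abs, sq_abs, sqL]; ring

lemma hasDerivAt_sqL (x z : Spc N) (s : ℝ) : HasDerivAt (sqL x z) (2 * ⟪x, z⟫ + 2 * s * ‖z‖ ^ 2) s := by
  have := (((hasDerivAt_id s).const_mul 2).mul_const ⟪x, z⟫).const_add (‖x‖ ^ 2) |>.add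
    ((hasDerivAt_pow 2 s).mul_const (‖z‖ ^ 2))
  refine this.congr_deriv ?_
  norm_num

lemma Barrier.consistent_pointwise (hp : 2 ≤ p) (H : Barrier N p κ w F ω ω1 ω2) (R : ℝ) {δ : ℝ} (hδ : 0 < δ) :
    ∃ ε0 > 0, ∀ ε, 0 < ε → ε < ε0 → ∀ x z : Spc N, ‖x‖ ≤ R → ‖z‖ ≤ 1 →
      ε ^ (-p) * (Psi p (ω (‖x + ε • z‖ ^ 2) - ω (‖x‖ ^ 2)) - Psi p (ω (‖x‖ ^ 2) - ω (‖x - ε • z‖ ^ 2))) ≤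
      (p - 1) * |2 * ω1 (‖x‖ ^ 2) * ⟪x, z⟫| ^ (p - 2) *
        (4 * ω2 (‖x‖ ^ 2) * ⟪x, z⟫ ^ 2 + 2 * ω1 (‖x‖ ^ 2) * ‖z‖ ^ 2) + δ := by
  set g : (Spc N × Spc N) × ℝ → ℝ := fun q => ω1 (sqL q.1.1 q.1.2 q.2) * (2 * ⟪q.1.1, q.1.2⟫ + 2 * q.2 * ‖q.1.2‖ ^ 2) with hg
  set r : (Spc N × Spc N) × ℝ → ℝ := fun q => ω2 (sqL q.1.1 q.1.2 q.2) * (2 * ⟪q.1.1, q.1.2⟫ + 2 * q.2 * ‖q.1.2‖ ^ 2) ^ 2 +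
    ω1 (sqL q.1.1 q.1.2 q.2) * (2 * ‖q.1.2‖ ^ 2) with hr
  have c1 : Continuous ω1 := continuous_iff_continuousAt.2 fun q => (H.d2 q).continuousAt
  have c2 := H.c2
  have cs : Continuous fun q : (Spc N × Spc N) × ℝ => sqL q.1.1 q.1.2 q.2 := by unfold sqL; fun_prop
  have cg : Continuous g := by simp only [hg]; fun_prop
  have cr : Continuous r := by simp only [hr]; fun_prop
  set P : Spc N × Spc N → ℝ := fun q => (p - 1) * |g (q, 0)| ^ (p - 2) * r (q, 0) with hP
  have ca : Continuous fun x : ℝ => |x| ^ (p - 2) := continuous_abs.rpow_const fun x => Or.inr (by linarith)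
  have cP : Continuous P := by
    simp only [hP]
    have : Continuous fun q : Spc N × Spc N => |g (q, 0)| ^ (p - 2) := ca.comp (cg.comp (by fun_prop))
    fun_prop
  set D : ℝ → Spc N × Spc N → ℝ := fun ε q => ε ^ (-p) * (Psi p (ω (sqL q.1 q.2 ε) - ω (sqL q.1 q.2 0)) -
    Psi p (ω (sqL q.1 q.2 0) - ω (sqL q.1 q.2 (-ε)))) with hD
  have key : ∀ q0 : Spc N × Spc N, Tendsto (fun e : (Spc N × Spc N) × ℝ => D e.2 e.1 - P e.1) (𝓝 q0 ×ˢ 𝓝[>] 0) (𝓝 0) := by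
    intro q0
    have hex : ∀ e : (Spc N × Spc N) × ℝ, ∃ s1 s2 s3 ξ : ℝ, 0 < e.2 → |s1| ≤ e.2 ∧ |s2| ≤ e.2 ∧ |s3| ≤ e.2 ∧
        min (g (e.1, s1)) (g (e.1, s2)) ≤ ξ ∧ ξ ≤ max (g (e.1, s1)) (g (e.1, s2)) ∧
        D e.2 e.1 = (p - 1) * |ξ| ^ (p - 2) * r (e.1, s3) := by
      intro e
      by_cases he : 0 < e.2
      · obtain ⟨s1, s2, s3, ξ, h⟩ := exists_second_diff (p := p) (ε := e.2) (y := fun s => ω (sqL e.1.1 e.1.2 s)) (y1 := fun s => g (e.1, s)) (y2 := fun s => r (e.1, s))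
          (fun s => (H.d1 _).comp s (hasDerivAt_sqL _ _ _)) (fun s => by
            have h1 := (H.d2 _).comp s (hasDerivAt_sqL e.1.1 e.1.2 s)
            have h2 : HasDerivAt (fun s : ℝ => 2 * ⟪e.1.1, e.1.2⟫ + 2 * s * ‖e.1.2‖ ^ 2) (2 * ‖e.1.2‖ ^ 2) s := by
              have := (((hasDerivAt_id s).const_mul 2).mul_const (‖e.1.2‖ ^ 2)).const_add (2 * ⟪e.1.1, e.1.2⟫)
              refine this.congr_deriv (by ring)
            have := h1.mul h2
            refine this.congr_deriv ?_
            simp only [hr, Function.comp]; ring) hp he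
        exact ⟨s1, s2, s3, ξ, fun _ => h⟩
      · exact ⟨0, 0, 0, 0, fun h => absurd h he⟩
    choose s1 s2 s3 ξ h using hex
    have hpos : ∀ᶠ e : (Spc N × Spc N) × ℝ in 𝓝 q0 ×ˢ 𝓝[>] 0, 0 < e.2 :=
      tendsto_snd.eventually (eventually_mem_nhdsWithin (a := (0:ℝ)) (s := Ioi 0))
    have t1 : Tendsto (fun e : (Spc N × Spc N) × ℝ => e.1) (𝓝 q0 ×ˢ 𝓝[>] 0) (𝓝 q0) := tendsto_fst
    have t2 : Tendsto (fun e : (Spc N × Spc N) × ℝ => e.2) (𝓝 q0 ×ˢ 𝓝[>] 0) (𝓝 0) :=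
      tendsto_snd.mono_right nhdsWithin_le_nhds
    have ts : ∀ s : (Spc N × Spc N) × ℝ → ℝ, (∀ e, 0 < e.2 → |s e| ≤ e.2) →
        Tendsto (fun e => (e.1, s e)) (𝓝 q0 ×ˢ 𝓝[>] 0) (𝓝 (q0, 0)) := by
      intro s hs
      refine t1.prodMk_nhds (squeeze_zero_norm' ?_ t2)
      filter_upwards [hpos] with e he using hs e he
    have a1 := (cg.tendsto (q0, 0)).comp (ts s1 fun e he => (h e he).1)
    have a2 := (cg.tendsto (q0, 0)).comp (ts s2 fun e he => (h e he).2.1)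
    have a3 := (cr.tendsto (q0, 0)).comp (ts s3 fun e he => (h e he).2.2.1)
    have mi := a1.min a2
    have ma := a1.max a2
    rw [min_self] at mi
    rw [max_self] at ma
    have a4 : Tendsto ξ (𝓝 q0 ×ˢ 𝓝[>] 0) (𝓝 (g (q0, 0))) := by
      refine tendsto_of_tendsto_of_tendsto_of_le_of_le' mi ma ?_ ?_
      · filter_upwards [hpos] with e he using (h e he).2.2.2.1
      · filter_upwards [hpos] with e he using (h e he).2.2.2.2.1
    have a5 := ((((ca.tendsto _).comp a4).const_mul (p - 1)).mul a3).sub ((cP.tendsto q0).comp t1)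
    rw [show (p - 1) * |g (q0, 0)| ^ (p - 2) * r (q0, 0) - P q0 = 0 by simp [hP]] at a5
    refine a5.congr' ?_
    filter_upwards [hpos] with e he
    rw [(h e he).2.2.2.2.2]; rfl
  have hcomp := ((isCompact_closedBall (0 : Spc N) R).prod (isCompact_closedBall (0 : Spc N) 1)).eventually_forall_of_forall_eventually
    (x₀ := (0:ℝ)) (P := fun ε q => 0 < ε → D ε q - P q < δ) (by
      intro q0 _
      have := (key q0).eventually (gt_mem_nhds hδ)
      rw [← nhdsWithin_univ q0, ← nhdsWithin_prod_eq, eventually_nhdsWithin_iff] at this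
      have h2 := (continuous_swap.tendsto ((0:ℝ), q0)).eventually this
      filter_upwards [h2] with e he h using he ⟨mem_univ _, h⟩)
  obtain ⟨ε0, h0, hε0⟩ := Metric.eventually_nhds_iff.1 hcomp
  refine ⟨ε0, h0, fun ε h1 h2 x z hx hz => ?_⟩
  have := hε0 (y := ε) (by rw [Real.dist_eq, sub_zero, abs_of_pos h1]; exact h2) (x, z) ⟨by simpa using hx, by simpa using hz⟩ h1
  simp only [hD, hP, hg, hr] at this
  simp only [← norm_add_smul_sq, zero_smul, add_zero, neg_smul, ← sub_eq_add_neg, mul_zero, zero_mul] at this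
  rw [show ω1 (‖x‖ ^ 2) * (2 * ⟪x, z⟫) = 2 * ω1 (‖x‖ ^ 2) * ⟪x, z⟫ by ring] at this
  linarith [show (p - 1) * |2 * ω1 (‖x‖ ^ 2) * ⟪x, z⟫| ^ (p - 2) * (ω2 (‖x‖ ^ 2) * (2 * ⟪x, z⟫) ^ 2 + ω1 (‖x‖ ^ 2) * (2 * ‖z‖ ^ 2))
    = (p - 1) * |2 * ω1 (‖x‖ ^ 2) * ⟪x, z⟫| ^ (p - 2) *
        (4 * ω2 (‖x‖ ^ 2) * ⟪x, z⟫ ^ 2 + 2 * ω1 (‖x‖ ^ 2) * ‖z‖ ^ 2) by ring]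

lemma Barrier.consistent (hp : 2 ≤ p) {ν : Measure (Spc N)} (hν : Kern p ν) (H : Barrier N p κ w F ω ω1 ω2)
    (hF : ∀ r, 0 ≤ F r) (R : ℝ) {δ : ℝ} (hδ : 0 < δ) :
    ∃ ε0 > 0, ∀ ε, 0 < ε → ε < ε0 → ∀ x : Spc N, ‖x‖ ≤ R → Lop p ν ε (fun y => ω (‖y‖ ^ 2)) x ≤ F ‖x‖ + δ := by
  have := hν.fin
  set V := ν.real univ with hV
  have hV0 : 0 ≤ V := measureReal_nonneg
  obtain ⟨ε0, h0, hε0⟩ := H.consistent_pointwise hp R (δ := δ / (V + 1)) (by positivity)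
  refine ⟨ε0, h0, fun ε hε hε' x hx => ?_⟩
  have c0 : Continuous ω := continuous_iff_continuousAt.2 fun q => (H.d1 q).continuousAt
  have cΨ := continuous_Psi hp
  have ca : Continuous fun x : ℝ => |x| ^ (p - 2) := continuous_abs.rpow_const fun x => Or.inr (by linarith)
  have int : ∀ {G : Spc N → ℝ}, Continuous G → Integrable G ν := fun h => ae_bdd_integrable_of_continuous hν.supp h
  set A := ω1 (‖x‖ ^ 2) with hA
  set B := ω2 (‖x‖ ^ 2) with hB
  have hA0 : 0 ≤ A := H.nonneg _
  have e1 : Lop p ν ε (fun y => ω (‖y‖ ^ 2)) x = ∫ z, ε ^ (-p) * (Psi p (ω (‖x + ε • z‖ ^ 2) - ω (‖x‖ ^ 2)) -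
      Psi p (ω (‖x‖ ^ 2) - ω (‖x - ε • z‖ ^ 2))) ∂ν := by
    have i1 : Integrable (fun z => Psi p (ω (‖x + ε • z‖ ^ 2) - ω (‖x‖ ^ 2))) ν := int (by fun_prop)
    have i2 : Integrable (fun z => Psi p (ω (‖x‖ ^ 2) - ω (‖x - ε • z‖ ^ 2))) ν := int (by fun_prop)
    rw [integral_const_mul, integral_sub i1 i2]
    have h3 : ∫ z, Psi p (ω (‖x‖ ^ 2) - ω (‖x - ε • z‖ ^ 2)) ∂ν = - ∫ z, Psi p (ω (‖x + ε • z‖ ^ 2) - ω (‖x‖ ^ 2)) ∂ν := by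
      rw [← integral_iso hν.iso (LinearIsometryEquiv.neg ℝ) fun z => Psi p (ω (‖x‖ ^ 2) - ω (‖x - ε • z‖ ^ 2)), ← integral_neg]
      refine integral_congr_ae (ae_of_all _ fun z => ?_)
      simp only [LinearIsometryEquiv.coe_neg, smul_neg, sub_neg_eq_add, ← Psi_neg, neg_sub]
    rw [h3, Lop]; ring
  have i3 : Integrable (fun z => (p - 1) * |2 * A * ⟪x, z⟫| ^ (p - 2) * (4 * B * ⟪x, z⟫ ^ 2 + 2 * A * ‖z‖ ^ 2)) ν := by
    have : Continuous fun z : Spc N => |2 * A * ⟪x, z⟫| ^ (p - 2) := ca.comp (by fun_prop)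
    exact int (by fun_prop)
  have e2 : Lop p ν ε (fun y => ω (‖y‖ ^ 2)) x ≤
      ∫ z, ((p - 1) * |2 * A * ⟪x, z⟫| ^ (p - 2) * (4 * B * ⟪x, z⟫ ^ 2 + 2 * A * ‖z‖ ^ 2) + δ / (V + 1)) ∂ν := by
    rw [e1]
    refine integral_mono_ae (int (by fun_prop)) (i3.add (integrable_const _)) ?_
    filter_upwards [hν.supp] with z hz using hε0 ε hε hε' x z hx hz
  rw [integral_add i3 (integrable_const _), integral_const, smul_eq_mul] at e2
  have e3 : V * (δ / (V + 1)) ≤ δ := by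
    rw [← mul_div_assoc, div_le_iff₀ (by positivity)]; nlinarith
  suffices h : ∫ z, (p - 1) * |2 * A * ⟪x, z⟫| ^ (p - 2) * (4 * B * ⟪x, z⟫ ^ 2 + 2 * A * ‖z‖ ^ 2) ∂ν ≤ F ‖x‖ by linarith
  by_cases hx0 : x = 0
  · have : A = 0 := by rw [hA, hx0]; simpa using H.zero
    simp only [this, hx0]
    simpa using hF 0
  have hr : 0 < ‖x‖ := norm_pos_iff.2 hx0
  set r := ‖x‖ with hrdef
  set e : Spc N := r⁻¹ • x with he
  have hxe : x = r • e := by rw [he, smul_smul, mul_inv_cancel₀ hr.ne', one_smul]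
  have hen : ‖e‖ = 1 := by rw [he, norm_smul, norm_inv, norm_norm, inv_mul_cancel₀ hr.ne']
  have c2 : Continuous fun z : Spc N => |⟪e, z⟫| ^ (p - 2) := ca.comp (by fun_prop)
  have j1 : Integrable (fun z : Spc N => |⟪e, z⟫| ^ (p - 2) * (‖z‖ ^ 2 - ⟪e, z⟫ ^ 2)) ν := int (by fun_prop)
  have j2 : Integrable (fun z : Spc N => |⟪e, z⟫| ^ (p - 2) * ⟪e, z⟫ ^ 2) ν := int (by fun_prop)
  have m1 : ∫ z, |⟪e, z⟫| ^ (p - 2) * ⟪e, z⟫ ^ 2 ∂ν = 1 := by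
    have := hν.mom e e
    rw [hen, Real.one_rpow, real_inner_self_eq_norm_sq, hen] at this
    norm_num at this
    rw [← this]
    refine integral_congr_ae (ae_of_all _ fun z => ?_)
    simp only [Psi]; ring
  have e4 : ∀ z : Spc N, (p - 1) * |2 * A * ⟪x, z⟫| ^ (p - 2) * (4 * B * ⟪x, z⟫ ^ 2 + 2 * A * ‖z‖ ^ 2) =
      ((p - 1) * (2 * r * A) ^ (p - 2) * (2 * A)) * (|⟪e, z⟫| ^ (p - 2) * (‖z‖ ^ 2 - ⟪e, z⟫ ^ 2)) +
      ((p - 1) * (2 * r * A) ^ (p - 2) * (2 * A + 4 * r ^ 2 * B)) * (|⟪e, z⟫| ^ (p - 2) * ⟪e, z⟫ ^ 2) := by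
    intro z
    have h1 : ⟪x, z⟫ = r * ⟪e, z⟫ := by conv_lhs => rw [hxe]; rw [real_inner_smul_left]
    have h2 : |2 * A * ⟪x, z⟫| ^ (p - 2) = (2 * r * A) ^ (p - 2) * |⟪e, z⟫| ^ (p - 2) := by
      rw [h1, ← Real.mul_rpow (by positivity) (abs_nonneg _), show 2 * A * (r * ⟪e, z⟫) = (2 * r * A) * ⟪e, z⟫ by ring, abs_mul,
        abs_of_nonneg (show 0 ≤ 2 * r * A by positivity)]
    rw [h2, h1]; ring
  rw [integral_congr_ae (ae_of_all _ e4), integral_add (j1.const_mul _) (j2.const_mul _), integral_const_mul, integral_const_mul, m1]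
  have l1 := hν.lap e hen
  have := H.pde r hr
  have h5 : (2 * r * A) ^ (p - 1) / r = (2 * r * A) ^ (p - 2) * (2 * A) := by
    rcases hA0.eq_or_lt with h | h
    · rw [← h]; simp [Real.zero_rpow (show p - 1 ≠ 0 by linarith)]
    · rw [show p - 1 = (p - 2) + 1 by ring, Real.rpow_add_one (by positivity)]; field_simp
  rw [mul_div_assoc, h5, ← l1] at this
  refine le_trans (le_of_eq ?_) this
  ring

/-- comparison of the scheme with the stationary solution. -/
lemma iter_le_stationary (hN : 1 ≤ N) (hp : 2 ≤ p) {ν : Measure (Spc N)} (hν : Kern p ν) {f : ℝ → ℝ} (hf : Absorb f) {b : ℝ}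
    (hb : 0 < b) (hw : Radial N p f b w F) (M : ℝ) {η : ℝ} (hη : 0 < η) :
    ∃ ε0 > 0, ∀ ε τ R : ℝ, ∀ (L : ℝ≥0) (u : Spc N → ℝ), ε < ε0 → CFL p ν f R ε τ → 2 * M ≤ R → Adm M L u →
      (∀ x, u x ≤ w ‖x‖) → ∀ (k : ℕ) x, (stp p ν f ε τ)^[k] u x ≤ w ‖x‖ + η * (1 + k * τ) := by
  obtain ⟨R1, hR1, hwM⟩ := hw.unbounded hN hp hf hb M
  have hp1 : 0 < p - 1 := by linarith
  obtain ⟨κ, hκ, hκη⟩ : ∃ κ > 0, 2 * κ ^ (1 / (p - 1)) * R1 = η := by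
    refine ⟨(η / (2 * R1)) ^ (p - 1), by positivity, ?_⟩
    rw [← Real.rpow_mul (by positivity), mul_one_div_cancel hp1.ne', Real.rpow_one]; field_simp
  obtain ⟨ω, ω1, ω2, H⟩ := hw.exists_barrier hN hp hf hb hκ
  obtain ⟨ε0, h0, hε0⟩ := H.consistent hp hν (hw.Fnonneg hf hb) R1 hη
  have c0 : Continuous ω := continuous_iff_continuousAt.2 fun q => (H.d1 q).continuousAt
  have hmono : Monotone ω := monotone_of_hasDerivAt_nonneg H.d1 fun q => H.nonneg q
  have ge : ∀ r, 0 ≤ r → r ≤ R1 → w r ≤ ω (r ^ 2) + η := by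
    intro r hr hr1
    have h1 := H.ge r hr
    have h2 : 2 * κ ^ (1 / (p - 1)) * r ≤ η := by
      rw [← hκη]; gcongr
    linarith
  have ge2 : ∀ r, R1 ≤ r → M ≤ ω (r ^ 2) + η := by
    intro r hr
    have h1 := ge R1 hR1.le le_rfl
    have h2 : ω (R1 ^ 2) ≤ ω (r ^ 2) := hmono (by gcongr)
    linarith
  refine ⟨ε0, h0, fun ε τ R L u hε hC hMR hu huw k => ?_⟩
  have hτ := hC.tau
  have main : ∀ x, (stp p ν f ε τ)^[k] u x ≤ ω (‖x‖ ^ 2) + η + η * (k * τ) := by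
    induction k with
    | zero =>
      intro x
      simp only [Function.iterate_zero, id, Nat.cast_zero, zero_mul, mul_zero, add_zero]
      rcases le_total ‖x‖ R1 with h | h
      · exact (huw x).trans (ge _ (norm_nonneg _) h)
      · exact (hu.mem x).2.trans (ge2 _ h)
    | succ k ih =>
      intro x
      have hadm := hu.iter hp hν hf hC hMR k
      have hnext := ((hu.iter hp hν hf hC hMR (k + 1)).mem x).2
      have hk0 : 0 ≤ η * (k * τ) := by positivity
      have hst : η * ((k + 1 : ℕ) * τ) = η * (k * τ) + τ * η := by push_cast; ring
      rw [hst]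
      set β := ω (‖x‖ ^ 2) + η + η * (k * τ) with hβ
      have hτη : 0 ≤ τ * η := by positivity
      by_cases hcase : M ≤ β
      · linarith
      have hxR : ‖x‖ ≤ R1 := by
        by_contra hcon
        have := ge2 ‖x‖ (not_le.1 hcon).le
        exact hcase (by linarith)
      have hM0 : 0 ≤ M := (hu.mem 0).1.trans (hu.mem 0).2
      have := step_mono hp hν hC (α := (stp p ν f ε τ)^[k] u x) (β := β)
        (a := fun z => (stp p ν f ε τ)^[k] u (x + ε • z)) (b := fun z => ω (‖x + ε • z‖ ^ 2) + η + η * (k * τ))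
        (hadm.mem x).1 (ih x) (by linarith) (ae_of_all _ fun z => ⟨(hadm.mem _).1, (hadm.mem _).2.trans (by linarith)⟩)
        (ae_of_all _ fun z => ih _) (hν.integrable_incr hp hadm.cont x _ _)
        (hν.integrable_incr (u := fun y => ω (‖y‖ ^ 2) + η + η * (k * τ)) hp (by fun_prop) x _ _)
      have hL := hε0 ε hC.eps hε x hxR
      have hL2 : 2 * ε ^ (-p) * (∫ z, Psi p (ω (‖x + ε • z‖ ^ 2) + η + η * (k * τ) - β) ∂ν) =
          Lop p ν ε (fun y => ω (‖y‖ ^ 2)) x := by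
        simp only [Lop, hβ]; congr 3; ext z; congr 1; ring
      rw [hL2] at this
      have hfF : F ‖x‖ ≤ f β := by
        rw [hw.Feq, max_eq_left (norm_nonneg _)]
        have h2 := hw.wge ‖x‖ (norm_nonneg _)
        have h3 := ge ‖x‖ (norm_nonneg _) hxR
        exact hf.mono (mem_Ici.2 (by linarith)) (mem_Ici.2 (by linarith)) (by linarith)
      rw [Function.iterate_succ_apply']
      have h4 := ih x
      have e5 : stp p ν f ε τ ((stp p ν f ε τ)^[k] u) x = (stp p ν f ε τ)^[k] u x +
        τ * (2 * ε ^ (-p) * (∫ z, Psi p ((stp p ν f ε τ)^[k] u (x + ε • z) - (stp p ν f ε τ)^[k] u x) ∂ν) -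
          f ((stp p ν f ε τ)^[k] u x)) := rfl
      rw [e5]
      have h6 : τ * (Lop p ν ε (fun y => ω (‖y‖ ^ 2)) x - f β) ≤ τ * η := by gcongr; linarith
      linarith
  intro x
  have h1 := main x
  have h2 := H.le ‖x‖ (norm_nonneg _)
  linarith

end

section
variable {N : ℕ} {p : ℝ} {ν : Measure (Spc N)} {f : ℝ → ℝ} {R ε τ : ℝ}

lemma abs_Lop_quad_le (hp : 2 ≤ p) (hν : Kern p ν) (hε : 0 < ε) (hε1 : ε ≤ 1) {H : ℝ} (hH : 0 ≤ H) (x0 : Spc N) {x : Spc N}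
    (hx : ‖x - x0‖ ≤ 1) :
    |Lop p ν ε (fun x => H * ‖x - x0‖ ^ 2) x| ≤ 2 * ν.real univ * ((p - 1) * 3 ^ (p - 2) * H ^ (p - 1)) := by
  have := hν.fin
  have cΨ := continuous_Psi hp
  set y := x - x0 with hy
  set a : Spc N → ℝ := fun z => H * (2 * ε * ⟪y, z⟫ + ε ^ 2 * ‖z‖ ^ 2) with ha
  have ca : Continuous a := by simp only [ha]; fun_prop
  have int : ∀ {G : Spc N → ℝ}, Continuous G → Integrable G ν := fun h => ae_bdd_integrable_of_continuous hν.supp h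
  have e1 : ∀ z, H * ‖x + ε • z - x0‖ ^ 2 - H * ‖x - x0‖ ^ 2 = a z := by
    intro z
    rw [show x + ε • z - x0 = y + ε • z by rw [hy]; abel, norm_add_sq_real, inner_smul_right, norm_smul, mul_pow,
      Real.norm_eq_abs, sq_abs]
    simp only [ha]; ring
  have e2 : Lop p ν ε (fun x => H * ‖x - x0‖ ^ 2) x = 2 * ε ^ (-p) * ∫ z, Psi p (a z) ∂ν := by
    simp only [Lop, e1]
  have e3 : ∫ z, Psi p (a (-z)) ∂ν = ∫ z, Psi p (a z) ∂ν := integral_iso hν.iso (LinearIsometryEquiv.neg ℝ) fun z => Psi p (a z)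
  have e4 : ∫ z, Psi p (a z) ∂ν = ∫ z, (Psi p (a z) - Psi p (-a (-z))) / 2 ∂ν := by
    rw [integral_div, integral_sub (int (by fun_prop)) (int (by fun_prop))]
    have : ∫ z, Psi p (-a (-z)) ∂ν = -∫ z, Psi p (a z) ∂ν := by
      rw [← e3, ← integral_neg]; simp only [Psi_neg]
    rw [this]; ring
  have hb : ∀ z : Spc N, ‖z‖ ≤ 1 → |a z| ≤ 3 * H * ε := by
    intro z hz
    have h1 : |⟪y, z⟫| ≤ 1 := (abs_real_inner_le_norm y z).trans (by nlinarith [norm_nonneg y, norm_nonneg z])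
    have h2 := abs_le.1 h1
    have h3 : ‖z‖ ^ 2 ≤ 1 := by nlinarith [norm_nonneg z]
    have h4 : |2 * ε * ⟪y, z⟫ + ε ^ 2 * ‖z‖ ^ 2| ≤ 3 * ε := by
      have h5 : ε ^ 2 * ‖z‖ ^ 2 ≤ ε * 1 := by
        have : ε ^ 2 ≤ ε := by nlinarith
        nlinarith [sq_nonneg ‖z‖]
      have h6 : 0 ≤ ε ^ 2 * ‖z‖ ^ 2 := by positivity
      rw [abs_le]; constructor <;> nlinarith
    simp only [ha]
    rw [abs_mul, abs_of_nonneg hH]; nlinarith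
  have hp1 : 0 ≤ p - 1 := by linarith
  have hq : ‖∫ z, (Psi p (a z) - Psi p (-a (-z))) / 2 ∂ν‖ ≤ ((p - 1) * (3 * H * ε) ^ (p - 2) * (H * ε ^ 2)) * ν.real univ := by
    refine norm_integral_le_of_norm_le_const ?_
    filter_upwards [hν.supp] with z hz
    have h1 := Psi_lip hp (hb z hz) (b := -a (-z)) (by rw [abs_neg]; exact hb _ (by rwa [norm_neg]))
    have h2 : |a z - -a (-z)| ≤ 2 * (H * ε ^ 2) := by
      have : a z - -a (-z) = 2 * (H * ε ^ 2) * ‖z‖ ^ 2 := by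
        simp only [ha, inner_neg_right, norm_neg]; ring
      rw [this, abs_of_nonneg (by positivity)]
      have : ‖z‖ ^ 2 ≤ 1 := by nlinarith [norm_nonneg z]
      have h0 : 0 ≤ 2 * (H * ε ^ 2) := by positivity
      nlinarith
    rw [Real.norm_eq_abs, abs_div, abs_two, div_le_iff₀ two_pos]
    refine h1.trans ?_
    calc _ ≤ (p - 1) * (3 * H * ε) ^ (p - 2) * (2 * (H * ε ^ 2)) := by gcongr
      _ = _ := by ring
  rw [e2, e4, abs_mul, ← Real.norm_eq_abs (∫ _, _ ∂ν), abs_of_nonneg (by positivity)]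
  calc _ ≤ 2 * ε ^ (-p) * (((p - 1) * (3 * H * ε) ^ (p - 2) * (H * ε ^ 2)) * ν.real univ) := by gcongr
    _ = 2 * ν.real univ * ((p - 1) * 3 ^ (p - 2) * (H ^ (p - 2) * H)) * (ε ^ (-p) * ε ^ (p - 2) * ε ^ (2:ℝ)) := by
      rw [Real.mul_rpow (by positivity) hε.le, Real.mul_rpow (by norm_num) hH, Real.rpow_two]; ring
    _ = _ := by
      rw [← Real.rpow_add hε, ← Real.rpow_add hε, show -p + (p - 2) + 2 = 0 by ring, Real.rpow_zero, mul_one]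
      congr 2
      rcases hH.eq_or_lt with h | h
      · rw [← h, Real.zero_rpow (by linarith : p - 1 ≠ 0), mul_zero]
      · rw [show p - 1 = p - 2 + 1 by ring, Real.rpow_add_one h.ne']

/-- local modulus of continuity in time. -/
lemma iter_time_modulus (hp : 2 ≤ p) (hν : Kern p ν) (hf : Absorb f) (h : CFL p ν f R ε τ) (hε1 : ε ≤ 1) {u : Spc N → ℝ} {M : ℝ}
    {L : ℝ≥0} (hM : 2 * M ≤ R) (hu : Adm M L u) {S H η : ℝ} (hSH : S ≤ H) (hη : 0 ≤ η) (x0 : Spc N) (n : ℕ)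
    (hS : ∀ k, k ≤ n → ∀ x, ‖x - x0‖ ≤ 2 → (stp p ν f ε τ)^[k] u x ≤ S)
    (hmod : ∀ x, ‖x - x0‖ ≤ 2 → |u x - u x0| ≤ η + H * ‖x - x0‖ ^ 2) (k : ℕ) (hk : k ≤ n) :
    |(stp p ν f ε τ)^[k] u x0 - u x0| ≤
      η + (2 * ν.real univ * ((p - 1) * 3 ^ (p - 2) * H ^ (p - 1)) + f S) * (k * τ) := by
  have hεp := h.eps
  have hτ := h.tau
  have u0S : u x0 ≤ S := hS 0 (Nat.zero_le _) x0 (by simp)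
  have u00 := (hu.mem x0).1
  have hS0 : 0 ≤ S := u00.trans u0S
  have hH : 0 ≤ H := hS0.trans hSH
  have hfS := hf.nonneg hS0
  have := hν.fin
  have cΨ := continuous_Psi hp
  have int : ∀ {G : Spc N → ℝ}, Continuous G → Integrable G ν := fun h => ae_bdd_integrable_of_continuous hν.supp h
  have hp1 : 0 ≤ p - 1 := by linarith
  set C := 2 * ν.real univ * ((p - 1) * 3 ^ (p - 2) * H ^ (p - 1)) with hC
  have hC0 : 0 ≤ C := by positivity
  have hM0 : 0 ≤ M := (hu.mem 0).1.trans (hu.mem 0).2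
  have hsucc : ∀ k x, (stp p ν f ε τ)^[k + 1] u x = (stp p ν f ε τ)^[k] u x +
        τ * (2 * ε ^ (-p) * (∫ z, Psi p ((stp p ν f ε τ)^[k] u (x + ε • z) - (stp p ν f ε τ)^[k] u x) ∂ν) -
          f ((stp p ν f ε τ)^[k] u x)) := by
    intro k x; rw [Function.iterate_succ_apply']; rfl
  have near : ∀ {x z : Spc N}, ‖x - x0‖ < 1 → ‖z‖ ≤ 1 → ‖x + ε • z - x0‖ ≤ 2 := by
    intro x z hx hz
    rw [show x + ε • z - x0 = (x - x0) + ε • z by abel]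
    refine (norm_add_le _ _).trans ?_
    rw [norm_smul, Real.norm_eq_abs, abs_of_pos hεp]
    nlinarith [norm_nonneg z]
  have sq1 : ∀ {x : Spc N}, 1 ≤ ‖x - x0‖ → H ≤ H * ‖x - x0‖ ^ 2 := by
    intro x hx
    have : 1 ≤ ‖x - x0‖ ^ 2 := by nlinarith
    nlinarith
  have up : ∀ k, k ≤ n → ∀ x, ‖x - x0‖ ≤ 2 → (stp p ν f ε τ)^[k] u x ≤ u x0 + η + H * ‖x - x0‖ ^ 2 + C * (k * τ) := by
    intro k
    induction k with
    | zero =>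
      intro _ x hx
      have := (abs_le.1 (hmod x hx)).2
      simp only [Function.iterate_zero, id, Nat.cast_zero, zero_mul, mul_zero]; linarith
    | succ k ih =>
      intro hk x hx
      have hkn : k ≤ n := (Nat.le_succ k).trans hk
      have hk0 : 0 ≤ C * (k * τ) := by positivity
      have hst : C * ((k + 1 : ℕ) * τ) = C * (k * τ) + τ * C := by push_cast; ring
      rw [hst]
      have hτC : 0 ≤ τ * C := by positivity
      have hnx := hS (k + 1) hk x hx
      have hadm := hu.iter hp hν hf h hM k
      have hnext := ((hu.iter hp hν hf h hM (k + 1)).mem x).2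
      rcases le_or_gt 1 ‖x - x0‖ with h1 | h1
      · linarith [sq1 h1]
      set β := u x0 + η + H * ‖x - x0‖ ^ 2 + C * (k * τ) with hβ
      have hβ0 : 0 ≤ β := by positivity
      by_cases hcase : M ≤ β
      · linarith
      have key := step_mono hp hν h (α := (stp p ν f ε τ)^[k] u x) (β := β)
        (a := fun z => (stp p ν f ε τ)^[k] u (x + ε • z)) (b := fun z => u x0 + η + H * ‖x + ε • z - x0‖ ^ 2 + C * (k * τ))
        (hadm.mem x).1 (ih hkn x hx) (by linarith) (ae_of_all _ fun z => ⟨(hadm.mem _).1, (hadm.mem _).2.trans (by linarith)⟩)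
        (by filter_upwards [hν.supp] with z hz using ih hkn _ (near h1 hz)) (hν.integrable_incr hp hadm.cont x _ _)
        (int (by fun_prop))
      have hL := (abs_le.1 (abs_Lop_quad_le (N := N) hp hν hεp hε1 hH x0 h1.le)).2
      have hL2 : 2 * ε ^ (-p) * (∫ z, Psi p (u x0 + η + H * ‖x + ε • z - x0‖ ^ 2 + C * (k * τ) - β) ∂ν) =
          Lop p ν ε (fun x => H * ‖x - x0‖ ^ 2) x := by
        simp only [Lop, hβ]; congr 3; ext z; congr 1; ring
      rw [hL2] at key
      rw [hsucc]
      have h4 := ih hkn x hx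
      have h6 : τ * (Lop p ν ε (fun x => H * ‖x - x0‖ ^ 2) x - f β) ≤ τ * C := by
        have := hf.nonneg hβ0
        gcongr; linarith
      linarith
  have lo : ∀ k, k ≤ n → ∀ x, ‖x - x0‖ ≤ 2 → u x0 - η - H * ‖x - x0‖ ^ 2 - (C + f S) * (k * τ) ≤ (stp p ν f ε τ)^[k] u x := by
    intro k
    induction k with
    | zero =>
      intro _ x hx
      have := (abs_le.1 (hmod x hx)).1
      simp only [Function.iterate_zero, id, Nat.cast_zero, zero_mul, mul_zero]; linarith
    | succ k ih =>
      intro hk x hx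
      have hkn : k ≤ n := (Nat.le_succ k).trans hk
      have hk0 : 0 ≤ (C + f S) * (k * τ) := by positivity
      have hst : (C + f S) * ((k + 1 : ℕ) * τ) = (C + f S) * (k * τ) + τ * (C + f S) := by push_cast; ring
      rw [hst]
      have hτC : 0 ≤ τ * (C + f S) := by positivity
      have hadm := hu.iter hp hν hf h hM k
      have hnext := ((hu.iter hp hν hf h hM (k + 1)).mem x).1
      rcases le_or_gt 1 ‖x - x0‖ with h1 | h1
      · linarith [sq1 h1]
      set α := u x0 - η - H * ‖x - x0‖ ^ 2 - (C + f S) * (k * τ) with hα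
      rcases lt_or_ge α 0 with hα0 | hα0
      · linarith
      have hq0 : 0 ≤ H * ‖x - x0‖ ^ 2 := by positivity
      have hαS : α ≤ S := by linarith
      set a : Spc N → ℝ := fun z => max (u x0 - η - H * ‖x + ε • z - x0‖ ^ 2 - (C + f S) * (k * τ)) 0 with ha
      have ca : Continuous a := by simp only [ha]; fun_prop
      have key := step_mono hp hν h (α := α) (β := (stp p ν f ε τ)^[k] u x)
        (a := a) (b := fun z => (stp p ν f ε τ)^[k] u (x + ε • z))
        hα0 (ih hkn x hx) ((hadm.mem x).2.trans (by linarith)) (ae_of_all _ fun z => ⟨le_max_right _ _, max_le (by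
          have := (hu.mem x0).2
          have : 0 ≤ H * ‖x + ε • z - x0‖ ^ 2 := by positivity
          linarith) (by linarith)⟩)
        (by filter_upwards [hν.supp] with z hz using max_le (ih hkn _ (near h1 hz)) (hadm.mem _).1)
        (int (by fun_prop)) (hν.integrable_incr hp hadm.cont x _ _)
      have hL := (abs_le.1 (abs_Lop_quad_le (N := N) hp hν hεp hε1 hH x0 h1.le)).2
      have hεp' : 0 < ε ^ (-p) := Real.rpow_pos_of_pos hεp _
      have hL2 : -Lop p ν ε (fun x => H * ‖x - x0‖ ^ 2) x ≤ 2 * ε ^ (-p) * (∫ z, Psi p (a z - α) ∂ν) := by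
        simp only [Lop]
        rw [← mul_neg, ← integral_neg]
        refine mul_le_mul_of_nonneg_left (integral_mono (int (by fun_prop)) (int (by fun_prop)) fun z => ?_) (by positivity)
        simp only [← Psi_neg]
        refine monotone_Psi hp ?_
        have : u x0 - η - H * ‖x + ε • z - x0‖ ^ 2 - (C + f S) * (k * τ) ≤ a z := le_max_left _ _
        linarith
      rw [hsucc]
      have h4 := ih hkn x hx
      have hfα : f α ≤ f S := hf.mono (mem_Ici.2 hα0) (mem_Ici.2 hS0) hαS
      have h6 : τ * (-(C + f S)) ≤ τ * (2 * ε ^ (-p) * (∫ z, Psi p (a z - α) ∂ν) - f α) := by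
        gcongr; linarith
      linarith
  have h1 := up k hk x0 (by simp)
  have h2 := lo k hk x0 (by simp)
  simp only [sub_self, norm_zero, ne_eq, OfNat.ofNat_ne_zero, not_false_eq_true, zero_pow, mul_zero, add_zero, sub_zero] at h1 h2
  have hk0 : 0 ≤ f S * (k * τ) := by positivity
  rw [abs_le]; constructor <;> linarith

end

lemma exists_lip_approx {N : ℕ} {u₀ : Spc N → ℝ} (hc : Continuous u₀) (h0 : ∀ x, 0 ≤ u₀ x) :
    ∃ g : ℕ → Spc N → ℝ, (∀ n : ℕ, Adm ((n : ℝ) + 1) ((n : ℝ≥0) + 1) (g n)) ∧ (∀ n x, g n x ≤ u₀ x) ∧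
      ∀ R η : ℝ, 0 < η → ∀ᶠ n in atTop, ∀ x, ‖x‖ ≤ R → u₀ x - η ≤ g n x := by
  set h : ℕ → Spc N → ℝ := fun n x => ⨅ y, (u₀ y + (n + 1) * ‖x - y‖) with hh
  have bdd : ∀ (n : ℕ) x, BddBelow (range fun y => u₀ y + ((n:ℝ) + 1) * ‖x - y‖) := fun n x =>
    ⟨0, by rintro _ ⟨y, rfl⟩; exact add_nonneg (h0 y) (mul_nonneg (by positivity) (norm_nonneg _))⟩
  have hle : ∀ n x y, h n x ≤ u₀ y + (n + 1) * ‖x - y‖ := fun n x y => ciInf_le (bdd n x) y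
  have hge : ∀ n x, 0 ≤ h n x := fun n x => Real.iInf_nonneg fun y => by have := h0 y; positivity
  have hlip : ∀ n : ℕ, LipschitzWith ((n : ℝ≥0) + 1) (h n) := by
    intro n
    refine LipschitzWith.of_le_add_mul _ fun x y => ?_
    have : h n x - ((n : ℝ) + 1) * ‖x - y‖ ≤ h n y := le_ciInf fun z => by
      have h1 := hle n x z
      have h2 := norm_sub_le_norm_sub_add_norm_sub x y z
      have h3 : ((n : ℝ) + 1) * ‖x - z‖ ≤ (n + 1) * (‖x - y‖ + ‖y - z‖) := by gcongr
      linarith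
    rw [dist_eq_norm]; push_cast; linarith
  refine ⟨fun n x => min (n + 1) (h n x), fun n => ⟨fun x => ⟨le_min (by positivity) (hge n x), min_le_left _ _⟩, ?_⟩,
    fun n x => (min_le_right _ _).trans (by simpa using hle n x x), fun R η hη => ?_⟩
  · exact (hlip n).const_min _
  · obtain ⟨S, hS⟩ := (isCompact_closedBall (0 : Spc N) R).exists_bound_of_continuousOn hc.continuousOn
    have huc := (isCompact_closedBall (0 : Spc N) (R + 1)).uniformContinuousOn_of_continuous hc.continuousOn
    rw [Metric.uniformContinuousOn_iff] at huc
    obtain ⟨ρ, hρ, hu⟩ := huc η hη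
    set ρ' := min ρ 1 with hρ'
    have hρ0 : 0 < ρ' := by positivity
    obtain ⟨n0, hn0⟩ := exists_nat_gt (|S| / ρ' + |S|)
    filter_upwards [eventually_ge_atTop n0] with n hn x hx
    have hn' : (n0 : ℝ) ≤ n := by exact_mod_cast hn
    have hxS : u₀ x ≤ |S| := (le_abs_self _).trans ((hS x (by simpa using hx)).trans (le_abs_self _))
    have hq : 0 ≤ |S| / ρ' := by positivity
    refine le_min (by linarith) (le_ciInf fun y => ?_)
    rcases lt_or_ge ‖x - y‖ ρ' with hxy | hxy
    · have hy : ‖y‖ ≤ R + 1 := by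
        have h1 : ‖x - y‖ ≤ 1 := hxy.le.trans (min_le_right _ _)
        have h2 : ‖y‖ ≤ ‖x‖ + ‖x - y‖ := by
          calc ‖y‖ = ‖x - (x - y)‖ := by congr 1; abel
            _ ≤ _ := norm_sub_le _ _
        linarith
      have := hu x (by simpa using hx.trans (by linarith)) y (by simpa using hy) (by
        rw [dist_eq_norm]; exact hxy.trans_le (min_le_left _ _))
      rw [Real.dist_eq] at this
      have h3 := (abs_lt.1 this).2
      have h4 : 0 ≤ ((n : ℝ) + 1) * ‖x - y‖ := by positivity
      linarith
    · have h3 := h0 y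
      have h4 : |S| ≤ ((n : ℝ) + 1) * ‖x - y‖ := by
        have : |S| / ρ' ≤ (n : ℝ) + 1 := by linarith [abs_nonneg S]
        rw [div_le_iff₀ hρ0] at this
        exact this.trans (by gcongr)
      linarith

/-- parameters and data of the approximating schemes. -/
structure Scheme {N : ℕ} (p : ℝ) (ν : Measure (Spc N)) (f w : ℝ → ℝ) (u₀ : Spc N → ℝ) (ε τ : ℕ → ℝ) (g : ℕ → Spc N → ℝ) : Prop where
  cfl : ∀ n : ℕ, CFL p ν f (6 * ((n : ℝ) + 1)) (ε n) (τ n)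
  eps_le : ∀ n : ℕ, ε n ≤ 1 / ((n : ℝ) + 1) ^ 2
  tau_le : ∀ n : ℕ, τ n ≤ ε n ^ 2 / ((n : ℝ) + 1)
  incr : ∀ n : ℕ, τ n * (2 * ν.real univ * ((n : ℝ) + 1) ^ (p - 1) / ε n + f ((n : ℝ) + 1)) ^ 2 ≤ 1 / ((n : ℝ) + 1)
  adm : ∀ n : ℕ, Adm ((n : ℝ) + 1) ((n : ℝ≥0) + 1) (g n)
  g_le : ∀ n x, g n x ≤ u₀ x
  g_ge : ∀ R η : ℝ, 0 < η → ∀ᶠ n in atTop, ∀ x, ‖x‖ ≤ R → u₀ x - η ≤ g n x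
  le_w : ∀ (n k : ℕ) (x : Spc N), (stp p ν f (ε n) (τ n))^[k] (g n) x ≤ w ‖x‖ + 1 / ((n : ℝ) + 1) * (1 + k * τ n)

lemma exists_Scheme {N : ℕ} (hN : 1 ≤ N) {p : ℝ} (hp : 2 ≤ p) {ν : Measure (Spc N)} (hν : Kern p ν) {f : ℝ → ℝ} (hf : Absorb f) {b : ℝ}
    (hb : 0 < b) {w F : ℝ → ℝ} (hw : Radial N p f b w F) {u₀ : Spc N → ℝ} (hc : Continuous u₀) (h0 : ∀ x, 0 ≤ u₀ x ∧ u₀ x ≤ w ‖x‖) :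
    ∃ ε τ g, Scheme p ν f w u₀ ε τ g := by
  obtain ⟨g, hg, hgle, hgge⟩ := exists_lip_approx hc fun x => (h0 x).1
  choose ε0 hε0 hst using fun n : ℕ => iter_le_stationary hN hp hν hf hb hw ((n:ℝ) + 1) (η := 1 / ((n : ℝ) + 1)) (by positivity)
  have hp1 : 0 ≤ p - 1 := by linarith
  have hV : 0 ≤ ν.real univ := measureReal_nonneg
  choose Lf hLf using fun n : ℕ => hf.lip (6 * ((n : ℝ) + 1)) (by positivity)
  set ε : ℕ → ℝ := fun n => min (ε0 n / 2) (1 / ((n : ℝ) + 1) ^ 2) with hε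
  have hεpos : ∀ n, 0 < ε n := fun n => lt_min (half_pos (hε0 n)) (by positivity)
  set A : ℕ → ℝ := fun n => 2 * ε n ^ (-p) * (ν.real univ * ((p - 1) * (6 * ((n : ℝ) + 1)) ^ (p - 2))) + Lf n with hA
  have hA0 : ∀ n, 0 ≤ A n := fun n => by have := hεpos n; positivity
  set B : ℕ → ℝ := fun n => 2 * ν.real univ * ((n : ℝ) + 1) ^ (p - 1) / ε n + f ((n : ℝ) + 1) with hB
  set τ : ℕ → ℝ := fun n => min (1 / (2 * (A n + 1))) (min (ε n ^ 2 / ((n : ℝ) + 1)) (1 / (((n : ℝ) + 1) * (B n ^ 2 + 1)))) with hτ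
  have hτpos : ∀ n, 0 < τ n := fun n => by
    have := hεpos n; have := hA0 n
    exact lt_min (by positivity) (lt_min (by positivity) (by positivity))
  have hcfl : ∀ n : ℕ, CFL p ν f (6 * ((n : ℝ) + 1)) (ε n) (τ n) := fun n => by
    refine ⟨hεpos n, hτpos n, Lf n, hLf n, ?_⟩
    have h1 : τ n ≤ 1 / (2 * (A n + 1)) := min_le_left _ _
    have h2 := hA0 n
    rw [le_div_iff₀ (by positivity)] at h1
    have h3 := hτpos n
    have : τ n * A n ≤ 1 / 2 := by nlinarith
    exact this
  refine ⟨ε, τ, g, hcfl, fun n => min_le_right _ _, fun n => (min_le_right _ _).trans (min_le_left _ _), fun n => ?_, hg, hgle, hgge, fun n k x => ?_⟩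
  · have h1 : τ n ≤ 1 / (((n : ℝ) + 1) * (B n ^ 2 + 1)) := (min_le_right _ _).trans (min_le_right _ _)
    rw [le_div_iff₀ (by positivity)] at h1
    rw [le_div_iff₀ (by positivity)]
    have h3 := hτpos n
    have : τ n * B n ^ 2 * ((n:ℝ) + 1) ≤ 1 := by
      have : 0 ≤ τ n * ((n:ℝ) + 1) := by positivity
      nlinarith
    exact this
  · refine hst n (ε n) (τ n) _ _ (g n) ?_ (hcfl n) ?_ (hg n) (fun x => (hgle n x).trans (h0 x).2) k x
    · have h1 : ε n ≤ ε0 n / 2 := min_le_left _ _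
      linarith [hε0 n]
    · have : (0:ℝ) ≤ n := n.cast_nonneg
      linarith

/-- piecewise constant in time interpolation of the scheme. -/
def uap {N : ℕ} (p : ℝ) (ν : Measure (Spc N)) (f : ℝ → ℝ) (ε τ : ℕ → ℝ) (g : ℕ → Spc N → ℝ) (n : ℕ) (x : Spc N) (t : ℝ) : ℝ :=
  (stp p ν f (ε n) (τ n))^[⌊t / τ n⌋₊] (g n) x

lemma floor_div_mul_le {t τ : ℝ} (ht : 0 ≤ t) (hτ : 0 < τ) : ⌊t / τ⌋₊ * τ ≤ t := by
  rw [← le_div_iff₀ hτ]; exact Nat.floor_le (by positivity)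

lemma lt_floor_div_mul_add {t τ : ℝ} (hτ : 0 < τ) : t < ⌊t / τ⌋₊ * τ + τ := by
  have := Nat.lt_floor_add_one (t / τ)
  rw [div_lt_iff₀ hτ] at this; linarith

namespace Scheme
variable {N : ℕ} {p : ℝ} {ν : Measure (Spc N)} {f w : ℝ → ℝ} {u₀ : Spc N → ℝ} {ε τ : ℕ → ℝ} {g : ℕ → Spc N → ℝ}

lemma n_eps (H : Scheme p ν f w u₀ ε τ g) : Tendsto (fun n : ℕ => ((n:ℝ) + 1) * ε n) atTop (𝓝 0) := by
  refine squeeze_zero (fun n => by have := (H.cfl n).eps; positivity) (fun n => ?_) tendsto_one_div_add_atTop_nhds_zero_nat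
  have := H.eps_le n
  calc ((n:ℝ) + 1) * ε n ≤ (n + 1) * (1 / ((n : ℝ) + 1) ^ 2) := by gcongr
    _ = _ := by field_simp

lemma eps_one (H : Scheme p ν f w u₀ ε τ g) (n : ℕ) : ε n ≤ 1 := by
  refine (H.eps_le n).trans ?_
  rw [div_le_one (by positivity)]
  have : (0:ℝ) ≤ n := n.cast_nonneg
  nlinarith

lemma eps_tendsto (H : Scheme p ν f w u₀ ε τ g) : Tendsto ε atTop (𝓝 0) := by
  refine squeeze_zero (fun n => (H.cfl n).eps.le) (fun n => ?_) H.n_eps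
  have := (H.cfl n).eps
  have : (0:ℝ) ≤ n := n.cast_nonneg
  nlinarith

lemma tau_div (H : Scheme p ν f w u₀ ε τ g) : Tendsto (fun n => τ n / ε n) atTop (𝓝 0) := by
  refine squeeze_zero (fun n => by have := (H.cfl n).eps; have := (H.cfl n).tau; positivity) (fun n => ?_) H.eps_tendsto
  have h1 := (H.cfl n).eps
  rw [div_le_iff₀ h1]
  refine (H.tau_le n).trans ?_
  rw [← pow_two]
  exact div_le_self (by positivity) (by linarith [(n.cast_nonneg : (0:ℝ) ≤ n)])

lemma n_tau (H : Scheme p ν f w u₀ ε τ g) : Tendsto (fun n : ℕ => ((n:ℝ) + 1) * τ n) atTop (𝓝 0) := by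
  refine squeeze_zero (fun n => by have := (H.cfl n).tau; positivity) (fun n => ?_) H.eps_tendsto
  have h1 := (H.cfl n).eps
  have h2 := H.tau_le n
  rw [le_div_iff₀ (by positivity)] at h2
  nlinarith [H.eps_one n]

lemma tau_tendsto (H : Scheme p ν f w u₀ ε τ g) : Tendsto τ atTop (𝓝 0) := by
  refine squeeze_zero (fun n => (H.cfl n).tau.le) (fun n => ?_) H.n_tau
  have := (H.cfl n).tau
  have : (0:ℝ) ≤ n := n.cast_nonneg
  nlinarith

lemma iter_adm (hp : 2 ≤ p) (hν : Kern p ν) (hf : Absorb f) (H : Scheme p ν f w u₀ ε τ g) (n k : ℕ) :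
    Adm ((n:ℝ) + 1) ((n : ℝ≥0) + 1) ((stp p ν f (ε n) (τ n))^[k] (g n)) :=
  (H.adm n).iter hp hν hf (H.cfl n) (by have : (0:ℝ) ≤ n := n.cast_nonneg
                                        linarith) k

lemma iter_le_flat (hp : 2 ≤ p) (hν : Kern p ν) (hf : Absorb f) (H : Scheme p ν f w u₀ ε τ g) {φ : ℝ → ℝ}
    (hφ : ∀ t : ℝ, 0 < t → 0 < φ t ∧ (∫ s in Ioi (φ t), 1 / f s) = t) (n k : ℕ) (x : Spc N) {t : ℝ} (ht : 0 < t) (htk : t ≤ k * τ n) :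
    (stp p ν f (ε n) (τ n))^[k] (g n) x ≤ φ t := by
  obtain ⟨s, hs, hsM⟩ := hf.flat_surj hφ (M := (n:ℝ) + 1) (by positivity)
  have h1 := _root_.iter_le_flat hp hν hf (H.cfl n) (by have : (0:ℝ) ≤ n := n.cast_nonneg
                                                        linarith) (H.adm n) hφ hs hsM k x
  exact h1.trans (hf.flat_antitone hφ ht (by linarith))

lemma uap_le_flat (hp : 2 ≤ p) (hν : Kern p ν) (hf : Absorb f) (H : Scheme p ν f w u₀ ε τ g) {φ : ℝ → ℝ}
    (hφ : ∀ t : ℝ, 0 < t → 0 < φ t ∧ (∫ s in Ioi (φ t), 1 / f s) = t) (n : ℕ) (x : Spc N) {t : ℝ} (ht : 0 < t) (hτ : τ n ≤ t / 2) :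
    uap p ν f ε τ g n x t ≤ φ t + τ n * f (φ (t / 2)) := by
  have h0 := (H.cfl n).tau
  have h1 := H.iter_le_flat hp hν hf hφ n ⌊t / τ n⌋₊ x (t := t - τ n) (by linarith)
    (by linarith [lt_floor_div_mul_add (t := t) h0])
  have h2 := hf.flat_step hφ (t := t - τ n) (by linarith) h0.le
  rw [sub_add_cancel] at h2
  have h3 := hf.flat_antitone hφ (s := t / 2) (t := t - τ n) (by linarith) (by linarith)
  have h4 : f (φ (t - τ n)) ≤ f (φ (t / 2)) := hf.mono (mem_Ici.2 (hφ _ (by linarith)).1.le) (mem_Ici.2 (hφ _ (by linarith)).1.le) h3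
  have h5 : τ n * f (φ (t - τ n)) ≤ τ n * f (φ (t / 2)) := by gcongr
  unfold uap; linarith

lemma lipx (hp : 2 ≤ p) (hν : Kern p ν) (hf : Absorb f) (H : Scheme p ν f w u₀ ε τ g) {φ : ℝ → ℝ}
    (hφ : ∀ t : ℝ, 0 < t → 0 < φ t ∧ (∫ s in Ioi (φ t), 1 / f s) = t) {δ : ℝ} (hδ : 0 < δ) (T : ℝ) :
    ∃ K0 > 0, ∀ᶠ n : ℕ in atTop, ∀ k : ℕ, δ - τ n ≤ k * τ n → k * τ n ≤ T → ∀ x y,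
      (stp p ν f (ε n) (τ n))^[k] (g n) x - (stp p ν f (ε n) (τ n))^[k] (g n) y ≤ K0 * ‖x - y‖ + 2 * (((n:ℝ) + 1) * ε n) := by
  obtain ⟨m, hm0, hm⟩ := hν.cone
  set D := m * 32 ^ (2 - p) / 16 with hD
  have hD0 : 0 < D := by positivity
  set M := max 1 (φ (δ / 2)) with hM
  have hM1 : 1 ≤ M := le_max_left _ _
  set K := max (max T 0 + 1) (4 * M ^ 2 / D) with hK
  have hK1 : max T 0 + 1 ≤ K := le_max_left _ _
  have hK1' : 1 ≤ K := by linarith [le_max_right T 0]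
  have hKD : 4 * M ^ 2 ≤ K * D := by rw [← div_le_iff₀ hD0]; exact le_max_right _ _
  refine ⟨K / (δ / 8), by positivity, ?_⟩
  filter_upwards [H.n_eps.eventually (gt_mem_nhds (show (0:ℝ) < 1 / 8 by norm_num)),
    H.n_tau.eventually (gt_mem_nhds (show (0:ℝ) < 1 / 2 by norm_num)),
    H.tau_div.eventually (gt_mem_nhds (show (0:ℝ) < K / (128 * M) by positivity)),
    H.tau_tendsto.eventually (gt_mem_nhds (show (0:ℝ) < δ / 16 by positivity)),
    eventually_ge_atTop ⌈M⌉₊, eventually_ge_atTop ⌈K⌉₊] with n e1 e2 e3 e4 e5 e6 k hk1 hk2 x y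
  have hτ := (H.cfl n).tau
  have hε := (H.cfl n).eps
  have hMn : M ≤ n := (Nat.le_ceil _).trans (by exact_mod_cast e5)
  have hKn : K ≤ n := (Nat.le_ceil _).trans (by exact_mod_cast e6)
  set k0 := ⌊(3 * δ / 4) / τ n⌋₊ with hk0
  have f1 : k0 * τ n ≤ 3 * δ / 4 := floor_div_mul_le (by positivity) hτ
  have f2 : 3 * δ / 4 < k0 * τ n + τ n := lt_floor_div_mul_add hτ
  have hkk : k0 ≤ k := by
    have : (k0 : ℝ) ≤ k := le_of_mul_le_mul_right (by linarith) hτ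
    exact_mod_cast this
  obtain ⟨j, rfl⟩ := Nat.exists_eq_add_of_le' hkk
  rw [Function.iterate_add_apply]
  set v := (stp p ν f (ε n) (τ n))^[k0] (g n) with hv
  have hvA := H.iter_adm hp hν hf n k0
  have hvM : Adm M ((n : ℝ≥0) + 1) v := ⟨fun x => ⟨(hvA.mem x).1, (H.iter_le_flat hp hν hf hφ n k0 x (t := δ / 2) (by positivity) (by linarith)).trans
    (le_max_right _ _)⟩, hvA.lip⟩
  have hn1 : (0:ℝ) < (n:ℝ) + 1 := by positivity
  set s := K / (2 * ((n:ℝ) + 1)) with hs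
  have hs0 : 0 < s := by positivity
  have hKs : K / s = 2 * ((n:ℝ) + 1) := by rw [hs]; field_simp
  have hs1 : s ≤ 1 := by rw [hs, div_le_one (by positivity)]; linarith
  have hsm : SmoothHyp M K s (ε n) (τ n) (6 * ((n:ℝ) + 1)) m p ((n : ℝ≥0) + 1) := by
    refine ⟨by linarith, hs0, by linarith, hm0, hKD, ?_, ?_, ?_, ?_, ?_⟩
    · rw [hKs]; linarith
    · push_cast; linarith
    · rw [hs, le_div_iff₀ (by positivity)]; linarith
    · rw [div_lt_div_iff₀ hε (by positivity)] at e3; linarith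
    · rw [hKs]; push_cast; rfl
  push_cast at hk1 hk2
  have hjT : j * τ n + s ≤ K := by
    have : 0 ≤ k0 * τ n := by positivity
    linarith [le_max_left T 0]
  have h1 := smoothing hp hν hf (H.cfl n) hvM hsm hm j hjT x y
  have h2 : K / (j * τ n + s) ≤ K / (δ / 8) := by
    gcongr; linarith
  have h3 : K / (j * τ n + s) * ‖x - y‖ ≤ K / (δ / 8) * ‖x - y‖ := by gcongr
  push_cast at h1
  linarith

end Scheme

namespace Scheme
variable {N : ℕ} {p : ℝ} {ν : Measure (Spc N)} {f w : ℝ → ℝ} {u₀ : Spc N → ℝ} {ε τ : ℕ → ℝ} {g : ℕ → Spc N → ℝ}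

lemma le_w_ball {b : ℝ} {F : ℝ → ℝ} (hN : 1 ≤ N) (hp : 2 ≤ p) (hf : Absorb f) (hb : 0 < b) (hw : Radial N p f b w F)
    (H : Scheme p ν f w u₀ ε τ g) (n k : ℕ) {T R : ℝ} (hk : k * τ n ≤ T) {x : Spc N} (hx : ‖x‖ ≤ R) :
    (stp p ν f (ε n) (τ n))^[k] (g n) x ≤ w R + (1 + T) := by
  have h1 := H.le_w n k x
  have h2 := hw.wmono hN hp hf hb (mem_Ici.2 (norm_nonneg x)) (mem_Ici.2 ((norm_nonneg x).trans hx)) hx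
  have h0 := (H.cfl n).tau
  have h3 : 1 / ((n : ℝ) + 1) ≤ 1 := by
    rw [div_le_one (by positivity)]; linarith [(n.cast_nonneg : (0:ℝ) ≤ n)]
  have h4 : 0 ≤ k * τ n := by positivity
  have h5 : 1 / ((n : ℝ) + 1) * (1 + k * τ n) ≤ 1 * (1 + T) := by gcongr
  linarith

lemma lip_uap_time {b : ℝ} {F : ℝ → ℝ} (hN : 1 ≤ N) (hp : 2 ≤ p) (hf : Absorb f) (hb : 0 < b) (hw : Radial N p f b w F) (hν : Kern p ν)
    (H : Scheme p ν f w u₀ ε τ g) (n k j : ℕ) {T S K η : ℝ} (hη : 0 ≤ η) (x0 : Spc N) (hT : (k + j : ℕ) * τ n ≤ T)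
    (hS : w (‖x0‖ + 2) + (1 + T) ≤ S) (hK : S ≤ K)
    (hmod : ∀ x, ‖x - x0‖ ≤ 2 → |(stp p ν f (ε n) (τ n))^[k] (g n) x - (stp p ν f (ε n) (τ n))^[k] (g n) x0| ≤ η + K * ‖x - x0‖ ^ 2) :
    |(stp p ν f (ε n) (τ n))^[k + j] (g n) x0 - (stp p ν f (ε n) (τ n))^[k] (g n) x0| ≤
      η + (2 * ν.real univ * ((p - 1) * 3 ^ (p - 2) * K ^ (p - 1)) + f S) * (j * τ n) := by
  have h0 := (H.cfl n).tau
  rw [add_comm k j, Function.iterate_add_apply]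
  refine iter_time_modulus hp hν hf (H.cfl n) (H.eps_one n) (M := (n:ℝ) + 1) (by linarith [(n.cast_nonneg : (0:ℝ) ≤ n)])
    (H.iter_adm hp hν hf n k) hK hη x0 j (fun i hi x hx => ?_) hmod j le_rfl
  rw [← Function.iterate_add_apply]
  refine (H.le_w_ball hN hp hf hb hw n (i + k) (T := T) (R := ‖x0‖ + 2) (le_trans ?_ hT) ?_).trans hS
  · exact mul_le_mul_of_nonneg_right (by exact_mod_cast (by omega : i + k ≤ k + j)) h0.le
  · have := norm_add_le (x - x0) x0
    rw [sub_add_cancel] at this; linarith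

lemma equicont_pos {b : ℝ} {F : ℝ → ℝ} (hN : 1 ≤ N) (hp : 2 ≤ p) (hf : Absorb f) (hb : 0 < b) (hw : Radial N p f b w F) (hν : Kern p ν)
    (H : Scheme p ν f w u₀ ε τ g) {φ : ℝ → ℝ}
    (hφ : ∀ t : ℝ, 0 < t → 0 < φ t ∧ (∫ s in Ioi (φ t), 1 / f s) = t) (x0 : Spc N) {t0 : ℝ} (ht0 : 0 < t0) {η : ℝ} (hη : 0 < η) :
    ∃ ρ > 0, ∀ᶠ n : ℕ in atTop, ∀ x t, ‖x - x0‖ < ρ → |t - t0| < ρ → |uap p ν f ε τ g n x t - uap p ν f ε τ g n x0 t0| ≤ η := by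
  obtain ⟨K0, hK0, hlip⟩ := H.lipx hp hν hf hφ (half_pos ht0) (t0 + 1)
  set S := |w (‖x0‖ + 2)| + (1 + (t0 + 1)) with hS
  have hS0 : 0 ≤ S := by positivity
  set K := max S (K0 ^ 2 / (4 * (η / 8))) with hK
  have hK00 : 0 ≤ K := hS0.trans (le_max_left _ _)
  set C := 2 * ν.real univ * ((p - 1) * 3 ^ (p - 2) * K ^ (p - 1)) + f S with hC
  have hV : 0 ≤ ν.real univ := measureReal_nonneg
  have hC0 : 0 ≤ C := by
    have := hf.nonneg hS0
    have : 0 ≤ p - 1 := by linarith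
    positivity
  set ρ := min (min (t0 / 2) 1) (min (η / (8 * (K0 + 1))) (η / (8 * (C + 1)))) with hρ
  have hρ0 : 0 < ρ := by positivity
  have r1 : ρ ≤ t0 / 2 := (min_le_left _ _).trans (min_le_left _ _)
  have r2 : ρ ≤ 1 := (min_le_left _ _).trans (min_le_right _ _)
  have r3 : (K0 + 1) * ρ ≤ η / 8 := by
    have : ρ ≤ η / (8 * (K0 + 1)) := (min_le_right _ _).trans (min_le_left _ _)
    rw [le_div_iff₀ (by positivity)] at this; linarith
  have r4 : (C + 1) * ρ ≤ η / 8 := by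
    have : ρ ≤ η / (8 * (C + 1)) := (min_le_right _ _).trans (min_le_right _ _)
    rw [le_div_iff₀ (by positivity)] at this; linarith
  refine ⟨ρ, hρ0, ?_⟩
  filter_upwards [hlip, H.n_eps.eventually (gt_mem_nhds (show (0:ℝ) < η / 16 by positivity)),
    H.tau_tendsto.eventually (gt_mem_nhds hρ0)] with n e1 e2 e3 x t hx ht
  have hτ := (H.cfl n).tau
  have hab : ∀ k : ℕ, t0 / 2 - τ n ≤ k * τ n → k * τ n ≤ t0 + 1 → ∀ x y,
      |(stp p ν f (ε n) (τ n))^[k] (g n) x - (stp p ν f (ε n) (τ n))^[k] (g n) y| ≤ K0 * ‖x - y‖ + η / 8 := by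
    intro k h1 h2 x y
    rw [abs_le]
    have a1 := e1 k h1 h2 x y
    have a2 := e1 k h1 h2 y x
    rw [norm_sub_rev] at a2
    constructor <;> linarith
  have htime : ∀ s s' : ℝ, t0 / 2 ≤ s → s ≤ s' → s' ≤ t0 + 1 → |uap p ν f ε τ g n x0 s' - uap p ν f ε τ g n x0 s| ≤
      η / 4 + C * (s' - s + τ n) := by
    intro s s' h1 h2 h3
    have hle : ⌊s / τ n⌋₊ ≤ ⌊s' / τ n⌋₊ := Nat.floor_mono (by gcongr)
    obtain ⟨j, hj⟩ := Nat.exists_eq_add_of_le hle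
    have b1 := floor_div_mul_le (t := s') (by linarith) hτ
    have b2 := floor_div_mul_le (t := s) (by linarith) hτ
    have b3 := lt_floor_div_mul_add (t := s) hτ
    unfold uap
    rw [hj] at b1 ⊢
    have hj' : j * τ n ≤ s' - s + τ n := by push_cast at b1; linarith
    refine (H.lip_uap_time hN hp hf hb hw hν n ⌊s / τ n⌋₊ j (T := t0 + 1) (S := S) (K := K) (η := η / 4) (by positivity) x0 (by linarith)
      (by linarith [le_abs_self (w (‖x0‖ + 2))]) (le_max_left _ _) (fun y hy => ?_)).trans ?_
    · have c1 := hab ⌊s / τ n⌋₊ (by linarith) (by linarith) y x0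
      have c2 : K0 * ‖y - x0‖ ≤ η / 8 + K0 ^ 2 / (4 * (η / 8)) * ‖y - x0‖ ^ 2 := by
        set d := ‖y - x0‖
        have : η / 8 + K0 ^ 2 / (4 * (η / 8)) * d ^ 2 - K0 * d = (η / 4 - K0 * d) ^ 2 * (2 / η) := by
          field_simp; ring
        have h0 : 0 ≤ (η / 4 - K0 * d) ^ 2 * (2 / η) := by positivity
        linarith
      have c3 : K0 ^ 2 / (4 * (η / 8)) * ‖y - x0‖ ^ 2 ≤ K * ‖y - x0‖ ^ 2 := by
        gcongr; exact le_max_right _ _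
      linarith
    · rw [← hC]
      have : C * (j * τ n) ≤ C * (s' - s + τ n) := by gcongr
      linarith
  rw [abs_lt] at ht
  have d1 : |uap p ν f ε τ g n x t - uap p ν f ε τ g n x0 t| ≤ K0 * ‖x - x0‖ + η / 8 := by
    have b2 := floor_div_mul_le (t := t) (by linarith) hτ
    have b3 := lt_floor_div_mul_add (t := t) hτ
    exact hab _ (by linarith) (by linarith) _ _
  have d2 : |uap p ν f ε τ g n x0 t - uap p ν f ε τ g n x0 t0| ≤ η / 4 + C * (ρ + τ n) := by
    rcases le_total t t0 with h | h
    · rw [abs_sub_comm]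
      refine (htime t t0 (by linarith) h (by linarith)).trans ?_
      have : C * (t0 - t + τ n) ≤ C * (ρ + τ n) := by gcongr; linarith
      linarith
    · refine (htime t0 t (by linarith) h (by linarith)).trans ?_
      have : C * (t - t0 + τ n) ≤ C * (ρ + τ n) := by gcongr; linarith
      linarith
  have d3 : K0 * ‖x - x0‖ ≤ K0 * ρ := by gcongr
  have d4 : C * (ρ + τ n) ≤ C * (ρ + ρ) := by gcongr
  have d5 := abs_sub_le (uap p ν f ε τ g n x t) (uap p ν f ε τ g n x0 t) (uap p ν f ε τ g n x0 t0)
  linarith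

lemma equicont_zero {b : ℝ} {F : ℝ → ℝ} (hN : 1 ≤ N) (hp : 2 ≤ p) (hf : Absorb f) (hb : 0 < b) (hw : Radial N p f b w F) (hν : Kern p ν)
    (hc : Continuous u₀) (H : Scheme p ν f w u₀ ε τ g) (x0 : Spc N) {η : ℝ} (hη : 0 < η) :
    ∃ ρ > 0, ∀ᶠ n : ℕ in atTop, ∀ x t, ‖x - x0‖ < ρ → 0 ≤ t → t < ρ → |uap p ν f ε τ g n x t - uap p ν f ε τ g n x0 0| ≤ η := by
  have hcomp := isCompact_closedBall x0 4
  obtain ⟨d, hd0, hd⟩ := Metric.uniformContinuousOn_iff_le.1 (hcomp.uniformContinuousOn_of_continuous hc.continuousOn) (η / 16) (by positivity)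
  obtain ⟨B, hB⟩ := hcomp.exists_bound_of_continuousOn hc.continuousOn
  have hB0 : 0 ≤ B := (norm_nonneg _).trans (hB x0 (by simp))
  set S := |w (‖x0‖ + 1 + 2)| + (1 + 1) with hS
  have hS0 : 0 ≤ S := by positivity
  set K := max S (2 * B / d ^ 2) with hK
  have hK00 : 0 ≤ K := hS0.trans (le_max_left _ _)
  have hKB : 2 * B ≤ K * d ^ 2 := by rw [← div_le_iff₀ (by positivity)]; exact le_max_right _ _
  set C := 2 * ν.real univ * ((p - 1) * 3 ^ (p - 2) * K ^ (p - 1)) + f S with hC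
  have hV : 0 ≤ ν.real univ := measureReal_nonneg
  have hC0 : 0 ≤ C := by
    have := hf.nonneg hS0
    have : 0 ≤ p - 1 := by linarith
    positivity
  have hmod : ∀ x y, ‖x - x0‖ ≤ 4 → ‖y - x0‖ ≤ 4 → |u₀ x - u₀ y| ≤ η / 16 + K * ‖x - y‖ ^ 2 := by
    intro x y hx hy
    have hx' : x ∈ Metric.closedBall x0 4 := by rwa [mem_closedBall_iff_norm]
    have hy' : y ∈ Metric.closedBall x0 4 := by rwa [mem_closedBall_iff_norm]
    by_cases hxy : ‖x - y‖ ≤ d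
    · have := hd x hx' y hy' (by rwa [dist_eq_norm])
      rw [Real.dist_eq] at this
      have : 0 ≤ K * ‖x - y‖ ^ 2 := by positivity
      linarith
    · have h1 := hB x hx'
      have h2 := hB y hy'
      rw [Real.norm_eq_abs, abs_le] at h1 h2
      have : K * d ^ 2 ≤ K * ‖x - y‖ ^ 2 := by gcongr; linarith
      rw [abs_le]; constructor <;> linarith
  refine ⟨min (min 1 d) (η / (4 * (C + 1))), by positivity, ?_⟩
  filter_upwards [H.g_ge (‖x0‖ + 4) (η / 16) (by positivity)] with n e1 x t hx ht htr
  have hτ := (H.cfl n).tau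
  have gmod : ∀ x y, ‖x - x0‖ ≤ 4 → ‖y - x0‖ ≤ 4 → |g n x - g n y| ≤ η / 8 + K * ‖x - y‖ ^ 2 := by
    intro x y hx hy
    have h1 := e1 x (by have := norm_add_le (x - x0) x0; rw [sub_add_cancel] at this; linarith)
    have h2 := e1 y (by have := norm_add_le (y - x0) x0; rw [sub_add_cancel] at this; linarith)
    have h3 := H.g_le n x
    have h4 := H.g_le n y
    have h5 := hmod x y hx hy
    rw [abs_le] at h5 ⊢
    constructor <;> linarith
  have hx1 : ‖x - x0‖ < 1 := hx.trans_le ((min_le_left _ _).trans (min_le_left _ _))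
  have hxd : ‖x - x0‖ < d := hx.trans_le ((min_le_left _ _).trans (min_le_right _ _))
  have ht1 : t < 1 := htr.trans_le ((min_le_left _ _).trans (min_le_left _ _))
  have htC : (C + 1) * t ≤ η / 4 := by
    have : t < η / (4 * (C + 1)) := htr.trans_le (min_le_right _ _)
    rw [lt_div_iff₀ (by positivity)] at this; linarith
  have hfl := floor_div_mul_le ht hτ
  have hxn : ‖x‖ ≤ ‖x0‖ + 1 := by have := norm_add_le (x - x0) x0; rw [sub_add_cancel] at this; linarith
  have hwm := hw.wmono hN hp hf hb (mem_Ici.2 (by positivity : 0 ≤ ‖x‖ + 2)) (mem_Ici.2 (by positivity : 0 ≤ ‖x0‖ + 1 + 2)) (by linarith)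
  have key := H.lip_uap_time hN hp hf hb hw hν n 0 ⌊t / τ n⌋₊ (T := 1) (S := S) (K := K) (η := η / 8) (by positivity) x (by rw [zero_add]; linarith)
      (by linarith [le_abs_self (w (‖x0‖ + 1 + 2))]) (le_max_left _ _) (fun y hy => gmod y x (by
        have := norm_add_le (y - x) (x - x0); rw [sub_add_sub_cancel] at this; linarith) (by linarith))
  rw [zero_add, Function.iterate_zero, id, ← hC] at key
  have h6 : C * (⌊t / τ n⌋₊ * τ n) ≤ C * t := by gcongr
  have h7 : |g n x - g n x0| ≤ η / 4 := by
    have h1 := e1 x (by linarith)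
    have h2 := e1 x0 (by linarith)
    have h3 := H.g_le n x
    have h4 := H.g_le n x0
    have h5 := hd x (by rw [mem_closedBall_iff_norm]; linarith) x0 (by simp) (by rw [dist_eq_norm]; linarith)
    rw [Real.dist_eq, abs_le] at h5
    rw [abs_le]
    constructor <;> linarith
  have d5 := abs_sub_le (uap p ν f ε τ g n x t) (g n x) (g n x0)
  have d6 : uap p ν f ε τ g n x0 0 = g n x0 := by simp [uap]
  rw [d6]
  unfold uap at d5 ⊢
  linarith

lemma equicont {b : ℝ} {F : ℝ → ℝ} (hN : 1 ≤ N) (hp : 2 ≤ p) (hf : Absorb f) (hb : 0 < b) (hw : Radial N p f b w F) (hν : Kern p ν)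
    (hc : Continuous u₀) (H : Scheme p ν f w u₀ ε τ g) {φ : ℝ → ℝ}
    (hφ : ∀ t : ℝ, 0 < t → 0 < φ t ∧ (∫ s in Ioi (φ t), 1 / f s) = t) (x0 : Spc N) {t0 : ℝ} (ht0 : 0 ≤ t0) {η : ℝ} (hη : 0 < η) :
    ∃ ρ > 0, ∀ᶠ n : ℕ in atTop, ∀ x t, ‖x - x0‖ < ρ → 0 ≤ t → |t - t0| < ρ → |uap p ν f ε τ g n x t - uap p ν f ε τ g n x0 t0| ≤ η := by
  rcases ht0.eq_or_lt with rfl | h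
  · obtain ⟨ρ, h1, h2⟩ := H.equicont_zero hN hp hf hb hw hν hc x0 hη
    refine ⟨ρ, h1, h2.mono fun n hn x t hx ht htr => hn x t hx ht ?_⟩
    rw [sub_zero] at htr
    exact (le_abs_self _).trans_lt htr
  · obtain ⟨ρ, h1, h2⟩ := H.equicont_pos hN hp hf hb hw hν hφ x0 h hη
    exact ⟨ρ, h1, h2.mono fun n hn x t hx _ htr => hn x t hx htr⟩

end Scheme

/-- Arzelà–Ascoli under asymptotic equicontinuity. -/
lemma exists_subseq_tendsto_of_asymp_equicont {Y : Type*} [TopologicalSpace Y] [TopologicalSpace.SeparableSpace Y] [Nonempty Y] (v : ℕ → Y → ℝ)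
    (hbd : ∀ y, ∃ B, ∀ n, |v n y| ≤ B)
    (heq : ∀ y, ∀ η : ℝ, 0 < η → ∃ U ∈ 𝓝 y, ∀ᶠ n in atTop, ∀ y' ∈ U, |v n y' - v n y| ≤ η) :
    ∃ (σ : ℕ → ℕ) (u : Y → ℝ), StrictMono σ ∧ Continuous u ∧
      ∀ y (yn : ℕ → Y), Tendsto yn atTop (𝓝 y) → Tendsto (fun n => v (σ n) (yn n)) atTop (𝓝 (u y)) := by
  obtain ⟨d, hd⟩ := TopologicalSpace.exists_dense_seq Y
  choose B hB using hbd
  have hK : IsCompact (univ.pi fun k : ℕ => Icc (-B (d k)) (B (d k))) := isCompact_univ_pi fun k => isCompact_Icc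
  obtain ⟨L, -, σ, hσ, hL⟩ := hK.tendsto_subseq (x := fun n k => v n (d k)) fun n k _ => by
    exact abs_le.1 (hB (d k) n)
  rw [tendsto_pi_nhds] at hL
  have hcauchy : ∀ y, ∃ l, Tendsto (fun n => v (σ n) y) atTop (𝓝 l) := by
    intro y
    refine cauchySeq_tendsto_of_complete (Metric.cauchySeq_iff'.2 fun η hη => ?_)
    obtain ⟨U, hU, hn⟩ := heq y (η / 6) (by positivity)
    obtain ⟨_, hkU, ⟨k, rfl⟩⟩ := mem_closure_iff_nhds.1 (hd y) U hU
    have hn' := hσ.tendsto_atTop.eventually hn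
    have hc := (hL k).cauchySeq
    obtain ⟨n0, hn0⟩ := Metric.cauchySeq_iff'.1 hc (η / 6) (by positivity)
    obtain ⟨n1, hn1⟩ := eventually_atTop.1 hn'
    refine ⟨max n0 n1, fun n hnn => ?_⟩
    have a1 := hn1 n ((le_max_right _ _).trans hnn) (d k) hkU
    have a2 := hn1 (max n0 n1) (le_max_right _ _) (d k) hkU
    have a3 := hn0 n ((le_max_left _ _).trans hnn)
    have a4 := hn0 (max n0 n1) (le_max_left _ _)
    simp only [Function.comp_apply, Real.dist_eq] at a3 a4
    rw [Real.dist_eq]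
    rw [abs_lt] at a3 a4 ⊢
    rw [abs_le] at a1 a2
    constructor <;> linarith
  choose u hu using hcauchy
  have hclose : ∀ y, ∀ η : ℝ, 0 < η → ∃ U ∈ 𝓝 y, ∀ y' ∈ U, |u y' - u y| ≤ η := by
    intro y η hη
    obtain ⟨U, hU, hn⟩ := heq y η hη
    refine ⟨U, hU, fun y' hy' => ?_⟩
    refine le_of_tendsto ((hu y').sub (hu y)).abs ?_
    filter_upwards [hσ.tendsto_atTop.eventually hn] with n h using h y' hy'
  refine ⟨σ, u, hσ, continuous_iff_continuousAt.2 fun y => Metric.tendsto_nhds.2 fun η hη => ?_, fun y yn hy => ?_⟩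
  · obtain ⟨U, hU, h⟩ := hclose y (η / 2) (by positivity)
    filter_upwards [hU] with y' hy'
    rw [Real.dist_eq]; linarith [h y' hy']
  · refine Metric.tendsto_nhds.2 fun η hη => ?_
    obtain ⟨U, hU, hn⟩ := heq y (η / 2) (by positivity)
    filter_upwards [hσ.tendsto_atTop.eventually hn, hy hU, Metric.tendsto_nhds.1 (hu y) (η / 2) (by positivity)] with n h1 h2 h3
    have h4 := h1 _ h2
    rw [Real.dist_eq] at h3 ⊢
    linarith [abs_sub_le (v (σ n) (yn n)) (v (σ n) y) (u y)]

/-- exponential weight. -/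
def wt {N : ℕ} (x : Spc N) : ℝ := Real.exp (-‖x‖)

section
variable {N : ℕ}

lemma wt_pos (x : Spc N) : 0 < wt x := Real.exp_pos _

lemma wt_le_one (x : Spc N) : wt x ≤ 1 := Real.exp_le_one_iff.2 (by simp)

lemma continuous_wt : Continuous (wt : Spc N → ℝ) := by unfold wt; fun_prop

lemma integrable_wt : Integrable (wt : Spc N → ℝ) := by
  have h : Integrable (fun x : Spc N => (((N + 1).factorial : ℝ) * Real.exp 1) * (1 + ‖x‖) ^ (-((N : ℝ) + 1))) :=
    (integrable_one_add_norm (by simp)).const_mul _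
  refine h.mono' continuous_wt.aestronglyMeasurable (ae_of_all _ fun x => ?_)
  rw [Real.norm_of_nonneg (wt_pos x).le]
  have h1 := Real.pow_div_factorial_le_exp (1 + ‖x‖) (by positivity) (N + 1)
  rw [div_le_iff₀ (by positivity)] at h1
  have h2 : (0:ℝ) < 1 + ‖x‖ := by positivity
  rw [Real.rpow_neg h2.le, show ((N : ℝ) + 1) = ((N + 1 : ℕ) : ℝ) by push_cast; ring, Real.rpow_natCast, ← div_eq_mul_inv,
    le_div_iff₀ (by positivity)]
  calc wt x * (1 + ‖x‖) ^ (N + 1) ≤ wt x * (Real.exp (1 + ‖x‖) * ((N + 1).factorial : ℝ)) := by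
        gcongr; exact (wt_pos x).le
    _ = ((N + 1).factorial : ℝ) * (Real.exp (-‖x‖) * Real.exp (1 + ‖x‖)) := by unfold wt; ring
    _ = _ := by rw [← Real.exp_add]; ring_nf

lemma abs_wt_sub_le (x : Spc N) {y : Spc N} (hy : ‖y‖ ≤ 1) : |wt (x + y) - wt x| ≤ 2 * ‖y‖ * wt x := by
  have h1 : |‖x‖ - ‖x + y‖| ≤ ‖y‖ := by
    have := abs_norm_sub_norm_le x (x + y)
    simpa using this
  have h2 : wt (x + y) - wt x = wt x * (Real.exp (‖x‖ - ‖x + y‖) - 1) := by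
    unfold wt
    rw [mul_sub, ← Real.exp_add, mul_one]; ring_nf
  rw [h2, abs_mul, abs_of_pos (wt_pos x), mul_comm]
  have := (Real.abs_exp_sub_one_le (h1.trans hy)).trans (mul_le_mul_of_nonneg_left h1 zero_le_two)
  exact mul_le_mul_of_nonneg_right this (wt_pos x).le

lemma wt_add_le (x : Spc N) {y : Spc N} (hy : ‖y‖ ≤ 1) : wt (x + y) ≤ 3 * wt x := by
  have h1 := (abs_le.1 (abs_wt_sub_le x hy)).2
  have h2 := wt_pos x
  nlinarith
end

/-- total space: direction, position and two parameters. -/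
abbrev XX (N : ℕ) := Spc N × (Spc N × (ℝ × ℝ))

abbrev LL {N : ℕ} (ν : Measure (Spc N)) (κ : Measure (ℝ × ℝ)) : Measure (XX N) := ν.prod ((volume : Measure (Spc N)).prod κ)

/-- difference quotient. -/
def Dq {N : ℕ} (ε : ℝ) (w : Spc N → ℝ × ℝ → ℝ) (X : XX N) : ℝ := (w (X.2.1 + ε • X.1) X.2.2 - w X.2.1 X.2.2) / ε

/-- the flip exchanging the two endpoints. -/
def TT {N : ℕ} (ε : ℝ) : XX N ≃ᵐ XX N where
  toFun X := (-X.1, (X.2.1 + ε • X.1, X.2.2))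
  invFun X := (-X.1, (X.2.1 + ε • X.1, X.2.2))
  left_inv X := by simp
  right_inv X := by simp
  measurable_toFun := by
    show Measurable fun X : XX N => (-X.1, (X.2.1 + ε • X.1, X.2.2))
    fun_prop
  measurable_invFun := by
    show Measurable fun X : XX N => (-X.1, (X.2.1 + ε • X.1, X.2.2))
    fun_prop

lemma ae_norm_le_one {N : ℕ} {p : ℝ} {ν : Measure (Spc N)} {κ : Measure (ℝ × ℝ)} (hν : Kern p ν) : ∀ᵐ X ∂LL ν κ, ‖X.1‖ ≤ 1 :=
  Measure.quasiMeasurePreserving_fst.ae hν.supp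

section
variable {N : ℕ} {p : ℝ} {ν : Measure (Spc N)} {κ : Measure (ℝ × ℝ)} [IsFiniteMeasure κ] {ε : ℝ}

lemma TT_apply (X : XX N) : TT ε X = (-X.1, (X.2.1 + ε • X.1, X.2.2)) := rfl

lemma TT_mp [IsFiniteMeasure ν] (hν : Kern p ν) : MeasurePreserving (TT ε) (LL ν κ) (LL ν κ) := by
  refine MeasurePreserving.skew_product (f := fun z : Spc N => -z) (g := fun (z : Spc N) (y : Spc N × (ℝ × ℝ)) => (y.1 + ε • z, y.2))
    (hν.iso (LinearIsometryEquiv.neg ℝ)) (by unfold Function.uncurry; fun_prop) (ae_of_all _ fun z => ?_)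
  exact ((measurePreserving_add_right volume (ε • z)).prod (MeasurePreserving.id κ)).map_eq

lemma integral_TT [IsFiniteMeasure ν] (hν : Kern p ν) (F : XX N → ℝ) : ∫ X, F (TT ε X) ∂LL ν κ = ∫ X, F X ∂LL ν κ :=
  (TT_mp hν).integral_comp' F

lemma Dq_TT (w : Spc N → ℝ × ℝ → ℝ) (X : XX N) : Dq ε w (TT ε X) = - Dq ε w X := by
  simp [Dq, TT_apply]; ring

lemma integrable_wt_Y : Integrable (fun y : Spc N × (ℝ × ℝ) => wt y.1) ((volume : Measure (Spc N)).prod κ) :=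
  integrable_wt.comp_fst κ

lemma integrable_wt_X [IsFiniteMeasure ν] : Integrable (fun X : XX N => wt X.2.1) (LL ν κ) :=
  (integrable_wt_Y (κ := κ)).comp_snd ν

lemma integrable_of_le_wt [IsFiniteMeasure ν] {F : XX N → ℝ} (hF : AEStronglyMeasurable F (LL ν κ)) {C : ℝ}
    (h : ∀ᵐ X ∂LL ν κ, |F X| ≤ C * wt X.2.1) : Integrable F (LL ν κ) :=
  (integrable_wt_X.const_mul C).mono' hF h

lemma integrable_of_le_wt_Y {F : Spc N × (ℝ × ℝ) → ℝ} (hF : AEStronglyMeasurable F ((volume : Measure (Spc N)).prod κ)) {C : ℝ}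
    (h : ∀ᵐ y ∂((volume : Measure (Spc N)).prod κ), |F y| ≤ C * wt y.1) : Integrable F ((volume : Measure (Spc N)).prod κ) :=
  (integrable_wt_Y.const_mul C).mono' hF h

lemma measurable_shift {w : Spc N → ℝ × ℝ → ℝ} (hw : Measurable (Function.uncurry w)) :
    Measurable fun X : XX N => w (X.2.1 + ε • X.1) X.2.2 :=
  hw.comp (f := fun X : XX N => (X.2.1 + ε • X.1, X.2.2)) (by fun_prop)

lemma measurable_base {w : Spc N → ℝ × ℝ → ℝ} (hw : Measurable (Function.uncurry w)) :
    Measurable fun X : XX N => w X.2.1 X.2.2 :=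
  hw.comp measurable_snd

lemma measurable_Dq {w : Spc N → ℝ × ℝ → ℝ} (hw : Measurable (Function.uncurry w)) : Measurable (Dq ε w) :=
  ((measurable_shift hw).sub (measurable_base hw)).div_const ε

lemma abs_Dq_le {w : Spc N → ℝ × ℝ → ℝ} {M : ℝ} (hε : 0 < ε) (hM : ∀ x π, |w x π| ≤ M) (X : XX N) : |Dq ε w X| ≤ 2 * M / ε := by
  unfold Dq
  rw [abs_div, abs_of_pos hε]
  gcongr
  have h1 := abs_le.1 (hM (X.2.1 + ε • X.1) X.2.2)
  have h2 := abs_le.1 (hM X.2.1 X.2.2)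
  rw [abs_le]; constructor <;> linarith

lemma abs_Psi_le (hp : 2 ≤ p) {a C : ℝ} (h : |a| ≤ C) : |Psi p a| ≤ C ^ (p - 1) := by
  rw [abs_Psi hp]
  exact Real.rpow_le_rpow (abs_nonneg _) h (by linarith)

/-- discrete integration by parts. -/
lemma integral_Lop_mul (hp : 2 ≤ p) [IsFiniteMeasure ν] (hν : Kern p ν) (hε : 0 < ε) (hε1 : ε ≤ 1) {w ζ : Spc N → ℝ × ℝ → ℝ}
    (hw : Measurable (Function.uncurry w)) (hζ : Measurable (Function.uncurry ζ)) {M C : ℝ} (hM : ∀ x π, |w x π| ≤ M)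
    (hC : ∀ x π, |ζ x π| ≤ C * wt x) :
    ∫ y : Spc N × (ℝ × ℝ), Lop p ν ε (fun x => w x y.2) y.1 * ζ y.1 y.2 ∂((volume : Measure (Spc N)).prod κ) =
      - ∫ X, Psi p (Dq ε w X) * Dq ε ζ X ∂LL ν κ := by
  have hΨm : Measurable fun X => Psi p (Dq ε w X) := (continuous_Psi hp).measurable.comp (measurable_Dq hw)
  have hΨb : ∀ X : XX N, |Psi p (Dq ε w X)| ≤ (2 * M / ε) ^ (p - 1) := fun X => abs_Psi_le hp (abs_Dq_le hε hM X)
  have hB : 0 ≤ (2 * M / ε) ^ (p - 1) := (abs_nonneg _).trans (hΨb 0)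
  have hC0 : 0 ≤ C := by
    have := (abs_nonneg _).trans (hC 0 0)
    exact nonneg_of_mul_nonneg_left this (wt_pos _)
  have hF : Integrable (fun X => Psi p (Dq ε w X) * ζ X.2.1 X.2.2) (LL ν κ) := by
    refine integrable_of_le_wt (C := (2 * M / ε) ^ (p - 1) * C) (hΨm.mul (measurable_base hζ)).aestronglyMeasurable (ae_of_all _ fun X => ?_)
    rw [abs_mul, mul_assoc]
    exact mul_le_mul (hΨb X) (hC _ _) (abs_nonneg _) hB
  have hF' : Integrable (fun X => Psi p (Dq ε w X) * ζ (X.2.1 + ε • X.1) X.2.2) (LL ν κ) := by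
    refine integrable_of_le_wt (C := (2 * M / ε) ^ (p - 1) * (C * 3)) (hΨm.mul (measurable_shift hζ)).aestronglyMeasurable ?_
    filter_upwards [ae_norm_le_one hν (κ := κ)] with X hX
    rw [abs_mul, mul_assoc]
    refine mul_le_mul (hΨb X) ((hC _ _).trans ?_) (abs_nonneg _) hB
    rw [mul_assoc]
    refine mul_le_mul_of_nonneg_left (wt_add_le _ ?_) hC0
    rw [norm_smul, Real.norm_of_nonneg hε.le]
    nlinarith [norm_nonneg X.1]
  have h1 : ∫ X, Psi p (Dq ε w X) * ζ X.2.1 X.2.2 ∂LL ν κ = - ∫ X, Psi p (Dq ε w X) * ζ (X.2.1 + ε • X.1) X.2.2 ∂LL ν κ := by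
    rw [← integral_TT hν (ε := ε), ← integral_neg]
    refine integral_congr_ae (ae_of_all _ fun X => ?_)
    simp only [Dq_TT, Psi_neg, neg_mul]
    simp only [TT_apply]
  have h2 : ∫ y : Spc N × (ℝ × ℝ), Lop p ν ε (fun x => w x y.2) y.1 * ζ y.1 y.2 ∂((volume : Measure (Spc N)).prod κ) =
      2 / ε * ∫ X, Psi p (Dq ε w X) * ζ X.2.1 X.2.2 ∂LL ν κ := by
    rw [integral_prod_symm _ hF, ← integral_const_mul]
    refine integral_congr_ae (ae_of_all _ fun y => ?_)
    simp only [Lop, integral_mul_const]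
    have : ∀ z, Psi p (w (y.1 + ε • z) y.2 - w y.1 y.2) = ε ^ (p - 1) * Psi p (Dq ε w (z, y)) := by
      intro z
      rw [← Psi_mul hε, Dq, mul_div_cancel₀ _ hε.ne']
    simp only [this, integral_const_mul]
    have e : ε ^ (-p) * ε ^ (p - 1) = 1 / ε := by
      rw [← Real.rpow_add hε, show -p + (p - 1) = -1 by ring, Real.rpow_neg_one, one_div]
    linear_combination (2 * (∫ z, Psi p (Dq ε w (z, y)) ∂ν) * ζ y.1 y.2) * e
  have h3 : ∫ X, Psi p (Dq ε w X) * Dq ε ζ X ∂LL ν κ =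
      1 / ε * (∫ X, Psi p (Dq ε w X) * ζ (X.2.1 + ε • X.1) X.2.2 ∂LL ν κ - ∫ X, Psi p (Dq ε w X) * ζ X.2.1 X.2.2 ∂LL ν κ) := by
    rw [← integral_sub hF' hF, ← integral_const_mul]
    refine integral_congr_ae (ae_of_all _ fun X => ?_)
    simp only [Dq]; ring
  rw [h2, h3, h1]; ring
end

section
variable {N : ℕ} {p : ℝ} {ν : Measure (Spc N)} {κ : Measure (ℝ × ℝ)} [IsFiniteMeasure κ]

lemma integral_flip_dir [IsFiniteMeasure ν] (hν : Kern p ν) (F : XX N → ℝ) :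
    ∫ X : XX N, F (-X.1, X.2) ∂LL ν κ = ∫ X, F X ∂LL ν κ := by
  have h : MeasurePreserving ((MeasurableEquiv.neg (Spc N)).prodCongr (MeasurableEquiv.refl (Spc N × (ℝ × ℝ)))) (LL ν κ) (LL ν κ) :=
    (hν.iso (LinearIsometryEquiv.neg ℝ)).prod (MeasurePreserving.id _)
  exact h.integral_comp' F

lemma integral_shift [IsFiniteMeasure ν] (hν : Kern p ν) (ε : ℝ) (Γ : XX N → ℝ) (e : Spc N → ℝ × ℝ → ℝ) :
    ∫ X, Γ X * e (X.2.1 + ε • X.1) X.2.2 ∂LL ν κ = ∫ X, Γ (X.1, (X.2.1 - ε • X.1, X.2.2)) * e X.2.1 X.2.2 ∂LL ν κ := by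
  rw [← integral_TT hν (ε := ε), ← integral_flip_dir hν]
  refine integral_congr_ae (ae_of_all _ fun X => ?_)
  simp [TT_apply, sub_eq_add_neg]

lemma exists_smooth_sq_approx [IsFiniteMeasure ν] {F : XX N → ℝ} (hF : AEStronglyMeasurable F (LL ν κ))
    (hF2 : Integrable (fun X => F X ^ 2) (LL ν κ)) {δ : ℝ} (hδ : 0 < δ) :
    ∃ Φ : XX N → ℝ, HasCompactSupport Φ ∧ Continuous Φ ∧ (∃ L, LipschitzWith L Φ) ∧
      Integrable (fun X => (F X - Φ X) ^ 2) (LL ν κ) ∧ ∫ X, (F X - Φ X) ^ 2 ∂LL ν κ ≤ δ ^ 2 := by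
  have hm : MemLp F 2 (LL ν κ) := (memLp_two_iff_integrable_sq hF).2 hF2
  obtain ⟨Φ, h1, h2, h3⟩ := hm.exist_eLpNorm_sub_le (by simp) (by norm_num) hδ
  have hΦ : MemLp (F - Φ) 2 (LL ν κ) := ⟨hF.sub h2.continuous.aestronglyMeasurable, h3.trans_lt ENNReal.ofReal_lt_top⟩
  refine ⟨Φ, h1, h2.continuous, ⟨_, (h2.lipschitzWith_of_hasCompactSupport h1 (by simp)).choose_spec⟩, hΦ.integrable_sq, ?_⟩
  rw [hΦ.eLpNorm_eq_integral_rpow_norm (by simp) (by simp)] at h3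
  rw [ENNReal.ofReal_le_ofReal_iff hδ.le] at h3
  simp only [ENNReal.toReal_ofNat, Real.rpow_ofNat, Real.norm_eq_abs, sq_abs, Pi.sub_apply] at h3
  have h0 : 0 ≤ ∫ X, (F X - Φ X) ^ 2 ∂LL ν κ := integral_nonneg fun X => sq_nonneg _
  calc _ = ((∫ X, (F X - Φ X) ^ 2 ∂LL ν κ) ^ ((2:ℝ)⁻¹)) ^ 2 := by
        rw [← Real.rpow_natCast, ← Real.rpow_mul h0]; norm_num
    _ ≤ δ ^ 2 := by gcongr

/-- discrete gradients of sequences tending to zero tend weakly to zero. -/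
lemma tendsto_integral_mul_Dq [IsFiniteMeasure ν] (hν : Kern p ν) {ε : ℕ → ℝ} (hε : ∀ n, 0 < ε n) (hε1 : ∀ n, ε n ≤ 1)
    {e : ℕ → Spc N → ℝ × ℝ → ℝ} (he : ∀ n, Measurable (Function.uncurry (e n))) {M : ℝ} (hM : ∀ n x π, |e n x π| ≤ M)
    (h0 : ∀ x π, Tendsto (fun n => e n x π) atTop (𝓝 0)) {H : XX N → ℝ} (hH : Measurable H) {C : ℝ} (hC : ∀ᵐ X ∂LL ν κ, |H X| ≤ C)
    {C1 : ℝ} (hC1 : ∀ n, ∫ X, wt X.2.1 * Dq (ε n) (e n) X ^ 2 ∂LL ν κ ≤ C1) :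
    Tendsto (fun n => ∫ X, wt X.2.1 * (H X * Dq (ε n) (e n) X) ∂LL ν κ) atTop (𝓝 0) := by
  have hC10 : 0 ≤ C1 := (integral_nonneg fun X => mul_nonneg (wt_pos _).le (sq_nonneg _)).trans (hC1 0)
  rw [Metric.tendsto_atTop]
  intro η hη
  set δ := η / (2 * (C1 + 1)) with hδ
  have hδ0 : 0 < δ := by positivity
  have hwtm : Measurable fun X : XX N => wt X.2.1 := continuous_wt.measurable.comp (by fun_prop)
  set θ : Spc N → ℝ := fun x => wt ((1 / 2 : ℝ) • x) with hθ
  have hθc : Continuous θ := continuous_wt.comp (by fun_prop)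
  have hθ2 : ∀ x, θ x ^ 2 = wt x := by
    intro x
    simp only [hθ, wt, ← Real.exp_nat_mul, norm_smul]
    norm_num; ring
  have hθm : Measurable fun X : XX N => θ X.2.1 := hθc.measurable.comp (by fun_prop)
  obtain ⟨Φ, hΦs, hΦc, ⟨L, hL⟩, hΦi, hΦb⟩ := exists_smooth_sq_approx (ν := ν) (κ := κ) (F := fun X => θ X.2.1 * H X)
    (hθm.mul hH).aestronglyMeasurable
    (integrable_of_le_wt (C := C ^ 2) ((hθm.mul hH).pow_const 2).aestronglyMeasurable (by
      filter_upwards [hC] with X hX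
      rw [abs_of_nonneg (sq_nonneg _), mul_pow, hθ2, mul_comm]
      refine mul_le_mul_of_nonneg_right ?_ (wt_pos _).le
      rw [← sq_abs]; gcongr)) hδ0
  obtain ⟨B, hB⟩ := hΦs.exists_bound_of_continuous hΦc
  obtain ⟨R, hR⟩ := hΦs.isCompact.isBounded.subset_closedBall (0 : XX N)
  have hB0 : 0 ≤ B := (norm_nonneg _).trans (hB 0)
  have hΦR : ∀ X : XX N, R < ‖X.2.1‖ → Φ X = 0 := by
    intro X hX
    by_contra h
    have := hR (subset_tsupport _ h)
    rw [mem_closedBall_zero_iff] at this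
    exact absurd (hX.trans_le ((norm_fst_le X.2).trans ((norm_snd_le X).trans this))) (lt_irrefl _)
  set Γ : XX N → ℝ := fun X => θ X.2.1 * Φ X with hΓ
  have hΓc : Continuous Γ := by
    have : Continuous fun X : XX N => θ X.2.1 := hθc.comp (by fun_prop)
    exact this.mul hΦc
  have hθ1 : ∀ x, θ x ≤ 1 := fun x => wt_le_one _
  have hθp : ∀ x, 0 < θ x := fun x => wt_pos _
  have hθlip : ∀ x y : Spc N, ‖y‖ ≤ 1 → |θ (x - y) - θ x| ≤ ‖y‖ := by
    intro x y hy
    have h1 : ‖(-(1/2 : ℝ)) • y‖ = 1 / 2 * ‖y‖ := by rw [norm_smul]; norm_num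
    have := abs_wt_sub_le ((1/2 : ℝ) • x) (y := (-(1/2 : ℝ)) • y) (by rw [h1]; linarith)
    rw [h1, show (1/2 : ℝ) • x + (-(1/2 : ℝ)) • y = (1/2 : ℝ) • (x - y) by rw [smul_sub, neg_smul, sub_eq_add_neg]] at this
    refine this.trans ?_
    nlinarith [hθ1 x, hθp x, norm_nonneg y, wt_le_one ((1/2 : ℝ) • x)]
  have hΓd : ∀ X : XX N, ∀ y : Spc N, ‖y‖ ≤ 1 → |Γ (X.1, (X.2.1 - y, X.2.2)) - Γ X| ≤ ‖y‖ * ((L + B) * Real.exp (R + 1) * wt X.2.1) := by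
    intro X y hy
    by_cases hx : ‖X.2.1‖ ≤ R + 1
    · have h1 : |Φ (X.1, (X.2.1 - y, X.2.2)) - Φ X| ≤ L * ‖y‖ := by
        have := hL.dist_le_mul (X.1, (X.2.1 - y, X.2.2)) X
        rw [Real.dist_eq] at this
        refine this.trans (mul_le_mul_of_nonneg_left ?_ L.2)
        rw [Prod.dist_eq, Prod.dist_eq]
        simp
      have h2 := hθlip X.2.1 y hy
      have h3 : Γ (X.1, (X.2.1 - y, X.2.2)) - Γ X = θ (X.2.1 - y) * (Φ (X.1, (X.2.1 - y, X.2.2)) - Φ X) + (θ (X.2.1 - y) - θ X.2.1) * Φ X := by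
        simp only [hΓ]; ring
      have h4 : 1 ≤ Real.exp (R + 1) * wt X.2.1 := by
        rw [wt, ← Real.exp_add]; exact Real.one_le_exp (by linarith)
      have hBX := hB X
      rw [Real.norm_eq_abs] at hBX
      calc _ ≤ θ (X.2.1 - y) * |Φ (X.1, (X.2.1 - y, X.2.2)) - Φ X| + |θ (X.2.1 - y) - θ X.2.1| * |Φ X| := by
            rw [h3]
            refine (abs_add_le _ _).trans (le_of_eq ?_)
            rw [abs_mul, abs_mul, abs_of_pos (hθp _)]
        _ ≤ 1 * (L * ‖y‖) + ‖y‖ * B := by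
            gcongr
            exact hθ1 _
        _ = ‖y‖ * (L + B) * 1 := by ring
        _ ≤ ‖y‖ * (L + B) * (Real.exp (R + 1) * wt X.2.1) := by
            have := L.2
            gcongr
        _ = _ := by ring
    · have h1 : Φ X = 0 := hΦR X (by linarith)
      have h2 : Φ (X.1, (X.2.1 - y, X.2.2)) = 0 := hΦR _ (by
        have := norm_sub_norm_le X.2.1 y
        simp only; linarith)
      simp only [hΓ, h1, h2]
      have := L.2
      have := (wt_pos X.2.1).le
      simp only [mul_zero, sub_zero, abs_zero]
      have : 0 ≤ (L:ℝ) + B := add_nonneg L.2 hB0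
      positivity
  have hsmall : ∀ n, ∀ᵐ X ∂LL ν κ, ‖ε n • X.1‖ ≤ ε n ∧ ‖ε n • X.1‖ ≤ 1 := by
    intro n
    filter_upwards [ae_norm_le_one hν (κ := κ)] with X hX
    have : ‖ε n • X.1‖ ≤ ε n := by
      rw [norm_smul, Real.norm_of_nonneg (hε n).le]; nlinarith [hε n]
    exact ⟨this, this.trans (hε1 n)⟩
  have hΓb : ∀ X : XX N, |Γ X| ≤ B * Real.exp (R + 1) * wt X.2.1 := by
    intro X
    by_cases hx : ‖X.2.1‖ ≤ R + 1
    · have h4 : 1 ≤ Real.exp (R + 1) * wt X.2.1 := by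
        rw [wt, ← Real.exp_add]; exact Real.one_le_exp (by linarith)
      have hBX := hB X
      rw [Real.norm_eq_abs] at hBX
      calc |Γ X| = θ X.2.1 * |Φ X| := by simp only [hΓ]; rw [abs_mul, abs_of_pos (hθp _)]
        _ ≤ 1 * B := by gcongr; exact hθ1 _
        _ = B * 1 := by ring
        _ ≤ B * (Real.exp (R + 1) * wt X.2.1) := by gcongr
        _ = _ := by ring
    · simp only [hΓ, hΦR X (by linarith), mul_zero, abs_zero]
      have := (wt_pos X.2.1).le
      positivity
  have hM0 : 0 ≤ M := (abs_nonneg _).trans (hM 0 0 0)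
  have hlim : Tendsto (fun n => ∫ X : XX N, ((L + B) * Real.exp (R + 1) * wt X.2.1) * |e n X.2.1 X.2.2| ∂LL ν κ) atTop (𝓝 0) := by
    have := tendsto_integral_of_dominated_convergence (μ := LL ν κ)
      (F := fun n (X : XX N) => ((L + B) * Real.exp (R + 1) * wt X.2.1) * |e n X.2.1 X.2.2|) (f := fun _ => 0)
      (fun X => ((L + B) * Real.exp (R + 1) * M) * wt X.2.1)
      (fun n => ((hwtm.const_mul _).mul (measurable_base (he n)).abs).aestronglyMeasurable)
      (integrable_wt_X.const_mul _)
      (fun n => ae_of_all _ fun X => by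
        have := (wt_pos X.2.1).le
        have : 0 ≤ (L:ℝ) + B := add_nonneg L.2 hB0
        rw [Real.norm_of_nonneg (by positivity)]
        calc _ ≤ ((L + B) * Real.exp (R + 1) * wt X.2.1) * M := by gcongr; exact hM n _ _
          _ = _ := by ring)
      (ae_of_all _ fun X => by simpa using ((h0 X.2.1 X.2.2).abs.const_mul ((L + B) * Real.exp (R + 1) * wt X.2.1)))
    simpa using this
  obtain ⟨n0, hn0⟩ := Metric.tendsto_atTop.1 hlim (η / 2) (by positivity)
  refine ⟨n0, fun n hn => ?_⟩
  have k1 := hn0 n hn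
  rw [Real.dist_eq, sub_zero] at k1 ⊢
  have k1' := (le_abs_self _).trans_lt k1
  set D := Dq (ε n) (e n) with hD
  have hDm : Measurable D := measurable_Dq (he n)
  have hDb : ∀ X, |D X| ≤ 2 * M / ε n := abs_Dq_le (hε n) (hM n)
  have hBn : 0 ≤ 2 * M / ε n := by have := hε n; positivity
  have hΓD : Integrable (fun X => Γ X * D X) (LL ν κ) := by
    refine integrable_of_le_wt (C := B * Real.exp (R + 1) * (2 * M / ε n)) (hΓc.measurable.mul hDm).aestronglyMeasurable (ae_of_all _ fun X => ?_)
    rw [abs_mul]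
    calc _ ≤ (B * Real.exp (R + 1) * wt X.2.1) * (2 * M / ε n) := mul_le_mul (hΓb X) (hDb X) (abs_nonneg _) ((abs_nonneg _).trans (hΓb X))
      _ = _ := by ring
  have hHD : Integrable (fun X => wt X.2.1 * (H X * D X)) (LL ν κ) := by
    refine integrable_of_le_wt (C := C * (2 * M / ε n)) (hwtm.mul (hH.mul hDm)).aestronglyMeasurable ?_
    filter_upwards [hC] with X hX
    rw [abs_mul, abs_of_pos (wt_pos _), mul_comm, abs_mul]
    exact mul_le_mul_of_nonneg_right (mul_le_mul hX (hDb X) (abs_nonneg _) ((abs_nonneg _).trans hX)) (wt_pos _).le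
  have hD2 : Integrable (fun X => wt X.2.1 * D X ^ 2) (LL ν κ) := by
    refine integrable_of_le_wt (C := (2 * M / ε n) ^ 2) (hwtm.mul (hDm.pow_const 2)).aestronglyMeasurable (ae_of_all _ fun X => ?_)
    rw [abs_mul, abs_of_pos (wt_pos _), mul_comm, abs_of_nonneg (sq_nonneg _), ← sq_abs]
    have := hDb X
    have := (wt_pos X.2.1).le
    gcongr
  have part1 : |∫ X, wt X.2.1 * (H X * D X) ∂LL ν κ - ∫ X, Γ X * D X ∂LL ν κ| ≤ η / 2 - δ / 2 * 0 := by
    rw [← integral_sub hHD hΓD]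
    calc _ ≤ ∫ X, (δ / 2 * (wt X.2.1 * D X ^ 2) + 1 / (2 * δ) * (θ X.2.1 * H X - Φ X) ^ 2) ∂LL ν κ := by
          rw [← Real.norm_eq_abs]
          refine norm_integral_le_of_norm_le ((hD2.const_mul _).add (hΦi.const_mul _)) (ae_of_all _ fun X => ?_)
          rw [Real.norm_eq_abs, ← hθ2]
          have : θ X.2.1 ^ 2 * (H X * D X) - Γ X * D X = (θ X.2.1 * D X) * (θ X.2.1 * H X - Φ X) := by
            simp only [hΓ]; ring
          rw [this]
          set s := θ X.2.1 * D X
          set r := θ X.2.1 * H X - Φ X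
          have e1 : θ X.2.1 ^ 2 * D X ^ 2 = s ^ 2 := by simp only [s]; ring
          rw [e1]
          have e2 : δ / 2 * s ^ 2 + 1 / (2 * δ) * r ^ 2 - s * r = (δ * s - r) ^ 2 / (2 * δ) := by field_simp; ring
          have e3 : δ / 2 * s ^ 2 + 1 / (2 * δ) * r ^ 2 + s * r = (δ * s + r) ^ 2 / (2 * δ) := by field_simp; ring
          have e4 : 0 ≤ (δ * s - r) ^ 2 / (2 * δ) := by positivity
          have e5 : 0 ≤ (δ * s + r) ^ 2 / (2 * δ) := by positivity
          rw [abs_le]; constructor <;> linarith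
      _ = δ / 2 * ∫ X, wt X.2.1 * D X ^ 2 ∂LL ν κ + 1 / (2 * δ) * ∫ X, (θ X.2.1 * H X - Φ X) ^ 2 ∂LL ν κ := by
          rw [integral_add (hD2.const_mul _) (hΦi.const_mul _), integral_const_mul, integral_const_mul]
      _ ≤ δ / 2 * C1 + 1 / (2 * δ) * δ ^ 2 := by gcongr; exact hC1 n
      _ = δ * (2 * (C1 + 1)) / 4 := by field_simp; ring
      _ ≤ _ := by
          rw [hδ, div_mul_cancel₀ _ (by positivity)]; linarith
  have hΓe1 : Integrable (fun X : XX N => Γ X * e n (X.2.1 + ε n • X.1) X.2.2) (LL ν κ) := by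
    refine integrable_of_le_wt (C := B * Real.exp (R + 1) * M) (hΓc.measurable.mul (measurable_shift (he n))).aestronglyMeasurable (ae_of_all _ fun X => ?_)
    rw [abs_mul]
    calc _ ≤ (B * Real.exp (R + 1) * wt X.2.1) * M := mul_le_mul (hΓb X) (hM _ _ _) (abs_nonneg _) ((abs_nonneg _).trans (hΓb X))
      _ = _ := by ring
  have hΓe2 : Integrable (fun X : XX N => Γ X * e n X.2.1 X.2.2) (LL ν κ) := by
    refine integrable_of_le_wt (C := B * Real.exp (R + 1) * M) (hΓc.measurable.mul (measurable_base (he n))).aestronglyMeasurable (ae_of_all _ fun X => ?_)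
    rw [abs_mul]
    calc _ ≤ (B * Real.exp (R + 1) * wt X.2.1) * M := mul_le_mul (hΓb X) (hM _ _ _) (abs_nonneg _) ((abs_nonneg _).trans (hΓb X))
      _ = _ := by ring
  have hΓe3 : Integrable (fun X : XX N => Γ (X.1, (X.2.1 - ε n • X.1, X.2.2)) * e n X.2.1 X.2.2) (LL ν κ) := by
    refine integrable_of_le_wt (C := (((L + B) * Real.exp (R + 1)) + B * Real.exp (R + 1)) * M)
      ((hΓc.measurable.comp (by fun_prop)).mul (measurable_base (he n))).aestronglyMeasurable ?_
    filter_upwards [hsmall n] with X hX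
    rw [abs_mul]
    have a1 := hΓd X _ hX.2
    have a2 := hΓb X
    have a3 : ‖ε n • X.1‖ * ((L + B) * Real.exp (R + 1) * wt X.2.1) ≤ 1 * ((L + B) * Real.exp (R + 1) * wt X.2.1) := by
      have := (wt_pos X.2.1).le
      have : 0 ≤ (L:ℝ) + B := add_nonneg L.2 hB0
      gcongr
      exact hX.2
    have a4 := abs_sub_abs_le_abs_sub (Γ (X.1, (X.2.1 - ε n • X.1, X.2.2))) (Γ X)
    have a5 : |Γ (X.1, (X.2.1 - ε n • X.1, X.2.2))| ≤ (((L + B) * Real.exp (R + 1)) + B * Real.exp (R + 1)) * wt X.2.1 := by linarith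
    calc _ ≤ ((((L + B) * Real.exp (R + 1)) + B * Real.exp (R + 1)) * wt X.2.1) * M := mul_le_mul a5 (hM _ _ _) (abs_nonneg _) ((abs_nonneg _).trans a5)
      _ = _ := by ring
  have part2 : |∫ X, Γ X * D X ∂LL ν κ| < η / 2 := by
    have : ∫ X, Γ X * D X ∂LL ν κ = ∫ X, (1 / ε n) * (Γ (X.1, (X.2.1 - ε n • X.1, X.2.2)) - Γ X) * e n X.2.1 X.2.2 ∂LL ν κ := by
      have i1 : ∫ X, Γ X * D X ∂LL ν κ = ∫ X, (1 / ε n) * (Γ X * e n (X.2.1 + ε n • X.1) X.2.2 - Γ X * e n X.2.1 X.2.2) ∂LL ν κ :=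
        integral_congr_ae (ae_of_all _ fun X => by simp only [hD, Dq]; ring)
      rw [i1, integral_const_mul, integral_sub hΓe1 hΓe2, integral_shift hν, ← integral_sub hΓe3 hΓe2, ← integral_const_mul]
      exact integral_congr_ae (ae_of_all _ fun X => by simp only; ring)
    rw [this]
    refine lt_of_le_of_lt ?_ k1'
    rw [← Real.norm_eq_abs]
    refine norm_integral_le_of_norm_le ?_ ?_
    · refine integrable_of_le_wt (C := ((L + B) * Real.exp (R + 1)) * M) ((hwtm.const_mul _).mul (measurable_base (he n)).abs).aestronglyMeasurable (ae_of_all _ fun X => ?_)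
      have := (wt_pos X.2.1).le
      have : 0 ≤ (L:ℝ) + B := add_nonneg L.2 hB0
      rw [abs_of_nonneg (by positivity)]
      calc _ ≤ ((L + B) * Real.exp (R + 1) * wt X.2.1) * M := by gcongr; exact hM n _ _
          _ = _ := by ring
    · filter_upwards [hsmall n] with X hX
      rw [norm_mul, norm_mul, Real.norm_of_nonneg (one_div_nonneg.2 (hε n).le), Real.norm_eq_abs, Real.norm_eq_abs]
      refine mul_le_mul_of_nonneg_right ?_ (abs_nonneg _)
      rw [one_div, inv_mul_le_iff₀ (hε n)]
      refine (hΓd X _ hX.2).trans (mul_le_mul_of_nonneg_right hX.1 ?_)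
      have := (wt_pos X.2.1).le
      have : 0 ≤ (L:ℝ) + B := add_nonneg L.2 hB0
      positivity
  have := abs_sub_abs_le_abs_sub (∫ X, wt X.2.1 * (H X * D X) ∂LL ν κ) (∫ X, Γ X * D X ∂LL ν κ)
  linarith

end

/-- directional derivative of `w (·, π)` at `x` in direction `z`. -/
def Dlim {N : ℕ} (w : Spc N → ℝ × ℝ → ℝ) (X : XX N) : ℝ := fderiv ℝ (fun x => w x X.2.2) X.2.1 X.1

section
variable {N : ℕ} {p : ℝ} {ν : Measure (Spc N)} {κ : Measure (ℝ × ℝ)} [IsFiniteMeasure κ] {w : Spc N → ℝ × ℝ → ℝ} {K : ℝ}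

lemma lipschitzWith_of_abs_sub_le {g : Spc N → ℝ} (h : ∀ x y, |g x - g y| ≤ K * ‖x - y‖) : LipschitzWith K.toNNReal g :=
  LipschitzWith.of_dist_le' fun x y => by rw [Real.dist_eq, dist_eq_norm]; exact h x y

lemma measurable_Dlim (hw : Continuous (Function.uncurry w)) : Measurable (Dlim w) := by
  have h : Continuous (Function.uncurry fun (π : ℝ × ℝ) (x : Spc N) => w x π) := hw.comp continuous_swap
  have h1 := measurable_fderiv_with_param ℝ h
  have h2 : Measurable fun X : XX N => fderiv ℝ (fun x => w x X.2.2) X.2.1 :=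
    h1.comp (f := fun X : XX N => (X.2.2, X.2.1)) (by fun_prop)
  have h3 : Continuous fun q : (Spc N →L[ℝ] ℝ) × Spc N => q.1 q.2 := isBoundedBilinearMap_apply.continuous
  exact h3.measurable.comp (h2.prodMk measurable_fst)

lemma abs_Dlim_le (hK : 0 ≤ K) (hL : ∀ x y π, |w x π - w y π| ≤ K * ‖x - y‖) (X : XX N) : |Dlim w X| ≤ K * ‖X.1‖ := by
  have h := norm_fderiv_le_of_lipschitz ℝ (x₀ := X.2.1) (lipschitzWith_of_abs_sub_le fun x y => hL x y X.2.2)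
  rw [Real.coe_toNNReal _ hK] at h
  rw [← Real.norm_eq_abs]
  exact ((fderiv ℝ (fun x => w x X.2.2) X.2.1).le_opNorm X.1).trans (by gcongr)

lemma abs_Dq_le_lip {ε : ℝ} (hε : 0 < ε) (hL : ∀ x y π, |w x π - w y π| ≤ K * ‖x - y‖) (X : XX N) : |Dq ε w X| ≤ K * ‖X.1‖ := by
  unfold Dq
  rw [abs_div, abs_of_pos hε, div_le_iff₀ hε]
  refine (hL _ _ _).trans (le_of_eq ?_)
  rw [add_sub_cancel_left, norm_smul, Real.norm_of_nonneg hε.le]; ring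

lemma ae_tendsto_Dq [IsFiniteMeasure ν] (hw : Continuous (Function.uncurry w)) (hL : ∀ x y π, |w x π - w y π| ≤ K * ‖x - y‖)
    {ε : ℕ → ℝ} (hε : ∀ n, 0 < ε n) (h0 : Tendsto ε atTop (𝓝 0)) :
    ∀ᵐ X ∂LL ν κ, Tendsto (fun n => Dq (ε n) w X) atTop (𝓝 (Dlim w X)) := by
  have h : Continuous (Function.uncurry fun (π : ℝ × ℝ) (x : Spc N) => w x π) := hw.comp continuous_swap
  have hd : ∀ᵐ y : Spc N × (ℝ × ℝ) ∂(volume : Measure (Spc N)).prod κ, DifferentiableAt ℝ (fun x => w x y.2) y.1 := by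
    have hs : MeasurableSet {y : Spc N × (ℝ × ℝ) | DifferentiableAt ℝ (fun x => w x y.2) y.1} :=
      (measurableSet_of_differentiableAt_with_param ℝ h).preimage measurable_swap
    have hsw : ∀ᵐ q : (ℝ × ℝ) × Spc N ∂κ.prod volume, DifferentiableAt ℝ (fun x => w x q.1) q.2 := by
      refine (Measure.ae_prod_mem_iff_ae_ae_mem (measurableSet_of_differentiableAt_with_param ℝ h)).2 (ae_of_all _ fun π => ?_)
      exact (lipschitzWith_of_abs_sub_le fun x y => hL x y π).ae_differentiableAt
    exact (Measure.measurePreserving_swap (μ := (volume : Measure (Spc N))) (ν := κ)).quasiMeasurePreserving.ae hsw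
  have hd' : ∀ᵐ X ∂LL ν κ, DifferentiableAt ℝ (fun x => w x X.2.2) X.2.1 := Measure.quasiMeasurePreserving_snd.ae hd
  filter_upwards [hd'] with X hX
  have h1 := (hX.hasFDerivAt.hasLineDerivAt X.1).tendsto_slope_zero
  have h2 : Tendsto ε atTop (𝓝[≠] 0) := tendsto_nhdsWithin_iff.2 ⟨h0, Eventually.of_forall fun n => (hε n).ne'⟩
  refine (h1.comp h2).congr fun n => ?_
  simp [Dq, div_eq_inv_mul]

lemma tendsto_integral_zero_of_le_wt [IsFiniteMeasure ν] {F : ℕ → XX N → ℝ} (hF : ∀ n, AEStronglyMeasurable (F n) (LL ν κ)) {C : ℝ}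
    (hC : ∀ n, ∀ᵐ X ∂LL ν κ, |F n X| ≤ C * wt X.2.1) (h : ∀ᵐ X ∂LL ν κ, Tendsto (fun n => F n X) atTop (𝓝 0)) :
    Tendsto (fun n => ∫ X, F n X ∂LL ν κ) atTop (𝓝 0) := by
  have := tendsto_integral_of_dominated_convergence (μ := LL ν κ) (F := F) (f := fun _ => 0) (fun X => C * wt X.2.1) hF
    (integrable_wt_X.const_mul C) hC h
  simpa using this

lemma tendsto_integral_zero_of_le_wt_Y {F : ℕ → Spc N × (ℝ × ℝ) → ℝ}
    (hF : ∀ n, AEStronglyMeasurable (F n) ((volume : Measure (Spc N)).prod κ)) {C : ℝ}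
    (hC : ∀ n, ∀ᵐ y ∂(volume : Measure (Spc N)).prod κ, |F n y| ≤ C * wt y.1)
    (h : ∀ᵐ y ∂(volume : Measure (Spc N)).prod κ, Tendsto (fun n => F n y) atTop (𝓝 0)) :
    Tendsto (fun n => ∫ y, F n y ∂(volume : Measure (Spc N)).prod κ) atTop (𝓝 0) := by
  have := tendsto_integral_of_dominated_convergence (F := F) (f := fun _ => 0) (fun y => C * wt y.1) hF
    (integrable_wt_Y.const_mul C) hC h
  simpa using this

end

lemma tendsto_zero_of_forall_le {a : ℕ → ℝ} (h0 : ∀ n, 0 ≤ a n) {C η0 : ℝ} (hη0 : 0 < η0)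
    (h : ∀ η, 0 < η → η ≤ η0 → ∃ s : ℕ → ℝ, Tendsto s atTop (𝓝 0) ∧ ∀ n, a n ≤ C * η + s n) : Tendsto a atTop (𝓝 0) := by
  have hC : 0 < |C| + 1 := by positivity
  rw [Metric.tendsto_atTop]
  intro e he
  obtain ⟨s, hs, hle⟩ := h (min η0 (e / (2 * (|C| + 1)))) (by positivity) (min_le_left _ _)
  obtain ⟨n0, hn0⟩ := Metric.tendsto_atTop.1 hs (e / 2) (by positivity)
  refine ⟨n0, fun n hn => ?_⟩
  have h1 := hn0 n hn
  rw [Real.dist_eq, sub_zero] at h1 ⊢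
  rw [abs_of_nonneg (h0 n)]
  have h2 := le_abs_self (s n)
  have h3 : C * min η0 (e / (2 * (|C| + 1))) ≤ (|C| + 1) * (e / (2 * (|C| + 1))) := by
    refine mul_le_mul ?_ (min_le_right _ _) (by positivity) hC.le
    have := le_abs_self C; linarith
  have h4 : (|C| + 1) * (e / (2 * (|C| + 1))) = e / 2 := by field_simp
  have := hle n
  linarith

/-- a sequence of bounded functions converging continuously to a Lipschitz function. -/
structure GConv {N : ℕ} (ε : ℕ → ℝ) (ψ : ℕ → Spc N → ℝ × ℝ → ℝ) (v : Spc N → ℝ × ℝ → ℝ) (M K : ℝ) : Prop where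
  pos : ∀ n, 0 < ε n
  le_one : ∀ n, ε n ≤ 1
  lim : Tendsto ε atTop (𝓝 0)
  meas : ∀ n, Measurable (Function.uncurry (ψ n))
  bd : ∀ n x π, |ψ n x π| ≤ M
  vcont : Continuous (Function.uncurry v)
  vbd : ∀ x π, |v x π| ≤ M
  K0 : 0 ≤ K
  vlip : ∀ x y π, |v x π - v y π| ≤ K * ‖x - y‖
  conv : ∀ (xn : ℕ → Spc N) (x : Spc N) (π : ℝ × ℝ), Tendsto xn atTop (𝓝 x) → Tendsto (fun n => ψ n (xn n) π) atTop (𝓝 (v x π))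

section
variable {N : ℕ} {p : ℝ} {ν : Measure (Spc N)} {κ : Measure (ℝ × ℝ)} [IsFiniteMeasure κ] [IsFiniteMeasure ν]
  {ε : ℕ → ℝ} {ψ : ℕ → Spc N → ℝ × ℝ → ℝ} {v : Spc N → ℝ × ℝ → ℝ} {M K : ℝ}

namespace GConv

lemma M0 (h : GConv ε ψ v M K) : 0 ≤ M := (abs_nonneg _).trans (h.bd 0 0 0)

lemma tendsto_shift (h : GConv ε ψ v M K) (X : XX N) : Tendsto (fun n => X.2.1 + ε n • X.1) atTop (𝓝 X.2.1) := by
  simpa using (h.lim.smul_const X.1).const_add X.2.1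

lemma measv (h : GConv ε ψ v M K) : Measurable (Function.uncurry v) := h.vcont.measurable

lemma meas_sub (h : GConv ε ψ v M K) (n : ℕ) : Measurable (Function.uncurry fun x π => ψ n x π - v x π) :=
  (h.meas n).sub h.measv

lemma bd_sub (h : GConv ε ψ v M K) (n : ℕ) (x : Spc N) (π : ℝ × ℝ) : |ψ n x π - v x π| ≤ 2 * M := by
  have h1 := abs_le.1 (h.bd n x π)
  have h2 := abs_le.1 (h.vbd x π)
  rw [abs_le]; constructor <;> linarith

lemma conv_sub (h : GConv ε ψ v M K) (x : Spc N) (π : ℝ × ℝ) : Tendsto (fun n => ψ n x π - v x π) atTop (𝓝 0) := by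
  simpa using (h.conv (fun _ => x) x π tendsto_const_nhds).sub_const (v x π)

lemma conv_sub_shift (h : GConv ε ψ v M K) (X : XX N) :
    Tendsto (fun n => ψ n (X.2.1 + ε n • X.1) X.2.2 - v (X.2.1 + ε n • X.1) X.2.2) atTop (𝓝 0) := by
  have h1 := h.conv _ _ X.2.2 (h.tendsto_shift X)
  have h2 : Tendsto (fun n => v (X.2.1 + ε n • X.1) X.2.2) atTop (𝓝 (v X.2.1 X.2.2)) :=
    ((h.vcont.comp (by fun_prop : Continuous fun x : Spc N => (x, X.2.2))).tendsto X.2.1).comp (h.tendsto_shift X)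
  simpa using h1.sub h2

end GConv

lemma Dq_sub (ε : ℝ) (w1 w2 : Spc N → ℝ × ℝ → ℝ) (X : XX N) : Dq ε (fun x π => w1 x π - w2 x π) X = Dq ε w1 X - Dq ε w2 X := by
  simp only [Dq]; ring

lemma add_rpow_le_two {p a b : ℝ} (hp : 2 ≤ p) (ha : 0 ≤ a) (hb : 0 ≤ b) : (a + b) ^ p ≤ 2 ^ p * (a ^ p + b ^ p) := by
  have h1 : a + b ≤ 2 * max a b := by linarith [le_max_left a b, le_max_right a b]
  have hm : 0 ≤ max a b := ha.trans (le_max_left _ _)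
  calc (a + b) ^ p ≤ (2 * max a b) ^ p := Real.rpow_le_rpow (by positivity) h1 (by linarith)
    _ = 2 ^ p * (max a b) ^ p := Real.mul_rpow zero_le_two hm
    _ ≤ _ := by
      gcongr
      have := Real.rpow_nonneg ha p
      have := Real.rpow_nonneg hb p
      rcases max_cases a b with h | h <;> rw [h.1] <;> linarith

/-- pointwise energy inequality. -/
lemma energy_pointwise (hp : 2 ≤ p) {η A B e dw W : ℝ} (hη : 0 < η) (hW : 0 ≤ W) (hdw : |dw| ≤ 2 * W) (hB : |B| ≤ K) :
    2 ^ (1 - p) * (W * |A - B| ^ p) ≤ Psi p A * (W * (A - B) + e * dw) + 2 * η * 2 ^ p * (W * |A - B| ^ p)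
      + 2 * η * 2 ^ p * K ^ p * W + 2 * η ^ (1 - p) * (W * |e| ^ p) - W * (Psi p B * (A - B)) := by
  have h1 := mul_le_mul_of_nonneg_left (Psi_strong_mono hp A B) hW
  have h2 : -(Psi p A * (e * dw)) ≤ 2 * W * (|A| ^ (p - 1) * |e|) := by
    refine (neg_le_abs _).trans ?_
    rw [abs_mul, abs_mul, abs_Psi hp]
    calc _ ≤ |A| ^ (p - 1) * (|e| * (2 * W)) := by gcongr
      _ = _ := by ring
  have h3 := mul_le_mul_of_nonneg_left (rpow_mul_le_young hp hη (abs_nonneg A) (abs_nonneg e)) (by positivity : 0 ≤ 2 * W)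
  have h4 : |A| ^ p ≤ 2 ^ p * (|A - B| ^ p + K ^ p) := by
    have h5 : |A| ≤ |A - B| + K := by
      have := abs_add_le (A - B) B
      rw [sub_add_cancel] at this; linarith
    exact (Real.rpow_le_rpow (abs_nonneg _) h5 (by linarith)).trans (add_rpow_le_two hp (abs_nonneg _) ((abs_nonneg _).trans hB))
  have h6 := mul_le_mul_of_nonneg_left h4 (by positivity : 0 ≤ 2 * W * η)
  nlinarith

lemma GConv.integral_le (hp : 2 ≤ p) (hν : Kern p ν) (h : GConv ε ψ v M K) {η r : ℝ} (hη : 0 < η) (n : ℕ)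
    (hr : - ∫ y, Lop p ν (ε n) (fun x => ψ n x y.2) y.1 * (wt y.1 * (ψ n y.1 y.2 - v y.1 y.2)) ∂((volume : Measure (Spc N)).prod κ) ≤ r) :
    2 ^ (1 - p) * ∫ X, wt X.2.1 * |Dq (ε n) (ψ n) X - Dq (ε n) v X| ^ p ∂LL ν κ ≤
      r + 2 * η * 2 ^ p * (∫ X, wt X.2.1 * |Dq (ε n) (ψ n) X - Dq (ε n) v X| ^ p ∂LL ν κ)
        + 2 * η * 2 ^ p * K ^ p * (∫ X, wt X.2.1 ∂LL ν κ)
        + 2 * η ^ (1 - p) * (∫ X, wt X.2.1 * |ψ n (X.2.1 + ε n • X.1) X.2.2 - v (X.2.1 + ε n • X.1) X.2.2| ^ p ∂LL ν κ)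
        - ∫ X, wt X.2.1 * (Psi p (Dq (ε n) v X) * (Dq (ε n) (ψ n) X - Dq (ε n) v X)) ∂LL ν κ := by
  have hεp := h.pos n
  have hM0 := h.M0
  have hwtm : Measurable fun X : XX N => wt X.2.1 := continuous_wt.measurable.comp (by fun_prop)
  set ζ : Spc N → ℝ × ℝ → ℝ := fun x π => wt x * (ψ n x π - v x π) with hζ
  have hζm : Measurable (Function.uncurry ζ) := (continuous_wt.measurable.comp measurable_fst).mul (h.meas_sub n)
  have hζb : ∀ x π, |ζ x π| ≤ 2 * M * wt x := fun x π => by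
    rw [hζ]; simp only
    rw [abs_mul, abs_of_pos (wt_pos _), mul_comm]
    exact mul_le_mul_of_nonneg_right (h.bd_sub n x π) (wt_pos x).le
  rw [integral_Lop_mul hp hν hεp (h.le_one n) (h.meas n) hζm (h.bd n) hζb, neg_neg] at hr
  have hA := measurable_Dq (ε := ε n) (h.meas n)
  have hBm := measurable_Dq (ε := ε n) h.measv
  have hAb : ∀ X, |Dq (ε n) (ψ n) X| ≤ 2 * M / ε n := abs_Dq_le hεp (h.bd n)
  have hBb : ∀ X, |Dq (ε n) v X| ≤ 2 * M / ε n := abs_Dq_le hεp h.vbd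
  have hABb : ∀ X, |Dq (ε n) (ψ n) X - Dq (ε n) v X| ≤ 2 * (2 * M / ε n) := fun X => by
    have := abs_sub (Dq (ε n) (ψ n) X) (Dq (ε n) v X); linarith [hAb X, hBb X]
  have hΨc := (continuous_Psi hp).measurable
  have hpc : Continuous fun s : ℝ => |s| ^ p := continuous_abs.rpow_const fun x => Or.inr (by linarith)
  have i1 : Integrable (fun X => wt X.2.1 * |Dq (ε n) (ψ n) X - Dq (ε n) v X| ^ p) (LL ν κ) := by
    refine integrable_of_le_wt (C := (2 * (2 * M / ε n)) ^ p) (hwtm.mul (hpc.measurable.comp (hA.sub hBm))).aestronglyMeasurable (ae_of_all _ fun X => ?_)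
    rw [abs_mul, abs_of_pos (wt_pos _), mul_comm, abs_of_nonneg (by positivity)]
    exact mul_le_mul_of_nonneg_right (Real.rpow_le_rpow (abs_nonneg _) (hABb X) (by linarith)) (wt_pos _).le
  have i2 : Integrable (fun X => wt X.2.1 * |ψ n (X.2.1 + ε n • X.1) X.2.2 - v (X.2.1 + ε n • X.1) X.2.2| ^ p) (LL ν κ) := by
    refine integrable_of_le_wt (C := (2 * M) ^ p) (hwtm.mul (hpc.measurable.comp (measurable_shift (h.meas_sub n)))).aestronglyMeasurable (ae_of_all _ fun X => ?_)
    rw [abs_mul, abs_of_pos (wt_pos _), mul_comm, abs_of_nonneg (by positivity)]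
    exact mul_le_mul_of_nonneg_right (Real.rpow_le_rpow (abs_nonneg _) (h.bd_sub n _ _) (by linarith)) (wt_pos _).le
  have i3 : Integrable (fun X => wt X.2.1 * (Psi p (Dq (ε n) v X) * (Dq (ε n) (ψ n) X - Dq (ε n) v X))) (LL ν κ) := by
    refine integrable_of_le_wt (C := (2 * M / ε n) ^ (p - 1) * (2 * (2 * M / ε n))) (hwtm.mul ((hΨc.comp hBm).mul (hA.sub hBm))).aestronglyMeasurable (ae_of_all _ fun X => ?_)
    rw [abs_mul, abs_of_pos (wt_pos _), mul_comm, abs_mul]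
    exact mul_le_mul_of_nonneg_right (mul_le_mul (abs_Psi_le hp (hBb X)) (hABb X) (abs_nonneg _) (by positivity)) (wt_pos _).le
  have i4 : Integrable (fun X => Psi p (Dq (ε n) (ψ n) X) * Dq (ε n) ζ X) (LL ν κ) := by
    refine integrable_of_le_wt (C := (2 * M / ε n) ^ (p - 1) * (4 * (2 * M) / ε n)) ((hΨc.comp hA).mul (measurable_Dq hζm)).aestronglyMeasurable ?_
    filter_upwards [ae_norm_le_one hν (κ := κ)] with X hX
    rw [abs_mul, mul_assoc]
    refine mul_le_mul (abs_Psi_le hp (hAb X)) ?_ (abs_nonneg _) (by positivity)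
    have hz : ‖ε n • X.1‖ ≤ 1 := by
      rw [norm_smul, Real.norm_of_nonneg hεp.le]; nlinarith [h.le_one n, norm_nonneg X.1]
    unfold Dq
    rw [abs_div, abs_of_pos hεp, div_mul_eq_mul_div]
    gcongr
    have e1 := hζb (X.2.1 + ε n • X.1) X.2.2
    have e2 := hζb X.2.1 X.2.2
    have e3 := mul_le_mul_of_nonneg_left (wt_add_le X.2.1 hz) (by positivity : 0 ≤ 2 * M)
    have := abs_sub (ζ (X.2.1 + ε n • X.1) X.2.2) (ζ X.2.1 X.2.2)
    linarith
  have key : ∀ᵐ X ∂LL ν κ, 2 ^ (1 - p) * (wt X.2.1 * |Dq (ε n) (ψ n) X - Dq (ε n) v X| ^ p) ≤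
      Psi p (Dq (ε n) (ψ n) X) * Dq (ε n) ζ X + 2 * η * 2 ^ p * (wt X.2.1 * |Dq (ε n) (ψ n) X - Dq (ε n) v X| ^ p)
      + 2 * η * 2 ^ p * K ^ p * wt X.2.1
      + 2 * η ^ (1 - p) * (wt X.2.1 * |ψ n (X.2.1 + ε n • X.1) X.2.2 - v (X.2.1 + ε n • X.1) X.2.2| ^ p)
      - wt X.2.1 * (Psi p (Dq (ε n) v X) * (Dq (ε n) (ψ n) X - Dq (ε n) v X)) := by
    filter_upwards [ae_norm_le_one hν (κ := κ)] with X hX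
    have hz' : ‖ε n • X.1‖ ≤ ε n := by
      rw [norm_smul, Real.norm_of_nonneg hεp.le]; nlinarith
    have hz : ‖ε n • X.1‖ ≤ 1 := hz'.trans (h.le_one n)
    have hd : |(wt (X.2.1 + ε n • X.1) - wt X.2.1) / ε n| ≤ 2 * wt X.2.1 := by
      rw [abs_div, abs_of_pos hεp, div_le_iff₀ hεp]
      refine (abs_wt_sub_le _ hz).trans ?_
      have := wt_pos X.2.1
      nlinarith
    have e := energy_pointwise (K := K) hp (A := Dq (ε n) (ψ n) X) (B := Dq (ε n) v X)
      (e := ψ n (X.2.1 + ε n • X.1) X.2.2 - v (X.2.1 + ε n • X.1) X.2.2) hη (wt_pos X.2.1).le hd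
      ((abs_Dq_le_lip hεp h.vlip X).trans (by nlinarith [h.K0]))
    have e' : wt X.2.1 * (Dq (ε n) (ψ n) X - Dq (ε n) v X) + (ψ n (X.2.1 + ε n • X.1) X.2.2 - v (X.2.1 + ε n • X.1) X.2.2) *
        ((wt (X.2.1 + ε n • X.1) - wt X.2.1) / ε n) = Dq (ε n) ζ X := by
      simp only [Dq, hζ]; field_simp; ring
    rw [e'] at e
    exact e
  have := integral_mono_ae (i1.const_mul _) ((((i4.add (i1.const_mul _)).add (integrable_wt_X.const_mul _)).add (i2.const_mul _)).sub i3) key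
  rw [integral_const_mul] at this
  refine this.trans ?_
  rw [integral_sub' (((i4.add (i1.const_mul _)).add (integrable_wt_X.const_mul _)).add (i2.const_mul _)) i3,
    integral_add' ((i4.add (i1.const_mul _)).add (integrable_wt_X.const_mul _)) (i2.const_mul _),
    integral_add' (i4.add (i1.const_mul _)) (integrable_wt_X.const_mul _), integral_add' i4 (i1.const_mul _),
    integral_const_mul, integral_const_mul, integral_const_mul]
  linarith

/-- strong convergence of discrete gradients. -/
lemma GConv.strong (hp : 2 ≤ p) (hν : Kern p ν) (h : GConv ε ψ v M K) {r : ℕ → ℝ} (hr0 : Tendsto r atTop (𝓝 0))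
    (hr : ∀ n, - ∫ y, Lop p ν (ε n) (fun x => ψ n x y.2) y.1 * (wt y.1 * (ψ n y.1 y.2 - v y.1 y.2)) ∂((volume : Measure (Spc N)).prod κ) ≤ r n) :
    Tendsto (fun n => ∫ X, wt X.2.1 * |Dq (ε n) (ψ n) X - Dq (ε n) v X| ^ p ∂LL ν κ) atTop (𝓝 0) ∧
    ∃ C1, ∀ n, ∫ X, wt X.2.1 * Dq (ε n) (fun x π => ψ n x π - v x π) X ^ 2 ∂LL ν κ ≤ C1 := by
  have hM0 := h.M0
  have hK0 := h.K0
  have hwtm : Measurable fun X : XX N => wt X.2.1 := continuous_wt.measurable.comp (by fun_prop)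
  have hpc : Continuous fun s : ℝ => |s| ^ p := continuous_abs.rpow_const fun x => Or.inr (by linarith)
  have hΨc := (continuous_Psi hp).measurable
  have hA := fun n => measurable_Dq (ε := ε n) (h.meas n)
  have hBm := fun n => measurable_Dq (ε := ε n) h.measv
  have hAb : ∀ n X, |Dq (ε n) (ψ n) X| ≤ 2 * M / ε n := fun n => abs_Dq_le (h.pos n) (h.bd n)
  have hBb : ∀ n X, |Dq (ε n) v X| ≤ 2 * M / ε n := fun n => abs_Dq_le (h.pos n) h.vbd
  have hABb : ∀ n X, |Dq (ε n) (ψ n) X - Dq (ε n) v X| ≤ 2 * (2 * M / ε n) := fun n X => by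
    have := abs_sub (Dq (ε n) (ψ n) X) (Dq (ε n) v X); linarith [hAb n X, hBb n X]
  have hBK : ∀ n, ∀ᵐ X ∂LL ν κ, |Dq (ε n) v X| ≤ K := fun n => by
    filter_upwards [ae_norm_le_one hν (κ := κ)] with X hX
    exact (abs_Dq_le_lip (h.pos n) h.vlip X).trans (by nlinarith)
  set Q : ℕ → ℝ := fun n => ∫ X, wt X.2.1 * |Dq (ε n) (ψ n) X - Dq (ε n) v X| ^ p ∂LL ν κ with hQ
  set E : ℕ → ℝ := fun n => ∫ X, wt X.2.1 * |ψ n (X.2.1 + ε n • X.1) X.2.2 - v (X.2.1 + ε n • X.1) X.2.2| ^ p ∂LL ν κ with hE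
  set I3 : ℕ → ℝ := fun n => ∫ X, wt X.2.1 * (Psi p (Dq (ε n) v X) * (Dq (ε n) (ψ n) X - Dq (ε n) v X)) ∂LL ν κ with hI3
  set m : ℝ := ∫ X, wt X.2.1 ∂LL ν κ with hm
  have hm0 : 0 ≤ m := integral_nonneg fun X => (wt_pos _).le
  have hQ0 : ∀ n, 0 ≤ Q n := fun n => integral_nonneg fun X => mul_nonneg (wt_pos _).le (by positivity)
  have hE0 : ∀ n, 0 ≤ E n := fun n => integral_nonneg fun X => mul_nonneg (wt_pos _).le (by positivity)
  have i1 : ∀ n, Integrable (fun X => wt X.2.1 * |Dq (ε n) (ψ n) X - Dq (ε n) v X| ^ p) (LL ν κ) := fun n => by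
    refine integrable_of_le_wt (C := (2 * (2 * M / ε n)) ^ p) (hwtm.mul (hpc.measurable.comp ((hA n).sub (hBm n)))).aestronglyMeasurable (ae_of_all _ fun X => ?_)
    rw [abs_mul, abs_of_pos (wt_pos _), mul_comm, abs_of_nonneg (by positivity)]
    exact mul_le_mul_of_nonneg_right (Real.rpow_le_rpow (abs_nonneg _) (hABb n X) (by linarith)) (wt_pos _).le
  have hElim : Tendsto E atTop (𝓝 0) := by
    refine tendsto_integral_zero_of_le_wt (C := (2 * M) ^ p) (fun n => (hwtm.mul (hpc.measurable.comp (measurable_shift (h.meas_sub n)))).aestronglyMeasurable)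
      (fun n => ae_of_all _ fun X => ?_) (ae_of_all _ fun X => ?_)
    · rw [abs_mul, abs_of_pos (wt_pos _), mul_comm, abs_of_nonneg (by positivity)]
      exact mul_le_mul_of_nonneg_right (Real.rpow_le_rpow (abs_nonneg _) (h.bd_sub n _ _) (by linarith)) (wt_pos _).le
    · have := ((hpc.tendsto 0).comp (h.conv_sub_shift X)).const_mul (wt X.2.1)
      simpa [Real.zero_rpow (by linarith : p ≠ 0)] using this
  have hmain := fun (η : ℝ) (hη : 0 < η) n => h.integral_le hp hν hη n (hr n)
  set c0 : ℝ := 2 ^ (1 - p) with hc0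
  have hc0p : 0 < c0 := by positivity
  -- the a priori bound
  have hI3b : ∀ n, |I3 n| ≤ 8 * K ^ p * m + c0 / 4 * Q n := fun n => by
    rw [← Real.norm_eq_abs]
    refine (norm_integral_le_of_norm_le ((integrable_wt_X.const_mul (8 * K ^ p)).add ((i1 n).const_mul (c0 / 4))) ?_).trans ?_
    · filter_upwards [hBK n] with X hX
      have y := rpow_mul_le_young hp (by norm_num : (0:ℝ) < 8) hK0 (abs_nonneg (Dq (ε n) (ψ n) X - Dq (ε n) v X))
      have e8 : (8:ℝ) ^ (1 - p) ≤ c0 / 4 := by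
        rw [show (8:ℝ) = 4 * 2 by norm_num, Real.mul_rpow (by norm_num) (by norm_num)]
        have : (4:ℝ) ^ (1 - p) ≤ 4 ^ (-1 : ℝ) := Real.rpow_le_rpow_of_exponent_le (by norm_num) (by linarith)
        rw [Real.rpow_neg_one] at this
        nlinarith
      have y2 := mul_le_mul_of_nonneg_right e8 (by positivity : 0 ≤ |Dq (ε n) (ψ n) X - Dq (ε n) v X| ^ p)
      rw [Real.norm_eq_abs, abs_mul, abs_of_pos (wt_pos _), abs_mul]
      have y3 : |Psi p (Dq (ε n) v X)| * |Dq (ε n) (ψ n) X - Dq (ε n) v X| ≤ K ^ (p - 1) * |Dq (ε n) (ψ n) X - Dq (ε n) v X| :=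
        mul_le_mul_of_nonneg_right (abs_Psi_le hp hX) (abs_nonneg _)
      have := mul_le_mul_of_nonneg_left (y3.trans (y.trans (add_le_add_right y2 _))) (wt_pos X.2.1).le
      refine this.trans (le_of_eq ?_)
      simp only [Pi.add_apply]; ring
    · rw [integral_add' (integrable_wt_X.const_mul _) ((i1 n).const_mul _), integral_const_mul, integral_const_mul]
  set η0 : ℝ := c0 / (8 * 2 ^ p) with hη0
  have hη0p : 0 < η0 := by positivity
  have hη0e : 2 * η0 * 2 ^ p = c0 / 4 := by rw [hη0]; field_simp; norm_num
  obtain ⟨Rb, hRb⟩ := hr0.bddAbove_range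
  obtain ⟨Eb, hEb⟩ := hElim.bddAbove_range
  have hRb' : ∀ n, r n ≤ Rb := fun n => hRb ⟨n, rfl⟩
  have hEb' : ∀ n, E n ≤ Eb := fun n => hEb ⟨n, rfl⟩
  set Qb : ℝ := (Rb + c0 / 4 * K ^ p * m + 2 * η0 ^ (1 - p) * Eb + 8 * K ^ p * m) * (2 / c0) with hQb
  have hQle : ∀ n, Q n ≤ Qb := fun n => by
    have h1 := hmain η0 hη0p n
    rw [hη0e] at h1
    have h2 := (abs_le.1 (hI3b n)).1
    have h3 := mul_le_mul_of_nonneg_left (hEb' n) (by positivity : 0 ≤ 2 * η0 ^ (1 - p))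
    have h4 : c0 / 2 * Q n ≤ Rb + c0 / 4 * K ^ p * m + 2 * η0 ^ (1 - p) * Eb + 8 * K ^ p * m := by
      have := hRb' n
      linarith
    rw [hQb]
    have := mul_le_mul_of_nonneg_right h4 (by positivity : 0 ≤ 2 / c0)
    refine le_trans (le_of_eq ?_) this
    field_simp
  have hDe : ∀ n X, Dq (ε n) (fun x π => ψ n x π - v x π) X = Dq (ε n) (ψ n) X - Dq (ε n) v X := fun n X => Dq_sub _ _ _ _
  have i2 : ∀ n, Integrable (fun X => wt X.2.1 * Dq (ε n) (fun x π => ψ n x π - v x π) X ^ 2) (LL ν κ) := fun n => by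
    refine integrable_of_le_wt (C := (2 * (2 * M / ε n)) ^ 2) (hwtm.mul ((measurable_Dq (h.meas_sub n)).pow_const 2)).aestronglyMeasurable (ae_of_all _ fun X => ?_)
    rw [abs_mul, abs_of_pos (wt_pos _), mul_comm, abs_of_nonneg (by positivity), hDe, ← sq_abs]
    have := (wt_pos X.2.1).le
    gcongr
    exact hABb n X
  have hC1 : ∀ n, ∫ X, wt X.2.1 * Dq (ε n) (fun x π => ψ n x π - v x π) X ^ 2 ∂LL ν κ ≤ m + Qb := fun n => by
    refine le_trans ?_ (add_le_add_right (hQle n) m)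
    rw [hm, hQ]
    simp only
    rw [← integral_add integrable_wt_X (i1 n)]
    refine integral_mono (i2 n) (integrable_wt_X.add (i1 n)) fun X => ?_
    simp only [hDe]
    have : (Dq (ε n) (ψ n) X - Dq (ε n) v X) ^ 2 ≤ 1 + |Dq (ε n) (ψ n) X - Dq (ε n) v X| ^ p := by
      rw [← sq_abs]
      set a := |Dq (ε n) (ψ n) X - Dq (ε n) v X|
      have ha : 0 ≤ a := abs_nonneg _
      rcases le_total a 1 with h1 | h1
      · have := Real.rpow_nonneg ha p; nlinarith
      · have := Real.rpow_le_rpow_of_exponent_le h1 hp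
        rw [Real.rpow_two] at this; linarith
    have := mul_le_mul_of_nonneg_left this (wt_pos X.2.1).le
    linarith
  refine ⟨?_, _, hC1⟩
  -- the linear term
  have hDl := measurable_Dlim h.vcont
  have hDlb : ∀ᵐ X ∂LL ν κ, |Dlim v X| ≤ K := by
    filter_upwards [ae_norm_le_one hν (κ := κ)] with X hX
    exact (abs_Dlim_le hK0 h.vlip X).trans (by nlinarith)
  have hlin := tendsto_integral_mul_Dq hν h.pos h.le_one h.meas_sub h.bd_sub h.conv_sub (hΨc.comp hDl)
    (C := K ^ (p - 1)) (by filter_upwards [hDlb] with X hX; exact abs_Psi_le hp hX) hC1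
  set J : ℕ → ℝ := fun n => ∫ X, wt X.2.1 * (Psi p (Dq (ε n) v X) - Psi p (Dlim v X)) ^ 2 ∂LL ν κ with hJ
  have hJm : ∀ n, AEStronglyMeasurable (fun X => wt X.2.1 * (Psi p (Dq (ε n) v X) - Psi p (Dlim v X)) ^ 2) (LL ν κ) := fun n =>
    (hwtm.mul (((hΨc.comp (hBm n)).sub (hΨc.comp hDl)).pow_const 2)).aestronglyMeasurable
  have hJb : ∀ n, ∀ᵐ X ∂LL ν κ, |wt X.2.1 * (Psi p (Dq (ε n) v X) - Psi p (Dlim v X)) ^ 2| ≤ (2 * K ^ (p - 1)) ^ 2 * wt X.2.1 := fun n => by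
    filter_upwards [hBK n, hDlb] with X h1 h2
    rw [abs_mul, abs_of_pos (wt_pos _), mul_comm, abs_of_nonneg (by positivity), ← sq_abs]
    have := (wt_pos X.2.1).le
    have h3 := abs_sub (Psi p (Dq (ε n) v X)) (Psi p (Dlim v X))
    have h4 := abs_Psi_le hp h1
    have h5 := abs_Psi_le hp h2
    gcongr
    linarith
  have hJlim : Tendsto J atTop (𝓝 0) := by
    refine tendsto_integral_zero_of_le_wt hJm hJb ?_
    filter_upwards [ae_tendsto_Dq (ν := ν) (κ := κ) h.vcont h.vlip h.pos h.lim] with X hX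
    have := ((((continuous_Psi hp).tendsto _).comp hX).sub_const (Psi p (Dlim v X))).pow 2 |>.const_mul (wt X.2.1)
    simpa using this
  set I4 : ℕ → ℝ := fun n => ∫ X, wt X.2.1 * ((Psi p ∘ Dlim v) X * Dq (ε n) (fun x π => ψ n x π - v x π) X) ∂LL ν κ with hI4
  have hI3le : ∀ η, 0 < η → ∀ n, - I3 n ≤ |I4 n| + (η * (m + Qb) + 1 / η * J n) := fun η hη n => by
    have j1 : Integrable (fun X => wt X.2.1 * (Psi p (Dq (ε n) v X) - Psi p (Dlim v X)) ^ 2) (LL ν κ) := integrable_of_le_wt (hJm n) (hJb n)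
    have j2 : Integrable (fun X => wt X.2.1 * ((Psi p ∘ Dlim v) X * Dq (ε n) (fun x π => ψ n x π - v x π) X)) (LL ν κ) := by
      refine integrable_of_le_wt (C := K ^ (p - 1) * (2 * (2 * M / ε n)))
        (hwtm.mul ((hΨc.comp hDl).mul (measurable_Dq (h.meas_sub n)))).aestronglyMeasurable ?_
      filter_upwards [hDlb] with X hX
      rw [abs_mul, abs_of_pos (wt_pos _), mul_comm, abs_mul, hDe]
      exact mul_le_mul_of_nonneg_right (mul_le_mul (abs_Psi_le hp hX) (hABb n X) (abs_nonneg _) (by positivity)) (wt_pos _).le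
    have j3 := integral_mono_ae (μ := LL ν κ)
      (f := fun X => wt X.2.1 * ((Psi p ∘ Dlim v) X * Dq (ε n) (fun x π => ψ n x π - v x π) X) -
        (η * (wt X.2.1 * Dq (ε n) (fun x π => ψ n x π - v x π) X ^ 2) + 1 / η * (wt X.2.1 * (Psi p (Dq (ε n) v X) - Psi p (Dlim v X)) ^ 2)))
      (g := fun X => wt X.2.1 * (Psi p (Dq (ε n) v X) * (Dq (ε n) (ψ n) X - Dq (ε n) v X)))
      (j2.sub (((i2 n).const_mul η).add (j1.const_mul (1 / η)))) (by
        refine integrable_of_le_wt (C := (2 * M / ε n) ^ (p - 1) * (2 * (2 * M / ε n)))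
          (hwtm.mul ((hΨc.comp (hBm n)).mul ((hA n).sub (hBm n)))).aestronglyMeasurable (ae_of_all _ fun X => ?_)
        have := (h.pos n).le
        rw [abs_mul, abs_of_pos (wt_pos _), mul_comm, abs_mul]
        exact mul_le_mul_of_nonneg_right (mul_le_mul (abs_Psi_le hp (hBb n X)) (hABb n X) (abs_nonneg _) (by positivity)) (wt_pos _).le) ?_
    · have j4 := integral_sub j2 (((i2 n).const_mul η).add (j1.const_mul (1 / η)))
      have j5 := integral_add ((i2 n).const_mul η) (j1.const_mul (1 / η))
      rw [integral_const_mul, integral_const_mul] at j5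
      simp only [Pi.add_apply] at j4
      rw [j4, j5] at j3
      have j6 := mul_le_mul_of_nonneg_left (hC1 n) hη.le
      have j7 := neg_abs_le (I4 n)
      simp only [hI4, hI3, hJ] at j7 ⊢
      linarith
    · filter_upwards with X
      have hw := (wt_pos X.2.1).le
      simp only [hDe, Function.comp_apply]
      set d := Dq (ε n) (ψ n) X - Dq (ε n) v X
      set P := Psi p (Dq (ε n) v X)
      set P' := Psi p (Dlim v X)
      have : P' * d - (η * d ^ 2 + 1 / η * (P - P') ^ 2) ≤ P * d := by
        have e : η * d ^ 2 + 1 / η * (P - P') ^ 2 + (P - P') * d = ((η * d + (P - P')) ^ 2 + (η * d) ^ 2 + (P - P') ^ 2) / (2 * η) := by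
          field_simp; ring
        have : 0 ≤ ((η * d + (P - P')) ^ 2 + (η * d) ^ 2 + (P - P') ^ 2) / (2 * η) := by positivity
        nlinarith
      have := mul_le_mul_of_nonneg_left this hw
      linarith
  refine tendsto_zero_of_forall_le hQ0 (C := (2 * 2 ^ p * (Qb + K ^ p * m) + (m + Qb)) / c0) hη0p fun η hη hηle => ?_
  refine ⟨fun n => (r n + 2 * η ^ (1 - p) * E n + |I4 n| + 1 / η * J n) / c0, ?_, fun n => ?_⟩
  · have := (((hr0.add (hElim.const_mul (2 * η ^ (1 - p)))).add hlin.abs).add (hJlim.const_mul (1 / η))).div_const c0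
    simpa using this
  · have h1 := hmain η hη n
    have h2 := hI3le η hη n
    have h3 := mul_le_mul_of_nonneg_left (hQle n) (by positivity : 0 ≤ 2 * η * 2 ^ p)
    have h4 : c0 * Q n ≤ (2 * 2 ^ p * (Qb + K ^ p * m) + (m + Qb)) * η + (r n + 2 * η ^ (1 - p) * E n + |I4 n| + 1 / η * J n) := by
      linarith
    rw [div_mul_eq_mul_div, ← add_div, le_div_iff₀ hc0p]
    linarith

end

/-- telescoping estimate for time increments. -/
lemma telescoping_le {y : ℝ → ℝ} {h τ B s : ℝ} (hh : 0 < h) (hτ : 0 < τ) (hy : Measurable y) (hb : ∀ r, 0 ≤ r → |y r| ≤ B)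
    (hD : ∀ r, 0 ≤ r → (y (r + τ) - y r) ^ 2 ≤ s * τ) :
    ∫ σ in Icc (0:ℝ) 1, -(y (h * σ) * ((y (h * σ + τ) - y (h * σ)) / τ)) ≤ 1 / (2 * h) * (∫ σ in Icc (0:ℝ) 1, y (τ * σ) ^ 2) + s / 2 := by
  have hB : 0 ≤ B := (abs_nonneg _).trans (hb 0 le_rfl)
  have ii : ∀ {F : ℝ → ℝ} {C c d : ℝ}, Measurable F → 0 ≤ c → c ≤ d → (∀ r, 0 ≤ r → |F r| ≤ C) → IntervalIntegrable F volume c d := by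
    intro F C c d hF hc hcd hFb
    rw [intervalIntegrable_iff_integrableOn_Icc_of_le hcd]
    refine Measure.integrableOn_of_bounded (M := C) (by simp) hF.aestronglyMeasurable ?_
    exact (ae_restrict_iff' measurableSet_Icc).2 (ae_of_all _ fun r hr => hFb r (hc.trans hr.1))
  have hsq : Measurable fun r => y r ^ 2 := hy.pow_const 2
  have hsqb : ∀ r, 0 ≤ r → |y r ^ 2| ≤ B ^ 2 := fun r hr => by
    rw [abs_of_nonneg (sq_nonneg _), ← sq_abs]
    have := hb r hr
    gcongr
  have hsh : Measurable fun r => y (r + τ) := hy.comp (measurable_add_const τ)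
  have hFm : Measurable fun r => -(y r * ((y (r + τ) - y r) / τ)) := (hy.mul ((hsh.sub hy).div_const τ)).neg
  have hFb : ∀ r, 0 ≤ r → |-(y r * ((y (r + τ) - y r) / τ))| ≤ B * (2 * B / τ) := fun r hr => by
    rw [abs_neg, abs_mul, abs_div, abs_of_pos hτ]
    have h1 := hb r hr
    have h2 := hb (r + τ) (by linarith)
    have h3 := abs_sub (y (r + τ)) (y r)
    gcongr
    linarith
  rw [integral_Icc_eq_integral_Ioc, integral_Icc_eq_integral_Ioc, ← intervalIntegral.integral_of_le zero_le_one,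
    ← intervalIntegral.integral_of_le zero_le_one,
    intervalIntegral.integral_comp_mul_left (fun r => -(y r * ((y (r + τ) - y r) / τ))) hh.ne',
    intervalIntegral.integral_comp_mul_left (fun r => y r ^ 2) hτ.ne']
  simp only [mul_zero, mul_one, smul_eq_mul]
  have hm : ∫ r in (0:ℝ)..h, -(y r * ((y (r + τ) - y r) / τ)) ≤ ∫ r in (0:ℝ)..h, (1 / (2 * τ) * (y r ^ 2 - y (r + τ) ^ 2) + s / 2) := by
    refine intervalIntegral.integral_mono_on hh.le (ii hFm le_rfl hh.le hFb) ?_ fun r hr => ?_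
    · refine ii (C := 1 / (2 * τ) * (B ^ 2 + B ^ 2) + |s / 2|) (by fun_prop) le_rfl hh.le fun r hr => ?_
      refine (abs_add_le _ _).trans (add_le_add ?_ le_rfl)
      rw [abs_mul, abs_of_pos (by positivity)]
      gcongr
      exact (abs_sub _ _).trans (add_le_add (hsqb r hr) (hsqb (r + τ) (by linarith)))
    · have e : -(y r * ((y (r + τ) - y r) / τ)) = 1 / (2 * τ) * (y r ^ 2 - y (r + τ) ^ 2) + (y (r + τ) - y r) ^ 2 / (2 * τ) := by
        field_simp; ring
      rw [e]
      have := hD r hr.1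
      have : (y (r + τ) - y r) ^ 2 / (2 * τ) ≤ s / 2 := by
        rw [div_le_iff₀ (by positivity)]; linarith
      linarith
  have j1 : IntervalIntegrable (fun r => y r ^ 2) volume 0 h := ii hsq le_rfl hh.le hsqb
  have j2 : IntervalIntegrable (fun r => y (r + τ) ^ 2) volume 0 h :=
    ii (hsh.pow_const 2) le_rfl hh.le fun r hr => hsqb (r + τ) (by linarith)
  have e1 : ∫ r in (0:ℝ)..h, (1 / (2 * τ) * (y r ^ 2 - y (r + τ) ^ 2) + s / 2) =
      1 / (2 * τ) * ((∫ r in (0:ℝ)..h, y r ^ 2) - ∫ r in (0:ℝ)..h, y (r + τ) ^ 2) + h * (s / 2) := by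
    rw [intervalIntegral.integral_add ((j1.sub j2).const_mul _) intervalIntegrable_const, intervalIntegral.integral_const_mul,
      intervalIntegral.integral_sub j1 j2]
    simp only [intervalIntegral.integral_const, sub_zero, smul_eq_mul]
  have e2 : ∫ r in (0:ℝ)..h, y (r + τ) ^ 2 = ∫ r in τ..(h + τ), y r ^ 2 := by
    rw [intervalIntegral.integral_comp_add_right (fun r => y r ^ 2)]; simp
  have j3 : IntervalIntegrable (fun r => y r ^ 2) volume 0 (h + τ) := ii hsq le_rfl (by positivity) hsqb
  have j4 : IntervalIntegrable (fun r => y r ^ 2) volume 0 τ := ii hsq le_rfl hτ.le hsqb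
  have e3 := intervalIntegral.integral_interval_sub_left j3 j4
  have e4 : ∫ r in (0:ℝ)..h, y r ^ 2 ≤ ∫ r in (0:ℝ)..(h + τ), y r ^ 2 :=
    intervalIntegral.integral_mono_interval le_rfl hh.le (by linarith) (ae_of_all _ fun r => sq_nonneg _) j3
  rw [e1, e2, ← e3] at hm
  have e5 : 1 / (2 * τ) * ((∫ r in (0:ℝ)..h, y r ^ 2) - ((∫ r in (0:ℝ)..(h + τ), y r ^ 2) - ∫ r in (0:ℝ)..τ, y r ^ 2)) ≤
      1 / (2 * τ) * ∫ r in (0:ℝ)..τ, y r ^ 2 := by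
    gcongr; linarith
  have e6 := mul_le_mul_of_nonneg_left (hm.trans (add_le_add_left e5 _)) (by positivity : 0 ≤ h⁻¹)
  refine e6.trans (le_of_eq ?_)
  field_simp

/-- approximate solutions together with their limit, on the time interval `[a, ∞)`. -/
structure Appr {N : ℕ} (p : ℝ) (ν : Measure (Spc N)) (f : ℝ → ℝ) (ε τ s : ℕ → ℝ) (U : ℕ → Spc N → ℝ → ℝ) (u : Spc N → ℝ → ℝ)
    (a b M K : ℝ) : Prop where
  a0 : 0 < a
  pos : ∀ n, 0 < ε n
  le_one : ∀ n, ε n ≤ 1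
  lim : Tendsto ε atTop (𝓝 0)
  tpos : ∀ n, 0 < τ n
  tlim : Tendsto τ atTop (𝓝 0)
  slim : Tendsto s atTop (𝓝 0)
  meas : ∀ n, Measurable (Function.uncurry (U n))
  nonneg : ∀ n x t, a ≤ t → 0 ≤ U n x t
  bd : ∀ n x t, a ≤ t → U n x t ≤ M
  eq : ∀ n x t, a ≤ t → U n x (t + τ n) = U n x t + τ n * (Lop p ν (ε n) (fun y => U n y t) x - f (U n x t))
  incr : ∀ n x t, a ≤ t → (U n x (t + τ n) - U n x t) ^ 2 ≤ s n * τ n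
  conv : ∀ (xn : ℕ → Spc N) (tn : ℕ → ℝ) (x : Spc N) (t : ℝ), (∀ n, 0 ≤ tn n) → Tendsto xn atTop (𝓝 x) → Tendsto tn atTop (𝓝 t) →
    Tendsto (fun n => U n (xn n) (tn n)) atTop (𝓝 (u x t))
  ucont : Continuous (Function.uncurry u)
  K0 : 0 ≤ K
  ulip : ∀ x y t, a ≤ t → t ≤ b → |u x t - u y t| ≤ K * ‖x - y‖

/-- clamping to an interval. -/
def clamp (a b t : ℝ) : ℝ := max a (min b t)

lemma continuous_clamp (a b : ℝ) : Continuous (clamp a b) := by unfold clamp; fun_prop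
lemma le_clamp (a b t : ℝ) : a ≤ clamp a b t := le_max_left _ _
lemma clamp_le {a b : ℝ} (h : a ≤ b) (t : ℝ) : clamp a b t ≤ b := max_le h (min_le_left _ _)
lemma clamp_of_mem {a b t : ℝ} (h : t ∈ Icc a b) : clamp a b t = t := by rw [clamp, min_eq_right h.2, max_eq_right h.1]

/-- time-averaging measure. -/
abbrev kap (a b : ℝ) : Measure (ℝ × ℝ) := (volume.restrict (Icc a b)).prod (volume.restrict (Icc (0:ℝ) 1))

/-- parametrized time-translates. -/
def psh {N : ℕ} (U : ℕ → Spc N → ℝ → ℝ) (h : ℕ → ℝ) (a b : ℝ) (n : ℕ) (x : Spc N) (π : ℝ × ℝ) : ℝ :=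
  U n x (clamp a b π.1 + h n * clamp 0 1 π.2)

def vsh {N : ℕ} (u : Spc N → ℝ → ℝ) (a b : ℝ) (x : Spc N) (π : ℝ × ℝ) : ℝ := u x (clamp a b π.1)

section
variable {N : ℕ} {p : ℝ} {ν : Measure (Spc N)} {f : ℝ → ℝ} {ε τ s h : ℕ → ℝ} {U : ℕ → Spc N → ℝ → ℝ} {u : Spc N → ℝ → ℝ}
  {a b M K : ℝ}

/-- integrate the last parameter first. -/
lemma integral_Y_mono_inner {μ : Measure (Spc N)} [SFinite μ] {F1 F2 : Spc N × (ℝ × ℝ) → ℝ} (h1 : Integrable F1 (μ.prod (kap a b)))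
    (h2 : Integrable F2 (μ.prod (kap a b)))
    (h : ∀ x t, t ∈ Icc a b → ∫ σ in Icc (0:ℝ) 1, F1 (x, (t, σ)) ≤ ∫ σ in Icc (0:ℝ) 1, F2 (x, (t, σ))) :
    ∫ y, F1 y ∂μ.prod (kap a b) ≤ ∫ y, F2 y ∂μ.prod (kap a b) := by
  rw [integral_prod _ h1, integral_prod _ h2]
  refine integral_mono_ae h1.integral_prod_left h2.integral_prod_left ?_
  filter_upwards [h1.prod_right_ae, h2.prod_right_ae] with x k1 k2
  rw [integral_prod _ k1, integral_prod _ k2]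
  refine integral_mono_ae k1.integral_prod_left k2.integral_prod_left ?_
  filter_upwards [ae_restrict_mem measurableSet_Icc] with t ht using h x t ht

namespace Appr

lemma nonneg_u (H : Appr p ν f ε τ s U u a b M K) (x : Spc N) {t : ℝ} (ht : a ≤ t) : 0 ≤ u x t :=
  ge_of_tendsto' (H.conv (fun _ => x) (fun _ => t) x t (fun _ => H.a0.le.trans ht) tendsto_const_nhds tendsto_const_nhds)
    fun n => H.nonneg n x t ht

lemma u_le (H : Appr p ν f ε τ s U u a b M K) (x : Spc N) {t : ℝ} (ht : a ≤ t) : u x t ≤ M :=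
  le_of_tendsto' (H.conv (fun _ => x) (fun _ => t) x t (fun _ => H.a0.le.trans ht) tendsto_const_nhds tendsto_const_nhds)
    fun n => H.bd n x t ht

lemma gconv (H : Appr p ν f ε τ s U u a b M K) (hab : a ≤ b) (hh : ∀ n, 0 ≤ h n) (hh0 : Tendsto h atTop (𝓝 0)) :
    GConv ε (psh U h a b) (vsh u a b) M K where
  pos := H.pos
  le_one := H.le_one
  lim := H.lim
  meas n := (H.meas n).comp (f := fun q : Spc N × (ℝ × ℝ) => (q.1, clamp a b q.2.1 + h n * clamp 0 1 q.2.2)) (by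
    have := (continuous_clamp a b).measurable
    have := (continuous_clamp 0 1).measurable
    fun_prop)
  bd n x π := by
    have h1 : a ≤ clamp a b π.1 + h n * clamp 0 1 π.2 := by
      have := le_clamp a b π.1
      have := mul_nonneg (hh n) (le_clamp 0 1 π.2)
      linarith
    rw [psh, abs_of_nonneg (H.nonneg n x _ h1)]
    exact H.bd n x _ h1
  vcont := H.ucont.comp (f := fun q : Spc N × (ℝ × ℝ) => (q.1, clamp a b q.2.1)) (by
    have := continuous_clamp a b
    fun_prop)
  vbd x π := by
    rw [vsh, abs_of_nonneg (H.nonneg_u x (le_clamp a b π.1))]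
    exact H.u_le x (le_clamp a b π.1)
  K0 := H.K0
  vlip x y π := H.ulip x y _ (le_clamp a b π.1) (clamp_le hab π.1)
  conv xn x π hx := by
    refine H.conv xn _ x (clamp a b π.1) (fun n => ?_) hx ?_
    · have := le_clamp a b π.1
      have := mul_nonneg (hh n) (le_clamp 0 1 π.2)
      have := H.a0
      linarith
    · simpa using (hh0.mul_const (clamp 0 1 π.2)).const_add (clamp a b π.1)

end Appr
end

/-- time difference quotients of parametrized translates. -/
def tinc {N : ℕ} (U : ℕ → Spc N → ℝ → ℝ) (τ h : ℕ → ℝ) (a b : ℝ) (n : ℕ) (x : Spc N) (π : ℝ × ℝ) : ℝ :=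
  (U n x (clamp a b π.1 + h n * clamp 0 1 π.2 + τ n) - U n x (clamp a b π.1 + h n * clamp 0 1 π.2)) / τ n

section
variable {N : ℕ} {p : ℝ} {ν : Measure (Spc N)} {f : ℝ → ℝ} {ε τ s h : ℕ → ℝ} {U : ℕ → Spc N → ℝ → ℝ} {u : Spc N → ℝ → ℝ}
  {a b M K : ℝ}

namespace Appr

lemma le_time (H : Appr p ν f ε τ s U u a b M K) (hh : ∀ n, 0 ≤ h n) (n : ℕ) (π : ℝ × ℝ) :
    a ≤ clamp a b π.1 + h n * clamp 0 1 π.2 := by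
  have := le_clamp a b π.1
  have := mul_nonneg (hh n) (le_clamp 0 1 π.2)
  linarith

lemma M0 (H : Appr p ν f ε τ s U u a b M K) : 0 ≤ M := (H.nonneg 0 0 a le_rfl).trans (H.bd 0 0 a le_rfl)

lemma psh_nonneg (H : Appr p ν f ε τ s U u a b M K) (hh : ∀ n, 0 ≤ h n) (n : ℕ) (x : Spc N) (π : ℝ × ℝ) : 0 ≤ psh U h a b n x π :=
  H.nonneg n x _ (H.le_time hh n π)

lemma psh_le (H : Appr p ν f ε τ s U u a b M K) (hh : ∀ n, 0 ≤ h n) (n : ℕ) (x : Spc N) (π : ℝ × ℝ) : psh U h a b n x π ≤ M :=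
  H.bd n x _ (H.le_time hh n π)

lemma vsh_nonneg (H : Appr p ν f ε τ s U u a b M K) (x : Spc N) (π : ℝ × ℝ) : 0 ≤ vsh u a b x π :=
  H.nonneg_u x (le_clamp _ _ _)

lemma Lop_psh (H : Appr p ν f ε τ s U u a b M K) (hh : ∀ n, 0 ≤ h n) (n : ℕ) (x : Spc N) (π : ℝ × ℝ) :
    Lop p ν (ε n) (fun x => psh U h a b n x π) x = tinc U τ h a b n x π + f (psh U h a b n x π) := by
  have h1 := H.eq n x _ (H.le_time (b := b) hh n π)
  have h2 := H.tpos n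
  rw [tinc, h1]
  simp only [psh]
  field_simp
  ring

lemma measurable_tinc (H : Appr p ν f ε τ s U u a b M K) (n : ℕ) : Measurable (Function.uncurry (tinc U τ h a b n)) := by
  have h1 := (continuous_clamp a b).measurable
  have h2 := (continuous_clamp 0 1).measurable
  exact (((H.meas n).comp (f := fun q : Spc N × (ℝ × ℝ) => (q.1, clamp a b q.2.1 + h n * clamp 0 1 q.2.2 + τ n)) (by fun_prop)).sub
    ((H.meas n).comp (f := fun q : Spc N × (ℝ × ℝ) => (q.1, clamp a b q.2.1 + h n * clamp 0 1 q.2.2)) (by fun_prop))).div_const _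

lemma abs_tinc_le (H : Appr p ν f ε τ s U u a b M K) (hh : ∀ n, 0 ≤ h n) (n : ℕ) (x : Spc N) (π : ℝ × ℝ) :
    |tinc U τ h a b n x π| ≤ M / τ n := by
  have h0 := H.le_time (b := b) hh n π
  have h2 := H.tpos n
  rw [tinc, abs_div, abs_of_pos h2]
  gcongr
  have k1 := H.nonneg n x _ h0
  have k2 := H.bd n x _ h0
  have k3 := H.nonneg n x (clamp a b π.1 + h n * clamp 0 1 π.2 + τ n) (by linarith)
  have k4 := H.bd n x (clamp a b π.1 + h n * clamp 0 1 π.2 + τ n) (by linarith)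
  rw [abs_le]; constructor <;> linarith

lemma f_psh (H : Appr p ν f ε τ s U u a b M K) (hh : ∀ n, 0 ≤ h n) (n : ℕ) (x : Spc N) (π : ℝ × ℝ) :
    f (psh U h a b n x π) = (fun r => f (max r 0)) (psh U h a b n x π) := by
  simp only [max_eq_left (H.psh_nonneg hh n x π)]

lemma measurable_f_psh (hf : Absorb f) (H : Appr p ν f ε τ s U u a b M K) (hab : a ≤ b) (hh : ∀ n, 0 ≤ h n) (hh0 : Tendsto h atTop (𝓝 0))
    (n : ℕ) : Measurable (Function.uncurry fun x π => f (psh U h a b n x π)) := by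
  have e : (Function.uncurry fun x π => f (psh U h a b n x π)) = (fun r => f (max r 0)) ∘ Function.uncurry (psh U h a b n) := by
    ext q
    exact H.f_psh hh n q.1 q.2
  rw [e]
  exact hf.continuous_max.measurable.comp ((H.gconv hab hh hh0).meas n)

lemma abs_f_psh_le (hf : Absorb f) (H : Appr p ν f ε τ s U u a b M K) (hh : ∀ n, 0 ≤ h n) (n : ℕ) (x : Spc N) (π : ℝ × ℝ) :
    |f (psh U h a b n x π)| ≤ f M := by
  rw [abs_of_nonneg (hf.nonneg (H.psh_nonneg hh n x π))]
  exact hf.mono (H.psh_nonneg hh n x π) H.M0 (H.psh_le hh n x π)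

lemma tendsto_f_psh (hf : Absorb f) (H : Appr p ν f ε τ s U u a b M K) (hab : a ≤ b) (hh : ∀ n, 0 ≤ h n) (hh0 : Tendsto h atTop (𝓝 0))
    (x : Spc N) (π : ℝ × ℝ) : Tendsto (fun n => f (psh U h a b n x π)) atTop (𝓝 (f (vsh u a b x π))) := by
  have h1 := (hf.continuous_max.tendsto _).comp ((H.gconv hab hh hh0).conv (fun _ => x) x π tendsto_const_nhds)
  simp only [max_eq_left (H.vsh_nonneg x π)] at h1
  exact h1.congr fun n => (H.f_psh hh n x π).symm

/-- energy inequality for time-averaged translates. -/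
lemma energy (hf : Absorb f) (H : Appr p ν f ε τ s U u a b M K) (hab : a ≤ b) :
    ∃ h : ℕ → ℝ, (∀ n, 0 < h n) ∧ Tendsto h atTop (𝓝 0) ∧ ∃ r : ℕ → ℝ, Tendsto r atTop (𝓝 0) ∧
      ∀ n, - ∫ y, Lop p ν (ε n) (fun x => psh U h a b n x y.2) y.1 * (wt y.1 * (psh U h a b n y.1 y.2 - vsh u a b y.1 y.2))
        ∂((volume : Measure (Spc N)).prod (kap a b)) ≤ r n := by
  have hM0 := H.M0
  have hτ0 : ∀ n, 0 ≤ τ n := fun n => (H.tpos n).le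
  have Gτ := H.gconv hab hτ0 H.tlim
  have hwtm : Measurable fun y : Spc N × (ℝ × ℝ) => wt y.1 := continuous_wt.measurable.comp measurable_fst
  set q : ℕ → ℝ := fun n => ∫ y, wt y.1 * (psh U τ a b n y.1 y.2 - vsh u a b y.1 y.2) ^ 2 ∂((volume : Measure (Spc N)).prod (kap a b)) with hq
  have hq0 : ∀ n, 0 ≤ q n := fun n => integral_nonneg fun y => mul_nonneg (wt_pos _).le (sq_nonneg _)
  have hqm : ∀ n, AEStronglyMeasurable (fun y : Spc N × (ℝ × ℝ) => wt y.1 * (psh U τ a b n y.1 y.2 - vsh u a b y.1 y.2) ^ 2)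
      ((volume : Measure (Spc N)).prod (kap a b)) := fun n => (hwtm.mul ((Gτ.meas_sub n).pow_const 2)).aestronglyMeasurable
  have hqb : ∀ n, ∀ᵐ y ∂((volume : Measure (Spc N)).prod (kap a b)),
      |wt y.1 * (psh U τ a b n y.1 y.2 - vsh u a b y.1 y.2) ^ 2| ≤ (2 * M) ^ 2 * wt y.1 := fun n => ae_of_all _ fun y => by
    rw [abs_mul, abs_of_pos (wt_pos _), mul_comm, abs_of_nonneg (sq_nonneg _), ← sq_abs]
    have := (wt_pos y.1).le
    have := Gτ.bd_sub n y.1 y.2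
    gcongr
  have hqlim : Tendsto q atTop (𝓝 0) := by
    refine tendsto_integral_zero_of_le_wt_Y hqm hqb (ae_of_all _ fun y => ?_)
    simpa using ((Gτ.conv_sub y.1 y.2).pow 2).const_mul (wt y.1)
  set h : ℕ → ℝ := fun n => √(q n) + 1 / ((n:ℝ) + 1) with hh
  have hpos : ∀ n, 0 < h n := fun n => by have := Real.sqrt_nonneg (q n); positivity
  have hlim : Tendsto h atTop (𝓝 0) := by
    have h1 : Tendsto (fun n => √(q n)) atTop (𝓝 0) := by
      simpa using hqlim.sqrt
    have h2 := h1.add tendsto_one_div_add_atTop_nhds_zero_nat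
    rw [add_zero] at h2
    exact h2
  have hqh : Tendsto (fun n => q n / h n) atTop (𝓝 0) := by
    refine squeeze_zero (fun n => div_nonneg (hq0 n) (hpos n).le) (fun n => ?_) hlim
    rw [div_le_iff₀ (hpos n)]
    have h1 : √(q n) ≤ h n := le_add_of_nonneg_right (by positivity)
    calc q n = √(q n) * √(q n) := (Real.mul_self_sqrt (hq0 n)).symm
      _ ≤ h n * h n := mul_le_mul h1 h1 (Real.sqrt_nonneg _) (hpos n).le
  have hh0 : ∀ n, 0 ≤ h n := fun n => (hpos n).le
  have G := H.gconv hab hh0 hlim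
  set m : ℝ := ∫ y : Spc N × (ℝ × ℝ), wt y.1 ∂((volume : Measure (Spc N)).prod (kap a b)) with hm
  set I2 : ℕ → ℝ := fun n => ∫ y, f (psh U h a b n y.1 y.2) * (wt y.1 * (psh U h a b n y.1 y.2 - vsh u a b y.1 y.2))
    ∂((volume : Measure (Spc N)).prod (kap a b)) with hI2
  have hfM : 0 ≤ f M := hf.nonneg hM0
  have hm2 : ∀ n, AEStronglyMeasurable (fun y : Spc N × (ℝ × ℝ) => f (psh U h a b n y.1 y.2) * (wt y.1 * (psh U h a b n y.1 y.2 - vsh u a b y.1 y.2)))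
      ((volume : Measure (Spc N)).prod (kap a b)) := fun n =>
    ((H.measurable_f_psh hf hab hh0 hlim n).mul (hwtm.mul (G.meas_sub n))).aestronglyMeasurable
  have hb2 : ∀ n, ∀ᵐ y ∂((volume : Measure (Spc N)).prod (kap a b)),
      |f (psh U h a b n y.1 y.2) * (wt y.1 * (psh U h a b n y.1 y.2 - vsh u a b y.1 y.2))| ≤ f M * (2 * M) * wt y.1 := fun n => ae_of_all _ fun y => by
    rw [abs_mul, abs_mul, abs_of_pos (wt_pos _)]
    calc _ ≤ f M * (wt y.1 * (2 * M)) := mul_le_mul (H.abs_f_psh_le hf hh0 n _ _)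
          (mul_le_mul_of_nonneg_left (G.bd_sub n _ _) (wt_pos _).le) (mul_nonneg (wt_pos _).le (abs_nonneg _)) hfM
      _ = _ := by ring
  have hI2lim : Tendsto I2 atTop (𝓝 0) := by
    refine tendsto_integral_zero_of_le_wt_Y hm2 hb2 (ae_of_all _ fun y => ?_)
    simpa using (H.tendsto_f_psh hf hab hh0 hlim y.1 y.2).mul ((G.conv_sub y.1 y.2).const_mul (wt y.1))
  refine ⟨h, hpos, hlim, fun n => (1 / 2) * (q n / h n) + s n / 2 * m - I2 n, ?_, fun n => ?_⟩
  · have h3 := ((hqh.const_mul (1 / 2)).add ((H.slim.div_const 2).mul_const m)).sub hI2lim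
    simp only [mul_zero, zero_div, zero_mul, add_zero, sub_zero] at h3
    exact h3
  set F1 : Spc N × (ℝ × ℝ) → ℝ := fun y => -(wt y.1 * ((psh U h a b n y.1 y.2 - vsh u a b y.1 y.2) * tinc U τ h a b n y.1 y.2)) with hF1
  have i1 : Integrable F1 ((volume : Measure (Spc N)).prod (kap a b)) := by
    refine integrable_of_le_wt_Y (C := 2 * M * (M / τ n)) (hwtm.mul ((G.meas_sub n).mul (H.measurable_tinc n))).neg.aestronglyMeasurable
      (ae_of_all _ fun y => ?_)
    rw [hF1, abs_neg, abs_mul, abs_of_pos (wt_pos _), mul_comm, abs_mul]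
    exact mul_le_mul_of_nonneg_right (mul_le_mul (G.bd_sub n _ _) (H.abs_tinc_le hh0 n _ _) (abs_nonneg _) (by positivity)) (wt_pos _).le
  have i2 := integrable_of_le_wt_Y (hm2 n) (hb2 n)
  have iq := integrable_of_le_wt_Y (hqm n) (hqb n)
  have split : - ∫ y, Lop p ν (ε n) (fun x => psh U h a b n x y.2) y.1 * (wt y.1 * (psh U h a b n y.1 y.2 - vsh u a b y.1 y.2))
        ∂((volume : Measure (Spc N)).prod (kap a b)) = (∫ y, F1 y ∂((volume : Measure (Spc N)).prod (kap a b))) - I2 n := by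
    rw [← integral_sub i1 i2, ← integral_neg]
    refine integral_congr_ae (ae_of_all _ fun y => ?_)
    simp only [H.Lop_psh hh0, hF1]; ring
  rw [split]
  have iF2 := (iq.const_mul (1 / (2 * h n))).add ((integrable_wt_Y (κ := kap a b) (N := N)).const_mul (s n / 2))
  have hle := integral_Y_mono_inner i1 iF2 fun x t ht => ?_
  · rw [integral_add' (iq.const_mul _) (integrable_wt_Y.const_mul _), integral_const_mul, integral_const_mul] at hle
    have e : 1 / (2 * h n) * q n = 1 / 2 * (q n / h n) := by field_simp
    change _ ≤ 1 / 2 * (q n / h n) + s n / 2 * m - I2 n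
    rw [← e]
    exact sub_le_sub_right hle _
  · have hta := ht.1
    have htel := telescoping_le (y := fun r => U n x (t + r) - u x t) (B := M) (s := s n) (hpos n) (H.tpos n)
      (((H.meas n).comp (f := fun r : ℝ => (x, t + r)) (by fun_prop)).sub_const _)
      (fun r hr => by
        have k1 := H.nonneg n x (t + r) (by linarith)
        have k2 := H.bd n x (t + r) (by linarith)
        have k3 := H.nonneg_u x hta
        have k4 := H.u_le x hta
        rw [abs_le]; constructor <;> linarith)
      (fun r hr => by
        have := H.incr n x (t + r) (by linarith)
        simpa [add_assoc] using this)
    have htel' := mul_le_mul_of_nonneg_left htel (wt_pos x).le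
    have c1 : ∫ σ in Icc (0:ℝ) 1, F1 (x, (t, σ)) = wt x * ∫ σ in Icc (0:ℝ) 1,
        -((U n x (t + h n * σ) - u x t) * ((U n x (t + (h n * σ + τ n)) - u x t - (U n x (t + h n * σ) - u x t)) / τ n)) := by
      rw [← integral_const_mul]
      refine setIntegral_congr_fun measurableSet_Icc fun σ hσ => ?_
      simp only [hF1, psh, vsh, tinc, clamp_of_mem ht, clamp_of_mem hσ, add_assoc]
      ring
    have c2 : ∫ σ in Icc (0:ℝ) 1, ((fun y : Spc N × (ℝ × ℝ) => 1 / (2 * h n) * (wt y.1 * (psh U τ a b n y.1 y.2 - vsh u a b y.1 y.2) ^ 2)) +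
        (fun y : Spc N × (ℝ × ℝ) => s n / 2 * wt y.1) : Spc N × (ℝ × ℝ) → ℝ) (x, (t, σ)) =
        wt x * (1 / (2 * h n) * (∫ σ in Icc (0:ℝ) 1, (U n x (t + τ n * σ) - u x t) ^ 2) + s n / 2) := by
      have c3 : ∫ σ in Icc (0:ℝ) 1, ((fun y : Spc N × (ℝ × ℝ) => 1 / (2 * h n) * (wt y.1 * (psh U τ a b n y.1 y.2 - vsh u a b y.1 y.2) ^ 2)) +
          (fun y : Spc N × (ℝ × ℝ) => s n / 2 * wt y.1) : Spc N × (ℝ × ℝ) → ℝ) (x, (t, σ)) = ∫ σ in Icc (0:ℝ) 1,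
            ((wt x * (1 / (2 * h n))) * (U n x (t + τ n * σ) - u x t) ^ 2 + s n / 2 * wt x) := by
        refine setIntegral_congr_fun measurableSet_Icc fun σ hσ => ?_
        simp only [Pi.add_apply, psh, vsh, clamp_of_mem ht, clamp_of_mem hσ]
        ring
      rw [c3, integral_add, integral_const_mul]
      · simp; ring
      · refine Integrable.const_mul (Measure.integrableOn_of_bounded (M := M ^ 2) (by simp)
          ((((H.meas n).comp (f := fun r : ℝ => (x, t + τ n * r)) (by fun_prop)).sub_const _).pow_const 2).aestronglyMeasurable ?_) _
        refine (ae_restrict_iff' measurableSet_Icc).2 (ae_of_all _ fun r hr => ?_)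
        have h5 : a ≤ t + τ n * r := by have := mul_nonneg (hτ0 n) hr.1; linarith
        have k1 := H.nonneg n x _ h5
        have k2 := H.bd n x _ h5
        have k3 := H.nonneg_u x hta
        have k4 := H.u_le x hta
        rw [Real.norm_of_nonneg (sq_nonneg _)]
        have k5 : |U n x (t + τ n * r) - u x t| ≤ M := by rw [abs_le]; constructor <;> linarith
        rw [← sq_abs (_ - _)]
        exact pow_le_pow_left₀ (abs_nonneg _) k5 2
      · exact integrable_const _
    rw [c1, c2]
    exact htel'

end Appr
end

/-- data of a truncating function and a spatially localized Lipschitz test function. -/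
structure Tst {N : ℕ} (g : ℝ → ℝ) (φ : Spc N → ℝ × ℝ → ℝ) (L Φ R : ℝ) : Prop where
  L0 : 0 ≤ L
  glip : ∀ r r', |g r - g r'| ≤ L * |r - r'|
  cont : Continuous (Function.uncurry φ)
  bd : ∀ x π, |φ x π| ≤ Φ
  lip : ∀ x y π, |φ x π - φ y π| ≤ Φ * ‖x - y‖
  zero : ∀ x π, R ≤ ‖x‖ → φ x π = 0

namespace Tst
variable {N : ℕ} {g : ℝ → ℝ} {φ : Spc N → ℝ × ℝ → ℝ} {L Φ R M : ℝ}

lemma Phi0 (T : Tst g φ L Φ R) : 0 ≤ Φ := (abs_nonneg _).trans (T.bd 0 0)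

lemma gcont (T : Tst g φ L Φ R) : Continuous g := by
  refine (LipschitzWith.of_dist_le' (K := L) fun x y => ?_).continuous
  rw [Real.dist_eq, Real.dist_eq]; exact T.glip x y

lemma gbd (T : Tst g φ L Φ R) {r : ℝ} (hr : |r| ≤ M) : |g r| ≤ |g 0| + L * M := by
  have h1 := T.glip r 0
  rw [sub_zero] at h1
  have h2 := abs_sub_abs_le_abs_sub (g r) (g 0)
  have h3 := mul_le_mul_of_nonneg_left hr T.L0
  linarith

lemma Dq_zero (T : Tst g φ L Φ R) {ε : ℝ} (hε : 0 < ε) (hε1 : ε ≤ 1) (w : Spc N → ℝ × ℝ → ℝ) {X : XX N} (hz : ‖X.1‖ ≤ 1)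
    (hx : R + 1 ≤ ‖X.2.1‖) : Dq ε (fun x π => g (w x π) * φ x π) X = 0 := by
  have h1 : ‖X.2.1‖ ≤ ‖X.2.1 + ε • X.1‖ + ‖ε • X.1‖ := by
    have := norm_sub_le (X.2.1 + ε • X.1) (ε • X.1)
    rwa [add_sub_cancel_right] at this
  have h2 : ‖ε • X.1‖ ≤ 1 := by
    rw [norm_smul, Real.norm_of_nonneg hε.le]; nlinarith [norm_nonneg X.1]
  simp only [Dq, T.zero X.2.1 X.2.2 (by linarith), T.zero (X.2.1 + ε • X.1) X.2.2 (by linarith)]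
  simp

lemma sub_le (T : Tst g φ L Φ R) {w : Spc N → ℝ × ℝ → ℝ} (hw : ∀ x π, |w x π| ≤ M) (x y : Spc N) (π : ℝ × ℝ) :
    |g (w x π) * φ x π - g (w y π) * φ y π| ≤ L * Φ * |w x π - w y π| + (|g 0| + L * M) * Φ * ‖x - y‖ := by
  have e : g (w x π) * φ x π - g (w y π) * φ y π = (g (w x π) - g (w y π)) * φ x π + g (w y π) * (φ x π - φ y π) := by ring
  rw [e]
  refine (abs_add_le _ _).trans (add_le_add ?_ ?_)
  · rw [abs_mul]
    calc _ ≤ (L * |w x π - w y π|) * Φ := mul_le_mul (T.glip _ _) (T.bd _ _) (abs_nonneg _) (mul_nonneg T.L0 (abs_nonneg _))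
      _ = _ := by ring
  · rw [abs_mul, mul_assoc]
    exact mul_le_mul (T.gbd (hw y π)) (T.lip _ _ _) (abs_nonneg _) ((abs_nonneg _).trans (T.gbd (hw y π)))

lemma Dq_le (T : Tst g φ L Φ R) {ε : ℝ} (hε : 0 < ε) {w : Spc N → ℝ × ℝ → ℝ} (hw : ∀ x π, |w x π| ≤ M) {X : XX N} (hz : ‖X.1‖ ≤ 1) :
    |Dq ε (fun x π => g (w x π) * φ x π) X| ≤ L * Φ * |Dq ε w X| + (|g 0| + L * M) * Φ := by
  have h := T.sub_le hw (X.2.1 + ε • X.1) X.2.1 X.2.2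
  rw [add_sub_cancel_left, norm_smul, Real.norm_of_nonneg hε.le] at h
  have h0 : 0 ≤ (|g 0| + L * M) * Φ := mul_nonneg ((abs_nonneg _).trans (T.gbd (hw 0 0))) T.Phi0
  simp only [Dq]
  rw [abs_div, abs_div, abs_of_pos hε, div_le_iff₀ hε]
  refine h.trans ?_
  have : (|g 0| + L * M) * Φ * (ε * ‖X.1‖) ≤ (|g 0| + L * M) * Φ * ε := by gcongr; nlinarith
  have e : L * Φ * (|w (X.2.1 + ε • X.1) X.2.2 - w X.2.1 X.2.2| / ε) * ε = L * Φ * |w (X.2.1 + ε • X.1) X.2.2 - w X.2.1 X.2.2| := by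
    field_simp
  refine (add_le_add le_rfl this).trans (le_of_eq ?_)
  rw [← e]; ring

lemma one_le_wt {x : Spc N} (hx : ‖x‖ ≤ R + 1) : 1 ≤ Real.exp (R + 1) * wt x := by
  rw [wt, ← Real.exp_add, Real.one_le_exp_iff]; linarith

lemma Dq_le_wt (T : Tst g φ L Φ R) {ε : ℝ} (hε : 0 < ε) (hε1 : ε ≤ 1) {w : Spc N → ℝ × ℝ → ℝ} (hw : ∀ x π, |w x π| ≤ M) {X : XX N}
    (hz : ‖X.1‖ ≤ 1) :
    |Dq ε (fun x π => g (w x π) * φ x π) X| ≤ Real.exp (R + 1) * (L * Φ * |Dq ε w X| + (|g 0| + L * M) * Φ) * wt X.2.1 := by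
  have h0 := (abs_nonneg _).trans (T.Dq_le hε hw hz)
  rcases le_total ‖X.2.1‖ (R + 1) with h | h
  · have := one_le_wt h
    have := T.Dq_le hε hw hz
    nlinarith
  · rw [T.Dq_zero hε hε1 w hz h, abs_zero]
    have := (wt_pos X.2.1).le
    positivity

lemma abs_le_wt (T : Tst g φ L Φ R) {w : Spc N → ℝ × ℝ → ℝ} (hw : ∀ x π, |w x π| ≤ M) (x : Spc N) (π : ℝ × ℝ) :
    |g (w x π) * φ x π| ≤ (|g 0| + L * M) * Φ * Real.exp (R + 1) * wt x := by
  have h0 : 0 ≤ (|g 0| + L * M) := (abs_nonneg _).trans (T.gbd (hw x π))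
  have h1 : |g (w x π) * φ x π| ≤ (|g 0| + L * M) * Φ := by
    rw [abs_mul]; exact mul_le_mul (T.gbd (hw x π)) (T.bd _ _) (abs_nonneg _) h0
  rcases le_total ‖x‖ (R + 1) with h | h
  · have := one_le_wt h
    have := (abs_nonneg _).trans h1
    nlinarith
  · rw [T.zero x π (by linarith), mul_zero, abs_zero]
    have := (wt_pos x).le
    have := T.Phi0
    positivity

end Tst

section
variable {N : ℕ} {p : ℝ} {ν : Measure (Spc N)} {κ : Measure (ℝ × ℝ)} [IsFiniteMeasure κ] [IsFiniteMeasure ν]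
  {ε : ℕ → ℝ} {ψ : ℕ → Spc N → ℝ × ℝ → ℝ} {v : Spc N → ℝ × ℝ → ℝ} {M K : ℝ} {g : ℝ → ℝ} {φ : Spc N → ℝ × ℝ → ℝ} {L Φ R : ℝ}

/-- pointwise estimate of flux differences. -/
lemma flux_pointwise (hp : 2 ≤ p) {η A P D C2 B : ℝ} (hη : 0 < η) (hK0 : 0 ≤ K) (hC2 : 0 ≤ C2) (hP : |P| ≤ K) (hB : |B| ≤ K)
    (hD : |D| ≤ C2 * (|A - B| + 1)) :
    |(Psi p A - Psi p P) * D| ≤ (p - 1) * C2 * (η * 2 ^ p * (2 * K + 1) ^ p + (η * 2 ^ p + η ^ (1 - p)) * |A - P| ^ p) := by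
  set d := |A - P| with hd
  have hd0 : 0 ≤ d := abs_nonneg _
  have hA : |A| ≤ d + (2 * K + 1) := by
    have := abs_add_le (A - P) P
    rw [sub_add_cancel] at this; linarith
  have h1 := Psi_lip hp hA (hP.trans (by linarith : K ≤ d + (2 * K + 1)))
  have h2 : |A - B| + 1 ≤ d + (2 * K + 1) := by
    have e : A - B = (A - P) + (P - B) := by ring
    have k1 := abs_add_le (A - P) (P - B)
    have k2 := abs_sub P B
    rw [e]; linarith
  have hS : 0 < d + (2 * K + 1) := by linarith
  have h3 := rpow_mul_le_young hp hη hS.le hd0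
  have h4 := add_rpow_le_two hp hd0 (by linarith : 0 ≤ 2 * K + 1)
  have e1 : (d + (2 * K + 1)) ^ (p - 1) = (d + (2 * K + 1)) ^ (p - 2) * (d + (2 * K + 1)) := by
    rw [← Real.rpow_add_one hS.ne']; ring_nf
  have hp1 : 0 ≤ p - 1 := by linarith
  rw [abs_mul]
  calc |Psi p A - Psi p P| * |D| ≤ ((p - 1) * (d + (2 * K + 1)) ^ (p - 2) * d) * (C2 * (d + (2 * K + 1))) := by
        refine mul_le_mul h1 (hD.trans (by gcongr)) (abs_nonneg _) (by positivity)
    _ = (p - 1) * C2 * ((d + (2 * K + 1)) ^ (p - 1) * d) := by rw [e1]; ring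
    _ ≤ (p - 1) * C2 * (η * (2 ^ p * (d ^ p + (2 * K + 1) ^ p)) + η ^ (1 - p) * d ^ p) := by
        gcongr
        exact h3.trans (by gcongr)
    _ = _ := by ring

/-- discrete gradients converge strongly to the limiting directional derivative. -/
lemma GConv.strong_Dlim (hp : 2 ≤ p) (hν : Kern p ν) (h : GConv ε ψ v M K)
    (hQ : Tendsto (fun n => ∫ X, wt X.2.1 * |Dq (ε n) (ψ n) X - Dq (ε n) v X| ^ p ∂LL ν κ) atTop (𝓝 0)) :
    Tendsto (fun n => ∫ X, wt X.2.1 * |Dq (ε n) (ψ n) X - Dlim v X| ^ p ∂LL ν κ) atTop (𝓝 0) := by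
  have hwtm : Measurable fun X : XX N => wt X.2.1 := continuous_wt.measurable.comp (by fun_prop)
  have hpc : Continuous fun s : ℝ => |s| ^ p := continuous_abs.rpow_const fun x => Or.inr (by linarith)
  have hA := fun n => measurable_Dq (ε := ε n) (h.meas n)
  have hBm := fun n => measurable_Dq (ε := ε n) h.measv
  have hDl := measurable_Dlim h.vcont
  have hM0 := h.M0
  have hK0 := h.K0
  have hBK : ∀ n, ∀ᵐ X ∂LL ν κ, |Dq (ε n) v X| ≤ K := fun n => by
    filter_upwards [ae_norm_le_one hν (κ := κ)] with X hX
    exact (abs_Dq_le_lip (h.pos n) h.vlip X).trans (by nlinarith [h.K0])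
  have hDlb : ∀ᵐ X ∂LL ν κ, |Dlim v X| ≤ K := by
    filter_upwards [ae_norm_le_one hν (κ := κ)] with X hX
    exact (abs_Dlim_le h.K0 h.vlip X).trans (by nlinarith [h.K0])
  have j1m : ∀ n, AEStronglyMeasurable (fun X => wt X.2.1 * |Dq (ε n) v X - Dlim v X| ^ p) (LL ν κ) := fun n =>
    (hwtm.mul (hpc.measurable.comp ((hBm n).sub hDl))).aestronglyMeasurable
  have j1b : ∀ n, ∀ᵐ X ∂LL ν κ, |wt X.2.1 * |Dq (ε n) v X - Dlim v X| ^ p| ≤ (2 * K) ^ p * wt X.2.1 := fun n => by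
    filter_upwards [hBK n, hDlb] with X h1 h2
    rw [abs_mul, abs_of_pos (wt_pos _), mul_comm, abs_of_nonneg (by positivity)]
    have := abs_sub (Dq (ε n) v X) (Dlim v X)
    exact mul_le_mul_of_nonneg_right (Real.rpow_le_rpow (abs_nonneg _) (by linarith) (by linarith)) (wt_pos _).le
  have j1 : Tendsto (fun n => ∫ X, wt X.2.1 * |Dq (ε n) v X - Dlim v X| ^ p ∂LL ν κ) atTop (𝓝 0) := by
    refine tendsto_integral_zero_of_le_wt j1m j1b ?_
    filter_upwards [ae_tendsto_Dq (ν := ν) (κ := κ) h.vcont h.vlip h.pos h.lim] with X hX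
    have h1 := ((hpc.tendsto 0).comp (tendsto_sub_nhds_zero_iff.2 hX)).const_mul (wt X.2.1)
    simpa [Real.zero_rpow (by linarith : p ≠ 0)] using h1
  have i1 : ∀ n, Integrable (fun X => wt X.2.1 * |Dq (ε n) (ψ n) X - Dq (ε n) v X| ^ p) (LL ν κ) := fun n => by
    have := h.pos n
    refine integrable_of_le_wt (C := (2 * (2 * M / ε n)) ^ p) (hwtm.mul (hpc.measurable.comp ((hA n).sub (hBm n)))).aestronglyMeasurable (ae_of_all _ fun X => ?_)
    rw [abs_mul, abs_of_pos (wt_pos _), mul_comm, abs_of_nonneg (by positivity)]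
    refine mul_le_mul_of_nonneg_right (Real.rpow_le_rpow (abs_nonneg _) ?_ (by linarith)) (wt_pos _).le
    have k1 := abs_Dq_le (h.pos n) (h.bd n) X
    have k2 := abs_Dq_le (h.pos n) h.vbd X
    have := abs_sub (Dq (ε n) (ψ n) X) (Dq (ε n) v X); linarith
  have i2 := fun n => integrable_of_le_wt (j1m n) (j1b n)
  refine squeeze_zero (fun n => integral_nonneg fun X => mul_nonneg (wt_pos _).le (by positivity)) (fun n => ?_)
    (by simpa using (hQ.add j1).const_mul (2 ^ p))
  have hle : ∀ X : XX N, wt X.2.1 * |Dq (ε n) (ψ n) X - Dlim v X| ^ p ≤ 2 ^ p * (wt X.2.1 * |Dq (ε n) (ψ n) X - Dq (ε n) v X| ^ p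
      + wt X.2.1 * |Dq (ε n) v X - Dlim v X| ^ p) := fun X => by
    have e : Dq (ε n) (ψ n) X - Dlim v X = (Dq (ε n) (ψ n) X - Dq (ε n) v X) + (Dq (ε n) v X - Dlim v X) := by ring
    have k1 : |Dq (ε n) (ψ n) X - Dlim v X| ^ p ≤ _ := (Real.rpow_le_rpow (abs_nonneg _) (by rw [e]; exact abs_add_le _ _) (by linarith)).trans
      (add_rpow_le_two hp (abs_nonneg _) (abs_nonneg (Dq (ε n) v X - Dlim v X)))
    have := mul_le_mul_of_nonneg_left k1 (wt_pos X.2.1).le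
    refine this.trans (le_of_eq (by ring))
  have i3 := ((i1 n).add (i2 n)).const_mul (2 ^ p)
  have hintg : Integrable (fun X => wt X.2.1 * |Dq (ε n) (ψ n) X - Dlim v X| ^ p) (LL ν κ) := by
    refine i3.mono' (hwtm.mul (hpc.measurable.comp ((hA n).sub hDl))).aestronglyMeasurable (ae_of_all _ fun X => ?_)
    rw [Real.norm_of_nonneg (mul_nonneg (wt_pos _).le (by positivity))]
    exact hle X
  refine (integral_mono hintg i3 hle).trans (le_of_eq ?_)
  simp only [Pi.add_apply]
  rw [integral_const_mul, integral_add (i1 n) (i2 n)]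

end

section
variable {N : ℕ} {p : ℝ} {ν : Measure (Spc N)} {κ : Measure (ℝ × ℝ)} [IsFiniteMeasure κ] [IsFiniteMeasure ν]
  {ε : ℕ → ℝ} {ψ : ℕ → Spc N → ℝ × ℝ → ℝ} {v : Spc N → ℝ × ℝ → ℝ} {M K : ℝ} {g : ℝ → ℝ} {φ : Spc N → ℝ × ℝ → ℝ} {L Φ R : ℝ}

/-- limit of the discrete fluxes. -/
lemma GConv.flux (hp : 2 ≤ p) (hν : Kern p ν) (h : GConv ε ψ v M K) (T : Tst g φ L Φ R)
    (hQ : Tendsto (fun n => ∫ X, wt X.2.1 * |Dq (ε n) (ψ n) X - Dq (ε n) v X| ^ p ∂LL ν κ) atTop (𝓝 0)) {C1 : ℝ}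
    (hC1 : ∀ n, ∫ X, wt X.2.1 * Dq (ε n) (fun x π => ψ n x π - v x π) X ^ 2 ∂LL ν κ ≤ C1) :
    Tendsto (fun n => ∫ X, Psi p (Dq (ε n) (ψ n) X) * Dq (ε n) (fun x π => g (ψ n x π) * φ x π) X ∂LL ν κ) atTop
      (𝓝 (∫ X, Psi p (Dlim v X) * Dlim (fun x π => g (v x π) * φ x π) X ∂LL ν κ)) := by
  have hwtm : Measurable fun X : XX N => wt X.2.1 := continuous_wt.measurable.comp (by fun_prop)
  have hpc : Continuous fun s : ℝ => |s| ^ p := continuous_abs.rpow_const fun x => Or.inr (by linarith)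
  have hΨc := (continuous_Psi hp).measurable
  have hM0 := h.M0
  have hK0 := h.K0
  have hL0 := T.L0
  have hΦ0 := T.Phi0
  have hA := fun n => measurable_Dq (ε := ε n) (h.meas n)
  have hBm := fun n => measurable_Dq (ε := ε n) h.measv
  have hDl := measurable_Dlim h.vcont
  have hBK : ∀ n, ∀ᵐ X ∂LL ν κ, |Dq (ε n) v X| ≤ K := fun n => by
    filter_upwards [ae_norm_le_one hν (κ := κ)] with X hX
    exact (abs_Dq_le_lip (h.pos n) h.vlip X).trans (by nlinarith)
  have hDlb : ∀ᵐ X ∂LL ν κ, |Dlim v X| ≤ K := by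
    filter_upwards [ae_norm_le_one hν (κ := κ)] with X hX
    exact (abs_Dlim_le hK0 h.vlip X).trans (by nlinarith)
  have hQD := h.strong_Dlim hp hν hQ
  set Γ : ℝ := |g 0| + L * M with hΓ
  have hΓ0 : 0 ≤ Γ := by positivity
  set E : ℝ := Real.exp (R + 1) with hE
  have hE0 : 0 < E := Real.exp_pos _
  set C2 : ℝ := L * Φ * (1 + K) + Γ * Φ with hC2
  have hC20 : 0 ≤ C2 := by positivity
  set ζ : ℕ → Spc N → ℝ × ℝ → ℝ := fun n x π => g (ψ n x π) * φ x π with hζ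
  set ζ' : Spc N → ℝ × ℝ → ℝ := fun x π => g (v x π) * φ x π with hζ'
  have hζm : ∀ n, Measurable (Function.uncurry (ζ n)) := fun n => (T.gcont.measurable.comp (h.meas n)).mul T.cont.measurable
  have hζ'c : Continuous (Function.uncurry ζ') := (T.gcont.comp h.vcont).mul T.cont
  have hζ'lip : ∀ x y π, |ζ' x π - ζ' y π| ≤ C2 * ‖x - y‖ := fun x y π => by
    refine (T.sub_le h.vbd x y π).trans ?_
    have := mul_le_mul_of_nonneg_left (h.vlip x y π) (by positivity : 0 ≤ L * Φ)
    have : 0 ≤ L * Φ * ‖x - y‖ := by positivity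
    rw [hC2]; linarith
  -- bounds of the test quotients
  have hDζ : ∀ n, ∀ᵐ X ∂LL ν κ, |Dq (ε n) (ζ n) X| ≤ (wt X.2.1 * E * C2) * (|Dq (ε n) (ψ n) X - Dq (ε n) v X| + 1) := fun n => by
    filter_upwards [ae_norm_le_one hν (κ := κ), hBK n] with X hX hB
    refine (T.Dq_le_wt (h.pos n) (h.le_one n) (h.bd n) hX).trans ?_
    have k1 : |Dq (ε n) (ψ n) X| ≤ |Dq (ε n) (ψ n) X - Dq (ε n) v X| + K := by
      have := abs_add_le (Dq (ε n) (ψ n) X - Dq (ε n) v X) (Dq (ε n) v X)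
      rw [sub_add_cancel] at this; linarith
    have k2 : L * Φ * |Dq (ε n) (ψ n) X| + Γ * Φ ≤ C2 * (|Dq (ε n) (ψ n) X - Dq (ε n) v X| + 1) := by
      have a1 := mul_le_mul_of_nonneg_left k1 (by positivity : 0 ≤ L * Φ)
      have a2 : 0 ≤ L * Φ * K * |Dq (ε n) (ψ n) X - Dq (ε n) v X| := by positivity
      have a3 : 0 ≤ Γ * Φ * |Dq (ε n) (ψ n) X - Dq (ε n) v X| := by positivity
      have a4 : 0 ≤ L * Φ := by positivity
      rw [hC2]; linarith
    have hw := (wt_pos X.2.1).le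
    calc _ ≤ E * (C2 * (|Dq (ε n) (ψ n) X - Dq (ε n) v X| + 1)) * wt X.2.1 := by gcongr
      _ = _ := by ring
  have hDζ' : ∀ n, ∀ᵐ X ∂LL ν κ, |Dq (ε n) ζ' X| ≤ E * C2 * wt X.2.1 := fun n => by
    filter_upwards [ae_norm_le_one hν (κ := κ), hBK n] with X hX hB
    refine (T.Dq_le_wt (h.pos n) (h.le_one n) h.vbd hX).trans ?_
    have k2 : L * Φ * |Dq (ε n) v X| + Γ * Φ ≤ C2 := by
      have a1 := mul_le_mul_of_nonneg_left hB (by positivity : 0 ≤ L * Φ)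
      have a4 : 0 ≤ L * Φ := by positivity
      rw [hC2]; linarith
    have hw := (wt_pos X.2.1).le
    gcongr
  -- the three pieces
  set P : XX N → ℝ := fun X => Psi p (Dlim v X) with hP
  have hPm : Measurable P := hΨc.comp hDl
  have hPb : ∀ᵐ X ∂LL ν κ, |P X| ≤ K ^ (p - 1) := by
    filter_upwards [hDlb] with X hX using abs_Psi_le hp hX
  set e : ℕ → Spc N → ℝ × ℝ → ℝ := fun n x π => ζ n x π - ζ' x π with he
  have hem : ∀ n, Measurable (Function.uncurry (e n)) := fun n => (hζm n).sub hζ'c.measurable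
  have hAB : ∀ n X, |Dq (ε n) (ψ n) X - Dq (ε n) v X| ≤ 2 * (2 * M / ε n) := fun n X => by
    have k1 := abs_Dq_le (h.pos n) (h.bd n) X
    have k2 := abs_Dq_le (h.pos n) h.vbd X
    have := abs_sub (Dq (ε n) (ψ n) X) (Dq (ε n) v X); linarith
  have i1 : ∀ n, Integrable (fun X => (Psi p (Dq (ε n) (ψ n) X) - P X) * Dq (ε n) (ζ n) X) (LL ν κ) := fun n => by
    have := h.pos n
    refine integrable_of_le_wt (C := ((2 * M / ε n) ^ (p - 1) + K ^ (p - 1)) * (E * C2 * (2 * (2 * M / ε n) + 1)))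
      (((hΨc.comp (hA n)).sub hPm).mul (measurable_Dq (hζm n))).aestronglyMeasurable ?_
    filter_upwards [hPb, hDζ n] with X k1 k2
    have hw := (wt_pos X.2.1).le
    rw [abs_mul, mul_assoc]
    refine mul_le_mul ((abs_sub _ _).trans (add_le_add (abs_Psi_le hp (abs_Dq_le (h.pos n) (h.bd n) X)) k1)) (k2.trans ?_) (abs_nonneg _) (by positivity)
    calc _ ≤ (wt X.2.1 * E * C2) * (2 * (2 * M / ε n) + 1) := by gcongr; exact hAB n X
      _ = _ := by ring
  have i3 : ∀ n, Integrable (fun X => P X * Dq (ε n) ζ' X) (LL ν κ) := fun n => by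
    refine integrable_of_le_wt (C := K ^ (p - 1) * (E * C2)) (hPm.mul (measurable_Dq hζ'c.measurable)).aestronglyMeasurable ?_
    filter_upwards [hPb, hDζ' n] with X k1 k2
    rw [abs_mul, mul_assoc]
    exact mul_le_mul k1 k2 (abs_nonneg _) (by positivity)
  have hDe : ∀ n, ∀ᵐ X ∂LL ν κ, |Dq (ε n) (e n) X| ≤ (2 * E * C2) * (|Dq (ε n) (ψ n) X - Dq (ε n) v X| + 1) * wt X.2.1 := fun n => by
    filter_upwards [hDζ n, hDζ' n] with X k1 k2
    rw [he, Dq_sub]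
    refine (abs_sub _ _).trans ((add_le_add k1 k2).trans ?_)
    have := (wt_pos X.2.1).le
    have : 0 ≤ E * C2 * wt X.2.1 * |Dq (ε n) (ψ n) X - Dq (ε n) v X| := by positivity
    nlinarith
  have i2 : ∀ n, Integrable (fun X => P X * Dq (ε n) (e n) X) (LL ν κ) := fun n => by
    have := h.pos n
    refine integrable_of_le_wt (C := K ^ (p - 1) * ((2 * E * C2) * (2 * (2 * M / ε n) + 1))) (hPm.mul (measurable_Dq (hem n))).aestronglyMeasurable ?_
    filter_upwards [hPb, hDe n] with X k1 k2
    have hw := (wt_pos X.2.1).le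
    rw [abs_mul, mul_assoc]
    refine mul_le_mul k1 (k2.trans ?_) (abs_nonneg _) (by positivity)
    gcongr
    exact hAB n X
  have split : ∀ n, ∫ X, Psi p (Dq (ε n) (ψ n) X) * Dq (ε n) (ζ n) X ∂LL ν κ =
      (∫ X, (Psi p (Dq (ε n) (ψ n) X) - P X) * Dq (ε n) (ζ n) X ∂LL ν κ) + (∫ X, P X * Dq (ε n) (e n) X ∂LL ν κ)
        + ∫ X, P X * Dq (ε n) ζ' X ∂LL ν κ := fun n => by
    rw [← integral_add' (i1 n) (i2 n), ← integral_add' ((i1 n).add (i2 n)) (i3 n)]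
    refine integral_congr_ae (ae_of_all _ fun X => ?_)
    simp only [he, Dq_sub, Pi.add_apply]
    ring
  -- first piece
  have t1 : Tendsto (fun n => ∫ X, (Psi p (Dq (ε n) (ψ n) X) - P X) * Dq (ε n) (ζ n) X ∂LL ν κ) atTop (𝓝 0) := by
    have jd : ∀ n, Integrable (fun X => wt X.2.1 * |Dq (ε n) (ψ n) X - Dlim v X| ^ p) (LL ν κ) := fun n => by
      have := h.pos n
      refine integrable_of_le_wt (C := (2 * M / ε n + K) ^ p) (hwtm.mul (hpc.measurable.comp ((hA n).sub hDl))).aestronglyMeasurable ?_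
      filter_upwards [hDlb] with X hX
      rw [abs_mul, abs_of_pos (wt_pos _), mul_comm, abs_of_nonneg (by positivity)]
      refine mul_le_mul_of_nonneg_right (Real.rpow_le_rpow (abs_nonneg _) ?_ (by linarith)) (wt_pos _).le
      exact (abs_sub _ _).trans (add_le_add (abs_Dq_le (h.pos n) (h.bd n) X) hX)
    refine (tendsto_zero_iff_abs_tendsto_zero _).2 ?_
    refine tendsto_zero_of_forall_le (η0 := 1) (C := (p - 1) * (E * C2) * (2 ^ p * (2 * K + 1) ^ p) * ∫ X, wt X.2.1 ∂LL ν κ)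
      (fun n => abs_nonneg _) one_pos fun η hη _ => ?_
    refine ⟨fun n => (p - 1) * (E * C2) * (η * 2 ^ p + η ^ (1 - p)) * ∫ X, wt X.2.1 * |Dq (ε n) (ψ n) X - Dlim v X| ^ p ∂LL ν κ, ?_, fun n => ?_⟩
    · have := hQD.const_mul ((p - 1) * (E * C2) * (η * 2 ^ p + η ^ (1 - p)))
      rw [mul_zero] at this
      exact this
    have hb : ∀ᵐ X ∂LL ν κ, ‖(Psi p (Dq (ε n) (ψ n) X) - P X) * Dq (ε n) (ζ n) X‖ ≤
        (p - 1) * (E * C2) * (η * (2 ^ p * (2 * K + 1) ^ p)) * wt X.2.1 +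
        (p - 1) * (E * C2) * (η * 2 ^ p + η ^ (1 - p)) * (wt X.2.1 * |Dq (ε n) (ψ n) X - Dlim v X| ^ p) := by
      filter_upwards [hDlb, hBK n, hDζ n] with X k1 k2 k3
      have hw := (wt_pos X.2.1).le
      refine (flux_pointwise hp hη hK0 (by positivity) k1 k2 k3).trans (le_of_eq (by ring))
    refine (norm_integral_le_of_norm_le ((integrable_wt_X.const_mul _).add ((jd n).const_mul _)) hb).trans (le_of_eq ?_)
    rw [integral_add' (integrable_wt_X.const_mul _) ((jd n).const_mul _), integral_const_mul, integral_const_mul]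
    ring
  have t2 : Tendsto (fun n => ∫ X, P X * Dq (ε n) (e n) X ∂LL ν κ) atTop (𝓝 0) := by
    have hd2 : ∀ n, Integrable (fun X => wt X.2.1 * Dq (ε n) (fun x π => ψ n x π - v x π) X ^ 2) (LL ν κ) := fun n => by
      refine integrable_of_le_wt (C := (2 * (2 * M / ε n)) ^ 2) (hwtm.mul ((measurable_Dq (h.meas_sub n)).pow_const 2)).aestronglyMeasurable
        (ae_of_all _ fun X => ?_)
      rw [abs_mul, abs_of_pos (wt_pos _), mul_comm, abs_of_nonneg (by positivity), Dq_sub, ← sq_abs]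
      have := (wt_pos X.2.1).le
      have := hAB n X
      gcongr
    have hCe : ∀ n, ∫ X, wt X.2.1 * Dq (ε n) (e n) X ^ 2 ∂LL ν κ ≤ 2 * (2 * E * C2) ^ 2 * (C1 + ∫ X, wt X.2.1 ∂LL ν κ) := fun n => by
      have hb : ∀ᵐ X ∂LL ν κ, wt X.2.1 * Dq (ε n) (e n) X ^ 2 ≤
          2 * (2 * E * C2) ^ 2 * (wt X.2.1 * Dq (ε n) (fun x π => ψ n x π - v x π) X ^ 2 + wt X.2.1) := by
        filter_upwards [hDe n] with X k1
        rw [Dq_sub (ε n) (ψ n) v, ← sq_abs (Dq (ε n) (ψ n) X - Dq (ε n) v X), ← sq_abs (Dq (ε n) (e n) X)]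
        set a := |Dq (ε n) (ψ n) X - Dq (ε n) v X|
        have ha : 0 ≤ a := abs_nonneg _
        have hw := (wt_pos X.2.1).le
        have k2 : |Dq (ε n) (e n) X| ≤ (2 * E * C2) * (a + 1) :=
          k1.trans (mul_le_of_le_one_right (by positivity) (wt_le_one _))
        have k3 := pow_le_pow_left₀ (abs_nonneg _) k2 2
        have k4 : ((2 * E * C2) * (a + 1)) ^ 2 ≤ 2 * (2 * E * C2) ^ 2 * (a ^ 2 + 1) := by
          have : 0 ≤ (2 * E * C2) ^ 2 * (a - 1) ^ 2 := by positivity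
          nlinarith
        refine (mul_le_mul_of_nonneg_left (k3.trans k4) hw).trans (le_of_eq (by ring))
      have i5 := ((hd2 n).add integrable_wt_X).const_mul (2 * (2 * E * C2) ^ 2)
      have hi : Integrable (fun X => wt X.2.1 * Dq (ε n) (e n) X ^ 2) (LL ν κ) := by
        refine i5.mono' (hwtm.mul ((measurable_Dq (hem n)).pow_const 2)).aestronglyMeasurable ?_
        filter_upwards [hb] with X hX
        rwa [Real.norm_of_nonneg (mul_nonneg (wt_pos _).le (sq_nonneg _))]
      refine (integral_mono_ae hi i5 hb).trans ?_
      simp only [Pi.add_apply]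
      rw [integral_const_mul, integral_add (hd2 n) integrable_wt_X]
      have := hC1 n
      gcongr
    have heb : ∀ n x π, |e n x π| ≤ 2 * (Γ * Φ) := fun n x π => by
      have k1 : ∀ r, |r| ≤ M → |g r * φ x π| ≤ Γ * Φ := fun r hr => by
        rw [abs_mul]; exact mul_le_mul (T.gbd hr) (T.bd _ _) (abs_nonneg _) hΓ0
      refine (abs_sub _ _).trans ?_
      have := k1 _ (h.bd n x π)
      have := k1 _ (h.vbd x π)
      simp only [hζ, hζ']
      linarith
    have he0 : ∀ x π, Tendsto (fun n => e n x π) atTop (𝓝 0) := fun x π => by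
      have := ((T.gcont.tendsto _).comp (h.conv (fun _ => x) x π tendsto_const_nhds)).mul_const (φ x π)
      exact tendsto_sub_nhds_zero_iff.2 this
    have hset : MeasurableSet {X : XX N | ‖X.2.1‖ ≤ R + 1} := measurableSet_le (by fun_prop) measurable_const
    set H : XX N → ℝ := fun X => P X * {X : XX N | ‖X.2.1‖ ≤ R + 1}.indicator (fun X => (wt X.2.1)⁻¹) X with hH
    have hHm : Measurable H := hPm.mul (hwtm.inv.indicator hset)
    have hHb : ∀ᵐ X ∂LL ν κ, |H X| ≤ K ^ (p - 1) * E := by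
      filter_upwards [hPb] with X k1
      rw [hH, abs_mul]
      refine mul_le_mul k1 ?_ (abs_nonneg _) (by positivity)
      by_cases hx : ‖X.2.1‖ ≤ R + 1
      · rw [indicator_of_mem (by exact hx), abs_of_pos (inv_pos.2 (wt_pos _)), inv_le_iff_one_le_mul₀ (wt_pos _)]
        exact Tst.one_le_wt hx
      · rw [indicator_of_notMem (by exact hx), abs_zero]; exact hE0.le
    refine (tendsto_integral_mul_Dq hν h.pos h.le_one hem heb he0 hHm hHb hCe).congr fun n => integral_congr_ae ?_
    filter_upwards [ae_norm_le_one hν (κ := κ)] with X hX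
    by_cases hx : ‖X.2.1‖ ≤ R + 1
    · have hw := (wt_pos X.2.1).ne'
      rw [hH]
      simp only
      rw [indicator_of_mem (by exact hx)]
      field_simp
    · have hx' : R + 1 ≤ ‖X.2.1‖ := (not_le.1 hx).le
      have z1 : Dq (ε n) (e n) X = 0 := by
        rw [he]; simp only
        rw [Dq_sub, T.Dq_zero (h.pos n) (h.le_one n) (ψ n) hX hx', T.Dq_zero (h.pos n) (h.le_one n) v hX hx', sub_zero]
      rw [z1]; ring
  have t3 : Tendsto (fun n => ∫ X, P X * Dq (ε n) ζ' X ∂LL ν κ) atTop (𝓝 (∫ X, P X * Dlim ζ' X ∂LL ν κ)) := by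
    refine tendsto_integral_of_dominated_convergence (fun X => K ^ (p - 1) * (E * C2) * wt X.2.1)
      (fun n => (hPm.mul (measurable_Dq hζ'c.measurable)).aestronglyMeasurable) (integrable_wt_X.const_mul _) (fun n => ?_) ?_
    · filter_upwards [hPb, hDζ' n] with X k1 k2
      rw [norm_mul, mul_assoc]
      exact mul_le_mul k1 k2 (abs_nonneg _) (by positivity)
    · filter_upwards [ae_tendsto_Dq (ν := ν) (κ := κ) hζ'c hζ'lip h.pos h.lim] with X hX
      exact hX.const_mul _
  have := (t1.add t2).add t3
  rw [add_zero, zero_add] at this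
  exact this.congr fun n => (split n).symm

end

/-- data of a function with controlled time derivative and compact support. -/
structure TimeTst {N : ℕ} (φ φt : Spc N → ℝ → ℝ) (Φ a' b' R : ℝ) : Prop where
  contt : Continuous (Function.uncurry φt)
  der : ∀ x t, HasDerivAt (φ x) (φt x t) t
  bdt : ∀ x t, |φt x t| ≤ Φ
  tzero : ∀ x t, t ∉ Icc a' b' → φ x t = 0
  xzero : ∀ x t, R ≤ ‖x‖ → φ x t = 0

lemma shift_by_parts {y q : ℝ → ℝ} {a b a' b' τ B : ℝ} (hy : Measurable y) (hb : ∀ r, a ≤ r → |y r| ≤ B) (hq : Continuous q)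
    (hz : ∀ t, t ∉ Icc a' b' → q t = 0) (hτ : 0 < τ) (ha : a ≤ a') (hbb : b' + τ ≤ b) :
    ∫ t in Icc a b, (y (t + τ) - y t) / τ * q t = - ∫ t in Icc a b, y t * ((q t - q (t - τ)) / τ) := by
  have hB : 0 ≤ B := (abs_nonneg _).trans (hb a le_rfl)
  have int : ∀ {F k : ℝ → ℝ}, Measurable F → Continuous k → (∀ r, a ≤ r → |F r| ≤ B) → IntegrableOn (fun t => F t * k t) (Icc a b) := by
    intro F k hF hk hFb
    obtain ⟨Ck, hCk⟩ := isCompact_Icc.exists_bound_of_continuousOn (hk.continuousOn (s := Icc a b))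
    refine Measure.integrableOn_of_bounded (M := B * Ck) (by simp) (hF.mul hk.measurable).aestronglyMeasurable ?_
    refine (ae_restrict_iff' measurableSet_Icc).2 (ae_of_all _ fun r hr => ?_)
    rw [norm_mul]
    exact mul_le_mul (hFb r hr.1) (hCk r hr) (norm_nonneg _) hB
  have hqs : Continuous fun t => q (t - τ) := by fun_prop
  have i1 := int (hy.comp (measurable_add_const τ)) hq fun r hr => hb (r + τ) (by linarith)
  have i2 := int hy hq hb
  have i3 := int hy hqs hb
  have e1 : ∫ t in Icc a b, y (t + τ) * q t = ∫ t in Icc a b, y t * q (t - τ) := by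
    rw [setIntegral_eq_integral_of_forall_compl_eq_zero, setIntegral_eq_integral_of_forall_compl_eq_zero,
      ← integral_add_right_eq_self (fun t => y t * q (t - τ)) τ]
    · simp only [add_sub_cancel_right]
    · intro t ht
      rw [hz, mul_zero]
      exact fun h => ht ⟨by linarith [h.1], by linarith [h.2]⟩
    · intro t ht
      rw [hz, mul_zero]
      exact fun h => ht ⟨by linarith [h.1], by linarith [h.2]⟩
  have e2 : ∀ t, (y (t + τ) - y t) / τ * q t = (y (t + τ) * q t - y t * q t) / τ := fun t => by ring
  have e3 : ∀ t, y t * ((q t - q (t - τ)) / τ) = (y t * q t - y t * q (t - τ)) / τ := fun t => by ring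
  simp only [e2, e3, integral_div]
  have i1' : Integrable (fun t => y (t + τ) * q t) (volume.restrict (Icc a b)) := i1
  rw [integral_sub i1' i2, integral_sub i2 i3, e1]
  ring

lemma integral_Y_congr_inner {N : ℕ} {μ : Measure (Spc N)} [SFinite μ] {a b : ℝ} {F1 F2 : Spc N × (ℝ × ℝ) → ℝ}
    (h1 : Integrable F1 (μ.prod (kap a b))) (h2 : Integrable F2 (μ.prod (kap a b)))
    (h : ∀ x σ, 0 ≤ σ → ∫ t in Icc a b, F1 (x, (t, σ)) = ∫ t in Icc a b, F2 (x, (t, σ))) :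
    ∫ y, F1 y ∂μ.prod (kap a b) = ∫ y, F2 y ∂μ.prod (kap a b) := by
  rw [integral_prod _ h1, integral_prod _ h2]
  refine integral_congr_ae ?_
  filter_upwards [h1.prod_right_ae, h2.prod_right_ae] with x k1 k2
  rw [integral_prod_symm _ k1, integral_prod_symm _ k2]
  refine integral_congr_ae ?_
  filter_upwards [ae_restrict_mem measurableSet_Icc] with σ hσ using h x σ hσ.1

lemma abs_primitive_sub_le {g G : ℝ → ℝ} {L : ℝ} (hg : ∀ r r', |g r - g r'| ≤ L * |r - r'|) (hG : ∀ r, HasDerivAt G (g r) r) (x y : ℝ) :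
    |G y - G x - g x * (y - x)| ≤ L * (y - x) ^ 2 := by
  have h : ∀ r ∈ uIcc x y, HasDerivWithinAt (fun r => G r - g x * r) (g r - g x) (uIcc x y) r := fun r _ => by
    have := ((hG r).sub ((hasDerivAt_id r).const_mul (g x))).hasDerivWithinAt (s := uIcc x y)
    rw [mul_one] at this
    exact this
  have hL : 0 ≤ L := by have := (abs_nonneg _).trans (hg 1 0); simpa using this
  have h2 := (convex_uIcc x y).norm_image_sub_le_of_norm_hasDerivWithin_le h (C := L * |y - x|) (fun r hr => ?_) left_mem_uIcc right_mem_uIcc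
  · simp only [Real.norm_eq_abs] at h2
    rw [← sq_abs]
    refine le_trans (le_of_eq ?_) (h2.trans (le_of_eq (by ring)))
    congr 1; ring
  · refine (hg _ _).trans ?_
    have := abs_sub_left_of_mem_uIcc hr
    gcongr

namespace TimeTst
variable {N : ℕ} {φ φt : Spc N → ℝ → ℝ} {Φ a' b' R : ℝ}

lemma Phi0 (T : TimeTst φ φt Φ a' b' R) : 0 ≤ Φ := (abs_nonneg _).trans (T.bdt 0 0)

lemma txzero (T : TimeTst φ φt Φ a' b' R) (x : Spc N) (t : ℝ) (hx : R ≤ ‖x‖) : φt x t = 0 := by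
  have h : φ x = fun _ => 0 := by ext t; exact T.xzero x t hx
  have h2 := T.der x t
  rw [h] at h2
  exact h2.unique (hasDerivAt_const t 0)

lemma lip (T : TimeTst φ φt Φ a' b' R) (x : Spc N) (t s : ℝ) : |φ x t - φ x s| ≤ Φ * |t - s| := by
  have := convex_univ.norm_image_sub_le_of_norm_hasDerivWithin_le (f := φ x) (f' := φt x) (x := s) (y := t)
    (fun r _ => (T.der x r).hasDerivWithinAt) (fun r _ => T.bdt x r) (mem_univ _) (mem_univ _)
  exact this

lemma le_wt_of_zero {N : ℕ} {C R : ℝ} {q : Spc N → ℝ} (hC : 0 ≤ C) {x : Spc N} (h : |q x| ≤ C) (hz : R ≤ ‖x‖ → q x = 0) :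
    |q x| ≤ C * Real.exp (R + 1) * wt x := by
  rcases le_total ‖x‖ R with hx | hx
  · have := Tst.one_le_wt (R := R) (x := x) (by linarith)
    nlinarith
  · rw [hz hx, abs_zero]
    have := (wt_pos x).le
    positivity

end TimeTst

section
variable {N : ℕ} {p : ℝ} {ν : Measure (Spc N)} {f : ℝ → ℝ} {ε τ s h : ℕ → ℝ} {U : ℕ → Spc N → ℝ → ℝ} {u : Spc N → ℝ → ℝ}
  {a b M K : ℝ} {φ φt : Spc N → ℝ → ℝ} {g G : ℝ → ℝ} {L Φ R a' b' : ℝ}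

set_option maxHeartbeats 1000000 in
/-- convergence of the time-difference term in the weak formulation. -/
lemma Appr.time_limit (H : Appr p ν f ε τ s U u a b M K) (hab : a ≤ b) (hh : ∀ n, 0 ≤ h n) (hh0 : Tendsto h atTop (𝓝 0))
    (T : Tst g (fun x (π : ℝ × ℝ) => φ x π.1) L Φ R) (T' : TimeTst φ φt Φ a' b' R) (hG : ∀ r, HasDerivAt G (g r) r)
    (ha' : a ≤ a') (hb' : b' < b) :
    Tendsto (fun n => ∫ y, tinc U τ h a b n y.1 y.2 * (g (psh U h a b n y.1 y.2) * φ y.1 y.2.1)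
      ∂((volume : Measure (Spc N)).prod (kap a b))) atTop
      (𝓝 (- ∫ y, G (vsh u a b y.1 y.2) * φt y.1 y.2.1 ∂((volume : Measure (Spc N)).prod (kap a b)))) := by
  have hM0 := H.M0
  have hc := H.gconv hab hh hh0
  have hGc : Continuous G := continuous_iff_continuousAt.2 fun r => (hG r).continuousAt
  have hgc := T.gcont
  have hφc : Continuous (Function.uncurry φ) := T.cont.comp (f := fun z : Spc N × ℝ => (z.1, (z.2, (0:ℝ)))) (by fun_prop)
  have hΦ := T'.Phi0
  obtain ⟨B, hB⟩ := isCompact_Icc.exists_bound_of_continuousOn (hGc.continuousOn (s := Icc 0 M))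
  have hB0 : 0 ≤ B := (norm_nonneg _).trans (hB 0 ⟨le_rfl, hM0⟩)
  have hφm : Measurable fun y : Spc N × (ℝ × ℝ) => φ y.1 y.2.1 := (hφc.comp (by fun_prop : Continuous fun y : Spc N × (ℝ × ℝ) => (y.1, y.2.1))).measurable
  have hφtm : Measurable fun y : Spc N × (ℝ × ℝ) => φt y.1 y.2.1 :=
    (T'.contt.comp (by fun_prop : Continuous fun y : Spc N × (ℝ × ℝ) => (y.1, y.2.1))).measurable
  have hφsm : ∀ n, Measurable fun y : Spc N × (ℝ × ℝ) => φ y.1 (y.2.1 - τ n) := fun n =>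
    (hφc.comp (by fun_prop : Continuous fun y : Spc N × (ℝ × ℝ) => (y.1, y.2.1 - τ n))).measurable
  set A : ℕ → Spc N × (ℝ × ℝ) → ℝ := fun n y => G (psh U h a b n y.1 y.2 + τ n * tinc U τ h a b n y.1 y.2) with hA
  set Bn : ℕ → Spc N × (ℝ × ℝ) → ℝ := fun n y => G (psh U h a b n y.1 y.2) with hBn
  have hup : ∀ n (y : Spc N × (ℝ × ℝ)), psh U h a b n y.1 y.2 + τ n * tinc U τ h a b n y.1 y.2 =
      U n y.1 (clamp a b y.2.1 + h n * clamp 0 1 y.2.2 + τ n) := fun n y => by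
    have := (H.tpos n).ne'
    simp only [psh, tinc]; field_simp; ring
  have hpm : ∀ n, Measurable fun y : Spc N × (ℝ × ℝ) => psh U h a b n y.1 y.2 := fun n => hc.meas n
  have htm : ∀ n, Measurable fun y : Spc N × (ℝ × ℝ) => tinc U τ h a b n y.1 y.2 := fun n => H.measurable_tinc n
  have hAm : ∀ n, Measurable (A n) := fun n => hGc.measurable.comp ((hpm n).add ((htm n).const_mul _))
  have hBm : ∀ n, Measurable (Bn n) := fun n => hGc.measurable.comp (hpm n)
  have hAb : ∀ n y, |A n y| ≤ B := fun n y => by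
    refine hB _ ?_
    rw [hup]
    have h0 := H.le_time (b := b) hh n y.2
    have := (H.tpos n).le
    exact ⟨H.nonneg n _ _ (by linarith), H.bd n _ _ (by linarith)⟩
  have hBb : ∀ n y, |Bn n y| ≤ B := fun n y => hB _ ⟨H.psh_nonneg hh n _ _, H.psh_le hh n _ _⟩
  have lewt : ∀ {C : ℝ} {q : Spc N → ℝ}, 0 ≤ C → ∀ x, |q x| ≤ C → (R ≤ ‖x‖ → q x = 0) → |q x| ≤ C * Real.exp (R + 1) * wt x :=
    fun hC x h hz => TimeTst.le_wt_of_zero hC h hz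
  -- the error in the chain rule
  have herr : Tendsto (fun n => ∫ y, (tinc U τ h a b n y.1 y.2 * (g (psh U h a b n y.1 y.2) * φ y.1 y.2.1) -
      (A n y - Bn n y) / τ n * φ y.1 y.2.1) ∂((volume : Measure (Spc N)).prod (kap a b))) atTop (𝓝 0) := by
    have hpt : ∀ n (y : Spc N × (ℝ × ℝ)), |tinc U τ h a b n y.1 y.2 * (g (psh U h a b n y.1 y.2) * φ y.1 y.2.1) -
      (A n y - Bn n y) / τ n * φ y.1 y.2.1| ≤ |s n| * (L * Φ * Real.exp (R + 1) * wt y.1) := fun n y => by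
      have ht := H.tpos n
      have k1 := abs_primitive_sub_le T.glip hG (psh U h a b n y.1 y.2) (psh U h a b n y.1 y.2 + τ n * tinc U τ h a b n y.1 y.2)
      have k2 := H.incr n y.1 _ (H.le_time (b := b) hh n y.2)
      have k3 : (τ n * tinc U τ h a b n y.1 y.2) ^ 2 ≤ |s n| * τ n := by
        have := hup n y
        have e : τ n * tinc U τ h a b n y.1 y.2 = U n y.1 (clamp a b y.2.1 + h n * clamp 0 1 y.2.2 + τ n) - psh U h a b n y.1 y.2 := by linarith
        rw [e]
        exact k2.trans (mul_le_mul_of_nonneg_right (le_abs_self _) ht.le)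
      rw [add_sub_cancel_left] at k1
      have e : tinc U τ h a b n y.1 y.2 * (g (psh U h a b n y.1 y.2) * φ y.1 y.2.1) - (A n y - Bn n y) / τ n * φ y.1 y.2.1 =
          -((A n y - Bn n y - g (psh U h a b n y.1 y.2) * (τ n * tinc U τ h a b n y.1 y.2)) / τ n * φ y.1 y.2.1) := by
        field_simp; ring
      have k4 : |(A n y - Bn n y - g (psh U h a b n y.1 y.2) * (τ n * tinc U τ h a b n y.1 y.2)) / τ n| ≤ L * |s n| := by
        rw [abs_div, abs_of_pos ht, div_le_iff₀ ht]
        refine k1.trans ?_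
        have := T.L0
        calc _ ≤ L * (|s n| * τ n) := by gcongr
          _ = _ := by ring
      have k5 := lewt (q := fun x => φ x y.2.1) hΦ y.1 (T.bd y.1 y.2) (T'.xzero y.1 y.2.1)
      rw [e, abs_neg, abs_mul]
      have := T.L0
      calc _ ≤ (L * |s n|) * (Φ * Real.exp (R + 1) * wt y.1) := mul_le_mul k4 k5 (abs_nonneg _) (by positivity)
        _ = _ := by ring
    have hs0 : Tendsto (fun n => |s n| * ∫ y : Spc N × (ℝ × ℝ), (L * Φ * Real.exp (R + 1) * wt y.1)
        ∂((volume : Measure (Spc N)).prod (kap a b))) atTop (𝓝 0) := by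
      have := H.slim.abs.mul_const (∫ y : Spc N × (ℝ × ℝ), (L * Φ * Real.exp (R + 1) * wt y.1) ∂((volume : Measure (Spc N)).prod (kap a b)))
      rw [abs_zero, zero_mul] at this
      exact this
    refine squeeze_zero_norm (fun n => ?_) hs0
    rw [← integral_const_mul]
    refine norm_integral_le_of_norm_le ((integrable_wt_Y.const_mul _).const_mul _) (ae_of_all _ fun y => hpt n y)
  have hφb : ∀ y : Spc N × (ℝ × ℝ), |φ y.1 y.2.1| ≤ Φ * Real.exp (R + 1) * wt y.1 := fun y =>
    lewt (q := fun x => φ x y.2.1) hΦ y.1 (T.bd y.1 y.2) (T'.xzero y.1 y.2.1)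
  have hqb : ∀ n (y : Spc N × (ℝ × ℝ)), |(φ y.1 y.2.1 - φ y.1 (y.2.1 - τ n)) / τ n| ≤ Φ * Real.exp (R + 1) * wt y.1 := fun n y => by
    have ht := H.tpos n
    refine lewt (q := fun x => (φ x y.2.1 - φ x (y.2.1 - τ n)) / τ n) hΦ y.1 ?_ fun hx => ?_
    · rw [abs_div, abs_of_pos ht, div_le_iff₀ ht]
      refine (T'.lip y.1 _ _).trans (le_of_eq ?_)
      rw [sub_sub_cancel, abs_of_pos ht]
    · simp only [T'.xzero _ _ hx, sub_self, zero_div]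
  have hid : ∀ n, Integrable (fun y : Spc N × (ℝ × ℝ) => (A n y - Bn n y) / τ n * φ y.1 y.2.1) ((volume : Measure (Spc N)).prod (kap a b)) := fun n => by
    refine integrable_of_le_wt_Y (C := 2 * B / τ n * (Φ * Real.exp (R + 1))) ((((hAm n).sub (hBm n)).div_const _).mul hφm).aestronglyMeasurable
      (ae_of_all _ fun y => ?_)
    have ht := H.tpos n
    rw [abs_mul, mul_assoc]
    refine mul_le_mul ?_ (hφb y) (abs_nonneg _) (by positivity)
    rw [abs_div, abs_of_pos ht]
    gcongr
    have := abs_sub (A n y) (Bn n y)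
    have := hAb n y
    have := hBb n y
    linarith
  have hjb : ∀ n (y : Spc N × (ℝ × ℝ)), |Bn n y * ((φ y.1 y.2.1 - φ y.1 (y.2.1 - τ n)) / τ n)| ≤ B * (Φ * Real.exp (R + 1)) * wt y.1 := fun n y => by
    rw [abs_mul, mul_assoc]
    exact mul_le_mul (hBb n y) (hqb n y) (abs_nonneg _) hB0
  have hjm : ∀ n, AEStronglyMeasurable (fun y : Spc N × (ℝ × ℝ) => Bn n y * ((φ y.1 y.2.1 - φ y.1 (y.2.1 - τ n)) / τ n))
      ((volume : Measure (Spc N)).prod (kap a b)) := fun n => ((hBm n).mul ((hφm.sub (hφsm n)).div_const _)).aestronglyMeasurable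
  have hij : ∀ n, Integrable (fun y : Spc N × (ℝ × ℝ) => Bn n y * ((φ y.1 y.2.1 - φ y.1 (y.2.1 - τ n)) / τ n))
      ((volume : Measure (Spc N)).prod (kap a b)) := fun n => integrable_of_le_wt_Y (hjm n) (ae_of_all _ (hjb n))
  have hit : ∀ n, Integrable (fun y : Spc N × (ℝ × ℝ) => tinc U τ h a b n y.1 y.2 * (g (psh U h a b n y.1 y.2) * φ y.1 y.2.1))
      ((volume : Measure (Spc N)).prod (kap a b)) := fun n => by
    refine integrable_of_le_wt_Y (C := M / τ n * ((|g 0| + L * M) * Φ * Real.exp (R + 1)))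
      ((htm n).mul ((hgc.measurable.comp (hpm n)).mul hφm)).aestronglyMeasurable (ae_of_all _ fun y => ?_)
    have ht := H.tpos n
    rw [abs_mul, mul_assoc (M / τ n)]
    have k1 := H.abs_tinc_le (b := b) hh n y.1 y.2
    have k2 : |g (psh U h a b n y.1 y.2) * φ y.1 y.2.1| ≤ (|g 0| + L * M) * Φ * Real.exp (R + 1) * wt y.1 :=
      T.abs_le_wt (w := psh U h a b n) (hc.bd n) y.1 y.2
    have k3 : 0 ≤ M / τ n := div_nonneg hM0 ht.le
    exact mul_le_mul k1 k2 (abs_nonneg _) k3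
  have hlim : Tendsto (fun n => - ∫ y, Bn n y * ((φ y.1 y.2.1 - φ y.1 (y.2.1 - τ n)) / τ n) ∂((volume : Measure (Spc N)).prod (kap a b))) atTop
      (𝓝 (- ∫ y, G (vsh u a b y.1 y.2) * φt y.1 y.2.1 ∂((volume : Measure (Spc N)).prod (kap a b)))) := by
    have hbi : Integrable (fun y : Spc N × (ℝ × ℝ) => B * (Φ * Real.exp (R + 1)) * wt y.1) ((volume : Measure (Spc N)).prod (kap a b)) :=
      integrable_wt_Y.const_mul _
    have hd := tendsto_integral_of_dominated_convergence (f := fun y : Spc N × (ℝ × ℝ) => G (vsh u a b y.1 y.2) * φt y.1 y.2.1) _ hjm hbi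
      (fun n => ae_of_all _ (hjb n)) (ae_of_all _ fun y => ?_)
    · exact hd.neg
    refine ((hGc.tendsto _).comp (hc.conv (fun _ => y.1) y.1 y.2 tendsto_const_nhds)).mul ?_
    have hd := (T'.der y.1 y.2.1).tendsto_slope
    have ht0 : Tendsto (fun n => y.2.1 - τ n) atTop (𝓝[≠] y.2.1) := by
      refine tendsto_nhdsWithin_iff.2 ⟨by simpa using H.tlim.const_sub y.2.1, Eventually.of_forall fun n => ?_⟩
      have := H.tpos n
      simp only [mem_compl_iff, mem_singleton_iff]
      intro hcon; linarith
    refine (hd.comp ht0).congr fun n => ?_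
    simp only [Function.comp, slope_def_field]
    rw [sub_sub_cancel_left, div_neg, ← neg_div, neg_sub]
  have hev : ∀ᶠ n in atTop, b' + τ n ≤ b := by
    filter_upwards [H.tlim.eventually (gt_mem_nhds (sub_pos.2 hb'))] with n hn
    linarith
  have hpart : ∀ᶠ n in atTop, ∫ y, (A n y - Bn n y) / τ n * φ y.1 y.2.1 ∂((volume : Measure (Spc N)).prod (kap a b)) =
      - ∫ y, Bn n y * ((φ y.1 y.2.1 - φ y.1 (y.2.1 - τ n)) / τ n) ∂((volume : Measure (Spc N)).prod (kap a b)) := by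
    filter_upwards [hev] with n hn
    rw [← integral_neg]
    refine integral_Y_congr_inner (hid n) (hij n).neg fun x σ hσ => ?_
    have hτ := H.tpos n
    set y : ℝ → ℝ := fun t => G (U n x (t + h n * clamp 0 1 σ)) with hy
    have hc1 : ∀ t ∈ Icc a b, A n (x, (t, σ)) = y (t + τ n) := fun t ht => by
      have := hup n (x, (t, σ))
      simp only [hA, hy] at this ⊢
      rw [this, clamp_of_mem ht]
      congr 2; ring
    have hc2 : ∀ t ∈ Icc a b, Bn n (x, (t, σ)) = y t := fun t ht => by
      simp only [hBn, hy, psh, clamp_of_mem ht]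
    have hpar := shift_by_parts (y := y) (q := φ x) (a := a) (b := b) (B := B)
      (hGc.measurable.comp ((H.meas n).comp (f := fun t : ℝ => (x, t + h n * clamp 0 1 σ)) (by fun_prop)))
      (fun r hr => hB _ (by
        have := mul_nonneg (hh n) (le_clamp 0 1 σ)
        exact ⟨H.nonneg n _ _ (by linarith), H.bd n _ _ (by linarith)⟩))
      (hφc.comp (by fun_prop : Continuous fun t : ℝ => (x, t))) (T'.tzero x) hτ ha' hn
    rw [← integral_neg] at hpar
    refine (setIntegral_congr_fun measurableSet_Icc fun t ht => ?_).trans (hpar.trans (setIntegral_congr_fun measurableSet_Icc fun t ht => ?_))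
    · simp only [hc1 t ht, hc2 t ht]
    · simp only [hc2 t ht]
  have hfin := herr.add (hlim.congr' (hpart.mono fun n hn => hn.symm))
  rw [zero_add] at hfin
  refine hfin.congr fun n => ?_
  rw [integral_sub (hit n) (hid n)]
  ring

end

section
variable {N : ℕ} {p : ℝ} {ν : Measure (Spc N)} {f : ℝ → ℝ} {ε τ s h : ℕ → ℝ} {U : ℕ → Spc N → ℝ → ℝ} {u : Spc N → ℝ → ℝ}
  {a b M K : ℝ} {φ φt : Spc N → ℝ → ℝ} {g G : ℝ → ℝ} {L Φ R a' b' : ℝ}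

/-- the limit equation, with the flux written through the kernel. -/
lemma Appr.limit_eq (hp : 2 ≤ p) [IsFiniteMeasure ν] (hν : Kern p ν) (hf : Absorb f) (H : Appr p ν f ε τ s U u a b M K) (hab : a ≤ b)
    (T : Tst g (fun x (π : ℝ × ℝ) => φ x π.1) L Φ R) (T' : TimeTst φ φt Φ a' b' R) (hG : ∀ r, HasDerivAt G (g r) r)
    (ha' : a ≤ a') (hb' : b' < b) :
    - (∫ X, Psi p (Dlim (vsh u a b) X) * Dlim (fun x π => g (vsh u a b x π) * φ x π.1) X ∂LL ν (kap a b)) =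
      - (∫ y, G (vsh u a b y.1 y.2) * φt y.1 y.2.1 ∂((volume : Measure (Spc N)).prod (kap a b))) +
      ∫ y, f (vsh u a b y.1 y.2) * (g (vsh u a b y.1 y.2) * φ y.1 y.2.1) ∂((volume : Measure (Spc N)).prod (kap a b)) := by
  obtain ⟨h, hpos, hh0, r, hr0, hr⟩ := H.energy hf hab
  have hh : ∀ n, 0 ≤ h n := fun n => (hpos n).le
  have hc := H.gconv hab hh hh0
  obtain ⟨hQ, C1, hC1⟩ := GConv.strong hp hν hc hr0 hr
  have hflux := (GConv.flux hp hν hc T hQ hC1).neg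
  have htime := H.time_limit hab hh hh0 T T' hG ha' hb'
  have hpm : ∀ n, Measurable fun y : Spc N × (ℝ × ℝ) => psh U h a b n y.1 y.2 := fun n => hc.meas n
  have htm : ∀ n, Measurable fun y : Spc N × (ℝ × ℝ) => tinc U τ h a b n y.1 y.2 := fun n => H.measurable_tinc n
  have hfm : ∀ n, Measurable fun y : Spc N × (ℝ × ℝ) => f (psh U h a b n y.1 y.2) := fun n => H.measurable_f_psh hf hab hh hh0 n
  have hφm : Measurable fun y : Spc N × (ℝ × ℝ) => φ y.1 y.2.1 := T.cont.measurable
  have hζm : ∀ n, Measurable fun y : Spc N × (ℝ × ℝ) => g (psh U h a b n y.1 y.2) * φ y.1 y.2.1 := fun n =>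
    (T.gcont.measurable.comp (hpm n)).mul hφm
  have hζb : ∀ n x (π : ℝ × ℝ), |g (psh U h a b n x π) * φ x π.1| ≤ (|g 0| + L * M) * Φ * Real.exp (R + 1) * wt x := fun n x π =>
    T.abs_le_wt (w := psh U h a b n) (hc.bd n) x π
  have hfM : 0 ≤ f M := hf.nonneg H.M0
  have hfb : ∀ n (y : Spc N × (ℝ × ℝ)), |f (psh U h a b n y.1 y.2) * (g (psh U h a b n y.1 y.2) * φ y.1 y.2.1)| ≤
      f M * ((|g 0| + L * M) * Φ * Real.exp (R + 1)) * wt y.1 := fun n y => by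
    rw [abs_mul, mul_assoc (f M)]
    exact mul_le_mul (H.abs_f_psh_le hf hh n _ _) (hζb n _ _) (abs_nonneg _) hfM
  have hfint : ∀ n, Integrable (fun y : Spc N × (ℝ × ℝ) => f (psh U h a b n y.1 y.2) * (g (psh U h a b n y.1 y.2) * φ y.1 y.2.1))
      ((volume : Measure (Spc N)).prod (kap a b)) := fun n =>
    integrable_of_le_wt_Y ((hfm n).mul (hζm n)).aestronglyMeasurable (ae_of_all _ (hfb n))
  have htint : ∀ n, Integrable (fun y : Spc N × (ℝ × ℝ) => tinc U τ h a b n y.1 y.2 * (g (psh U h a b n y.1 y.2) * φ y.1 y.2.1))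
      ((volume : Measure (Spc N)).prod (kap a b)) := fun n => by
    refine integrable_of_le_wt_Y (C := M / τ n * ((|g 0| + L * M) * Φ * Real.exp (R + 1))) ((htm n).mul (hζm n)).aestronglyMeasurable
      (ae_of_all _ fun y => ?_)
    have k1 := H.abs_tinc_le (b := b) hh n y.1 y.2
    have k3 : 0 ≤ M / τ n := div_nonneg H.M0 (H.tpos n).le
    rw [abs_mul, mul_assoc (M / τ n)]
    exact mul_le_mul k1 (hζb n _ _) (abs_nonneg _) k3
  have habs : Tendsto (fun n => ∫ y, f (psh U h a b n y.1 y.2) * (g (psh U h a b n y.1 y.2) * φ y.1 y.2.1)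
      ∂((volume : Measure (Spc N)).prod (kap a b))) atTop
      (𝓝 (∫ y, f (vsh u a b y.1 y.2) * (g (vsh u a b y.1 y.2) * φ y.1 y.2.1) ∂((volume : Measure (Spc N)).prod (kap a b)))) := by
    have hbi : Integrable (fun y : Spc N × (ℝ × ℝ) => f M * ((|g 0| + L * M) * Φ * Real.exp (R + 1)) * wt y.1)
      ((volume : Measure (Spc N)).prod (kap a b)) := integrable_wt_Y.const_mul _
    refine tendsto_integral_of_dominated_convergence
      (f := fun y : Spc N × (ℝ × ℝ) => f (vsh u a b y.1 y.2) * (g (vsh u a b y.1 y.2) * φ y.1 y.2.1)) _ (fun n => (hfint n).1) hbi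
      (fun n => ae_of_all _ (hfb n)) (ae_of_all _ fun y => ?_)
    exact (H.tendsto_f_psh hf hab hh hh0 y.1 y.2).mul
      (((T.gcont.tendsto _).comp (hc.conv (fun _ => y.1) y.1 y.2 tendsto_const_nhds)).mul_const _)
  refine tendsto_nhds_unique hflux ((htime.add habs).congr fun n => ?_)
  have k := integral_Lop_mul (κ := kap a b) hp hν (H.pos n) (H.le_one n) (w := psh U h a b n)
    (ζ := fun x π => g (psh U h a b n x π) * φ x π.1) (hc.meas n) (hζm n) (hc.bd n) (hζb n)
  rw [← k, ← integral_add (htint n) (hfint n)]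
  refine integral_congr_ae (ae_of_all _ fun y => ?_)
  simp only [H.Lop_psh hh n]
  ring

end

section
variable {N : ℕ} {p : ℝ} {ν : Measure (Spc N)} {κ : Measure (ℝ × ℝ)} [IsFiniteMeasure κ] [IsFiniteMeasure ν]
  {v : Spc N → ℝ × ℝ → ℝ} {M K : ℝ} {g : ℝ → ℝ} {φ : Spc N → ℝ × ℝ → ℝ} {L Φ R : ℝ}

/-- spatial gradient with parameters. -/
def pgrad (v : Spc N → ℝ × ℝ → ℝ) (y : Spc N × (ℝ × ℝ)) : Spc N := gradient (fun x => v x y.2) y.1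

lemma Dlim_eq_inner (v : Spc N → ℝ × ℝ → ℝ) (X : XX N) : Dlim v X = ⟪pgrad v X.2, X.1⟫ := by
  simp only [Dlim, pgrad, gradient, InnerProductSpace.toDual_symm_apply]

lemma Tst.Dlim_zero (T : Tst g φ L Φ R) (v : Spc N → ℝ × ℝ → ℝ) {X : XX N} (hX : R < ‖X.2.1‖) :
    Dlim (fun x π => g (v x π) * φ x π) X = 0 := by
  have h : (fun x => g (v x X.2.2) * φ x X.2.2) =ᶠ[𝓝 X.2.1] fun _ => 0 := by
    filter_upwards [continuous_norm.continuousAt.eventually (lt_mem_nhds hX)] with x hx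
    rw [T.zero x X.2.2 hx.le, mul_zero]
  rw [Dlim, h.fderiv_eq]
  simp

/-- the kernel flux is the `p`-Laplacian flux. -/
lemma flux_eq (hp : 2 ≤ p) (hν : Kern p ν) (hK : 0 ≤ K) (hv : Continuous (Function.uncurry v)) (hvb : ∀ x π, |v x π| ≤ M)
    (hL : ∀ x y π, |v x π - v y π| ≤ K * ‖x - y‖) (T : Tst g φ L Φ R) :
    Integrable (fun y => ‖pgrad v y‖ ^ (p - 2) * ⟪pgrad v y, pgrad (fun x π => g (v x π) * φ x π) y⟫) ((volume : Measure (Spc N)).prod κ) ∧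
    ∫ X, Psi p (Dlim v X) * Dlim (fun x π => g (v x π) * φ x π) X ∂LL ν κ =
      ∫ y, ‖pgrad v y‖ ^ (p - 2) * ⟪pgrad v y, pgrad (fun x π => g (v x π) * φ x π) y⟫ ∂((volume : Measure (Spc N)).prod κ) := by
  set ζ : Spc N → ℝ × ℝ → ℝ := fun x π => g (v x π) * φ x π with hζ
  have hζc : Continuous (Function.uncurry ζ) := (T.gcont.comp hv).mul T.cont
  have hM : 0 ≤ (|g 0| + L * M) * Φ := mul_nonneg ((abs_nonneg _).trans (T.gbd (hvb 0 0))) T.Phi0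
  set C := L * Φ * K + (|g 0| + L * M) * Φ with hC
  have hC0 : 0 ≤ C := by have := T.L0; have := T.Phi0; positivity
  have hζL : ∀ x y π, |ζ x π - ζ y π| ≤ C * ‖x - y‖ := fun x y π => by
    refine (T.sub_le hvb x y π).trans ?_
    have := mul_le_mul_of_nonneg_left (hL x y π) (mul_nonneg T.L0 T.Phi0)
    rw [hC]; linarith
  have hintg : Integrable (fun X => Psi p (Dlim v X) * Dlim ζ X) (LL ν κ) := by
    refine integrable_of_le_wt (C := K ^ (p - 1) * (C * Real.exp (R + 1 + 1)))
      (((continuous_Psi hp).measurable.comp (measurable_Dlim hv)).mul (measurable_Dlim hζc)).aestronglyMeasurable ?_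
    filter_upwards [ae_norm_le_one hν] with X hX
    have k1 : |Psi p (Dlim v X)| ≤ K ^ (p - 1) := abs_Psi_le hp ((abs_Dlim_le hK hL X).trans (mul_le_of_le_one_right hK hX))
    have k2 : |Dlim ζ X| ≤ C * Real.exp (R + 1 + 1) * wt X.2.1 :=
      TimeTst.le_wt_of_zero (q := fun x => Dlim ζ (X.1, (x, X.2.2))) hC0 ((abs_Dlim_le hC0 hζL X).trans (mul_le_of_le_one_right hC0 hX))
        fun hx => T.Dlim_zero v (by simp only; linarith)
    rw [abs_mul, mul_assoc]
    exact mul_le_mul k1 k2 (abs_nonneg _) (by positivity)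
  have e : ∀ y, ∫ z, Psi p (Dlim v (z, y)) * Dlim ζ (z, y) ∂ν = ‖pgrad v y‖ ^ (p - 2) * ⟪pgrad v y, pgrad ζ y⟫ := fun y => by
    simp only [Dlim_eq_inner]
    exact hν.mom _ _
  constructor
  · have := hintg.integral_prod_right
    simp only [e] at this
    exact this
  · rw [integral_prod_symm _ hintg]
    simp only [e]

end

section
variable {N : ℕ} {p : ℝ} {ν : Measure (Spc N)} {f : ℝ → ℝ} {u : Spc N → ℝ → ℝ}

lemma measurable_pgrad {v : Spc N → ℝ × ℝ → ℝ} (hv : Continuous (Function.uncurry v)) : Measurable (pgrad v) := by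
  have h : Continuous (Function.uncurry fun (π : ℝ × ℝ) (x : Spc N) => v x π) := hv.comp continuous_swap
  have h2 : Measurable fun y : Spc N × (ℝ × ℝ) => fderiv ℝ (fun x => v x y.2) y.1 :=
    (measurable_fderiv_with_param ℝ h).comp (f := fun y : Spc N × (ℝ × ℝ) => (y.2, y.1)) (by fun_prop)
  exact (InnerProductSpace.toDual ℝ (Spc N)).symm.continuous.measurable.comp h2

lemma measurable_sgrad (hu : Continuous (Function.uncurry u)) : Measurable fun z : Spc N × ℝ => sgrad u z.1 z.2 :=
  (measurable_pgrad (v := fun x π => u x π.1) (hu.comp (by fun_prop : Continuous fun y : Spc N × (ℝ × ℝ) => (y.1, y.2.1)))).comp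
    (f := fun z : Spc N × ℝ => (z.1, (z.2, (0:ℝ)))) (by fun_prop)

lemma norm_sgrad_le {K : ℝ} (hK : 0 ≤ K) {t : ℝ} (hL : ∀ x y, |u x t - u y t| ≤ K * ‖x - y‖) (x : Spc N) : ‖sgrad u x t‖ ≤ K := by
  have h := norm_fderiv_le_of_lipschitz ℝ (x₀ := x) (lipschitzWith_of_abs_sub_le hL)
  rw [Real.coe_toNNReal _ hK] at h
  rwa [sgrad, gradient, LinearIsometryEquiv.norm_map]

lemma locallyIntegrableOn_sgrad (hp : 0 ≤ p) (hu : Continuous (Function.uncurry u))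
    (hL : ∀ a b, 0 < a → a ≤ b → ∃ K, 0 ≤ K ∧ ∀ x y t, a ≤ t → t ≤ b → |u x t - u y t| ≤ K * ‖x - y‖) :
    LocallyIntegrableOn (fun z : Spc N × ℝ => ‖sgrad u z.1 z.2‖ ^ p) (univ ×ˢ Ioi (0:ℝ)) := by
  rintro ⟨x0, t0⟩ ⟨-, ht0⟩
  have ht0' : 0 < t0 := ht0
  obtain ⟨K, hK, hKL⟩ := hL (t0 / 2) (t0 + 1) (by linarith) (by linarith)
  refine ⟨Metric.closedBall x0 1 ×ˢ Icc (t0 / 2) (t0 + 1), mem_nhdsWithin_of_mem_nhds ?_, ?_⟩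
  · exact prod_mem_nhds (Metric.closedBall_mem_nhds _ one_pos) (Icc_mem_nhds (by linarith) (by linarith))
  · have hc : IsCompact (Metric.closedBall x0 1 ×ˢ Icc (t0 / 2) (t0 + 1)) := (isCompact_closedBall _ _).prod isCompact_Icc
    refine Measure.integrableOn_of_bounded (M := K ^ p) hc.measure_lt_top.ne ((measurable_sgrad hu).norm.pow_const p).aestronglyMeasurable ?_
    refine (ae_restrict_iff' hc.isClosed.measurableSet).2 (ae_of_all _ fun z hz => ?_)
    rw [Real.norm_of_nonneg (Real.rpow_nonneg (norm_nonneg _) _)]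
    exact Real.rpow_le_rpow (norm_nonneg _) (norm_sgrad_le hK (fun x y => hKL x y z.2 hz.2.1 hz.2.2) _) hp

lemma measurePreserving_kap (a b : ℝ) : MeasurePreserving (fun y : Spc N × (ℝ × ℝ) => (y.1, y.2.1))
    ((volume : Measure (Spc N)).prod (kap a b)) ((volume : Measure (Spc N)).prod (volume.restrict (Icc a b))) := by
  have : IsProbabilityMeasure (volume.restrict (Icc (0:ℝ) 1)) := ⟨by simp⟩
  exact (MeasurePreserving.id _).prod measurePreserving_fst

/-- smooth compactly supported functions are admissible test data. -/
lemma exists_test_data {φ : Spc N → ℝ → ℝ} {g : ℝ → ℝ} {L : ℝ≥0}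
    (h1 : ContDiff ℝ (⊤ : ℕ∞) (fun z : Spc N × ℝ => φ z.1 z.2)) (h2 : HasCompactSupport (fun z : Spc N × ℝ => φ z.1 z.2))
    (h3 : tsupport (fun z : Spc N × ℝ => φ z.1 z.2) ⊆ univ ×ˢ Ioi (0:ℝ)) (hg : LipschitzWith L g) :
    ∃ Φ R a' b', 0 < a' ∧ a' ≤ b' ∧ Tst g (fun x (π : ℝ × ℝ) => φ x π.1) L Φ R ∧
      TimeTst φ (fun x t => deriv (fun s => φ x s) t) Φ a' b' R := by
  have hcont : Continuous fun z : Spc N × ℝ => φ z.1 z.2 := h1.continuous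
  have h1' : ContDiff ℝ 1 (fun z : Spc N × ℝ => φ z.1 z.2) := h1.of_le (by exact_mod_cast le_top)
  obtain ⟨C, hC⟩ := h1'.lipschitzWith_of_hasCompactSupport h2 one_ne_zero
  obtain ⟨B, hB⟩ := h2.exists_bound_of_continuous hcont
  obtain ⟨a', ha', hlow⟩ := h2.isCompact.exists_forall_le' (f := fun z : Spc N × ℝ => z.2) continuous_snd.continuousOn
    (a := 0) fun z hz => (h3 hz).2
  obtain ⟨R, hR⟩ := h2.isCompact.isBounded.exists_norm_le
  have hz : ∀ x t, (R < ‖x‖ ∨ t < a' ∨ R < t) → φ x t = 0 := fun x t h => by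
    by_contra hne
    have hm : (x, t) ∈ tsupport (fun z : Spc N × ℝ => φ z.1 z.2) := subset_tsupport _ hne
    have k1 := hR _ hm
    have k2 := hlow _ hm
    have k3 : ‖x‖ ≤ R := (norm_fst_le (x, t)).trans k1
    have k4 : |t| ≤ R := (norm_snd_le (x, t)).trans k1
    have k5 := le_abs_self t
    simp only at k2
    rcases h with h | h | h <;> linarith
  have hd : ∀ x t, HasDerivAt (φ x) (fderiv ℝ (fun z : Spc N × ℝ => φ z.1 z.2) (x, t) (0, 1)) t := fun x t => by
    have e1 : HasFDerivAt (fun z : Spc N × ℝ => φ z.1 z.2) (fderiv ℝ (fun z : Spc N × ℝ => φ z.1 z.2) (x, t)) (x, t) :=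
      (h1'.differentiable one_ne_zero _).hasFDerivAt
    have e2 : HasDerivAt (fun s : ℝ => (x, s)) ((0 : Spc N), (1:ℝ)) t := (hasDerivAt_const t x).prodMk (hasDerivAt_id t)
    exact e1.comp_hasDerivAt t e2
  have hφt : (Function.uncurry fun x t => deriv (fun s => φ x s) t) = fun z : Spc N × ℝ =>
      fderiv ℝ (fun z : Spc N × ℝ => φ z.1 z.2) z (0, 1) := by
    ext z
    exact (hd z.1 z.2).deriv
  have hlip : ∀ z w : Spc N × ℝ, |φ z.1 z.2 - φ w.1 w.2| ≤ C * ‖z - w‖ := fun z w => by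
    have := hC.dist_le_mul z w
    rwa [Real.dist_eq, dist_eq_norm] at this
  refine ⟨max C B, R + 1, a', max a' R, ha', le_max_left _ _, ⟨L.2, fun r r' => ?_, ?_, fun x π => ?_, fun x y π => ?_, fun x π hx => ?_⟩,
    ⟨?_, fun x t => ?_, fun x t => ?_, fun x t ht => ?_, fun x t hx => ?_⟩⟩
  · have := hg.dist_le_mul r r'
    rwa [Real.dist_eq, Real.dist_eq] at this
  · exact hcont.comp (by fun_prop : Continuous fun y : Spc N × (ℝ × ℝ) => (y.1, y.2.1))
  · exact (hB (x, π.1)).trans (le_max_right _ _)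
  · have := hlip (x, π.1) (y, π.1)
    rw [Prod.mk_sub_mk, sub_self, Prod.norm_mk, norm_zero, max_eq_left (norm_nonneg _)] at this
    exact this.trans (mul_le_mul_of_nonneg_right (le_max_left _ _) (norm_nonneg _))
  · exact hz _ _ (Or.inl (by linarith))
  · rw [hφt]
    exact (h1'.continuous_fderiv one_ne_zero).clm_apply continuous_const
  · exact (hd x t).differentiableAt.hasDerivAt
  · have hl : LipschitzWith C (fun s => φ x s) := LipschitzWith.of_dist_le_mul fun s s' => by
      have := hlip (x, s) (x, s')
      rw [Prod.mk_sub_mk, sub_self, Prod.norm_mk, norm_zero, max_eq_right (norm_nonneg _)] at this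
      rwa [Real.dist_eq, Real.dist_eq]
    exact (norm_deriv_le_of_lipschitz hl).trans (le_max_left _ _)
  · refine hz _ _ (Or.inr ?_)
    rw [mem_Icc, not_and_or, not_le, not_le] at ht
    exact ht.imp_right fun h => (le_max_right _ _).trans_lt h
  · exact hz _ _ (Or.inl (by linarith))

end

section
variable {N : ℕ} {p : ℝ} {ν : Measure (Spc N)} {f : ℝ → ℝ} {u : Spc N → ℝ → ℝ}

/-- locally uniform limits of approximate solutions are weak solutions. -/
lemma isWeakSolution_of_appr (hp : 2 ≤ p) [IsFiniteMeasure ν] (hν : Kern p ν) (hf : Absorb f) (hu : Continuous (Function.uncurry u))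
    (hu0 : ∀ x t, 0 ≤ u x t)
    (H : ∀ a b, 0 < a → a ≤ b → ∃ (ε τ s : ℕ → ℝ) (U : ℕ → Spc N → ℝ → ℝ) (M K : ℝ), Appr p ν f ε τ s U u a b M K) :
    IsWeakSolution p f univ (Ioi 0) u := by
  have hfu : ∀ x t, f (u x t) = f (max (u x t) 0) := fun x t => by rw [max_eq_left (hu0 x t)]
  have hfc : Continuous fun z : Spc N × ℝ => f (u z.1 z.2) := by
    simp only [hfu]
    exact hf.continuous_max.comp hu
  refine ⟨hu.locallyIntegrable.locallyIntegrableOn _, locallyIntegrableOn_sgrad (by linarith) hu fun a b ha hab => ?_,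
    hfc.locallyIntegrable.locallyIntegrableOn _, fun φ g G h1 h2 h3 hg hL hG => ?_⟩
  · obtain ⟨ε, τ, s, U, M, K, A⟩ := H a b ha hab
    exact ⟨K, A.K0, A.ulip⟩
  obtain ⟨L, hL⟩ := hL
  obtain ⟨Φ, R, a, b', ha, hab', T, T'⟩ := exists_test_data h1 h2 h3 hL
  set b := b' + 1 with hb
  have hab : a ≤ b := by linarith
  obtain ⟨ε, τ, s, U, M, K, A⟩ := H a b ha hab
  have hGc : Continuous G := continuous_iff_continuousAt.2 fun r => (hG r).continuousAt
  have hc := A.gconv (h := fun _ => 0) hab (fun _ => le_rfl) tendsto_const_nhds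
  have heq := A.limit_eq hp hν hf hab T T' hG le_rfl (by linarith)
  obtain ⟨hintg, hflux⟩ := flux_eq (κ := kap a b) hp hν A.K0 hc.vcont hc.vbd hc.vlip T
  set v := vsh u a b with hv
  set ζ : Spc N → ℝ × ℝ → ℝ := fun x π => g (v x π) * φ x π.1 with hζ
  have hvm : Continuous fun y : Spc N × (ℝ × ℝ) => v y.1 y.2 := hc.vcont
  have hζc : Continuous (Function.uncurry ζ) := (T.gcont.comp hc.vcont).mul T.cont
  have hv0 : ∀ x π, 0 ≤ v x π := A.vsh_nonneg
  have hfv : Continuous fun y : Spc N × (ℝ × ℝ) => f (v y.1 y.2) := by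
    have : ∀ x π, f (v x π) = f (max (v x π) 0) := fun x π => by rw [max_eq_left (hv0 x π)]
    simp only [this]
    exact hf.continuous_max.comp hvm
  obtain ⟨B, hB⟩ := isCompact_Icc.exists_bound_of_continuousOn (hGc.continuousOn (s := Icc 0 M))
  have hmem : ∀ x π, v x π ∈ Icc 0 M := fun x π => ⟨hv0 x π, (le_abs_self _).trans (hc.vbd x π)⟩
  have hB0 : 0 ≤ B := (norm_nonneg _).trans (hB _ (hmem 0 0))
  set FB : Spc N × (ℝ × ℝ) → ℝ := fun y => G (v y.1 y.2) * deriv (fun s => φ y.1 s) y.2.1 with hFB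
  set FC : Spc N × (ℝ × ℝ) → ℝ := fun y => f (v y.1 y.2) * ζ y.1 y.2 with hFC
  set FA : Spc N × (ℝ × ℝ) → ℝ := fun y => ‖pgrad v y‖ ^ (p - 2) * ⟪pgrad v y, pgrad ζ y⟫ with hFA
  have hFBm : Measurable FB := (hGc.comp hvm).measurable.mul
    (T'.contt.comp (by fun_prop : Continuous fun y : Spc N × (ℝ × ℝ) => (y.1, y.2.1))).measurable
  have hFCm : Measurable FC := (hfv.mul hζc).measurable
  have hFAm : Measurable FA := ((measurable_pgrad hc.vcont).norm.pow_const _).mul ((measurable_pgrad hc.vcont).inner (measurable_pgrad hζc))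
  have iB : Integrable FB ((volume : Measure (Spc N)).prod (kap a b)) := by
    refine integrable_of_le_wt_Y (C := B * (Φ * Real.exp (R + 1))) hFBm.aestronglyMeasurable (ae_of_all _ fun y => ?_)
    rw [abs_mul, mul_assoc]
    exact mul_le_mul (hB _ (hmem _ _)) (TimeTst.le_wt_of_zero (q := fun x => deriv (fun s => φ x s) y.2.1) T'.Phi0 (T'.bdt _ _)
      (T'.txzero _ _)) (abs_nonneg _) hB0
  have iC : Integrable FC ((volume : Measure (Spc N)).prod (kap a b)) := by
    refine integrable_of_le_wt_Y (C := f M * ((|g 0| + L * M) * Φ * Real.exp (R + 1))) hFCm.aestronglyMeasurable (ae_of_all _ fun y => ?_)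
    rw [abs_mul, mul_assoc (f M)]
    refine mul_le_mul ?_ (T.abs_le_wt (w := v) hc.vbd y.1 y.2) (abs_nonneg _) (hf.nonneg A.M0)
    rw [abs_of_nonneg (hf.nonneg (hv0 _ _))]
    exact hf.mono (hv0 _ _) A.M0 (hmem _ _).2
  set FJ : Spc N × (ℝ × ℝ) → ℝ := fun y => -FB y + FA y + FC y with hFJ
  have hzero : ∫ y, FJ y ∂((volume : Measure (Spc N)).prod (kap a b)) = 0 := by
    have e : FJ = (-FB + FA) + FC := rfl
    rw [e, integral_add' (iB.neg.add hintg) iC, integral_add' iB.neg hintg, integral_neg']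
    rw [hflux] at heq
    linarith
  have hFJm : Measurable FJ := (hFBm.neg.add hFAm).add hFCm
  set J : Spc N × ℝ → ℝ := fun z => FJ (z.1, (z.2, 0)) with hJ
  have hJm : Measurable J := hFJm.comp (by fun_prop)
  have hmp := measurePreserving_kap (N := N) a b
  have hJ0 : ∫ z, J z ∂((volume : Measure (Spc N)).prod (volume.restrict (Icc a b))) = 0 := by
    rw [← hmp.map_eq, integral_map hmp.measurable.aemeasurable hJm.aestronglyMeasurable, ← hzero]
    rfl
  have hres : (volume : Measure (Spc N)).prod (volume.restrict (Icc a b)) = (volume : Measure (Spc N × ℝ)).restrict (univ ×ˢ Icc a b) := by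
    rw [Measure.volume_eq_prod, ← Measure.prod_restrict, Measure.restrict_univ]
  rw [hres] at hJ0
  refine Eq.trans ?_ hJ0
  have hsub : (univ : Set (Spc N)) ×ˢ Icc a b ⊆ univ ×ˢ Ioi (0:ℝ) := prod_mono_right fun t ht => ha.trans_le ht.1
  rw [setIntegral_eq_of_subset_of_forall_sdiff_eq_zero (MeasurableSet.univ.prod measurableSet_Ioi) hsub ?_]
  · refine setIntegral_congr_fun (MeasurableSet.univ.prod measurableSet_Icc) fun z hz => ?_
    have hcl : ∀ x, v x (z.2, 0) = u x z.2 := fun x => by rw [hv, vsh, clamp_of_mem hz.2]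
    simp only [hJ, hFJ, hFA, hFB, hFC, pgrad, hζ, hcl, sgrad]
    ring
  · rintro ⟨x, t⟩ ⟨-, ht⟩
    have ht' : t ∉ Icc a b' := fun h => ht ⟨mem_univ _, h.1, by have := h.2; simp only at this ⊢; linarith⟩
    have e1 : ∀ y, φ y t = 0 := fun y => T'.tzero y t ht'
    have e2 : deriv (fun s => φ x s) t = 0 := by
      have : (fun s => φ x s) =ᶠ[𝓝 t] fun _ => 0 := by
        filter_upwards [isClosed_Icc.isOpen_compl.mem_nhds ht'] with s hs using T'.tzero x s hs
      rw [this.deriv_eq, deriv_const]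
    simp only [e1, e2, mul_zero]
    simp [gradient]

end

namespace Scheme
variable {N : ℕ} {p : ℝ} {ν : Measure (Spc N)} {f w : ℝ → ℝ} {u₀ : Spc N → ℝ} {ε τ : ℕ → ℝ} {g : ℕ → Spc N → ℝ}

lemma uap_nonneg (hp : 2 ≤ p) (hν : Kern p ν) (hf : Absorb f) (H : Scheme p ν f w u₀ ε τ g) (n : ℕ) (x : Spc N) (t : ℝ) :
    0 ≤ uap p ν f ε τ g n x t := ((H.iter_adm hp hν hf n _).mem x).1

lemma measurable_uap (hp : 2 ≤ p) (hν : Kern p ν) (hf : Absorb f) (H : Scheme p ν f w u₀ ε τ g) (n : ℕ) :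
    Measurable (Function.uncurry (uap p ν f ε τ g n)) := by
  have h1 : Measurable fun z : Spc N × ℕ => (stp p ν f (ε n) (τ n))^[z.2] (g n) z.1 :=
    measurable_from_prod_countable_left fun k => (H.iter_adm hp hν hf n k).cont.measurable
  have h2 : Measurable fun z : Spc N × ℝ => (z.1, ⌊z.2 / τ n⌋₊) :=
    measurable_fst.prodMk (Nat.measurable_floor.comp (measurable_snd.div_const _))
  exact h1.comp h2

lemma uap_add (H : Scheme p ν f w u₀ ε τ g) (n : ℕ) (x : Spc N) {t : ℝ} (ht : 0 ≤ t) :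
    uap p ν f ε τ g n x (t + τ n) = (stp p ν f (ε n) (τ n))^[⌊t / τ n⌋₊ + 1] (g n) x := by
  have h0 := (H.cfl n).tau
  rw [uap, add_div, div_self h0.ne', Nat.floor_add_one (by positivity)]

lemma uap_incr (hp : 2 ≤ p) (hν : Kern p ν) (hf : Absorb f) (H : Scheme p ν f w u₀ ε τ g) (n : ℕ) (x : Spc N) {t : ℝ} (ht : 0 ≤ t) :
    (uap p ν f ε τ g n x (t + τ n) - uap p ν f ε τ g n x t) ^ 2 ≤ 1 / ((n : ℝ) + 1) * τ n := by
  have h0 := (H.cfl n).tau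
  rw [H.uap_add n x ht, uap]
  have h1 := iter_incr hp hν hf (H.cfl n) (by linarith [(n.cast_nonneg : (0:ℝ) ≤ n)]) (H.adm n) ⌊t / τ n⌋₊ x
  have h2 := H.incr n
  push_cast at h1
  set X := 2 * ν.real univ * ((n : ℝ) + 1) ^ (p - 1) / ε n + f ((n : ℝ) + 1) with hX
  calc _ ≤ (τ n * X) ^ 2 := by rw [← sq_abs]; gcongr
    _ = τ n * X ^ 2 * τ n := by ring
    _ ≤ _ := by gcongr

/-- the tail of a convergent sequence of discrete solutions is an approximate solution. -/
lemma appr (hp : 2 ≤ p) (hν : Kern p ν) (hf : Absorb f) (H : Scheme p ν f w u₀ ε τ g) {φ : ℝ → ℝ}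
    (hφ : ∀ t : ℝ, 0 < t → 0 < φ t ∧ (∫ s in Ioi (φ t), 1 / f s) = t) {σ : ℕ → ℕ} (hσ : StrictMono σ) {u : Spc N → ℝ → ℝ}
    (hu : Continuous (Function.uncurry u))
    (hlim : ∀ (xn : ℕ → Spc N) (tn : ℕ → ℝ) (x : Spc N) (t : ℝ), (∀ n, 0 ≤ tn n) → Tendsto xn atTop (𝓝 x) → Tendsto tn atTop (𝓝 t) →
      Tendsto (fun n => uap p ν f ε τ g (σ n) (xn n) (tn n)) atTop (𝓝 (u x t))) {a b : ℝ} (ha : 0 < a) :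
    ∃ (ε' τ' s : ℕ → ℝ) (U : ℕ → Spc N → ℝ → ℝ) (M K : ℝ), Appr p ν f ε' τ' s U u a b M K := by
  obtain ⟨K, hK0, hK⟩ := H.lipx hp hν hf hφ ha b
  have hfa := hf.nonneg (hφ (a / 2) (by positivity)).1.le
  have hev : ∀ᶠ n in atTop, τ n ≤ a / 2 ∧ τ n ≤ 1 / (f (φ (a / 2)) + 1) := by
    filter_upwards [H.tau_tendsto.eventually (gt_mem_nhds (show (0:ℝ) < a / 2 by positivity)),
      H.tau_tendsto.eventually (gt_mem_nhds (show (0:ℝ) < 1 / (f (φ (a / 2)) + 1) by positivity))] with n h1 h2 using ⟨h1.le, h2.le⟩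
  obtain ⟨n0, hn0⟩ := eventually_atTop.1 (hσ.tendsto_atTop.eventually hev)
  have hρ : Tendsto (fun n => σ (n + n0)) atTop atTop := hσ.tendsto_atTop.comp (tendsto_add_atTop_nat n0)
  have ht2 : ∀ n, τ (σ (n + n0)) ≤ a / 2 ∧ τ (σ (n + n0)) ≤ 1 / (f (φ (a / 2)) + 1) := fun n => hn0 _ (by lia)
  refine ⟨fun n => ε (σ (n + n0)), fun n => τ (σ (n + n0)), fun n => 1 / ((σ (n + n0) : ℝ) + 1), fun n => uap p ν f ε τ g (σ (n + n0)),
    φ a + 1, K, ?_⟩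
  refine
  { a0 := ha
    pos := fun n => (H.cfl _).eps
    le_one := fun n => H.eps_one _
    lim := H.eps_tendsto.comp hρ
    tpos := fun n => (H.cfl _).tau
    tlim := H.tau_tendsto.comp hρ
    slim := tendsto_one_div_add_atTop_nhds_zero_nat.comp hρ
    meas := fun n => H.measurable_uap hp hν hf _
    nonneg := fun n x t _ => H.uap_nonneg hp hν hf _ x t
    bd := fun n x t hat => ?_
    eq := fun n x t hat => ?_
    incr := fun n x t hat => H.uap_incr hp hν hf _ x (ha.le.trans hat)
    conv := fun xn tn x t h0 hx ht => ?_
    ucont := hu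
    K0 := hK0.le
    ulip := fun x y t hat htb => ?_ }
  · have ht0 : 0 < t := ha.trans_le hat
    have h1 := H.uap_le_flat hp hν hf hφ (σ (n + n0)) x ht0 ((ht2 n).1.trans (by linarith))
    have h2 := hf.flat_antitone hφ ha hat
    have h3 := hf.flat_antitone hφ (by positivity : 0 < a / 2) (by linarith : a / 2 ≤ t / 2)
    have h4 := hf.mono (hφ (t / 2) (by positivity)).1.le (hφ (a / 2) (by positivity)).1.le h3
    have h5 := (ht2 n).2
    rw [le_div_iff₀ (by positivity)] at h5
    have h6 := (H.cfl (σ (n + n0))).tau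
    have h7 := mul_le_mul_of_nonneg_left h4 h6.le
    linarith
  · rw [H.uap_add _ x (ha.le.trans hat), Function.iterate_succ_apply']
    rfl
  · have h1 := hlim (fun m => xn (m - n0)) (fun m => tn (m - n0)) x t (fun m => h0 _) (hx.comp (tendsto_sub_atTop_nat n0))
      (ht.comp (tendsto_sub_atTop_nat n0))
    simpa [Function.comp_def] using h1.comp (tendsto_add_atTop_nat n0)
  · have ht0 : 0 ≤ t := ha.le.trans hat
    have key : ∀ x y, u x t - u y t ≤ K * ‖x - y‖ := by
      intro x y
      have l : ∀ x, Tendsto (fun n => uap p ν f ε τ g (σ n) x t) atTop (𝓝 (u x t)) := fun x =>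
        hlim (fun _ => x) (fun _ => t) x t (fun _ => ht0) tendsto_const_nhds tendsto_const_nhds
      have l2 : Tendsto (fun n => K * ‖x - y‖ + 2 * (((σ n : ℝ) + 1) * ε (σ n))) atTop (𝓝 (K * ‖x - y‖ + 2 * 0)) :=
        ((H.n_eps.comp hσ.tendsto_atTop).const_mul 2).const_add _
      have := le_of_tendsto_of_tendsto ((l x).sub (l y)) l2 (by
        filter_upwards [hσ.tendsto_atTop.eventually hK] with n hn
        have hτ := (H.cfl (σ n)).tau
        exact hn _ (by linarith [lt_floor_div_mul_add (t := t) hτ]) ((floor_div_mul_le ht0 hτ).trans htb) x y)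
      simpa using this
    refine abs_sub_le_iff.2 ⟨key x y, ?_⟩
    rw [norm_sub_rev]
    exact key y x

lemma exists_limit {b : ℝ} {F : ℝ → ℝ} (hN : 1 ≤ N) (hp : 2 ≤ p) (hf : Absorb f) (hb : 0 < b) (hw : Radial N p f b w F) (hν : Kern p ν)
    (hc : Continuous u₀) (H : Scheme p ν f w u₀ ε τ g) {φ : ℝ → ℝ}
    (hφ : ∀ t : ℝ, 0 < t → 0 < φ t ∧ (∫ s in Ioi (φ t), 1 / f s) = t) :
    ∃ (σ : ℕ → ℕ) (u : Spc N → ℝ → ℝ), StrictMono σ ∧ Continuous (Function.uncurry u) ∧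
      ∀ (xn : ℕ → Spc N) (tn : ℕ → ℝ) (x : Spc N) (t : ℝ), Tendsto xn atTop (𝓝 x) → Tendsto tn atTop (𝓝 t) →
      Tendsto (fun n => uap p ν f ε τ g (σ n) (xn n) (max (tn n) 0)) atTop (𝓝 (u x t)) := by
  have hbd : ∀ z : Spc N × ℝ, ∃ B, ∀ n, |uap p ν f ε τ g n z.1 (max z.2 0)| ≤ B := fun z => by
    refine ⟨w ‖z.1‖ + (1 + max z.2 0), fun n => ?_⟩
    rw [abs_of_nonneg (H.uap_nonneg hp hν hf _ _ _)]
    exact H.le_w_ball hN hp hf hb hw n _ (floor_div_mul_le (le_max_right _ _) (H.cfl n).tau) le_rfl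
  obtain ⟨σ, u, h1, h2, h3⟩ := exists_subseq_tendsto_of_asymp_equicont _ hbd fun z η hη => by
    obtain ⟨ρ, hρ, h⟩ := H.equicont hN hp hf hb hw hν hc hφ z.1 (le_max_right z.2 0) hη
    refine ⟨Metric.ball z ρ, Metric.ball_mem_nhds z hρ, ?_⟩
    filter_upwards [h] with n hn y hy
    rw [Metric.mem_ball, Prod.dist_eq, max_lt_iff, dist_eq_norm, Real.dist_eq] at hy
    exact hn _ _ hy.1 (le_max_right _ _) ((abs_max_sub_max_le_abs _ _ _).trans_lt hy.2)
  exact ⟨σ, fun x t => u (x, t), h1, h2, fun xn tn x t hx ht => h3 (x, t) (fun n => (xn n, tn n)) (hx.prodMk_nhds ht)⟩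

end Scheme

/-- existence of a solution dominated by `min{w_b, φ∞}` when `J < ∞`
and `K = ∞`. -/
theorem solution_below_min_of_stationary_and_flat
    {N : ℕ} (hN : 1 ≤ N) {p : ℝ} (hp : 2 * (N : ℝ) / ((N : ℝ) + 1) < p)
    (f : ℝ → ℝ)
    (hlip : ∀ M : ℝ, 0 < M → ∃ L : ℝ≥0, LipschitzOnWith L f (Icc 0 M))
    (hfm : MonotoneOn f (Ici 0)) (hf0 : f 0 = 0) (hfpos : ∀ s : ℝ, 0 < s → 0 < f s)
    (hJ : IntegrableOn (fun s : ℝ => 1 / f s) (Ioi 1))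
    (hK : ¬ IntegrableOn (fun s : ℝ => 1 / (Fint f s) ^ (1 / p)) (Ioi 1))
    {b : ℝ} (hb : 0 < b) (wb : ℝ → ℝ) (hwb : IsWa N p f b wb)
    (φinf : ℝ → ℝ)
    (hφ : ∀ t : ℝ, 0 < t → 0 < φinf t ∧ (∫ s in Ioi (φinf t), 1 / f s) = t)
    (u₀ : Spc N → ℝ) (hu₀c : Continuous u₀)
    (hu₀ : ∀ x : Spc N, 0 ≤ u₀ x ∧ u₀ x ≤ wb ‖x‖) :
    ∃ ulow : Spc N → ℝ → ℝ,
      (∀ x t, 0 ≤ ulow x t) ∧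
      IsWeakSolution p f univ (Ioi 0) ulow ∧
      ContinuousOn (fun z : Spc N × ℝ => ulow z.1 z.2)
        ((univ : Set (Spc N)) ×ˢ Ici (0:ℝ)) ∧
      (∀ x : Spc N, ulow x 0 = u₀ x) ∧
      (∀ (x : Spc N) (t : ℝ), 0 < t → ulow x t ≤ min (wb ‖x‖) (φinf t)) := by
  have hf : Absorb f := ⟨hlip, hfm, hf0, hfpos, hJ⟩
  have hp2 : 2 ≤ p := hf.two_le (lt_of_le_of_lt (by positivity) hp) hK
  obtain ⟨ν, hν⟩ := exists_Kern hN hp2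
  have := hν.fin
  obtain ⟨F, hF⟩ := hwb.radial hN hp2 hf hb
  obtain ⟨ε, τ, g, H⟩ := exists_Scheme hN hp2 hν hf hb hF hu₀c hu₀
  obtain ⟨σ, u, hσ, hu, hlim⟩ := H.exists_limit hN hp2 hf hb hF hν hu₀c hφ
  have hpt : ∀ x t, 0 ≤ t → Tendsto (fun n => uap p ν f ε τ g (σ n) x t) atTop (𝓝 (u x t)) := fun x t ht => by
    simpa [max_eq_left ht] using hlim (fun _ => x) (fun _ => t) x t tendsto_const_nhds tendsto_const_nhds
  have hu0 : ∀ x t, 0 ≤ u x t := fun x t =>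
    ge_of_tendsto' (hlim (fun _ => x) (fun _ => t) x t tendsto_const_nhds tendsto_const_nhds) fun n => H.uap_nonneg hp2 hν hf _ _ _
  have h1σ : Tendsto (fun n => 1 / ((σ n : ℝ) + 1)) atTop (𝓝 0) := tendsto_one_div_add_atTop_nhds_zero_nat.comp hσ.tendsto_atTop
  have hτσ : Tendsto (fun n => τ (σ n)) atTop (𝓝 0) := H.tau_tendsto.comp hσ.tendsto_atTop
  refine ⟨u, hu0, ?_, hu.continuousOn, fun x => ?_, fun x t ht => le_min ?_ ?_⟩
  · refine isWeakSolution_of_appr hp2 hν hf hu hu0 fun a b ha _ => H.appr hp2 hν hf hφ hσ hu (fun xn tn x t h0 hx ht => ?_) ha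
    simpa only [max_eq_left (h0 _)] using hlim xn tn x t hx ht
  · have hg : Tendsto (fun n => g (σ n) x) atTop (𝓝 (u x 0)) := by simpa [uap] using hpt x 0 le_rfl
    refine le_antisymm (le_of_tendsto' hg fun n => H.g_le _ x) (le_of_forall_pos_sub_le fun η hη => ?_)
    refine ge_of_tendsto hg ?_
    filter_upwards [hσ.tendsto_atTop.eventually (H.g_ge ‖x‖ η hη)] with n hn using hn x le_rfl
  · have l : Tendsto (fun n => wb ‖x‖ + 1 / ((σ n : ℝ) + 1) * (1 + t)) atTop (𝓝 (wb ‖x‖ + 0 * (1 + t))) :=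
      (h1σ.mul_const _).const_add _
    have := le_of_tendsto_of_tendsto' (hpt x t ht.le) l fun n => (H.le_w (σ n) ⌊t / τ (σ n)⌋₊ x).trans (by
      have := floor_div_mul_le ht.le (H.cfl (σ n)).tau
      gcongr)
    simpa using this
  · have l : Tendsto (fun n => φinf t + τ (σ n) * f (φinf (t / 2))) atTop (𝓝 (φinf t + 0 * f (φinf (t / 2)))) :=
      (hτσ.mul_const _).const_add _
    have := le_of_tendsto_of_tendsto (hpt x t ht.le) l (by
      filter_upwards [hτσ.eventually (gt_mem_nhds (show (0:ℝ) < t / 2 by positivity))] with n hn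
      exact H.uap_le_flat hp2 hν hf hφ (σ n) x ht hn.le)
    simpa using this

end
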